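/- Let $K$ be an algebraically closed field, let $\Gamma$ be a Brauer tree with $n \ge 2$ edges and multiplicity one (a tree with a cyclic ordering of the edges around each vertex), and let $A$ be its basic Brauer tree algebra $KQ_\Gamma/I$: the vertices of $Q_\Gamma$ are the edges of $\Gamma$; for each end point $v$ of each edge $i$ there is an arrow from $i$ to the edge following $i$ around $v$ (a loop if $i$ is the only edge at $v$), so that $Q_\Gamma$ is a union of oriented cycles, one for each vertex of $\Gamma$; $I$ is generated by the products of composable arrows of different cycles and by the differences of the two full cycles starting at each vertex of $Q_\Gamma$. Write $K^b(A)$ for the bounded homotopy category of finitely generated projective left $A$-modules. A perfect complex $T$ is tilting if $\mathrm{Hom}_{D^b(A)}(T,T[i])=0$ for $i\neq 0$ and $T$ generates the perfect complexes as a triangulated category (closed under direct summands); it is basic if it has no two isomorphic nonzero direct summands in a direct sum decomposition; two-term means concentrated in degrees $0$ and $1$. An $A$-cycle is a maximal ordered set of nonrepeating arrows of $Q_\Gamma$ such that the product of any two neighboring arrows is nonzero in $A$, up to cyclic rotation. An indecomposable complex $P_0\xrightarrow{f}P_1$ with $P_0=\bigoplus_{i\in I_0}Ae_i$, $P_1=\bigoplus_{j\in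 J_0}Ae_j$, $I_0$ and $J_0$ disjoint and nonempty, has a diagram on $Q_\Gamma$, consisting of the vertices in $I_0\cup J_0$ and, for each nonzero component $Ae_i\to Ae_j$ of $f$, the path from $i$ to $j$; the elements of $I_0$ are its sources, those of $J_0$ its sinks, and a source or sink has degree one if exactly one component of $f$ at it is nonzero. For an $A$-cycle $\Upsilon$ of $A$, an indecomposable summand of $T$ belongs to the $A$-cycle of $\mathrm{End}_{K^b(A)}(T)$ corresponding to the sources on $\Upsilon$ if it is isomorphic to a stalk complex $Ae_x$ in degree $0$ with $x$ on $\Upsilon$, or to such a two-term complex whose diagram has a degree-one source on $\Upsilon$ and no other vertex on $\Upsilon$; it belongs to the $A$-cycle corresponding to the sinks on $\Upsilon$ if it is isomorphic to a stalk complex $Ae_x$ in degree $1$ with $x$ on $\Upsilon$, or to such a two-term complex whose diagram has a degree-one sink on $\Upsilon$ and no other vertex on $\Upsilon$. Then there are exactly $2(n+1)$ isomorphism classes of basic two-term tilting complexes $T$ over $A$ such that $\mathrm{End}_{K^b(A)}(T)$ is isomorphic, as a $K$-algebra, to the Brauer star algebra with $n$ edges (the basic Brauer tree algebra, with multiplicity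 one, of the tree with $n$ edges all incident to a common vertex). Moreover $A$ has exactly $n+1$ $A$-cycles, and for each $A$-cycle $\Upsilon$ there is, up to isomorphism, exactly one such $T$ all of whose indecomposable summands belong to the $A$-cycle of $\mathrm{End}_{K^b(A)}(T)$ corresponding to the sources on $\Upsilon$, and exactly one such $T$ all of whose indecomposable summands belong to the $A$-cycle corresponding to the sinks on $\Upsilon$. -/

import Mathlib

open CategoryTheory CategoryTheory.Limits

universe w v u

/-! ### Brauer trees, their quivers and their algebras -/

/-- A Brauer tree (of multiplicity one): a tree together with a cyclic ordering of the edges around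
each vertex. A dart `d` is an edge together with one of its end points `d.fst`; `next d` is the
edge that follows it in the cyclic ordering around `d.fst`. (At a vertex with a single edge, that
edge follows itself.) -/
structure BrauerTree (V : Type v) where
  graph : SimpleGraph V
  isTree : graph.IsTree
  next : Equiv.Perm graph.Dart
  next_fst : ∀ d, (next d).fst = d.fst
  next_cyclic : ∀ d d' : graph.Dart, d.fst = d'.fst → next.SameCycle d d'

namespace BrauerTree

variable {V : Type v} (Γ : BrauerTree V)

/-- The vertices of the quiver of `Γ` are the edges of `Γ`. -/
abbrev Edge : Type v := Γ.graph.edgeSet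

/-- The arrows of the quiver of `Γ`: for each end point of each edge `i` there is one arrow, from
`i` to the edge that follows `i` around that end point. They are indexed by the darts. -/
abbrev Arrow : Type v := Γ.graph.Dart

/-- The vertex of the quiver at which an arrow starts. -/
def source (a : Γ.Arrow) : Γ.Edge := ⟨a.edge, a.edge_mem⟩

/-- The vertex of the quiver at which an arrow ends. -/
def target (a : Γ.Arrow) : Γ.Edge := Γ.source (Γ.next a)

/-- `Γ` is a star: all edges are incident to a common vertex. -/
def IsStar : Prop := ∃ c : V, ∀ d : Γ.graph.Dart, d.fst = c ∨ d.snd = c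

section Algebra

variable (K : Type u) [Field K]

/-- The free algebra on the vertices and the arrows of the quiver. -/
abbrev Free : Type (max u v) := FreeAlgebra K (Γ.Edge ⊕ Γ.Arrow)

/-- The trivial path at `i`. -/
def freeIdem (i : Γ.Edge) : Γ.Free K := FreeAlgebra.ι K (Sum.inl i)

/-- An arrow, as an element of the free algebra. -/
def freeArrow (a : Γ.Arrow) : Γ.Free K := FreeAlgebra.ι K (Sum.inr a)

/-- The product of all the arrows, each taken once, of the cycle around the vertex `a.fst` of `Γ`,
starting with the arrow `a`. -/
noncomputable def freeCycle (a : Γ.Arrow) : Γ.Free K :=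
  ((List.range (Function.minimalPeriod Γ.next a)).map
    fun k => Γ.freeArrow K (Γ.next^[k] a)).prod

/-- The relations of the basic Brauer tree algebra. The first five present the path algebra of the
quiver (the product `a * b` is the path `a` followed by `b`). The last two are the Brauer tree
relations: the product of arrows belonging to different cycles is zero, and the two cycles that
start at a given vertex of the quiver are equal. -/
inductive Rel : Γ.Free K → Γ.Free K → Prop
  | idem_mul_self (i : Γ.Edge) : Rel (Γ.freeIdem K i * Γ.freeIdem K i) (Γ.freeIdem K i)
  | idem_mul_idem (i j : Γ.Edge) (h : i ≠ j) : Rel (Γ.freeIdem K i * Γ.freeIdem K j) 0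
  | sum_idem : Rel (∑ᶠ i : Γ.Edge, Γ.freeIdem K i) 1
  | source_mul (a : Γ.Arrow) :
      Rel (Γ.freeIdem K (Γ.source a) * Γ.freeArrow K a) (Γ.freeArrow K a)
  | mul_target (a : Γ.Arrow) :
      Rel (Γ.freeArrow K a * Γ.freeIdem K (Γ.target a)) (Γ.freeArrow K a)
  | mul_eq_zero (a b : Γ.Arrow) (h : a.fst ≠ b.fst) :
      Rel (Γ.freeArrow K a * Γ.freeArrow K b) 0
  | cycle_eq (a : Γ.Arrow) : Rel (Γ.freeCycle K a) (Γ.freeCycle K a.symm)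

/-- The basic Brauer tree algebra of `Γ` with multiplicity one. -/
def Alg : Type (max u v) := RingQuot (Γ.Rel K)

noncomputable instance : Ring (Γ.Alg K) := inferInstanceAs (Ring (RingQuot (Γ.Rel K)))

noncomputable instance : Algebra K (Γ.Alg K) := inferInstanceAs (Algebra K (RingQuot (Γ.Rel K)))

/-- The quotient map from the free algebra. -/
noncomputable def toAlg : Γ.Free K →ₐ[K] Γ.Alg K := RingQuot.mkAlgHom K (Γ.Rel K)

/-- The primitive idempotent `e_i`. -/
noncomputable def idem (i : Γ.Edge) : Γ.Alg K := Γ.toAlg K (Γ.freeIdem K i)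

/-- An arrow of the quiver, as an element of the algebra. -/
noncomputable def arrow (a : Γ.Arrow) : Γ.Alg K := Γ.toAlg K (Γ.freeArrow K a)

/-- An ordered set of nonrepeating arrows such that the product of any two neighboring ones is
nonzero in the algebra. -/
def IsArrowChain (L : List Γ.Arrow) : Prop :=
  L ≠ [] ∧ L.Nodup ∧ L.IsChain fun a b => Γ.arrow K a * Γ.arrow K b ≠ 0

/-- `A`-cycles: maximal ordered sets of nonrepeating arrows such that the product of any two
neighboring arrows is nonzero, considered up to cyclic rotation. -/
def IsACycle (Υ : Cycle Γ.Arrow) : Prop :=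
  ∃ L : List Γ.Arrow, (L : Cycle Γ.Arrow) = Υ ∧ Γ.IsArrowChain K L ∧
    ∀ L' : List Γ.Arrow, Γ.IsArrowChain K L' → L <:+: L' → L' = L

end Algebra

/-- The vertex `x` of the quiver lies on the cycle `Υ`. -/
def OnCycle (x : Γ.Edge) (Υ : Cycle Γ.Arrow) : Prop := ∃ a ∈ Υ, Γ.source a = x

/-- The vertex `x` of the quiver lies on the path that goes from `i` to `j` along the arrows
around a common end point of `i` and `j` (for `i ≠ j` there is at most one such end point), and
that does not go fully around. -/
def OnPath (i j x : Γ.Edge) : Prop :=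
  ∃ (a : Γ.Arrow) (k l : ℕ), k < Function.minimalPeriod Γ.next a ∧ l ≤ k ∧
    Γ.source a = i ∧ Γ.source (Γ.next^[k] a) = j ∧ Γ.source (Γ.next^[l] a) = x

end BrauerTree

/-! ### Tilting complexes -/

section Tilting

variable {A : Type u} [Ring A]

/-- Bounded complexes of finitely generated projective (left) modules. -/
def IsPerfectComplex (T : CochainComplex (ModuleCat.{w} A) ℤ) : Prop :=
  (∀ i, Module.Finite A (T.X i) ∧ Module.Projective A (T.X i)) ∧
    ∃ a b : ℤ, ∀ i, i < a ∨ b < i → IsZero (T.X i)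

/-- Two-term complexes of finitely generated projective modules, concentrated in
degrees `0` and `1`. -/
def IsTwoTerm (T : CochainComplex (ModuleCat.{w} A) ℤ) : Prop :=
  IsPerfectComplex T ∧ ∀ i, i ≠ 0 → i ≠ 1 → IsZero (T.X i)

/-- Tilting complexes: perfect complexes `T` with `Hom(T, T[i]) = 0` in the derived category for
all `i ≠ 0` that generate the perfect complexes as a triangulated category (the triangulated
envelope is the smallest triangulated subcategory closed under direct summands). -/
def IsTilting [HasDerivedCategory.{v} (ModuleCat.{w} A)]
    (T : CochainComplex (ModuleCat.{w} A) ℤ) : Prop :=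
  IsPerfectComplex T ∧
  (∀ i : ℤ, i ≠ 0 →
    Subsingleton (DerivedCategory.Q.obj T ⟶ (DerivedCategory.Q.obj T)⟦i⟧)) ∧
  ∀ X : CochainComplex (ModuleCat.{w} A) ℤ, IsPerfectComplex X →
    (ObjectProperty.singleton (DerivedCategory.Q.obj T)).triangEnvelope (DerivedCategory.Q.obj X)

/-- The homotopy category of complexes of modules. The category of the bounded complexes of
finitely generated projective modules is a full subcategory. -/
abbrev HtpyCat (A : Type u) [Ring A] := HomotopyCategory (ModuleCat.{w} A) (ComplexShape.up ℤ)

/-- A complex, as an object of the homotopy category. -/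
abbrev toHtpy (T : CochainComplex (ModuleCat.{w} A) ℤ) : HtpyCat.{w} A :=
  (HomotopyCategory.quotient (ModuleCat.{w} A) (ComplexShape.up ℤ)).obj T

/-- `T` does not contain isomorphic nonzero direct summands: no `S ⊕ S` with `S ≠ 0` is a direct
summand of `T`. -/
def IsBasic (T : CochainComplex (ModuleCat.{w} A) ℤ) : Prop :=
  ∀ S : HtpyCat.{w} A, Nonempty (Retract (S ⊞ S) (toHtpy T)) → IsZero S

/-- `S` is an indecomposable direct summand of `T` in the homotopy category. -/
def IsIndecSummand (S T : CochainComplex (ModuleCat.{w} A) ℤ) : Prop :=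
  IsPerfectComplex S ∧ Indecomposable (toHtpy S) ∧ Nonempty (Retract (toHtpy S) (toHtpy T))

/-- The set of isomorphism classes, in the homotopy category, of complexes with property `P`. -/
def isoClasses (P : CochainComplex (ModuleCat.{w} A) ℤ → Prop) :
    Set (Quotient (isIsomorphicSetoid (HtpyCat.{w} A))) :=
  {c | ∃ T, P T ∧ Quotient.mk _ (toHtpy T) = c}

end Tilting

/-! ### Diagrams, and the summands belonging to the source and sink cycles -/

namespace BrauerTree

variable {V : Type v} (Γ : BrauerTree V) (K : Type u) [Field K]

/-- Complexes of modules over the Brauer tree algebra. -/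
abbrev Cplx := CochainComplex (ModuleCat.{max u v} (Γ.Alg K)) ℤ

/-- The indecomposable projective left module `A e_i`. -/
noncomputable abbrev Proj (i : Γ.Edge) : Ideal (Γ.Alg K) := Ideal.span {Γ.idem K i}

/-- The stalk complex of `A e_i` in degree `m`. -/
noncomputable def stalk (m : ℤ) (i : Γ.Edge) : Γ.Cplx K :=
  (HomologicalComplex.single (ModuleCat.{max u v} (Γ.Alg K)) (ComplexShape.up ℤ) m).obj
    (ModuleCat.of (Γ.Alg K) (Γ.Proj K i))

/-- A morphism `f : P₀ ⟶ P₁` with `P₀ = ⨁_{i ∈ I} A e_i` and `P₁ = ⨁_{j ∈ J} A e_j`, where `I` and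
`J` are disjoint sets of vertices of the quiver, given by its components. When the
complex `P₀ ⟶ P₁` is indecomposable and `I`, `J` are nonempty, it is the minimal projective
presentation of the cokernel of `f`; it defines a diagram on the quiver, with marked
vertices `I ∪ J`. -/
structure Presentation where
  I : Finset Γ.Edge
  J : Finset Γ.Edge
  disjoint : Disjoint I J
  comp : ∀ (i : I) (j : J), Γ.Proj K i →ₗ[Γ.Alg K] Γ.Proj K j

namespace Presentation

variable {Γ K} (D : Γ.Presentation K)

/-- The morphism `f` with the given components. -/
noncomputable def map : (∀ i : D.I, Γ.Proj K i) →ₗ[Γ.Alg K] (∀ j : D.J, Γ.Proj K j) :=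
  LinearMap.pi fun j => ∑ i : D.I, (D.comp i j).comp (LinearMap.proj i)

/-- The complex `P₀ ⟶ P₁`, in degrees `0` and `1`. -/
noncomputable def complex : Γ.Cplx K :=
  HomologicalComplex.double (c := ComplexShape.up ℤ) (i₀ := 0) (i₁ := 1)
    (ModuleCat.ofHom D.map) (by simp)

/-- The vertices of the diagram: the marked ones, and those on the path from `i` to `j` whenever
the component of `f` from `A e_i` to `A e_j` is nonzero. -/
def OnDiagram (x : Γ.Edge) : Prop :=
  x ∈ D.I ∨ x ∈ D.J ∨ ∃ (i : D.I) (j : D.J), D.comp i j ≠ 0 ∧ Γ.OnPath i j x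

/-- `x` is a source of degree one of the diagram. -/
def DegOneSource (x : Γ.Edge) : Prop := ∃ h : x ∈ D.I, ∃! j : D.J, D.comp ⟨x, h⟩ j ≠ 0

/-- `x` is a sink of degree one of the diagram. -/
def DegOneSink (x : Γ.Edge) : Prop := ∃ h : x ∈ D.J, ∃! i : D.I, D.comp i ⟨x, h⟩ ≠ 0

/-- `x` is on `Υ`, and no other vertex of the diagram is. -/
def OnlyVertexOn (x : Γ.Edge) (Υ : Cycle Γ.Arrow) : Prop :=
  Γ.OnCycle x Υ ∧ ∀ y, D.OnDiagram y → Γ.OnCycle y Υ → y = x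

end Presentation

variable {Γ K}

/-- The indecomposable complex `S` is a stalk complex in degree `0` whose vertex is on `Υ`, or its
diagram has a degree-one source on `Υ` and no other vertex on `Υ`. -/
def IsSourceSummand (Υ : Cycle Γ.Arrow) (S : Γ.Cplx K) : Prop :=
  (∃ x, Γ.OnCycle x Υ ∧ Nonempty (toHtpy S ≅ toHtpy (Γ.stalk K 0 x))) ∨
  ∃ D : Γ.Presentation K, Nonempty (toHtpy S ≅ toHtpy D.complex) ∧
    ∃ x, D.DegOneSource x ∧ D.OnlyVertexOn x Υ

/-- The indecomposable complex `S` is a stalk complex in degree `1` whose vertex is on `Υ`, or its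
diagram has a degree-one sink on `Υ` and no other vertex on `Υ`. -/
def IsSinkSummand (Υ : Cycle Γ.Arrow) (S : Γ.Cplx K) : Prop :=
  (∃ x, Γ.OnCycle x Υ ∧ Nonempty (toHtpy S ≅ toHtpy (Γ.stalk K 1 x))) ∨
  ∃ D : Γ.Presentation K, Nonempty (toHtpy S ≅ toHtpy D.complex) ∧
    ∃ x, D.DegOneSink x ∧ D.OnlyVertexOn x Υ

/-- All indecomposable summands of `T` belong to the `A`-cycle of the endomorphism algebra of `T`
corresponding to the sources on `Υ`. -/
def IsSourceComplex (Υ : Cycle Γ.Arrow) (T : Γ.Cplx K) : Prop :=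
  ∀ S, IsIndecSummand S T → IsSourceSummand Υ S

/-- All indecomposable summands of `T` belong to the `A`-cycle of the endomorphism algebra of `T`
corresponding to the sinks on `Υ`. -/
def IsSinkComplex (Υ : Cycle Γ.Arrow) (T : Γ.Cplx K) : Prop :=
  ∀ S, IsIndecSummand S T → IsSinkSummand Υ S

/-- The endomorphism algebra of `T` in the homotopy category is isomorphic to the Brauer star
algebra with `n` edges. -/
def EndIsStar (n : ℕ) (T : Γ.Cplx K) : Prop :=
  ∃ S : BrauerTree (Fin (n + 1)), S.IsStar ∧ Nonempty (End (toHtpy T) ≃ₐ[K] S.Alg K)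

/-- Basic two-term tilting complexes whose endomorphism algebra is the Brauer star algebra with
`n` edges. -/
def IsStarTilting [HasDerivedCategory.{w} (ModuleCat.{max u v} (Γ.Alg K))]
    (n : ℕ) (T : Γ.Cplx K) : Prop :=
  IsTwoTerm T ∧ IsTilting T ∧ IsBasic T ∧ EndIsStar n T

end BrauerTree

/-! ### The structure of the Brauer tree algebra -/

namespace BrauerTree

section Darts

variable {V : Type v} (Γ : BrauerTree V)

/-- The number of edges at the vertex `a.fst`, as the length of the cycle through `a`. -/
noncomputable abbrev per (a : Γ.Arrow) : ℕ := Function.minimalPeriod Γ.next a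

instance [Finite V] : Finite Γ.graph.Dart :=
  Finite.of_injective (fun d => d.toProd) fun _ _ h => SimpleGraph.Dart.ext _ _ h

theorem per_pos [Finite V] (a : Γ.Arrow) : 0 < Γ.per a :=
  Function.minimalPeriod_pos_of_mem_periodicPts
    (Γ.next.injective.mem_periodicPts a)

@[simp] theorem iterate_next_fst (a : Γ.Arrow) (k : ℕ) : (Γ.next^[k] a).fst = a.fst := by
  induction k with
  | zero => rfl
  | succ k ih => rw [Function.iterate_succ_apply', Γ.next_fst, ih]

theorem iterate_per (a : Γ.Arrow) : Γ.next^[Γ.per a] a = a :=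
  Function.iterate_minimalPeriod

theorem per_iterate [Finite V] (a : Γ.Arrow) (k : ℕ) : Γ.per (Γ.next^[k] a) = Γ.per a :=
  Function.minimalPeriod_apply_iterate (Γ.next.injective.mem_periodicPts a) k

theorem exists_iterate_eq [Finite V] {a b : Γ.Arrow} (h : a.fst = b.fst) :
    ∃ k < Γ.per a, Γ.next^[k] a = b := by
  obtain ⟨k, hk⟩ := (Γ.next_cyclic a b h).exists_nat_pow_eq
  refine ⟨k % Γ.per a, Nat.mod_lt _ (Γ.per_pos a), ?_⟩
  rw [Function.iterate_mod_minimalPeriod_eq, ← hk, Equiv.Perm.iterate_eq_pow]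

theorem iterate_inj {a : Γ.Arrow} {k l : ℕ} (hk : k < Γ.per a) (hl : l < Γ.per a)
    (h : Γ.next^[k] a = Γ.next^[l] a) : k = l :=
  (Function.iterate_eq_iterate_iff_of_lt_minimalPeriod hk hl).1 h

theorem source_eq_iff {a b : Γ.Arrow} : Γ.source a = Γ.source b ↔ a = b ∨ a = b.symm := by
  rw [source, source, Subtype.mk.injEq, SimpleGraph.dart_edge_eq_iff]

@[simp] theorem source_symm (a : Γ.Arrow) : Γ.source a.symm = Γ.source a :=
  Γ.source_eq_iff.2 (Or.inr rfl)

theorem eq_of_source_eq {a b : Γ.Arrow} (h : Γ.source a = Γ.source b) (h' : a.fst = b.fst) :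
    a = b := by
  rcases Γ.source_eq_iff.1 h with h | h
  · exact h
  · subst h
    exact absurd h' b.snd_ne_fst

theorem exists_source_eq (i : Γ.Edge) : ∃ a : Γ.Arrow, Γ.source a = i := by
  obtain ⟨⟨x, y⟩, h⟩ := i
  exact ⟨⟨(x, y), h⟩, rfl⟩

theorem mem_source_iff {a : Γ.Arrow} {x : V} : x ∈ (Γ.source a).1 ↔ x = a.fst ∨ x = a.snd := by
  obtain ⟨⟨p, q⟩, h⟩ := a
  simp [source, SimpleGraph.Dart.edge]

theorem fst_mem_source (a : Γ.Arrow) : a.fst ∈ (Γ.source a).1 := Γ.mem_source_iff.2 (Or.inl rfl)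

theorem exists_dart_of_mem {i : Γ.Edge} {x : V} (h : x ∈ i.1) :
    ∃ a : Γ.Arrow, Γ.source a = i ∧ a.fst = x := by
  obtain ⟨a, rfl⟩ := Γ.exists_source_eq i
  rcases Γ.mem_source_iff.1 h with h | h
  · exact ⟨a, rfl, h.symm⟩
  · exact ⟨a.symm, by simp, h.symm⟩

/-- Distinct edges have at most one common end point. -/
theorem eq_of_mem_of_mem {i j : Γ.Edge} (hij : i ≠ j) {x y : V} (hxi : x ∈ i.1) (hxj : x ∈ j.1)
    (hyi : y ∈ i.1) (hyj : y ∈ j.1) : x = y := by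
  by_contra hne
  exact hij (Subtype.ext (((Sym2.mem_and_mem_iff hne).1 ⟨hxi, hyi⟩).trans
    ((Sym2.mem_and_mem_iff hne).1 ⟨hxj, hyj⟩).symm))

end Darts

section Algebra

variable {V : Type v} (Γ : BrauerTree V) (K : Type u) [Field K]

theorem toAlg_eq_of_rel {x y : Γ.Free K} (h : Γ.Rel K x y) : Γ.toAlg K x = Γ.toAlg K y :=
  RingQuot.mkAlgHom_rel K h

theorem toAlg_surjective : Function.Surjective (Γ.toAlg K) :=
  RingQuot.mkAlgHom_surjective K _

@[simp] theorem idem_mul_self (i : Γ.Edge) : Γ.idem K i * Γ.idem K i = Γ.idem K i := by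
  simpa [idem] using Γ.toAlg_eq_of_rel K (Rel.idem_mul_self i)

theorem idem_mul_idem {i j : Γ.Edge} (h : i ≠ j) : Γ.idem K i * Γ.idem K j = 0 := by
  simpa [idem] using Γ.toAlg_eq_of_rel K (Rel.idem_mul_idem i j h)

theorem finsum_idem [Finite V] : ∑ᶠ i : Γ.Edge, Γ.idem K i = 1 := by
  have h := Γ.toAlg_eq_of_rel K Rel.sum_idem
  rw [map_one] at h
  rw [← h]
  exact ((Γ.toAlg K).toAddMonoidHom.map_finsum (Set.toFinite _)).symm

theorem sum_idem [Fintype Γ.Edge] [Finite V] : ∑ i : Γ.Edge, Γ.idem K i = 1 := by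
  rw [← Γ.finsum_idem K, finsum_eq_sum_of_fintype]

@[simp] theorem source_mul (a : Γ.Arrow) :
    Γ.idem K (Γ.source a) * Γ.arrow K a = Γ.arrow K a := by
  simpa [idem, arrow] using Γ.toAlg_eq_of_rel K (Rel.source_mul a)

@[simp] theorem mul_target (a : Γ.Arrow) :
    Γ.arrow K a * Γ.idem K (Γ.target a) = Γ.arrow K a := by
  simpa [idem, arrow] using Γ.toAlg_eq_of_rel K (Rel.mul_target a)

theorem arrow_mul_arrow {a b : Γ.Arrow} (h : a.fst ≠ b.fst) : Γ.arrow K a * Γ.arrow K b = 0 := by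
  simpa [arrow] using Γ.toAlg_eq_of_rel K (Rel.mul_eq_zero a b h)

/-- The path formed by `k` consecutive arrows, starting with `a`. -/
noncomputable def path : ℕ → Γ.Arrow → Γ.Alg K
  | 0, a => Γ.idem K (Γ.source a)
  | k + 1, a => Γ.arrow K a * path k (Γ.next a)

@[simp] theorem path_zero (a : Γ.Arrow) : Γ.path K 0 a = Γ.idem K (Γ.source a) := rfl

theorem path_succ (k : ℕ) (a : Γ.Arrow) :
    Γ.path K (k + 1) a = Γ.arrow K a * Γ.path K k (Γ.next a) := rfl

@[simp] theorem path_one (a : Γ.Arrow) : Γ.path K 1 a = Γ.arrow K a := Γ.mul_target K a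

@[simp] theorem source_mul_path (k : ℕ) (a : Γ.Arrow) :
    Γ.idem K (Γ.source a) * Γ.path K k a = Γ.path K k a := by
  cases k with
  | zero => simp
  | succ k => rw [path_succ, ← mul_assoc, source_mul]

theorem path_add (k l : ℕ) (a : Γ.Arrow) :
    Γ.path K k a * Γ.path K l (Γ.next^[k] a) = Γ.path K (k + l) a := by
  induction k generalizing a with
  | zero => simp
  | succ k ih => rw [path_succ, mul_assoc, Function.iterate_succ_apply, ih, ← path_succ]; congr 1; omega

@[simp] theorem path_mul_target (k : ℕ) (a : Γ.Arrow) :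
    Γ.path K k a * Γ.idem K (Γ.source (Γ.next^[k] a)) = Γ.path K k a :=
  Γ.path_add K k 0 a

theorem path_succ' (k : ℕ) (a : Γ.Arrow) :
    Γ.path K (k + 1) a = Γ.path K k a * Γ.arrow K (Γ.next^[k] a) := by
  rw [← path_add, path_one]

theorem path_mul_path_of_fst_ne {k l : ℕ} {a b : Γ.Arrow} (h : a.fst ≠ b.fst) :
    Γ.path K (k + 1) a * Γ.path K (l + 1) b = 0 := by
  rw [path_succ', path_succ, mul_assoc, ← mul_assoc (Γ.arrow K _),
    Γ.arrow_mul_arrow K (by simpa using h), zero_mul, mul_zero]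

theorem toAlg_freeCycle [Finite V] (a : Γ.Arrow) :
    Γ.toAlg K (Γ.freeCycle K a) = Γ.path K (Γ.per a) a := by
  have key : ∀ k (a : Γ.Arrow),
      Γ.toAlg K ((List.range k).map fun l => Γ.freeArrow K (Γ.next^[l] a)).prod *
        Γ.idem K (Γ.source (Γ.next^[k] a)) = Γ.path K k a := by
    intro k a
    induction k with
    | zero => simp
    | succ k ih =>
      rw [List.range_succ, List.map_append, List.prod_append, path_succ', ← ih, map_mul, mul_assoc]
      have h : Γ.toAlg K (Γ.freeArrow K (Γ.next^[k] a)) = Γ.arrow K (Γ.next^[k] a) := rfl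
      simp only [List.map_cons, List.map_nil, List.prod_cons, List.prod_nil, mul_one, h]
      rw [Function.iterate_succ_apply', mul_assoc, source_mul]
      congr 1
      exact Γ.mul_target K _
  obtain ⟨k, hk⟩ := Nat.exists_eq_succ_of_ne_zero (Γ.per_pos a).ne'
  have h := key (Γ.per a) a
  rw [← h, freeCycle]
  simp only [per, Nat.succ_eq_add_one] at hk ⊢
  rw [hk, List.range_succ, List.map_append, List.prod_append, map_mul,
    mul_assoc]
  congr 1
  have h : Γ.toAlg K (Γ.freeArrow K (Γ.next^[k] a)) = Γ.arrow K (Γ.next^[k] a) := rfl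
  simp only [List.map_cons, List.map_nil, List.prod_cons, List.prod_nil, mul_one, h]
  rw [Function.iterate_succ_apply']
  exact (Γ.mul_target K _).symm

theorem path_per_symm [Finite V] (a : Γ.Arrow) :
    Γ.path K (Γ.per a) a = Γ.path K (Γ.per a.symm) a.symm := by
  rw [← toAlg_freeCycle, ← toAlg_freeCycle]
  exact Γ.toAlg_eq_of_rel K (Rel.cycle_eq a)

theorem path_eq_zero [Finite V] {k : ℕ} {a : Γ.Arrow} (h : Γ.per a < k) : Γ.path K k a = 0 := by
  obtain ⟨l, rfl⟩ := Nat.exists_eq_add_of_lt h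
  rw [add_assoc, ← path_add, path_per_symm, iterate_per]
  obtain ⟨m, hm⟩ := Nat.exists_eq_succ_of_ne_zero (Γ.per_pos a.symm).ne'
  rw [hm]
  exact Γ.path_mul_path_of_fst_ne K a.snd_ne_fst

/-- The full cycle at the vertex `i` of the quiver; it spans the socle of `A e_i`. -/
noncomputable def soc (i : Γ.Edge) : Γ.Alg K :=
  Γ.path K (Γ.per (Γ.exists_source_eq i).choose) (Γ.exists_source_eq i).choose

theorem path_per [Finite V] (a : Γ.Arrow) : Γ.path K (Γ.per a) a = Γ.soc K (Γ.source a) := by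
  have h := (Γ.exists_source_eq (Γ.source a)).choose_spec
  rw [soc]
  rcases Γ.source_eq_iff.1 h with h | h
  · rw [h]
  · rw [h, ← path_per_symm]

/-- The product of two nontrivial paths. -/
theorem path_mul_path_of_ne {k l : ℕ} {a b : Γ.Arrow} (hk : 0 < k) (hl : 0 < l)
    (h : Γ.next^[k] a ≠ b) : Γ.path K k a * Γ.path K l b = 0 := by
  obtain ⟨k, rfl⟩ := Nat.exists_eq_succ_of_ne_zero hk.ne'
  obtain ⟨l, rfl⟩ := Nat.exists_eq_succ_of_ne_zero hl.ne'
  by_cases hf : a.fst = b.fst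
  · have hs : Γ.source (Γ.next^[k.succ] a) ≠ Γ.source b := fun hs =>
      h (Γ.eq_of_source_eq hs ((Γ.iterate_next_fst a _).trans hf))
    rw [← path_mul_target, ← Γ.source_mul_path K _ b, mul_assoc, ← mul_assoc (Γ.idem K _),
      Γ.idem_mul_idem K hs, zero_mul, mul_zero]
  · exact Γ.path_mul_path_of_fst_ne K hf

theorem idem_mul_path_of_ne {k : ℕ} {a : Γ.Arrow} {i : Γ.Edge} (h : i ≠ Γ.source a) :
    Γ.idem K i * Γ.path K k a = 0 := by
  rw [← source_mul_path, ← mul_assoc, Γ.idem_mul_idem K h, zero_mul]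

theorem path_mul_idem_of_ne {k : ℕ} {a : Γ.Arrow} {i : Γ.Edge} (h : Γ.source (Γ.next^[k] a) ≠ i) :
    Γ.path K k a * Γ.idem K i = 0 := by
  rw [← path_mul_target, mul_assoc, Γ.idem_mul_idem K h, mul_zero]

/-- The trivial paths and the nontrivial paths span the algebra. -/
theorem mem_span_path [Finite V] (z : Γ.Alg K) :
    z ∈ Submodule.span K (Set.range (Γ.idem K) ∪
      Set.range fun p : ℕ × Γ.Arrow => Γ.path K (p.1 + 1) p.2) := by
  set N := Submodule.span K (Set.range (Γ.idem K) ∪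
      Set.range fun p : ℕ × Γ.Arrow => Γ.path K (p.1 + 1) p.2) with hN
  have hidem : ∀ i, Γ.idem K i ∈ N := fun i => Submodule.subset_span (Or.inl ⟨i, rfl⟩)
  have hpath : ∀ k a, Γ.path K k a ∈ N := by
    intro k a
    cases k with
    | zero => exact hidem _
    | succ k => exact Submodule.subset_span (Or.inr ⟨(k, a), rfl⟩)
  have hgen : ∀ x : Γ.Free K, ∀ y ∈ N, Γ.toAlg K x * y ∈ N := by
    intro x
    induction x using FreeAlgebra.induction with
    | grade0 r =>
      intro y hy
      rw [AlgHom.commutes, ← Algebra.smul_def]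
      exact N.smul_mem _ hy
    | grade1 g =>
      intro y hy
      induction hy using Submodule.span_induction with
      | zero => simp
      | add y y' _ _ hy hy' => rw [mul_add]; exact N.add_mem hy hy'
      | smul c y _ hy => rw [mul_smul_comm]; exact N.smul_mem _ hy
      | mem y hy =>
        rcases g with i | a
        · change Γ.idem K i * y ∈ N
          rcases hy with ⟨j, rfl⟩ | ⟨⟨k, b⟩, rfl⟩
          · by_cases h : i = j
            · subst h; rw [idem_mul_self]; exact hidem i
            · rw [Γ.idem_mul_idem K h]; exact N.zero_mem
          · by_cases h : i = Γ.source b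
            · subst h; rw [source_mul_path]; exact hpath _ _
            · rw [Γ.idem_mul_path_of_ne K h]; exact N.zero_mem
        · change Γ.arrow K a * y ∈ N
          rw [← path_one]
          rcases hy with ⟨j, rfl⟩ | ⟨⟨k, b⟩, rfl⟩
          · by_cases h : Γ.source (Γ.next^[1] a) = j
            · subst h; rw [path_mul_target]; exact hpath _ _
            · rw [Γ.path_mul_idem_of_ne K h]; exact N.zero_mem
          · by_cases h : Γ.next^[1] a = b
            · subst h; rw [path_add]; exact hpath _ _
            · rw [Γ.path_mul_path_of_ne K Nat.one_pos (Nat.succ_pos _) h]; exact N.zero_mem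
    | mul x y hx hy => intro z hz; rw [map_mul, mul_assoc]; exact hx _ (hy _ hz)
    | add x y hx hy => intro z hz; rw [map_add, add_mul]; exact N.add_mem (hx _ hz) (hy _ hz)
  obtain ⟨x, rfl⟩ := Γ.toAlg_surjective K z
  have h1 : (1 : Γ.Alg K) ∈ N := by
    have := Fintype.ofFinite Γ.Edge
    rw [← Γ.sum_idem K]
    exact N.sum_mem fun i _ => hidem i
  simpa using hgen x 1 h1

end Algebra

section Lift

variable {V : Type v} (Γ : BrauerTree V) (K : Type u) [Field K]

/-- The universal property of the Brauer tree algebra. -/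
theorem exists_algHom [Finite V] {R : Type*} [Ring R] [Algebra K R] (e : Γ.Edge → R)
    (x : Γ.Arrow → R) (h₁ : ∀ i, e i * e i = e i) (h₂ : ∀ i j, i ≠ j → e i * e j = 0)
    (h₃ : ∑ᶠ i, e i = 1) (h₄ : ∀ a, e (Γ.source a) * x a = x a)
    (h₅ : ∀ a, x a * e (Γ.target a) = x a) (h₆ : ∀ a b, a.fst ≠ b.fst → x a * x b = 0)
    (h₇ : ∀ a, ((List.range (Γ.per a)).map fun k => x (Γ.next^[k] a)).prod =
      ((List.range (Γ.per a.symm)).map fun k => x (Γ.next^[k] a.symm)).prod) :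
    ∃ φ : Γ.Alg K →ₐ[K] R, (∀ i, φ (Γ.idem K i) = e i) ∧ ∀ a, φ (Γ.arrow K a) = x a := by
  set ψ : Γ.Free K →ₐ[K] R := FreeAlgebra.lift K (Sum.elim e x) with hψ
  have hi : ∀ i, ψ (Γ.freeIdem K i) = e i := fun i => by simp [hψ, freeIdem]
  have ha : ∀ a, ψ (Γ.freeArrow K a) = x a := fun i => by simp [hψ, freeArrow]
  have hc : ∀ a, ψ (Γ.freeCycle K a) =
      ((List.range (Γ.per a)).map fun k => x (Γ.next^[k] a)).prod := fun a => by
    rw [freeCycle, map_list_prod, List.map_map]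
    congr 2
    funext k
    exact ha _
  have hrel : ∀ ⦃y z : Γ.Free K⦄, Γ.Rel K y z → ψ y = ψ z := by
    intro y z h
    cases h with
    | idem_mul_self i => rw [map_mul, hi, h₁]
    | idem_mul_idem i j h => rw [map_mul, hi, hi, h₂ _ _ h, map_zero]
    | sum_idem =>
      rw [map_one, ← h₃]
      refine (ψ.toAddMonoidHom.map_finsum (Set.toFinite _)).trans ?_
      exact finsum_congr hi
    | source_mul a => rw [map_mul, hi, ha, h₄]
    | mul_target a => rw [map_mul, hi, ha, h₅]
    | mul_eq_zero a b h => rw [map_mul, ha, ha, h₆ _ _ h, map_zero]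
    | cycle_eq a => rw [hc, hc, h₇]
  refine ⟨RingQuot.liftAlgHom K ⟨ψ, hrel⟩, fun i => ?_, fun a => ?_⟩
  · rw [← hi]; exact RingQuot.liftAlgHom_mkAlgHom_apply K ψ hrel _
  · rw [← ha]; exact RingQuot.liftAlgHom_mkAlgHom_apply K ψ hrel _

open Classical in
/-- The character of the simple module at `i`. -/
theorem exists_char [Finite V] (i : Γ.Edge) : ∃ χ : Γ.Alg K →ₐ[K] K,
    (∀ j, χ (Γ.idem K j) = if j = i then 1 else 0) ∧ ∀ a, χ (Γ.arrow K a) = 0 := by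
  refine Γ.exists_algHom K (fun j => if j = i then 1 else 0) (fun _ => 0) ?_ ?_ ?_ ?_ ?_ ?_ ?_
  · intro j; split_ifs <;> simp
  · intro j k h; split_ifs <;> simp_all
  · rw [finsum_eq_single _ i (fun j hj => if_neg hj), if_pos rfl]
  · simp
  · simp
  · simp
  · intro a
    have h1 := (Γ.per_pos a).ne'
    have h2 := (Γ.per_pos a.symm).ne'
    simp [h1, h2]

/-- The character of the simple module at `i`. -/
noncomputable def char [Finite V] (i : Γ.Edge) : Γ.Alg K →ₐ[K] K := (Γ.exists_char K i).choose

@[simp] theorem char_idem_self [Finite V] (i : Γ.Edge) : Γ.char K i (Γ.idem K i) = 1 := by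
  rw [char, (Γ.exists_char K i).choose_spec.1, if_pos rfl]

theorem char_idem_of_ne [Finite V] {i j : Γ.Edge} (h : j ≠ i) : Γ.char K i (Γ.idem K j) = 0 := by
  rw [char, (Γ.exists_char K i).choose_spec.1, if_neg h]

theorem char_path_succ [Finite V] (i : Γ.Edge) (k : ℕ) (a : Γ.Arrow) :
    Γ.char K i (Γ.path K (k + 1) a) = 0 := by
  rw [path_succ, map_mul, char, (Γ.exists_char K i).choose_spec.2, zero_mul]

@[simp] theorem char_soc [Finite V] (i j : Γ.Edge) : Γ.char K i (Γ.soc K j) = 0 := by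
  obtain ⟨a, rfl⟩ := Γ.exists_source_eq j
  obtain ⟨k, hk⟩ := Nat.exists_eq_succ_of_ne_zero (Γ.per_pos a).ne'
  rw [← path_per, hk]
  exact Γ.char_path_succ K i k a

end Lift

section Regular

variable {V : Type v} (Γ : BrauerTree V) (K : Type u) [Field K]

/-- A basis of the regular representation: trivial paths, nontrivial paths that are not full cycles
(`(a, k)` stands for the path of length `k + 1` starting with `a`), full cycles. -/
abbrev RegBasis : Type v := Γ.Edge ⊕ (Γ.Arrow × ℕ) ⊕ Γ.Edge

open Classical in
/-- The path of length `k + 1` starting with `a`, in the regular representation. -/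
noncomputable def regPath (a : Γ.Arrow) (k : ℕ) : Γ.RegBasis →₀ K :=
  if k + 1 < Γ.per a then Finsupp.single (Sum.inr (Sum.inl (a, k))) 1
  else if k + 1 = Γ.per a then Finsupp.single (Sum.inr (Sum.inr (Γ.source a))) 1 else 0

open Classical in
/-- The action of a trivial path on the basis of the regular representation. -/
noncomputable def regIdem (i : Γ.Edge) : (Γ.RegBasis →₀ K) →ₗ[K] (Γ.RegBasis →₀ K) :=
  Finsupp.linearCombination K fun b => match b with
    | Sum.inl j => if i = j then Finsupp.single b 1 else 0
    | Sum.inr (Sum.inl (a, _)) => if i = Γ.source a then Finsupp.single b 1 else 0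
    | Sum.inr (Sum.inr j) => if i = j then Finsupp.single b 1 else 0

open Classical in
/-- The action of an arrow on the basis of the regular representation. -/
noncomputable def regArrow (c : Γ.Arrow) : (Γ.RegBasis →₀ K) →ₗ[K] (Γ.RegBasis →₀ K) :=
  Finsupp.linearCombination K fun b => match b with
    | Sum.inl j => if Γ.target c = j then Γ.regPath K c 0 else 0
    | Sum.inr (Sum.inl (a, k)) => if Γ.next c = a then Γ.regPath K c (k + 1) else 0
    | Sum.inr (Sum.inr _) => 0

theorem regIdem_regPath (i : Γ.Edge) (a : Γ.Arrow) (k : ℕ) [Decidable (i = Γ.source a)] :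
    Γ.regIdem K i (Γ.regPath K a k) = if i = Γ.source a then Γ.regPath K a k else 0 := by
  rw [regPath]
  split_ifs <;> simp_all [regIdem, Finsupp.linearCombination_single]

theorem regArrow_regPath [Finite V] (c a : Γ.Arrow) (k : ℕ) [Decidable (Γ.next c = a)] :
    Γ.regArrow K c (Γ.regPath K a k) = if Γ.next c = a then Γ.regPath K c (k + 1) else 0 := by
  by_cases h : Γ.next c = a
  · subst h
    have hp : Γ.per (Γ.next c) = Γ.per c := Γ.per_iterate c 1
    rw [if_pos rfl]
    by_cases h1 : k + 1 < Γ.per c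
    · rw [regPath, hp, if_pos h1]
      simp [regArrow, Finsupp.linearCombination_single]
    · have : Γ.regPath K c (k + 1) = 0 := by
        rw [regPath, if_neg (by omega), if_neg (by omega)]
      rw [this, regPath, hp, if_neg h1]
      split_ifs <;> simp [regArrow, Finsupp.linearCombination_single]
  · rw [if_neg h, regPath]
    split_ifs <;> simp [regArrow, Finsupp.linearCombination_single, h]

theorem regArrow_prod_apply [Finite V] {x : Γ.RegBasis →₀ K} {Q : Γ.Arrow → Prop} {n : ℕ}
    [DecidablePred Q]
    (hx : ∀ c, Γ.regArrow K c x = if Q (Γ.next c) then Γ.regPath K c n else 0)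
    (l : ℕ) (c : Γ.Arrow) :
    (((List.range (l + 1)).map fun m => Γ.regArrow K (Γ.next^[m] c)).prod :
      Module.End K (Γ.RegBasis →₀ K)) x =
      if Q (Γ.next^[l + 1] c) then Γ.regPath K c (n + l) else 0 := by
  classical
  induction l generalizing c with
  | zero => simpa using hx c
  | succ l ih =>
    have h := ih (Γ.next c)
    rw [List.range_succ_eq_map, List.map_cons, List.prod_cons, List.map_map,
      Module.End.mul_apply]
    have h2 : ((List.range (l + 1)).map
        ((fun m => Γ.regArrow K (Γ.next^[m] c)) ∘ Nat.succ)) =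
        (List.range (l + 1)).map fun m => Γ.regArrow K (Γ.next^[m] (Γ.next c)) := by
      simp [Function.comp_def]
    rw [h2, h, ← Function.iterate_succ_apply]
    split_ifs with hQ
    · rw [Function.iterate_zero, id, regArrow_regPath, if_pos rfl, add_assoc]
    · simp

theorem regPath_eq_zero {a : Γ.Arrow} {k : ℕ} (h : Γ.per a < k + 1) : Γ.regPath K a k = 0 := by
  rw [regPath, if_neg (by omega), if_neg (by omega)]

open Classical in
theorem regArrow_cycle_apply [Finite V] (c : Γ.Arrow) (b : Γ.RegBasis) :
    (((List.range (Γ.per c)).map fun m => Γ.regArrow K (Γ.next^[m] c)).prod :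
      Module.End K (Γ.RegBasis →₀ K)) (Finsupp.single b 1) =
      if b = Sum.inl (Γ.source c) then Finsupp.single (Sum.inr (Sum.inr (Γ.source c))) 1
      else 0 := by
  obtain ⟨l, hl⟩ := Nat.exists_eq_succ_of_ne_zero (Γ.per_pos c).ne'
  rw [hl, Nat.succ_eq_add_one]
  have hc : Γ.next^[l + 1] c = c := by
    have := Γ.iterate_per c
    rwa [hl] at this
  rcases b with j | ⟨a, k⟩ | j
  · rw [Γ.regArrow_prod_apply K (Q := fun a => Γ.source a = j) (n := 0), hc]
    · by_cases h : Γ.source c = j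
      · subst h
        simp [regPath, hl]
      · rw [if_neg h, if_neg]
        simpa using Ne.symm h
    · intro c
      simp only [regArrow, Finsupp.linearCombination_single, target, one_smul]
      congr
  · rw [Γ.regArrow_prod_apply K (Q := fun b => b = a) (n := k + 1),
      Γ.regPath_eq_zero K (by omega), ite_self, if_neg (by simp)]
    · intro c
      simp [regArrow, Finsupp.linearCombination_single]
  · rw [Γ.regArrow_prod_apply K (Q := fun _ => False) (n := 0)]
    · simp
    · intro c
      simp [regArrow, Finsupp.linearCombination_single]

theorem exists_regular [Finite V] :
    ∃ φ : Γ.Alg K →ₐ[K] Module.End K (Γ.RegBasis →₀ K),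
      (∀ i, φ (Γ.idem K i) = Γ.regIdem K i) ∧ ∀ a, φ (Γ.arrow K a) = Γ.regArrow K a := by
  classical
  refine Γ.exists_algHom K (Γ.regIdem K) (Γ.regArrow K) ?_ ?_ ?_ ?_ ?_ ?_ ?_
  · intro i
    refine Finsupp.lhom_ext' fun b => LinearMap.ext_ring ?_
    rcases b with j | ⟨a, k⟩ | j <;>
    · simp only [regIdem, LinearMap.comp_apply, Finsupp.lsingle_apply, Module.End.mul_apply,
        Finsupp.linearCombination_single, one_smul]
      split_ifs <;> simp_all [Finsupp.linearCombination_single]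
  · intro i j hij
    refine Finsupp.lhom_ext' fun b => LinearMap.ext_ring ?_
    rcases b with j | ⟨a, k⟩ | j <;>
    · simp only [regIdem, LinearMap.comp_apply, Finsupp.lsingle_apply, Module.End.mul_apply,
        Finsupp.linearCombination_single, one_smul]
      split_ifs <;> simp_all [Finsupp.linearCombination_single]
  · have := Fintype.ofFinite Γ.Edge
    rw [finsum_eq_sum_of_fintype]
    refine Finsupp.lhom_ext' fun b => LinearMap.ext_ring ?_
    rcases b with j | ⟨a, k⟩ | j <;>
      simp [regIdem, Finsupp.linearCombination_single]
  · intro c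
    refine Finsupp.lhom_ext' fun b => LinearMap.ext_ring ?_
    rcases b with j | ⟨a, k⟩ | j <;>
    · simp only [regArrow, LinearMap.comp_apply, Finsupp.lsingle_apply, Module.End.mul_apply,
        Finsupp.linearCombination_single, one_smul]
      try split_ifs
      all_goals simp [regIdem_regPath]
  · intro c
    refine Finsupp.lhom_ext' fun b => LinearMap.ext_ring ?_
    rcases b with j | ⟨a, k⟩ | j
    · by_cases h : Γ.target c = j <;>
        simp [regArrow, regIdem, Finsupp.linearCombination_single, h]
    · by_cases h : Γ.target c = Γ.source a
      · simp [regArrow, regIdem, Finsupp.linearCombination_single, h]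
      · have h' : Γ.next c ≠ a := fun h' => h (by rw [← h']; rfl)
        simp [regArrow, regIdem, Finsupp.linearCombination_single, h, h']
    · by_cases h : Γ.target c = j <;>
        simp [regArrow, regIdem, Finsupp.linearCombination_single, h]
  · intro c c' h
    have h' : Γ.next c ≠ c' := fun h' => h (by rw [← h', Γ.next_fst])
    refine Finsupp.lhom_ext' fun b => LinearMap.ext_ring ?_
    have key : ∀ k, Γ.regArrow K c (Γ.regPath K c' k) = 0 := fun k => by
      rw [regArrow_regPath, if_neg h']
    rcases b with j | ⟨a, k⟩ | j
    · rw [LinearMap.comp_apply, Finsupp.lsingle_apply, Module.End.mul_apply]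
      nth_rw 2 [regArrow]
      rw [Finsupp.linearCombination_single, one_smul]
      dsimp only
      split_ifs <;> simp [key]
    · rw [LinearMap.comp_apply, Finsupp.lsingle_apply, Module.End.mul_apply]
      nth_rw 2 [regArrow]
      rw [Finsupp.linearCombination_single, one_smul]
      dsimp only
      split_ifs <;> simp [key]
    · simp [regArrow, Finsupp.linearCombination_single]
  · intro c
    refine Finsupp.lhom_ext' fun b => LinearMap.ext_ring ?_
    rw [LinearMap.comp_apply, Finsupp.lsingle_apply, LinearMap.comp_apply, Finsupp.lsingle_apply,
      regArrow_cycle_apply, regArrow_cycle_apply, source_symm]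

theorem soc_ne_zero [Finite V] (i : Γ.Edge) : Γ.soc K i ≠ 0 := by
  classical
  obtain ⟨φ, -, hφ⟩ := Γ.exists_regular K
  obtain ⟨a, rfl⟩ := Γ.exists_source_eq i
  intro h
  have h2 : φ (Γ.toAlg K (Γ.freeCycle K a)) = 0 := by rw [toAlg_freeCycle, path_per, h, map_zero]
  rw [freeCycle, map_list_prod, map_list_prod, List.map_map, List.map_map] at h2
  have h3 : (φ ∘ Γ.toAlg K) ∘ (fun k => Γ.freeArrow K (Γ.next^[k] a)) =
      fun k => Γ.regArrow K (Γ.next^[k] a) := by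
    funext k
    exact hφ _
  rw [h3] at h2
  have h4 := Γ.regArrow_cycle_apply K a (Sum.inl (Γ.source a))
  rw [h2, if_pos rfl] at h4
  have := DFunLike.congr_fun h4 (Sum.inr (Sum.inr (Γ.source a)))
  simp at this

end Regular

section Corner

variable {V : Type v} (Γ : BrauerTree V) (K : Type u) [Field K]

theorem path_ne_zero [Finite V] {k : ℕ} {a : Γ.Arrow} (h : k ≤ Γ.per a) : Γ.path K k a ≠ 0 := by
  intro h0
  have := Γ.path_add K k (Γ.per a - k) a
  rw [h0, zero_mul, Nat.add_sub_cancel' h, path_per] at this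
  exact Γ.soc_ne_zero K _ this.symm

theorem idem_ne_zero [Finite V] (i : Γ.Edge) : Γ.idem K i ≠ 0 := by
  intro h
  have := Γ.char_idem_self K i
  rw [h, map_zero] at this
  exact zero_ne_one this

@[simp] theorem idem_mul_soc [Finite V] (i : Γ.Edge) : Γ.idem K i * Γ.soc K i = Γ.soc K i := by
  obtain ⟨a, rfl⟩ := Γ.exists_source_eq i
  rw [← path_per, source_mul_path]

@[simp] theorem soc_mul_idem [Finite V] (i : Γ.Edge) : Γ.soc K i * Γ.idem K i = Γ.soc K i := by
  obtain ⟨a, rfl⟩ := Γ.exists_source_eq i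
  conv_lhs => rw [← path_per]
  conv_lhs => rw [← Γ.iterate_per a]
  rw [iterate_per]
  nth_rw 3 [← Γ.iterate_per a]
  rw [path_mul_target, path_per]

/-- The space `e_i A e_j`. -/
def corner (i j : Γ.Edge) : Submodule K (Γ.Alg K) where
  carrier := {z | Γ.idem K i * z = z ∧ z * Γ.idem K j = z}
  add_mem' := fun h h' => ⟨by rw [mul_add, h.1, h'.1], by rw [add_mul, h.2, h'.2]⟩
  zero_mem' := ⟨mul_zero _, zero_mul _⟩
  smul_mem' := fun c z h => ⟨by rw [mul_smul_comm, h.1], by rw [smul_mul_assoc, h.2]⟩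

theorem mem_corner {i j : Γ.Edge} {z : Γ.Alg K} :
    z ∈ Γ.corner K i j ↔ Γ.idem K i * z = z ∧ z * Γ.idem K j = z := Iff.rfl

variable {Γ K} in
theorem mul_mem_corner {i j k : Γ.Edge} {z w : Γ.Alg K} (hz : z ∈ Γ.corner K i j)
    (hw : w ∈ Γ.corner K j k) : z * w ∈ Γ.corner K i k :=
  ⟨by rw [← mul_assoc, hz.1], by rw [mul_assoc, hw.2]⟩

theorem idem_mem_corner (i : Γ.Edge) : Γ.idem K i ∈ Γ.corner K i i :=
  ⟨Γ.idem_mul_self K i, Γ.idem_mul_self K i⟩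

theorem soc_mem_corner [Finite V] (i : Γ.Edge) : Γ.soc K i ∈ Γ.corner K i i :=
  ⟨Γ.idem_mul_soc K i, Γ.soc_mul_idem K i⟩

theorem path_mem_corner (k : ℕ) (a : Γ.Arrow) :
    Γ.path K k a ∈ Γ.corner K (Γ.source a) (Γ.source (Γ.next^[k] a)) :=
  ⟨Γ.source_mul_path K k a, Γ.path_mul_target K k a⟩

/-- An element of `e_i A e_j` is a combination of paths from `i` to `j`. -/
theorem corner_le [Finite V] (i j : Γ.Edge) : Γ.corner K i j ≤ Submodule.span K
    ({z | i = j ∧ z = Γ.idem K i} ∪ {z | ∃ (k : ℕ) (a : Γ.Arrow), 0 < k ∧ Γ.source a = i ∧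
      Γ.source (Γ.next^[k] a) = j ∧ z = Γ.path K k a}) := by
  intro z hz
  set N := Submodule.span K
    ({z | i = j ∧ z = Γ.idem K i} ∪ {z | ∃ (k : ℕ) (a : Γ.Arrow), 0 < k ∧ Γ.source a = i ∧
      Γ.source (Γ.next^[k] a) = j ∧ z = Γ.path K k a}) with hN
  have key : ∀ y : Γ.Alg K, Γ.idem K i * y * Γ.idem K j ∈ N := by
    intro y
    induction Γ.mem_span_path K y using Submodule.span_induction with
    | zero => simp
    | add y y' _ _ hy hy' => rw [mul_add, add_mul]; exact N.add_mem hy hy'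
    | smul c y _ hy => rw [mul_smul_comm, smul_mul_assoc]; exact N.smul_mem _ hy
    | mem y hy =>
      rcases hy with ⟨l, rfl⟩ | ⟨⟨k, a⟩, rfl⟩
      · by_cases h1 : i = l
        · subst h1
          by_cases h2 : i = j
          · subst h2
            rw [idem_mul_self, idem_mul_self]
            exact Submodule.subset_span (Or.inl ⟨rfl, rfl⟩)
          · rw [idem_mul_self, Γ.idem_mul_idem K h2]; exact N.zero_mem
        · rw [Γ.idem_mul_idem K h1, zero_mul]; exact N.zero_mem
      · dsimp only
        by_cases h1 : i = Γ.source a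
        · by_cases h2 : Γ.source (Γ.next^[k + 1] a) = j
          · subst h1
            subst h2
            rw [source_mul_path, path_mul_target]
            exact Submodule.subset_span (Or.inr ⟨k + 1, a, Nat.succ_pos k, rfl, rfl, rfl⟩)
          · rw [mul_assoc, Γ.path_mul_idem_of_ne K h2, mul_zero]; exact N.zero_mem
        · rw [Γ.idem_mul_path_of_ne K h1, zero_mul]; exact N.zero_mem
  have := key z
  rwa [hz.1, hz.2] at this

theorem exists_eq_of_mem_corner_self [Finite V] {i : Γ.Edge} {z : Γ.Alg K}
    (hz : z ∈ Γ.corner K i i) : ∃ c d : K, z = c • Γ.idem K i + d • Γ.soc K i := by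
  replace hz := Γ.corner_le K i i hz
  induction hz using Submodule.span_induction with
  | zero => exact ⟨0, 0, by simp⟩
  | add y y' _ _ hy hy' =>
    obtain ⟨c, d, rfl⟩ := hy
    obtain ⟨c', d', rfl⟩ := hy'
    exact ⟨c + c', d + d', by rw [add_smul, add_smul]; abel⟩
  | smul r y _ hy =>
    obtain ⟨c, d, rfl⟩ := hy
    exact ⟨r * c, r * d, by rw [smul_add, mul_smul, mul_smul]⟩
  | mem y hy =>
    rcases hy with ⟨-, rfl⟩ | ⟨k, a, hk, rfl, h2, rfl⟩
    · exact ⟨1, 0, by simp⟩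
    · have ha : Γ.next^[k] a = a := Γ.eq_of_source_eq h2 (by simp)
      by_cases hlt : Γ.per a < k
      · exact ⟨0, 0, by rw [Γ.path_eq_zero K hlt]; simp⟩
      · have : Γ.per a ≤ k := Nat.le_of_dvd hk (Function.IsPeriodicPt.minimalPeriod_dvd ha)
        have : k = Γ.per a := by omega
        subst this
        exact ⟨0, 1, by rw [path_per]; simp⟩

theorem idem_soc_independent [Finite V] {i : Γ.Edge} {c d : K}
    (h : c • Γ.idem K i + d • Γ.soc K i = 0) : c = 0 ∧ d = 0 := by
  have h1 := congrArg (Γ.char K i) h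
  rw [map_add, map_smul, map_smul, char_idem_self, char_soc, smul_zero, add_zero, map_zero,
    smul_eq_mul, mul_one] at h1
  subst h1
  rw [zero_smul, zero_add, smul_eq_zero] at h
  exact ⟨rfl, h.resolve_right (Γ.soc_ne_zero K i)⟩

theorem exists_eq_of_mem_corner [Finite V] {a b : Γ.Arrow} (hab : a ≠ b) (hf : a.fst = b.fst)
    {k : ℕ} (hk : k < Γ.per a) (hb : Γ.next^[k] a = b) {z : Γ.Alg K}
    (hz : z ∈ Γ.corner K (Γ.source a) (Γ.source b)) : ∃ c : K, z = c • Γ.path K k a := by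
  have hne : Γ.source a ≠ Γ.source b := fun h => hab (Γ.eq_of_source_eq h hf)
  replace hz := Γ.corner_le K _ _ hz
  induction hz using Submodule.span_induction with
  | zero => exact ⟨0, by simp⟩
  | add y y' _ _ hy hy' =>
    obtain ⟨c, rfl⟩ := hy
    obtain ⟨c', rfl⟩ := hy'
    exact ⟨c + c', by rw [add_smul]⟩
  | smul r y _ hy =>
    obtain ⟨c, rfl⟩ := hy
    exact ⟨r * c, by rw [mul_smul]⟩
  | mem y hy =>
    rcases hy with ⟨h, -⟩ | ⟨l, a', hl, h1, h2, rfl⟩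
    · exact absurd h hne
    · have hfst : a'.fst = a.fst := by
        refine Γ.eq_of_mem_of_mem hne (h1 ▸ Γ.fst_mem_source a') ?_ (Γ.fst_mem_source a)
          (hf ▸ Γ.fst_mem_source b)
        have := Γ.fst_mem_source (Γ.next^[l] a')
        rwa [h2, iterate_next_fst] at this
      obtain rfl : a' = a := Γ.eq_of_source_eq h1 hfst
      have hl' : Γ.next^[l] a' = b := Γ.eq_of_source_eq h2 (by simpa using hf)
      by_cases hlt : Γ.per a' < l
      · exact ⟨0, by rw [Γ.path_eq_zero K hlt]; simp⟩
      · have hne' : l ≠ Γ.per a' := fun h => hab (by rw [← hl', h, iterate_per])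
        obtain rfl : l = k := Γ.iterate_inj (by omega) hk (hl'.trans hb.symm)
        exact ⟨1, by simp⟩

theorem eq_zero_of_mem_corner [Finite V] {i j : Γ.Edge} (h : ∀ x, x ∈ i.1 → x ∉ j.1) {z : Γ.Alg K}
    (hz : z ∈ Γ.corner K i j) : z = 0 := by
  replace hz := Γ.corner_le K _ _ hz
  induction hz using Submodule.span_induction with
  | zero => rfl
  | add y y' _ _ hy hy' => rw [hy, hy', add_zero]
  | smul r y _ hy => rw [hy, smul_zero]
  | mem y hy =>
    exfalso
    rcases hy with ⟨rfl, -⟩ | ⟨l, a, hl, rfl, rfl, rfl⟩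
    · obtain ⟨a, rfl⟩ := Γ.exists_source_eq i
      exact h _ (Γ.fst_mem_source a) (Γ.fst_mem_source a)
    · refine h _ (Γ.fst_mem_source a) ?_
      have := Γ.fst_mem_source (Γ.next^[l] a)
      rwa [iterate_next_fst] at this

end Corner

end BrauerTree


/-! ### Projective modules over the Brauer tree algebra -/

namespace BrauerTree

section Proj

variable {V : Type v} {Γ : BrauerTree V} {K : Type u} [Field K]

theorem mem_Proj {i : Γ.Edge} {z : Γ.Alg K} : z ∈ Γ.Proj K i ↔ z * Γ.idem K i = z := by
  rw [Ideal.mem_span_singleton']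
  constructor
  · rintro ⟨y, rfl⟩
    rw [mul_assoc, idem_mul_self]
  · intro h
    exact ⟨z, h⟩

variable (Γ K) in
/-- The generator of `A e_i`. -/
noncomputable def gen (i : Γ.Edge) : Γ.Proj K i := ⟨Γ.idem K i, mem_Proj.2 (Γ.idem_mul_self K i)⟩

@[simp] theorem coe_gen (i : Γ.Edge) : (Γ.gen K i : Γ.Alg K) = Γ.idem K i := rfl

theorem smul_gen {i : Γ.Edge} (z : Γ.Proj K i) : (z : Γ.Alg K) • Γ.gen K i = z :=
  Subtype.ext (mem_Proj.1 z.2)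

theorem idem_smul_gen (i : Γ.Edge) : Γ.idem K i • Γ.gen K i = Γ.gen K i := smul_gen (Γ.gen K i)

/-- The map from `A e_i` that sends the generator to `e_i m`. -/
noncomputable def homOf {M : Type*} [AddCommGroup M] [Module (Γ.Alg K) M] (i : Γ.Edge) (m : M) :
    Γ.Proj K i →ₗ[Γ.Alg K] M :=
  (LinearMap.toSpanSingleton (Γ.Alg K) M m).comp (Γ.Proj K i).subtype

@[simp] theorem homOf_apply {M : Type*} [AddCommGroup M] [Module (Γ.Alg K) M] (i : Γ.Edge) (m : M)
    (z : Γ.Proj K i) : homOf i m z = (z : Γ.Alg K) • m := rfl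

instance (i : Γ.Edge) : Module.Projective (Γ.Alg K) (Γ.Proj K i) :=
  Module.Projective.of_split (Γ.Proj K i).subtype
    (LinearMap.toSpanSingleton (Γ.Alg K) _ (Γ.gen K i)) (by
      ext z
      exact congrArg Subtype.val (smul_gen z))

instance (i : Γ.Edge) : Module.Finite (Γ.Alg K) (Γ.Proj K i) :=
  Module.Finite.of_surjective (LinearMap.toSpanSingleton (Γ.Alg K) _ (Γ.gen K i))
    fun z => ⟨z, smul_gen z⟩

variable [Finite V]

theorem soc_mul_soc (i : Γ.Edge) : Γ.soc K i * Γ.soc K i = 0 := by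
  obtain ⟨a, rfl⟩ := Γ.exists_source_eq i
  rw [← path_per]
  nth_rw 4 [← Γ.iterate_per a]
  rw [path_add]
  exact Γ.path_eq_zero K (by have := Γ.per_pos a; omega)

/-- `A e_j` is a local module. -/
theorem surjective_of_char_ne_zero {M : Type*} [AddCommGroup M] [Module (Γ.Alg K) M] {j : Γ.Edge}
    {φ : M →ₗ[Γ.Alg K] Γ.Proj K j} {m : M} (h : Γ.char K j (φ m) ≠ 0) : Function.Surjective φ := by
  obtain ⟨c, d, hz⟩ := Γ.exists_eq_of_mem_corner_self K (i := j) (z := Γ.idem K j * φ m)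
    ⟨by rw [← mul_assoc, idem_mul_self], by rw [mul_assoc, mem_Proj.1 (φ m).2]⟩
  have hc : c = Γ.char K j (φ m) := by
    have := congrArg (Γ.char K j) hz
    simpa using this.symm
  have hc0 : c ≠ 0 := hc ▸ h
  have key : ((c⁻¹ • Γ.idem K j - (c⁻¹ * c⁻¹ * d) • Γ.soc K j) * Γ.idem K j) * φ m =
      Γ.idem K j := by
    rw [mul_assoc, hz]
    simp only [sub_mul, mul_add, smul_mul_smul_comm, idem_mul_self, idem_mul_soc, soc_mul_idem,
      soc_mul_soc, smul_zero, sub_zero]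
    have : c⁻¹ * c⁻¹ * d * c = c⁻¹ * d := by field_simp
    rw [inv_mul_cancel₀ hc0, one_smul, this, sub_add_cancel]
  intro z
  refine ⟨((z : Γ.Alg K) * ((c⁻¹ • Γ.idem K j - (c⁻¹ * c⁻¹ * d) • Γ.soc K j) * Γ.idem K j)) • m, ?_⟩
  rw [map_smul]
  apply Subtype.ext
  rw [Submodule.coe_smul, smul_eq_mul, mul_assoc, key, mem_Proj.1 z.2]

instance : Module.Finite K (Γ.Alg K) := by
  have hfin : (Set.range (Γ.idem K) ∪ ⋃ a : Γ.Arrow, (fun k => Γ.path K k a) ''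
      (Set.Iic (Γ.per a))).Finite :=
    (Set.finite_range _).union (Set.finite_iUnion fun a => (Set.finite_Iic _).image _)
  refine Module.Finite.of_fg_top (Submodule.fg_def.2 ⟨_, hfin, ?_⟩) 
  rw [eq_top_iff]
  intro z _
  refine Submodule.span_le.2 ?_ (Γ.mem_span_path K z)
  rintro y (⟨i, rfl⟩ | ⟨⟨k, a⟩, rfl⟩)
  · exact Submodule.subset_span (Or.inl ⟨i, rfl⟩)
  · by_cases h : Γ.per a < k + 1
    · dsimp only
      rw [Γ.path_eq_zero K h]
      exact Submodule.zero_mem _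
    · exact Submodule.subset_span (Or.inr (Set.mem_iUnion.2 ⟨a, k + 1, not_lt.1 h, rfl⟩))

theorem exists_idem_smul_ne_zero {M : Type*} [AddCommGroup M] [Module (Γ.Alg K) M] {m : M}
    (h : m ≠ 0) : ∃ j, Γ.idem K j • m ≠ 0 := by
  by_contra! hj
  have := Fintype.ofFinite Γ.Edge
  apply h
  rw [← one_smul (Γ.Alg K) m, ← Γ.sum_idem K, Finset.sum_smul]
  exact Finset.sum_eq_zero fun j _ => hj j

/-- A nonzero finitely generated projective module maps onto some `A e_j`. -/
theorem exists_surjective_of_projective (M : Type*) [AddCommGroup M] [Module (Γ.Alg K) M]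
    [Module.Finite (Γ.Alg K) M] [Module.Projective (Γ.Alg K) M] [Nontrivial M] :
    ∃ (j : Γ.Edge) (φ : M →ₗ[Γ.Alg K] Γ.Proj K j), Function.Surjective φ := by
  obtain ⟨N, hN, -⟩ := (IsCoatomic.eq_top_or_exists_le_coatom (⊥ : Submodule (Γ.Alg K) M)).resolve_left
    bot_ne_top
  have hs : IsSimpleModule (Γ.Alg K) (M ⧸ N) := isSimpleModule_iff_isCoatom.2 hN
  have hnt : Nontrivial (M ⧸ N) := IsSimpleModule.nontrivial (Γ.Alg K) _
  obtain ⟨m₀, hm₀⟩ := exists_ne (0 : M ⧸ N)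
  obtain ⟨j, hj⟩ := exists_idem_smul_ne_zero (Γ := Γ) (K := K) hm₀
  set π : Γ.Proj K j →ₗ[Γ.Alg K] M ⧸ N := homOf j m₀ with hπ
  have hg : π (Γ.gen K j) ≠ 0 := hj
  have hsurj : Function.Surjective π :=
    (LinearMap.surjective_or_eq_zero π).resolve_right fun h => hg (by rw [h]; rfl)
  obtain ⟨φ, hφ⟩ := Module.projective_lifting_property π N.mkQ hsurj
  refine ⟨j, φ, ?_⟩
  by_contra hns
  have h0 : ∀ m, Γ.char K j (φ m) = 0 := fun m => by
    by_contra h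
    exact hns (surjective_of_char_ne_zero h)
  obtain ⟨m, hm⟩ := N.mkQ_surjective (π (Γ.gen K j))
  have hker : φ m - Γ.gen K j ∈ LinearMap.ker π := by
    rw [LinearMap.mem_ker, map_sub, ← LinearMap.comp_apply, hφ, hm, sub_self]
  have hk := surjective_of_char_ne_zero (φ := (LinearMap.ker π).subtype) (m := ⟨_, hker⟩) (by
    simp [h0])
  obtain ⟨y, hy⟩ := hk (Γ.gen K j)
  apply hg
  rw [← hy]
  exact y.2

/-- The projective module `⨁ A e_{s a}`. -/
abbrev PiProj (K : Type u) [Field K] {α : Type*} (s : α → Γ.Edge) := ∀ a, Γ.Proj K (s a)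

theorem exists_equiv_PiProj_aux (n : ℕ) : ∀ (M : Type w) [AddCommGroup M] [Module (Γ.Alg K) M]
    [Module K M] [IsScalarTower K (Γ.Alg K) M]
    [Module.Finite (Γ.Alg K) M] [Module.Projective (Γ.Alg K) M], Module.finrank K M = n →
    ∃ (k : ℕ) (s : Fin k → Γ.Edge), Nonempty (M ≃ₗ[Γ.Alg K] PiProj K s) := by
  induction n using Nat.strong_induction_on with
  | _ n ih =>
    intro M _ _ _ _ _ _ hn
    rcases subsingleton_or_nontrivial M with h | h
    · exact ⟨0, Fin.elim0, ⟨0, 0, fun _ => Subsingleton.elim _ _, fun _ => Subsingleton.elim _ _⟩⟩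
    · have hfin : Module.Finite K M := Module.Finite.trans (Γ.Alg K) M
      obtain ⟨j, φ, hφ⟩ := exists_surjective_of_projective (Γ := Γ) (K := K) M
      obtain ⟨ψ, hψ⟩ := Module.projective_lifting_property φ LinearMap.id hφ
      have hexact : Function.Exact (LinearMap.ker φ).subtype φ := LinearMap.exact_subtype_ker_map φ
      obtain ⟨e, -, -⟩ := hexact.splitSurjectiveEquiv (Submodule.injective_subtype _) ⟨ψ, hψ⟩
      have hker : Module.Projective (Γ.Alg K) (LinearMap.ker φ) :=
        Module.Projective.of_split (M := M)
          (e.symm.toLinearMap.comp (LinearMap.inl (Γ.Alg K) (LinearMap.ker φ) (Γ.Proj K j)))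
          ((LinearMap.fst (Γ.Alg K) (LinearMap.ker φ) (Γ.Proj K j)).comp e.toLinearMap)
          (by ext; simp)
      have hkf : Module.Finite (Γ.Alg K) (LinearMap.ker φ) :=
        Module.Finite.of_surjective ((LinearMap.fst (Γ.Alg K) (LinearMap.ker φ) (Γ.Proj K j)).comp e.toLinearMap)
          (Prod.fst_surjective.comp e.surjective)
      have hlt : Module.finrank K (LinearMap.ker φ) < n := by
        rw [← hn]
        refine Submodule.finrank_lt (s := (LinearMap.ker φ).restrictScalars K) ?_
        intro h
        obtain ⟨m, hm⟩ := hφ (Γ.gen K j)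
        have : m ∈ (LinearMap.ker φ).restrictScalars K := h ▸ Submodule.mem_top
        rw [Submodule.restrictScalars_mem, LinearMap.mem_ker, hm] at this
        exact Γ.idem_ne_zero K j (congrArg Subtype.val this)
      obtain ⟨k, s, ⟨f⟩⟩ := ih _ hlt (LinearMap.ker φ) rfl
      refine ⟨k + 1, Fin.cons j s, ⟨?_⟩⟩
      let e₁ : M ≃ₗ[Γ.Alg K] (Γ.Proj K j × LinearMap.ker φ) :=
        e.trans (LinearEquiv.prodComm (Γ.Alg K) _ _)
      let e₂ : (Γ.Proj K j × LinearMap.ker φ) ≃ₗ[Γ.Alg K] (Γ.Proj K j × PiProj K s) :=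
        (LinearEquiv.refl (Γ.Alg K) (Γ.Proj K j)).prodCongr f
      let e₃ : (Γ.Proj K j × PiProj K s) ≃ₗ[Γ.Alg K]
          PiProj K (Fin.cons j s : Fin (k + 1) → Γ.Edge) :=
        Fin.consLinearEquiv (Γ.Alg K) (fun a : Fin (k + 1) =>
          Γ.Proj K ((Fin.cons j s : Fin (k + 1) → Γ.Edge) a))
      exact (e₁.trans e₂).trans e₃

/-- Every finitely generated projective module is a direct sum of modules `A e_i`. -/
theorem exists_equiv_PiProj (M : Type w) [AddCommGroup M] [Module (Γ.Alg K) M]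
    [Module.Finite (Γ.Alg K) M] [Module.Projective (Γ.Alg K) M] :
    ∃ (k : ℕ) (s : Fin k → Γ.Edge), Nonempty (M ≃ₗ[Γ.Alg K] PiProj K s) := by
  let _ : Module K M := Module.compHom M (algebraMap K (Γ.Alg K))
  have : IsScalarTower K (Γ.Alg K) M := ⟨fun c z m => by
    rw [Algebra.smul_def, mul_smul]; rfl⟩
  exact exists_equiv_PiProj_aux _ M rfl

end Proj

section Matrices

set_option linter.unusedSectionVars false
set_option linter.unusedDecidableInType false
set_option linter.unusedFintypeInType false

variable {V : Type v} {Γ : BrauerTree V} {K : Type u} [Field K]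
variable {α β γ : Type*} (s : α → Γ.Edge) (t : β → Γ.Edge) (r : γ → Γ.Edge)

variable (K) in
/-- Matrices with entries in the spaces `e_{s a} A e_{t b}`. -/
def MatHom : Submodule K (Matrix α β (Γ.Alg K)) where
  carrier := {M | ∀ a b, M a b ∈ Γ.corner K (s a) (t b)}
  add_mem' := fun h h' a b => Submodule.add_mem _ (h a b) (h' a b)
  zero_mem' := fun _ _ => Submodule.zero_mem _
  smul_mem' := fun c _ h a b => Submodule.smul_mem _ c (h a b)

variable {s t r}

theorem mul_mem_MatHom [Fintype β] {M : Matrix α β (Γ.Alg K)} {N : Matrix β γ (Γ.Alg K)}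
    (hM : M ∈ MatHom K s t) (hN : N ∈ MatHom K t r) : M * N ∈ MatHom K s r := fun a c => by
  rw [Matrix.mul_apply]
  exact Submodule.sum_mem _ fun b _ => mul_mem_corner (hM a b) (hN b c)

variable [Fintype α] [Fintype β] [DecidableEq α] [DecidableEq β] [Fintype γ] [DecidableEq γ]

variable (s t) in
/-- The map of projective modules given by a matrix. -/
noncomputable def toLin (M : Matrix α β (Γ.Alg K)) : PiProj K s →ₗ[Γ.Alg K] PiProj K t :=
  LinearMap.pi fun b => ∑ a, (homOf (s a) (M a b • Γ.gen K (t b))).comp (LinearMap.proj a)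

theorem toLin_apply {M : Matrix α β (Γ.Alg K)} (hM : M ∈ MatHom K s t) (x : PiProj K s) (b : β) :
    (toLin s t M x b : Γ.Alg K) = ∑ a, (x a : Γ.Alg K) * M a b := by
  simp [toLin, (hM _ b).2]

/-- The matrix of a map of projective modules. -/
noncomputable def toMat (φ : PiProj K s →ₗ[Γ.Alg K] PiProj K t) : Matrix α β (Γ.Alg K) :=
  fun a b => φ (Pi.single a (Γ.gen K (s a))) b

theorem toMat_mem (φ : PiProj K s →ₗ[Γ.Alg K] PiProj K t) : toMat φ ∈ MatHom K s t := fun a b =>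
  ⟨by
    have h : Γ.idem K (s a) • φ (Pi.single a (Γ.gen K (s a))) =
        φ (Pi.single a (Γ.gen K (s a))) := by
      rw [← map_smul, ← Pi.single_smul, idem_smul_gen]
    exact congrArg Subtype.val (congrFun h b), mem_Proj.1 (φ _ b).2⟩

theorem toLin_toMat (φ : PiProj K s →ₗ[Γ.Alg K] PiProj K t) : toLin s t (toMat φ) = φ := by
  ext a z b
  have hx : (Pi.single a z : PiProj K s) =
      (z : Γ.Alg K) • (Pi.single a (Γ.gen K (s a)) : PiProj K s) := by
    rw [← Pi.single_smul, smul_gen]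
  simp only [LinearMap.comp_apply, LinearMap.single_apply]
  rw [toLin_apply (toMat_mem φ), Finset.sum_eq_single a]
  · rw [Pi.single_eq_same, hx, map_smul]
    rfl
  · intro a' _ h
    rw [Pi.single_eq_of_ne h]
    exact zero_mul _
  · simp

theorem toMat_toLin {M : Matrix α β (Γ.Alg K)} (hM : M ∈ MatHom K s t) :
    toMat (toLin s t M) = M := by
  ext a b
  rw [toMat, toLin_apply hM, Finset.sum_eq_single a]
  · rw [Pi.single_eq_same]
    exact (hM a b).1
  · intro a' _ h
    rw [Pi.single_eq_of_ne h]
    exact zero_mul _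
  · simp

theorem toLin_comp {M : Matrix α β (Γ.Alg K)} {N : Matrix β γ (Γ.Alg K)}
    (hM : M ∈ MatHom K s t) (hN : N ∈ MatHom K t r) :
    (toLin t r N).comp (toLin s t M) = toLin s r (M * N) := by
  refine LinearMap.ext fun x => funext fun c => Subtype.ext ?_
  rw [LinearMap.comp_apply, toLin_apply hN, toLin_apply (mul_mem_MatHom hM hN)]
  simp only [toLin_apply hM, Matrix.mul_apply, Finset.sum_mul, Finset.mul_sum, mul_assoc]
  exact Finset.sum_comm

theorem toMat_comp (φ : PiProj K s →ₗ[Γ.Alg K] PiProj K t)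
    (ψ : PiProj K t →ₗ[Γ.Alg K] PiProj K r) : toMat (ψ.comp φ) = toMat φ * toMat ψ := by
  rw [← toMat_toLin (mul_mem_MatHom (toMat_mem φ) (toMat_mem ψ)),
    ← toLin_comp (toMat_mem φ) (toMat_mem ψ), toLin_toMat, toLin_toMat]

variable (K s t) in
/-- Maps of projective modules are the same as matrices. -/
noncomputable def matEquiv : (PiProj K s →ₗ[Γ.Alg K] PiProj K t) ≃ₗ[K] MatHom K s t where
  toFun φ := ⟨toMat φ, toMat_mem φ⟩
  map_add' _ _ := rfl
  map_smul' _ _ := rfl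
  invFun M := toLin s t M.1
  left_inv φ := toLin_toMat φ
  right_inv M := Subtype.ext (toMat_toLin M.2)

end Matrices

section Dimension

variable {V : Type v} (Γ : BrauerTree V) (K : Type u) [Field K] [Fintype V]

open Classical in
/-- The incidence vector of an edge. -/
noncomputable def inc (i : Γ.Edge) (x : V) : ℤ := if x ∈ i.1 then 1 else 0

open Classical in
theorem sum_inc_mul_inc (i j : Γ.Edge) : ∑ x, Γ.inc i x * Γ.inc j x =
    if i = j then 2 else if ∃ x, x ∈ i.1 ∧ x ∈ j.1 then 1 else 0 := by
  have h : ∀ x, Γ.inc i x * Γ.inc j x = if x ∈ i.1 ∧ x ∈ j.1 then 1 else 0 := by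
    intro x; unfold inc; split_ifs <;> simp_all
  simp only [h, Finset.sum_boole]
  split_ifs with h1 h2
  · subst h1
    obtain ⟨a, rfl⟩ := Γ.exists_source_eq i
    have : ({x | x ∈ (Γ.source a).1 ∧ x ∈ (Γ.source a).1} : Finset V) = {a.fst, a.snd} := by
      ext x; simp [mem_source_iff]
    rw [this, Finset.card_pair a.fst_ne_snd]
    rfl
  · obtain ⟨x, hx⟩ := h2
    have : ({y | y ∈ i.1 ∧ y ∈ j.1} : Finset V) = {x} := by
      ext y
      simp only [Finset.mem_filter, Finset.mem_univ, true_and, Finset.mem_singleton]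
      exact ⟨fun hy => Γ.eq_of_mem_of_mem h1 hy.1 hy.2 hx.1 hx.2, fun hy => hy ▸ hx⟩
    rw [this]
    simp
  · push Not at h2
    have : ({y | y ∈ i.1 ∧ y ∈ j.1} : Finset V) = ∅ := by
      ext y
      simpa using h2 y
    rw [this]
    simp

/-- The dimension of `e_i A e_j` is the number of common end points of `i` and `j`. -/
theorem finrank_corner (i j : Γ.Edge) :
    (Module.finrank K (Γ.corner K i j) : ℤ) = ∑ x, Γ.inc i x * Γ.inc j x := by
  classical
  rw [sum_inc_mul_inc]
  split_ifs with h1 h2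
  · subst h1
    have hspan : Γ.corner K i i =
        Submodule.span K (Set.range ![Γ.idem K i, Γ.soc K i]) := by
      apply le_antisymm
      · intro z hz
        obtain ⟨c, d, rfl⟩ := Γ.exists_eq_of_mem_corner_self K hz
        exact Submodule.add_mem _
          (Submodule.smul_mem _ _ (Submodule.subset_span ⟨0, rfl⟩))
          (Submodule.smul_mem _ _ (Submodule.subset_span ⟨1, rfl⟩))
      · rw [Submodule.span_le]
        rintro _ ⟨k, rfl⟩
        fin_cases k
        · exact Γ.idem_mem_corner K i
        · exact Γ.soc_mem_corner K i
    have hind : LinearIndependent K ![Γ.idem K i, Γ.soc K i] := by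
      rw [LinearIndependent.pair_iff]
      intro c d h
      exact Γ.idem_soc_independent K h
    rw [hspan, finrank_span_eq_card hind]
    simp
  · obtain ⟨x, hxi, hxj⟩ := h2
    obtain ⟨a, rfl, rfl⟩ := Γ.exists_dart_of_mem hxi
    obtain ⟨b, rfl, hb⟩ := Γ.exists_dart_of_mem hxj
    obtain ⟨k, hk, hkb⟩ := Γ.exists_iterate_eq hb.symm
    have hab : a ≠ b := fun h => h1 (by rw [h])
    have hspan : Γ.corner K (Γ.source a) (Γ.source b) =
        Submodule.span K {Γ.path K k a} := by
      apply le_antisymm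
      · intro z hz
        obtain ⟨c, rfl⟩ := Γ.exists_eq_of_mem_corner K hab hb.symm hk hkb hz
        exact Submodule.smul_mem _ _ (Submodule.subset_span rfl)
      · rw [Submodule.span_le, Set.singleton_subset_iff, ← hkb]
        exact Γ.path_mem_corner K k a
    rw [hspan, finrank_span_singleton (Γ.path_ne_zero K hk.le)]
    rfl
  · push Not at h2
    have : Γ.corner K i j = ⊥ := by
      rw [eq_bot_iff]
      intro z hz
      exact Γ.eq_zero_of_mem_corner K h2 hz
    rw [this, finrank_bot]
    rfl

/-- The class of `⨁ A e_{s a}` in the Grothendieck group, as a function on the vertices. -/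
noncomputable def cls {α : Type*} [Fintype α] (s : α → Γ.Edge) (x : V) : ℤ := ∑ a, Γ.inc (s a) x

variable {Γ}

theorem finrank_hom_PiProj {α β : Type*} [Fintype α] [Fintype β]
    (s : α → Γ.Edge) (t : β → Γ.Edge) :
    (Module.finrank K (PiProj K s →ₗ[Γ.Alg K] PiProj K t) : ℤ) =
      ∑ x, Γ.cls s x * Γ.cls t x := by
  classical
  let e : MatHom K s t ≃ₗ[K] (∀ a b, Γ.corner K (s a) (t b)) :=
    { toFun := fun M a b => ⟨M.1 a b, M.2 a b⟩
      map_add' := fun _ _ => rfl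
      map_smul' := fun _ _ => rfl
      invFun := fun M => ⟨fun a b => M a b, fun a b => (M a b).2⟩
      left_inv := fun _ => rfl
      right_inv := fun _ => rfl }
  rw [((matEquiv K s t).trans e).finrank_eq, Module.finrank_pi_fintype]
  simp only [Module.finrank_pi_fintype, Nat.cast_sum, finrank_corner, cls, Finset.sum_mul_sum]
  rw [Finset.sum_comm]
  conv_lhs => rw [Finset.sum_comm]
  conv_lhs =>
    enter [2, a]
    rw [Finset.sum_comm]
  exact Finset.sum_comm

end Dimension

end BrauerTree


/-! ### Two-term complexes -/

section TwoTerm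

open CochainComplex.HomComplex

variable {A : Type u} [Ring A]
variable {P₀ P₁ Q₀ Q₁ R₀ R₁ : Type w} [AddCommGroup P₀] [AddCommGroup P₁] [AddCommGroup Q₀]
  [AddCommGroup Q₁] [AddCommGroup R₀] [AddCommGroup R₁] [Module A P₀] [Module A P₁] [Module A Q₀]
  [Module A Q₁] [Module A R₀] [Module A R₁]

/-- The complex `P₀ ⟶ P₁`, in degrees `0` and `1`. -/
noncomputable def dbl (f : P₀ →ₗ[A] P₁) : CochainComplex (ModuleCat.{w} A) ℤ :=
  HomologicalComplex.double (c := ComplexShape.up ℤ) (i₀ := 0) (i₁ := 1)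
    (ModuleCat.ofHom f) (by simp)

/-- The component of `dbl f` in degree `0`. -/
noncomputable def dblX₀ (f : P₀ →ₗ[A] P₁) : (dbl f).X 0 ≅ ModuleCat.of A P₀ :=
  HomologicalComplex.doubleXIso₀ _ _

/-- The component of `dbl f` in degree `1`. -/
noncomputable def dblX₁ (f : P₀ →ₗ[A] P₁) : (dbl f).X 1 ≅ ModuleCat.of A P₁ :=
  HomologicalComplex.doubleXIso₁ _ _ (by simp)

theorem dbl_d (f : P₀ →ₗ[A] P₁) :
    (dbl f).d 0 1 = (dblX₀ f).hom ≫ ModuleCat.ofHom f ≫ (dblX₁ f).inv :=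
  HomologicalComplex.double_d _ _ (by simp)

theorem isZero_dbl_X (f : P₀ →ₗ[A] P₁) {k : ℤ} (h₀ : k ≠ 0) (h₁ : k ≠ 1) : IsZero ((dbl f).X k) :=
  HomologicalComplex.isZero_double_X _ _ _ h₀ h₁

variable {f : P₀ →ₗ[A] P₁} {g : Q₀ →ₗ[A] Q₁} {e : R₀ →ₗ[A] R₁}

/-- The map of two-term complexes with given components. -/
noncomputable def dblMap (h₀ : P₀ →ₗ[A] Q₀) (h₁ : P₁ →ₗ[A] Q₁) (h : g.comp h₀ = h₁.comp f) :
    dbl f ⟶ dbl g :=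
  HomologicalComplex.mkHomFromDouble _ (by simp) (ModuleCat.ofHom h₀ ≫ (dblX₀ g).inv)
    (ModuleCat.ofHom h₁ ≫ (dblX₁ g).inv) (by
      rw [dbl_d, Category.assoc, Iso.inv_hom_id_assoc, ← Category.assoc, ← Category.assoc,
        ← ModuleCat.ofHom_comp, ← ModuleCat.ofHom_comp, h]) (fun k _ => by
      rw [show (dbl g).d 1 k = 0 from HomologicalComplex.double_d_eq_zero₀ _ _ _ _ (by simp),
        comp_zero])

theorem dblMap_f₀ (h₀ : P₀ →ₗ[A] Q₀) (h₁ : P₁ →ₗ[A] Q₁) (h : g.comp h₀ = h₁.comp f) :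
    (dblMap h₀ h₁ h).f 0 = (dblX₀ f).hom ≫ ModuleCat.ofHom h₀ ≫ (dblX₀ g).inv :=
  HomologicalComplex.mkHomFromDouble_f₀ _ _ _ _ _ _

theorem dblMap_f₁ (h₀ : P₀ →ₗ[A] Q₀) (h₁ : P₁ →ₗ[A] Q₁) (h : g.comp h₀ = h₁.comp f) :
    (dblMap h₀ h₁ h).f 1 = (dblX₁ f).hom ≫ ModuleCat.ofHom h₁ ≫ (dblX₁ g).inv :=
  HomologicalComplex.mkHomFromDouble_f₁ _ _ _ _ _ _

theorem dbl_hom_ext {X : CochainComplex (ModuleCat.{w} A) ℤ} {φ ψ : dbl f ⟶ X}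
    (h₀ : φ.f 0 = ψ.f 0) (h₁ : φ.f 1 = ψ.f 1) : φ = ψ :=
  HomologicalComplex.from_double_hom_ext h₀ h₁

/-- A map between components in degree `0`, as a linear map. -/
noncomputable def lin₀₀ (φ : (dbl f).X 0 ⟶ (dbl g).X 0) : P₀ →ₗ[A] Q₀ :=
  ((dblX₀ f).inv ≫ φ ≫ (dblX₀ g).hom).hom

/-- A map between components in degree `1`, as a linear map. -/
noncomputable def lin₁₁ (φ : (dbl f).X 1 ⟶ (dbl g).X 1) : P₁ →ₗ[A] Q₁ :=
  ((dblX₁ f).inv ≫ φ ≫ (dblX₁ g).hom).hom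

/-- A map from the component in degree `1` to the component in degree `0`, as a linear map. -/
noncomputable def lin₁₀ (φ : (dbl f).X 1 ⟶ (dbl g).X 0) : P₁ →ₗ[A] Q₀ :=
  ((dblX₁ f).inv ≫ φ ≫ (dblX₀ g).hom).hom

/-- A map from the component in degree `0` to the component in degree `1`, as a linear map. -/
noncomputable def lin₀₁ (φ : (dbl f).X 0 ⟶ (dbl g).X 1) : P₀ →ₗ[A] Q₁ :=
  ((dblX₀ f).inv ≫ φ ≫ (dblX₁ g).hom).hom

theorem ofHom_inj {M N : Type w} [AddCommGroup M] [AddCommGroup N] [Module A M] [Module A N]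
    {φ ψ : M →ₗ[A] N} (h : ModuleCat.ofHom φ = ModuleCat.ofHom ψ) : φ = ψ :=
  congrArg ModuleCat.Hom.hom h

theorem ofHom_lin₀₀ (φ : (dbl f).X 0 ⟶ (dbl g).X 0) :
    ModuleCat.ofHom (lin₀₀ φ) = (dblX₀ f).inv ≫ φ ≫ (dblX₀ g).hom := rfl

theorem ofHom_lin₁₁ (φ : (dbl f).X 1 ⟶ (dbl g).X 1) :
    ModuleCat.ofHom (lin₁₁ φ) = (dblX₁ f).inv ≫ φ ≫ (dblX₁ g).hom := rfl

theorem ofHom_lin₁₀ (φ : (dbl f).X 1 ⟶ (dbl g).X 0) :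
    ModuleCat.ofHom (lin₁₀ φ) = (dblX₁ f).inv ≫ φ ≫ (dblX₀ g).hom := rfl

theorem ofHom_lin₀₁ (φ : (dbl f).X 0 ⟶ (dbl g).X 1) :
    ModuleCat.ofHom (lin₀₁ φ) = (dblX₀ f).inv ≫ φ ≫ (dblX₁ g).hom := rfl

theorem exists_dblMap (φ : dbl f ⟶ dbl g) : ∃ (h₀ : P₀ →ₗ[A] Q₀) (h₁ : P₁ →ₗ[A] Q₁)
    (h : g.comp h₀ = h₁.comp f), φ = dblMap h₀ h₁ h := by
  have hc := φ.comm 0 1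
  refine ⟨lin₀₀ (φ.f 0), lin₁₁ (φ.f 1), ?_, ?_⟩
  · apply ofHom_inj
    rw [ModuleCat.ofHom_comp, ModuleCat.ofHom_comp, ofHom_lin₀₀, ofHom_lin₁₁]
    rw [dbl_d, dbl_d] at hc
    have := congrArg (fun x => (dblX₀ f).inv ≫ x ≫ (dblX₁ g).hom) hc
    simpa using this
  · apply dbl_hom_ext
    · rw [dblMap_f₀, ofHom_lin₀₀]; simp
    · rw [dblMap_f₁, ofHom_lin₁₁]; simp

theorem dblMap_comp (h₀ : P₀ →ₗ[A] Q₀) (h₁ : P₁ →ₗ[A] Q₁) (h : g.comp h₀ = h₁.comp f)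
    (k₀ : Q₀ →ₗ[A] R₀) (k₁ : Q₁ →ₗ[A] R₁) (k : e.comp k₀ = k₁.comp g) :
    dblMap h₀ h₁ h ≫ dblMap k₀ k₁ k = dblMap (k₀.comp h₀) (k₁.comp h₁) (by
      rw [← LinearMap.comp_assoc, k, LinearMap.comp_assoc, h, LinearMap.comp_assoc]) := by
  apply dbl_hom_ext
  · simp [dblMap_f₀]
  · simp [dblMap_f₁]

theorem dblMap_id : dblMap LinearMap.id LinearMap.id (by rfl) = 𝟙 (dbl f) := by
  apply dbl_hom_ext
  · simp [dblMap_f₀]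
  · simp [dblMap_f₁]

theorem dblMap_add (h₀ k₀ : P₀ →ₗ[A] Q₀) (h₁ k₁ : P₁ →ₗ[A] Q₁) (h : g.comp h₀ = h₁.comp f)
    (k : g.comp k₀ = k₁.comp f) :
    dblMap h₀ h₁ h + dblMap k₀ k₁ k = dblMap (h₀ + k₀) (h₁ + k₁) (by
      rw [LinearMap.comp_add, LinearMap.add_comp, h, k]) := by
  apply dbl_hom_ext
  · simp [dblMap_f₀, ModuleCat.ofHom_add]
  · simp [dblMap_f₁, ModuleCat.ofHom_add]

/-- The morphism in the homotopy category with given components. -/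
noncomputable def qmap (h₀ : P₀ →ₗ[A] Q₀) (h₁ : P₁ →ₗ[A] Q₁) (h : g.comp h₀ = h₁.comp f) :
    toHtpy (dbl f) ⟶ toHtpy (dbl g) :=
  (HomotopyCategory.quotient _ _).map (dblMap h₀ h₁ h)

theorem exists_qmap (φ : toHtpy (dbl f) ⟶ toHtpy (dbl g)) :
    ∃ (h₀ : P₀ →ₗ[A] Q₀) (h₁ : P₁ →ₗ[A] Q₁) (h : g.comp h₀ = h₁.comp f), φ = qmap h₀ h₁ h := by
  obtain ⟨ψ, rfl⟩ := (HomotopyCategory.quotient _ _).map_surjective φ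
  obtain ⟨h₀, h₁, h, rfl⟩ := exists_dblMap ψ
  exact ⟨h₀, h₁, h, rfl⟩

theorem qmap_comp (h₀ : P₀ →ₗ[A] Q₀) (h₁ : P₁ →ₗ[A] Q₁) (h : g.comp h₀ = h₁.comp f)
    (k₀ : Q₀ →ₗ[A] R₀) (k₁ : Q₁ →ₗ[A] R₁) (k : e.comp k₀ = k₁.comp g) :
    qmap h₀ h₁ h ≫ qmap k₀ k₁ k = qmap (k₀.comp h₀) (k₁.comp h₁) (by
      rw [← LinearMap.comp_assoc, k, LinearMap.comp_assoc, h, LinearMap.comp_assoc]) := by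
  rw [qmap, qmap, qmap, ← Functor.map_comp, dblMap_comp]

theorem qmap_id : qmap LinearMap.id LinearMap.id (by rfl) = 𝟙 (toHtpy (dbl f)) := by
  rw [qmap, dblMap_id, CategoryTheory.Functor.map_id]

theorem qmap_add (h₀ k₀ : P₀ →ₗ[A] Q₀) (h₁ k₁ : P₁ →ₗ[A] Q₁) (h : g.comp h₀ = h₁.comp f)
    (k : g.comp k₀ = k₁.comp f) :
    qmap h₀ h₁ h + qmap k₀ k₁ k = qmap (h₀ + k₀) (h₁ + k₁) (by
      rw [LinearMap.comp_add, LinearMap.add_comp, h, k]) := by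
  rw [qmap, qmap, qmap, ← Functor.map_add, dblMap_add]

/-- A map of two-term complexes is null-homotopic if and only if it factors through the
differentials in a compatible way. -/
theorem qmap_eq_zero_iff {h₀ : P₀ →ₗ[A] Q₀} {h₁ : P₁ →ₗ[A] Q₁} {h : g.comp h₀ = h₁.comp f} :
    qmap h₀ h₁ h = 0 ↔ ∃ k : P₁ →ₗ[A] Q₀, h₀ = k.comp f ∧ h₁ = g.comp k := by
  rw [qmap, HomotopyCategory.quotient_map_eq_zero_iff]
  constructor
  · rintro ⟨H⟩
    obtain ⟨z, hz⟩ := Cochain.equivHomotopy _ _ H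
    have e₀ := Cochain.congr_v hz 0 0 (by simp)
    have e₁ := Cochain.congr_v hz 1 1 (by simp)
    rw [Cochain.ofHom_v, Cochain.add_v, Cochain.ofHom_zero, Cochain.zero_v, add_zero,
      δ_v (-1) 0 (by simp) z 0 0 (by simp) (-1) 1 (by simp) (by simp),
      (isZero_dbl_X g (by simp) (by simp)).eq_zero_of_tgt (z.v 0 (-1) _), zero_comp, zero_add,
      Int.negOnePow_zero, one_smul, dblMap_f₀, dbl_d] at e₀
    rw [Cochain.ofHom_v, Cochain.add_v, Cochain.ofHom_zero, Cochain.zero_v, add_zero,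
      δ_v (-1) 0 (by simp) z 1 1 (by simp) 0 2 (by simp) (by simp),
      (isZero_dbl_X f (by simp) (by simp)).eq_zero_of_src (z.v 2 1 _), comp_zero, smul_zero,
      add_zero, dblMap_f₁, dbl_d] at e₁
    refine ⟨lin₁₀ (z.v 1 0 (by simp)), ?_, ?_⟩
    · apply ofHom_inj
      rw [ModuleCat.ofHom_comp, ofHom_lin₁₀]
      have := congrArg (fun x => (dblX₀ f).inv ≫ x ≫ (dblX₀ g).hom) e₀
      simpa using this
    · apply ofHom_inj
      rw [ModuleCat.ofHom_comp, ofHom_lin₁₀]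
      have := congrArg (fun x => (dblX₁ f).inv ≫ x ≫ (dblX₁ g).hom) e₁
      simpa using this
  · rintro ⟨k, rfl, rfl⟩
    refine ⟨(Cochain.equivHomotopy _ _).symm
      ⟨Cochain.single ((dblX₁ f).hom ≫ ModuleCat.ofHom k ≫ (dblX₀ g).inv) (-1), ?_⟩⟩
    rw [Cochain.ofHom_zero, add_zero, Cochain.δ_single _ (-1) 0 (by simp) 0 1 (by simp) (by simp)]
    refine Cochain.ext₀ _ _ fun p => ?_
    rw [Cochain.ofHom_v]
    by_cases hp₀ : p = 0
    · subst hp₀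
      rw [Cochain.add_v, Cochain.units_smul_v, Cochain.single_v,
        Cochain.single_v_eq_zero _ _ _ _ _ (by simp), dblMap_f₀, dbl_d]
      simp
    · by_cases hp₁ : p = 1
      · subst hp₁
        rw [Cochain.add_v, Cochain.units_smul_v, Cochain.single_v, Cochain.single_v_eq_zero _ _ _ _ _ (by simp),
          dblMap_f₁, dbl_d]
        simp
      · exact (isZero_dbl_X f hp₀ hp₁).eq_of_src _ _

theorem qmap_congr {h₀ k₀ : P₀ →ₗ[A] Q₀} {h₁ k₁ : P₁ →ₗ[A] Q₁} (h : g.comp h₀ = h₁.comp f)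
    (e₀ : h₀ = k₀) (e₁ : h₁ = k₁) : qmap h₀ h₁ h = qmap k₀ k₁ (e₀ ▸ e₁ ▸ h) := by
  subst e₀ e₁
  rfl

/-- An isomorphism of maps gives an isomorphism of two-term complexes. -/
noncomputable def dblIso (e₀ : P₀ ≃ₗ[A] Q₀) (e₁ : P₁ ≃ₗ[A] Q₁)
    (h : g.comp e₀.toLinearMap = e₁.toLinearMap.comp f) : dbl f ≅ dbl g where
  hom := dblMap e₀ e₁ h
  inv := dblMap e₀.symm e₁.symm (by
    ext x
    have := LinearMap.congr_fun h (e₀.symm x)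
    simp only [LinearMap.comp_apply, LinearEquiv.coe_coe, LinearEquiv.apply_symm_apply] at this ⊢
    rw [this, LinearEquiv.symm_apply_apply])
  hom_inv_id := by
    rw [dblMap_comp, ← dblMap_id]
    congr 1
    · ext x; simp
    · ext x; simp
  inv_hom_id := by
    rw [dblMap_comp, ← dblMap_id]
    congr 1
    · ext x; simp
    · ext x; simp

/-- Every two-term complex is of the form `dbl f`. -/
theorem IsTwoTerm.exists_iso {T : CochainComplex (ModuleCat.{w} A) ℤ} (hT : IsTwoTerm T) :
    Nonempty (dbl (T.d 0 1).hom ≅ T) := by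
  let φ : dbl (T.d 0 1).hom ⟶ T :=
    HomologicalComplex.mkHomFromDouble _ (by simp) (𝟙 (T.X 0)) (𝟙 (T.X 1)) (by
      rw [Category.id_comp, Category.comp_id]; rfl) (fun k hk => by
        have : k = 2 := by
          have : (1 : ℤ) + 1 = k := hk
          omega
        subst this
        exact (hT.2 2 (by simp) (by simp)).eq_of_tgt _ _)
  have h₀ : φ.f 0 = (dblX₀ _).hom ≫ 𝟙 _ := HomologicalComplex.mkHomFromDouble_f₀ _ _ _ _ _ _
  have h₁ : φ.f 1 = (dblX₁ _).hom ≫ 𝟙 _ := HomologicalComplex.mkHomFromDouble_f₁ _ _ _ _ _ _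
  have : ∀ k, IsIso (φ.f k) := by
    intro k
    by_cases hk₀ : k = 0
    · subst hk₀
      rw [h₀, Category.comp_id]
      infer_instance
    · by_cases hk₁ : k = 1
      · subst hk₁
        rw [h₁, Category.comp_id]
        infer_instance
      · exact ⟨0, (isZero_dbl_X _ hk₀ hk₁).eq_of_src _ _, (hT.2 k hk₀ hk₁).eq_of_src _ _⟩
  have : IsIso φ := HomologicalComplex.Hom.isIso_of_components φ
  exact ⟨asIso φ⟩

section Perfect

variable [Module.Finite A P₀] [Module.Finite A P₁] [Module.Projective A P₀] [Module.Projective A P₁]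

theorem isTwoTerm_dbl (f : P₀ →ₗ[A] P₁) : IsTwoTerm (dbl f) := by
  refine ⟨⟨fun i => ?_, 0, 1, fun i hi => isZero_dbl_X f (by omega) (by omega)⟩,
    fun i h₀ h₁ => isZero_dbl_X f h₀ h₁⟩
  by_cases h₀ : i = 0
  · subst h₀
    exact ⟨Module.Finite.equiv (dblX₀ f).toLinearEquiv.symm,
      Module.Projective.of_equiv (dblX₀ f).toLinearEquiv.symm⟩
  · by_cases h₁ : i = 1
    · subst h₁
      exact ⟨Module.Finite.equiv (dblX₁ f).toLinearEquiv.symm,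
        Module.Projective.of_equiv (dblX₁ f).toLinearEquiv.symm⟩
    · have := ModuleCat.subsingleton_of_isZero (isZero_dbl_X f h₀ h₁)
      exact ⟨inferInstance, inferInstance⟩

end Perfect

theorem IsPerfectComplex.isKProjective [Small.{w} A] {T : CochainComplex (ModuleCat.{w} A) ℤ}
    (hT : IsPerfectComplex T) : T.IsKProjective := by
  obtain ⟨h, a, b, hab⟩ := hT
  have : ∀ n, Projective (T.X n) := fun n =>
    (IsProjective.iff_projective (T.X n)).1 (h n).2
  have : T.IsStrictlyLE b := by
    rw [CochainComplex.isStrictlyLE_iff]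
    exact fun i hi => hab i (Or.inr hi)
  exact CochainComplex.isKProjective_of_projective T b

/-- Morphisms in the derived category from a perfect complex to a shift vanish if and only if
all cocycles in the complex of morphisms are coboundaries. -/
theorem subsingleton_derived_iff [Small.{w} A] [HasDerivedCategory.{v} (ModuleCat.{w} A)]
    {X Y : CochainComplex (ModuleCat.{w} A) ℤ} (hX : IsPerfectComplex X) (n : ℤ) :
    Subsingleton (DerivedCategory.Q.obj X ⟶ (DerivedCategory.Q.obj Y)⟦n⟧) ↔
      ∀ z : Cocycle X Y n, ∃ β : Cochain X Y (n - 1), δ (n - 1) n β = z.1 := by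
  have := hX.isKProjective
  let e₁ : (DerivedCategory.Q.obj X ⟶ (DerivedCategory.Q.obj Y)⟦n⟧) ≃
      (DerivedCategory.Qh.obj (toHtpy X) ⟶ DerivedCategory.Qh.obj (toHtpy (Y⟦n⟧))) :=
    Iso.homCongr ((DerivedCategory.quotientCompQhIso _).symm.app X)
      ((DerivedCategory.Q.commShiftIso n).symm.app Y ≪≫
        (DerivedCategory.quotientCompQhIso _).symm.app (Y⟦n⟧))
  let e₂ : (toHtpy X ⟶ toHtpy (Y⟦n⟧)) ≃
      (DerivedCategory.Qh.obj (toHtpy X) ⟶ DerivedCategory.Qh.obj (toHtpy (Y⟦n⟧))) :=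
    Equiv.ofBijective _ (CochainComplex.IsKProjective.Qh_map_bijective X (toHtpy (Y⟦n⟧)))
  let e₃ : CohomologyClass X Y n ≃ (toHtpy X ⟶ toHtpy (Y⟦n⟧)) :=
    Equiv.ofBijective _ (CohomologyClass.toHom_bijective X Y n)
  rw [(e₁.trans (e₂.symm.trans e₃.symm)).subsingleton_congr]
  constructor
  · intro h z
    have := Subsingleton.elim (CohomologyClass.mk z) 0
    rw [CohomologyClass.mk_eq_zero_iff, mem_coboundaries_iff _ (n - 1) (by simp)] at this
    exact this
  · intro h
    refine ⟨fun x y => ?_⟩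
    rw [← sub_eq_zero]
    obtain ⟨z, hz⟩ := CohomologyClass.mk_surjective (x - y)
    rw [← hz, CohomologyClass.mk_eq_zero_iff, mem_coboundaries_iff _ (n - 1) (by simp)]
    exact h z

/-- Vanishing of the morphisms of degree one, in terms of the components. -/
def ExtOneVanish (f : P₀ →ₗ[A] P₁) (g : Q₀ →ₗ[A] Q₁) : Prop :=
  ∀ u : P₀ →ₗ[A] Q₁, ∃ (h₀ : P₀ →ₗ[A] Q₀) (h₁ : P₁ →ₗ[A] Q₁), u = g.comp h₀ + h₁.comp f

/-- Vanishing of the morphisms of degree minus one, in terms of the components. -/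
def ExtNegOneVanish (f : P₀ →ₗ[A] P₁) (g : Q₀ →ₗ[A] Q₁) : Prop :=
  ∀ k : P₁ →ₗ[A] Q₀, g.comp k = 0 → k.comp f = 0 → k = 0

theorem extOneVanish_iff : (∀ z : Cocycle (dbl f) (dbl g) 1,
    ∃ β : Cochain (dbl f) (dbl g) (1 - 1), δ (1 - 1) 1 β = z.1) ↔ ExtOneVanish f g := by
  constructor
  · intro H u
    obtain ⟨β, hβ⟩ := H (Cocycle.mk
      (Cochain.single ((dblX₀ f).hom ≫ ModuleCat.ofHom u ≫ (dblX₁ g).inv) 1) 2 (by simp) (by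
        refine Cochain.ext _ _ fun p q hpq => ?_
        by_cases hp : p = 0 ∨ p = 1
        · have : q ≠ 0 ∧ q ≠ 1 := by omega
          exact (isZero_dbl_X g this.1 this.2).eq_of_tgt _ _
        · push Not at hp
          exact (isZero_dbl_X f hp.1 hp.2).eq_of_src _ _))
    have e := Cochain.congr_v hβ 0 1 (by simp)
    rw [δ_v (1 - 1) 1 (by simp) β 0 1 (by simp) 0 1 (by simp) (by simp)] at e
    simp only [Cocycle.mk_coe, Cochain.single_v] at e
    rw [dbl_d, dbl_d] at e
    refine ⟨lin₀₀ (β.v 0 0 (by simp)), - lin₁₁ (β.v 1 1 (by simp)), ?_⟩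
    apply ofHom_inj
    have hneg : ModuleCat.ofHom (-(lin₁₁ (β.v 1 1 (by simp))).comp f) =
      -ModuleCat.ofHom ((lin₁₁ (β.v 1 1 (by simp))).comp f) := rfl
    rw [LinearMap.neg_comp, ModuleCat.ofHom_add, hneg, ModuleCat.ofHom_comp,
      ModuleCat.ofHom_comp, ofHom_lin₀₀, ofHom_lin₁₁]
    have := congrArg (fun x => (dblX₀ f).inv ≫ x ≫ (dblX₁ g).hom) e
    simpa [Int.negOnePow_one] using this.symm
  · intro H z
    obtain ⟨h₀, h₁, hu⟩ := H (lin₀₁ (z.1.v 0 1 (by simp)))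
    refine ⟨Cochain.single ((dblX₀ f).hom ≫ ModuleCat.ofHom h₀ ≫ (dblX₀ g).inv) _ -
      Cochain.single ((dblX₁ f).hom ≫ ModuleCat.ofHom h₁ ≫ (dblX₁ g).inv) _, ?_⟩
    refine Cochain.ext _ _ fun p q hpq => ?_
    by_cases hp : p = 0
    · subst hp
      obtain rfl : q = 1 := by omega
      rw [δ_v (1 - 1) 1 (by simp) _ 0 1 (by simp) 0 1 (by simp) (by simp), Cochain.sub_v,
        Cochain.sub_v, Cochain.single_v, Cochain.single_v, Cochain.single_v_eq_zero _ _ _ _ _ (by simp),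
        Cochain.single_v_eq_zero _ _ _ _ _ (by simp), dbl_d, dbl_d]
      have h2 := congrArg ModuleCat.ofHom hu
      rw [ModuleCat.ofHom_add, ModuleCat.ofHom_comp, ModuleCat.ofHom_comp,
        ofHom_lin₀₁] at h2
      have := congrArg (fun x => (dblX₀ f).hom ≫ x ≫ (dblX₁ g).inv) h2
      simp only [Category.assoc, Iso.hom_inv_id_assoc, Iso.hom_inv_id, Category.comp_id,
        Preadditive.comp_add, Preadditive.add_comp] at this
      rw [this]
      simp [Int.negOnePow_one]
    · by_cases hp₁ : p = 1
      · exact (isZero_dbl_X g (by omega) (by omega)).eq_of_tgt _ _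
      · exact (isZero_dbl_X f hp hp₁).eq_of_src _ _

theorem extNegOneVanish_iff : (∀ z : Cocycle (dbl f) (dbl g) (-1),
    ∃ β : Cochain (dbl f) (dbl g) (-1 - 1), δ (-1 - 1) (-1) β = z.1) ↔ ExtNegOneVanish f g := by
  have hβ : ∀ β : Cochain (dbl f) (dbl g) (-1 - 1), β = 0 := by
    intro β
    refine Cochain.ext _ _ fun p q hpq => ?_
    by_cases hp : p = 0 ∨ p = 1
    · exact (isZero_dbl_X g (by omega) (by omega)).eq_of_tgt _ _
    · push Not at hp
      exact (isZero_dbl_X f hp.1 hp.2).eq_of_src _ _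
  constructor
  · intro H k h₁ h₂
    obtain ⟨β, hk⟩ := H (Cocycle.mk
      (Cochain.single ((dblX₁ f).hom ≫ ModuleCat.ofHom k ≫ (dblX₀ g).inv) (-1)) 0 (by simp) (by
        rw [Cochain.δ_single _ (-1) 0 (by simp) 0 1 (by simp) (by simp), dbl_d, dbl_d]
        simp only [Category.assoc, Iso.inv_hom_id_assoc]
        have h₁' := congrArg ModuleCat.ofHom h₁
        have h₂' := congrArg ModuleCat.ofHom h₂
        rw [ModuleCat.ofHom_comp] at h₁' h₂'
        rw [reassoc_of% h₁', reassoc_of% h₂']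
        simp))
    rw [hβ β, δ_zero] at hk
    have e := Cochain.congr_v hk 1 0 (by simp)
    simp only [Cocycle.mk_coe, Cochain.single_v, Cochain.zero_v] at e
    apply ofHom_inj
    have := congrArg (fun x => (dblX₁ f).inv ≫ x ≫ (dblX₀ g).hom) e
    simpa using this.symm
  · intro H z
    refine ⟨0, ?_⟩
    rw [δ_zero]
    have hz := z.δ_eq_zero 0
    have e₀ := Cochain.congr_v hz 0 0 (by simp)
    have e₁ := Cochain.congr_v hz 1 1 (by simp)
    rw [δ_v (-1) 0 (by simp) z.1 0 0 (by simp) (-1) 1 (by simp) (by simp),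
      (isZero_dbl_X g (by simp) (by simp)).eq_zero_of_tgt (z.1.v 0 (-1) _), zero_comp, zero_add,
      Int.negOnePow_zero, one_smul, Cochain.zero_v, dbl_d] at e₀
    rw [δ_v (-1) 0 (by simp) z.1 1 1 (by simp) 0 2 (by simp) (by simp),
      (isZero_dbl_X f (by simp) (by simp)).eq_zero_of_src (z.1.v 2 1 _), comp_zero, smul_zero,
      add_zero, Cochain.zero_v, dbl_d] at e₁
    have hk := H (lin₁₀ (z.1.v 1 0 (by simp))) (by
      apply ofHom_inj
      rw [ModuleCat.ofHom_comp, ofHom_lin₁₀]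
      have := congrArg (fun x => (dblX₁ f).inv ≫ x ≫ (dblX₁ g).hom) e₁
      simpa using this) (by
      apply ofHom_inj
      rw [ModuleCat.ofHom_comp, ofHom_lin₁₀]
      have := congrArg (fun x => (dblX₀ f).inv ≫ x ≫ (dblX₀ g).hom) e₀
      simpa using this)
    refine Cochain.ext _ _ fun p q hpq => ?_
    by_cases hp : p = 1
    · subst hp
      obtain rfl : q = 0 := by omega
      have h2 := congrArg ModuleCat.ofHom hk
      rw [ofHom_lin₁₀] at h2
      have := congrArg (fun x => (dblX₁ f).hom ≫ x ≫ (dblX₀ g).inv) h2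
      simpa using this.symm
    · by_cases hp₀ : p = 0
      · exact (isZero_dbl_X g (by omega) (by omega)).eq_of_tgt _ _
      · exact (isZero_dbl_X f hp₀ hp).eq_of_src _ _

theorem subsingleton_derived_dbl_iff [Small.{w} A] [HasDerivedCategory.{v} (ModuleCat.{w} A)]
    [Module.Finite A P₀] [Module.Finite A P₁] [Module.Projective A P₀] [Module.Projective A P₁] :
    (∀ i : ℤ, i ≠ 0 → Subsingleton (DerivedCategory.Q.obj (dbl f) ⟶
      (DerivedCategory.Q.obj (dbl g))⟦i⟧)) ↔ ExtOneVanish f g ∧ ExtNegOneVanish f g := by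
  have hf := (isTwoTerm_dbl f).1
  simp only [subsingleton_derived_iff hf]
  constructor
  · intro H
    exact ⟨extOneVanish_iff.1 (H 1 (by simp)), extNegOneVanish_iff.1 (H (-1) (by simp))⟩
  · rintro ⟨h₁, h₂⟩ i hi
    by_cases hi₁ : i = 1
    · subst hi₁
      exact extOneVanish_iff.2 h₁
    by_cases hi₂ : i = -1
    · subst hi₂
      exact extNegOneVanish_iff.2 h₂
    intro z
    refine ⟨0, ?_⟩
    rw [δ_zero]
    refine Cochain.ext _ _ fun p q hpq => ?_
    by_cases hp : p = 0 ∨ p = 1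
    · exact (isZero_dbl_X g (by omega) (by omega)).eq_of_tgt _ _
    · push Not at hp
      exact (isZero_dbl_X f hp.1 hp.2).eq_of_src _ _

section Linear

variable {K : Type*} [Field K] [Algebra K A] [Module K Q₀] [Module K Q₁] [IsScalarTower K A Q₀]
  [IsScalarTower K A Q₁] [SMulCommClass A K Q₀] [SMulCommClass A K Q₁]

theorem moduleCat_smul_apply {X Y : ModuleCat.{w} A} (c : K) (φ : X ⟶ Y) (x : X) :
    (c • φ).hom x = algebraMap K A c • φ.hom x := rfl

theorem comp_smul_of_comp_eq {h₀ : P₀ →ₗ[A] Q₀} {h₁ : P₁ →ₗ[A] Q₁} (h : g.comp h₀ = h₁.comp f)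
    (c : K) : g.comp (c • h₀) = (c • h₁).comp f := by
  ext x
  have := LinearMap.congr_fun h x
  simp only [LinearMap.comp_apply, LinearMap.smul_apply] at this ⊢
  rw [← this, ← algebraMap_smul A c (h₀ x), map_smul, algebraMap_smul]

theorem dblMap_smul (c : K) (h₀ : P₀ →ₗ[A] Q₀) (h₁ : P₁ →ₗ[A] Q₁) (h : g.comp h₀ = h₁.comp f) :
    c • dblMap h₀ h₁ h = dblMap (c • h₀) (c • h₁) (comp_smul_of_comp_eq h c) := by
  apply dbl_hom_ext
  · rw [HomologicalComplex.smul_f_apply, dblMap_f₀, dblMap_f₀]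
    refine ModuleCat.hom_ext (LinearMap.ext fun x => ?_)
    rw [moduleCat_smul_apply]
    change algebraMap K A c • (dblX₀ g).inv.hom (h₀ ((dblX₀ f).hom.hom x)) =
      (dblX₀ g).inv.hom (c • h₀ ((dblX₀ f).hom.hom x))
    rw [← algebraMap_smul A c, ← map_smul]
  · rw [HomologicalComplex.smul_f_apply, dblMap_f₁, dblMap_f₁]
    refine ModuleCat.hom_ext (LinearMap.ext fun x => ?_)
    rw [moduleCat_smul_apply]
    change algebraMap K A c • (dblX₁ g).inv.hom (h₁ ((dblX₁ f).hom.hom x)) =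
      (dblX₁ g).inv.hom (c • h₁ ((dblX₁ f).hom.hom x))
    rw [← algebraMap_smul A c, ← map_smul]

theorem qmap_smul (c : K) (h₀ : P₀ →ₗ[A] Q₀) (h₁ : P₁ →ₗ[A] Q₁) (h : g.comp h₀ = h₁.comp f) :
    c • qmap h₀ h₁ h = qmap (c • h₀) (c • h₁) (comp_smul_of_comp_eq h c) := by
  rw [qmap, qmap, ← Functor.map_smul, dblMap_smul]

end Linear

end TwoTerm


/-! ### Rigid two-term complexes are determined by their terms -/

section Rigid

open Polynomial

variable {K : Type*} [Field K]

/-- The inverse of `1 + t N`, up to the determinant, depends polynomially on `t`. -/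
theorem exists_polynomial_inverse {W : Type*} [AddCommGroup W] [Module K W]
    {n : Type*} [Fintype n] [DecidableEq n] (b : Module.Basis n K W) (N : W →ₗ[K] W) (g : W) :
    ∃ (D : K[X]) (y : n → K[X]), D.eval 0 = 1 ∧ ∀ t : K,
      (∑ i, (y i).eval t • b i) + t • N (∑ i, (y i).eval t • b i) = D.eval t • g := by
  let M : Matrix n n K[X] := 1 + (X : K[X]) • (LinearMap.toMatrix b b N).map C
  have hM : ∀ t : K, (evalRingHom t).mapMatrix M = 1 + t • LinearMap.toMatrix b b N := by
    intro t
    ext i j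
    simp [M, Matrix.one_apply, apply_ite, mul_comm t]
  refine ⟨M.det, M.adjugate.mulVec fun i => C (b.repr g i), ?_, fun t => ?_⟩
  · rw [← coe_evalRingHom, RingHom.map_det, hM]
    simp
  · set v : n → K := fun i => (M.adjugate.mulVec (fun i => C (b.repr g i)) i).eval t with hv
    have h₁ : (1 + t • LinearMap.toMatrix b b N).mulVec v = M.det.eval t • ⇑(b.repr g) := by
      have h₂ : M.mulVec (M.adjugate.mulVec fun i => C (b.repr g i)) =
          M.det • fun i => C (b.repr g i) := by
        rw [Matrix.mulVec_mulVec, Matrix.mul_adjugate, Matrix.smul_mulVec, Matrix.one_mulVec]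
      funext i
      have h₃ := congrArg (eval t) (congrFun h₂ i)
      rw [← hM]
      simp only [Matrix.mulVec, dotProduct, eval_finsetSum, eval_mul, Pi.smul_apply, smul_eq_mul,
        eval_C] at h₃ ⊢
      rw [← h₃]
      refine Finset.sum_congr rfl fun j _ => ?_
      simp [hv, Matrix.mulVec, dotProduct, eval_finsetSum]
    apply b.repr.injective
    ext i
    have h₄ := congrFun h₁ i
    have h₅ : b.repr (∑ i, v i • b i) = Finsupp.equivFunOnFinite.symm v := by
      ext j
      rw [map_sum]
      simp [Finsupp.single_apply]
    have h₆ : b.repr (N (∑ i, v i • b i)) i = ((LinearMap.toMatrix b b N).mulVec v) i := by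
      rw [← LinearMap.toMatrix_mulVec_repr b b N, h₅]
      rfl
    rw [map_add, map_smul, map_smul, Finsupp.add_apply, Finsupp.smul_apply, Finsupp.smul_apply, h₆,
      h₅]
    rw [Matrix.add_mulVec, Matrix.one_mulVec, Matrix.smul_mulVec] at h₄
    exact h₄

/-- The determinant of a polynomial family of endomorphisms is a polynomial. -/
theorem exists_polynomial_det {W : Type*} [AddCommGroup W] [Module K W] [Module.Finite K W]
    {n : Type*} [Fintype n] (F : n → W →ₗ[K] W) (y : n → K[X]) :
    ∃ p : K[X], ∀ t, p.eval t = LinearMap.det (∑ i, (y i).eval t • F i) := by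
  let c := Module.finBasis K W
  refine ⟨Matrix.det (∑ i, y i • (LinearMap.toMatrix c c (F i)).map C), fun t => ?_⟩
  rw [← LinearMap.det_toMatrix c, ← coe_evalRingHom, RingHom.map_det]
  congr 1
  ext i j
  simp [Matrix.sum_apply]

variable {A : Type u} [Ring A] [Algebra K A]
variable {P₀ P₁ : Type w} [AddCommGroup P₀] [AddCommGroup P₁] [Module A P₀] [Module A P₁]
  [Module K P₀] [Module K P₁] [IsScalarTower K A P₀] [IsScalarTower K A P₁] [SMulCommClass A K P₀]
  [SMulCommClass A K P₁] [Module.Finite K P₀] [Module.Finite K P₁]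

set_option linter.unusedSectionVars false in
theorem finite_linearMap_of_algebra : Module.Finite K (P₀ →ₗ[A] P₁) :=
  Module.Finite.of_injective (LinearMap.restrictScalarsₗ K A P₀ P₁ K)
    (LinearMap.restrictScalars_injective K)

theorem ExtOneVanish.exists_polynomial {f : P₀ →ₗ[A] P₁} (hf : ExtOneVanish f f)
    (g : P₀ →ₗ[A] P₁) :
    ∃ p : K[X], p ≠ 0 ∧ ∀ t, p.eval t ≠ 0 → ∃ (e₀ : P₀ ≃ₗ[A] P₀) (e₁ : P₁ ≃ₗ[A] P₁),
      (f + t • g).comp e₀.toLinearMap = e₁.toLinearMap.comp f := by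
  have hfin : Module.Finite K (P₀ →ₗ[A] P₁) := finite_linearMap_of_algebra
  let b := Module.finBasis K (P₀ →ₗ[A] P₁)
  choose h₀ h₁ hh using fun i => hf (b i)
  let σ₀ : (P₀ →ₗ[A] P₁) →ₗ[K] (P₀ →ₗ[A] P₀) := b.constr K h₀
  let σ₁ : (P₀ →ₗ[A] P₁) →ₗ[K] (P₁ →ₗ[A] P₁) := b.constr K h₁
  have hσ : ∀ u, f.comp (σ₀ u) + (σ₁ u).comp f = u := by
    intro u
    rw [← b.sum_repr u]
    ext x
    simp only [map_sum, map_smul, σ₀, σ₁, b.constr_basis, LinearMap.add_apply,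
      LinearMap.comp_apply, LinearMap.sum_apply, LinearMap.smul_apply]
    rw [← Finset.sum_add_distrib]
    refine Finset.sum_congr rfl fun i _ => ?_
    have := LinearMap.congr_fun (hh i) x
    rw [this, LinearMap.add_apply, smul_add]
    congr 1
    rw [← algebraMap_smul A, map_smul, algebraMap_smul, LinearMap.comp_apply]
  let N : (P₀ →ₗ[A] P₁) →ₗ[K] (P₀ →ₗ[A] P₁) :=
    { toFun := fun u => g.comp (σ₀ u)
      map_add' := fun u v => by rw [map_add, LinearMap.comp_add]
      map_smul' := fun c u => by
        ext x
        simp only [map_smul, LinearMap.comp_apply, LinearMap.smul_apply, RingHom.id_apply]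
        rw [← algebraMap_smul A, map_smul, algebraMap_smul] }
  obtain ⟨D, y, hD, hy⟩ := exists_polynomial_inverse b N g
  have key : ∀ (P : Type w) [AddCommGroup P] [Module A P] [Module K P] [IsScalarTower K A P]
      [SMulCommClass A K P] [Module.Finite K P] (h : Fin (Module.finrank K (P₀ →ₗ[A] P₁)) →
        P →ₗ[A] P), ∃ p : K[X], p.eval 0 = 1 ∧ ∀ t, p.eval t ≠ 0 → Function.Bijective
          (D.eval t • LinearMap.id - t • ∑ i, (y i).eval t • h i : P →ₗ[A] P) := by
    intro P _ _ _ _ _ _ h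
    obtain ⟨p, hp⟩ := exists_polynomial_det
      (fun i : Option (Fin (Module.finrank K (P₀ →ₗ[A] P₁))) =>
        i.elim LinearMap.id fun i => -(h i).restrictScalars K) fun i => i.elim D fun i => X * y i
    have hs : ∀ t, (∑ i : Option (Fin (Module.finrank K (P₀ →ₗ[A] P₁))),
        (eval t (i.elim D fun i => X * y i)) •
          (i.elim LinearMap.id fun i => -(h i).restrictScalars K : P →ₗ[K] P)) =
        (D.eval t • LinearMap.id - t • ∑ i, (y i).eval t • h i : P →ₗ[A] P).restrictScalars K := by
      intro t
      ext x
      simp [Fintype.sum_option, LinearMap.sum_apply, sub_eq_add_neg, mul_smul, Finset.smul_sum]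
    refine ⟨p, ?_, fun t ht => ?_⟩
    · rw [hp, hs]
      simp only [hD, one_smul, zero_smul, sub_zero]
      exact LinearMap.det_id
    · rw [hp, hs] at ht
      exact LinearEquiv.bijective (LinearMap.equivOfDetNeZero _ ht)
  obtain ⟨p₀, hp₀, hb₀⟩ := key P₀ h₀
  obtain ⟨p₁, hp₁, hb₁⟩ := key P₁ fun i => -h₁ i
  refine ⟨p₀ * p₁, fun h => ?_, fun t ht => ?_⟩
  · have := congrArg (eval 0) h
    rw [eval_mul, hp₀, hp₁, eval_zero, one_mul] at this
    exact one_ne_zero this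
  · rw [eval_mul] at ht
    refine ⟨LinearEquiv.ofBijective _ (hb₀ t (left_ne_zero_of_mul ht)),
      LinearEquiv.ofBijective _ (hb₁ t (right_ne_zero_of_mul ht)), ?_⟩
    have e₀ : ∑ i, (y i).eval t • h₀ i = σ₀ (∑ i, (y i).eval t • b i) := by
      simp [σ₀, map_sum, b.constr_basis]
    have e₁ : ∑ i, (y i).eval t • -h₁ i = -σ₁ (∑ i, (y i).eval t • b i) := by
      simp [σ₁, map_sum, b.constr_basis]
    set u := ∑ i, (y i).eval t • b i
    have hu := hy t
    ext x
    have h₂ := LinearMap.congr_fun (hσ u) x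
    have h₃ := LinearMap.congr_fun hu x
    have hsm : ∀ (φ : P₀ →ₗ[A] P₁) (c : K) (z : P₀), φ (c • z) = c • φ z := fun φ c z => by
      rw [← algebraMap_smul A, map_smul, algebraMap_smul]
    simp only [LinearMap.comp_apply, LinearMap.add_apply, LinearMap.smul_apply,
      LinearMap.sub_apply, LinearEquiv.coe_coe, LinearEquiv.ofBijective_apply, e₀, e₁,
      LinearMap.id_apply, map_sub, hsm, LinearMap.neg_apply] at h₂ h₃ ⊢
    change u x + t • g (σ₀ u x) = _ at h₃
    have h₄ : (σ₁ u) (f x) = u x - f (σ₀ u x) := by rw [← h₂]; abel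
    rw [h₄]
    have h₅ : eval t D • g x = u x + t • g (σ₀ u x) := h₃.symm
    rw [smul_add, smul_comm (eval t D) t, h₅]
    simp only [smul_add, smul_sub, smul_neg]
    abel

/-- Rigid two-term complexes with the same terms are isomorphic. -/
theorem ExtOneVanish.exists_equiv [Infinite K] {f f' : P₀ →ₗ[A] P₁} (hf : ExtOneVanish f f)
    (hf' : ExtOneVanish f' f') : ∃ (e₀ : P₀ ≃ₗ[A] P₀) (e₁ : P₁ ≃ₗ[A] P₁),
      f'.comp e₀.toLinearMap = e₁.toLinearMap.comp f := by
  obtain ⟨p, hp, h⟩ := hf.exists_polynomial (K := K) (f' - f)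
  obtain ⟨q, hq, h'⟩ := hf'.exists_polynomial (K := K) (f - f')
  have hpq : p * q.comp (1 - X) ≠ 0 := by
    refine mul_ne_zero hp fun h0 => hq ?_
    have := congrArg (fun r : K[X] => r.comp (1 - X)) h0
    simpa [comp_assoc] using this
  obtain ⟨t, ht⟩ : ∃ t, (p * q.comp (1 - X)).eval t ≠ 0 := by
    by_contra! hc
    exact hpq (Polynomial.funext fun t => by rw [hc, eval_zero])
  rw [eval_mul, eval_comp] at ht
  obtain ⟨a₀, a₁, ha⟩ := h t (left_ne_zero_of_mul ht)
  obtain ⟨b₀, b₁, hb⟩ := h' _ (right_ne_zero_of_mul ht)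
  have hft : f' + (eval t (1 - X : K[X])) • (f - f') = f + t • (f' - f) := by
    simp only [eval_sub, eval_one, eval_X, sub_smul, one_smul, smul_sub]
    abel
  rw [hft] at hb
  refine ⟨a₀.trans b₀.symm, a₁.trans b₁.symm, ?_⟩
  ext x
  have h₁ := LinearMap.congr_fun ha x
  have h₂ := LinearMap.congr_fun hb (b₀.symm (a₀ x))
  simp only [LinearMap.comp_apply, LinearEquiv.coe_coe, LinearEquiv.apply_symm_apply,
    LinearEquiv.trans_apply] at h₁ h₂ ⊢
  rw [← h₁, h₂, LinearEquiv.symm_apply_apply]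

end Rigid


/-! ### Rooted trees -/

namespace BrauerTree

section Rooted

variable {V : Type v} (Γ : BrauerTree V) (v : V)

theorem exists_down_dart (i : Γ.Edge) : ∃ a : Γ.Arrow, Γ.source a = i ∧
    Γ.graph.dist v a.snd = Γ.graph.dist v a.fst + 1 := by
  obtain ⟨a, rfl⟩ := Γ.exists_source_eq i
  rcases Γ.isTree.dist_eq_dist_add_one_of_adj v a.adj with h | h
  · exact ⟨a.symm, Γ.source_symm a, h⟩
  · exact ⟨a, rfl, h⟩

/-- The dart of an edge that points away from the root `v`. -/
noncomputable def down (i : Γ.Edge) : Γ.Arrow := (Γ.exists_down_dart v i).choose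

@[simp] theorem source_down (i : Γ.Edge) : Γ.source (Γ.down v i) = i :=
  (Γ.exists_down_dart v i).choose_spec.1

/-- The end point of an edge that is closer to the root. -/
noncomputable def top (i : Γ.Edge) : V := (Γ.down v i).fst

/-- The end point of an edge that is farther from the root. -/
noncomputable def bot (i : Γ.Edge) : V := (Γ.down v i).snd

/-- The level of an edge: its distance from the root. -/
noncomputable def lev (i : Γ.Edge) : ℕ := Γ.graph.dist v (Γ.top v i)

theorem dist_bot (i : Γ.Edge) : Γ.graph.dist v (Γ.bot v i) = Γ.lev v i + 1 :=
  (Γ.exists_down_dart v i).choose_spec.2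

theorem mem_iff_top_or_bot {i : Γ.Edge} {x : V} : x ∈ i.1 ↔ x = Γ.top v i ∨ x = Γ.bot v i := by
  conv_lhs => rw [← Γ.source_down v i]
  exact Γ.mem_source_iff

theorem top_ne_bot (i : Γ.Edge) : Γ.top v i ≠ Γ.bot v i := (Γ.down v i).fst_ne_snd

theorem bot_ne_root (i : Γ.Edge) : Γ.bot v i ≠ v := by
  intro h
  have := Γ.dist_bot v i
  rw [h, SimpleGraph.dist_self] at this
  omega

theorem eq_of_adj_of_dist {a b x : V} (ha : Γ.graph.Adj a x) (hb : Γ.graph.Adj b x)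
    (hda : Γ.graph.dist v x = Γ.graph.dist v a + 1)
    (hdb : Γ.graph.dist v x = Γ.graph.dist v b + 1) : a = b := by
  obtain ⟨p, hp⟩ := Γ.isTree.connected.exists_walk_length_eq_dist v a
  obtain ⟨q, hq⟩ := Γ.isTree.connected.exists_walk_length_eq_dist v b
  have hp' : (p.concat ha).IsPath := (p.concat ha).isPath_of_length_eq_dist (by simp [hp, hda])
  have hq' : (q.concat hb).IsPath := (q.concat hb).isPath_of_length_eq_dist (by simp [hq, hdb])
  have h := congrArg Subtype.val ((Γ.isTree.isAcyclic.subsingleton_path _ _).elim ⟨_, hp'⟩ ⟨_, hq'⟩)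
  have := congrArg SimpleGraph.Walk.penultimate h
  simpa using this

theorem bot_injective : Function.Injective (Γ.bot v) := by
  intro i j h
  have hi := (Γ.down v i).adj
  have hj := (Γ.down v j).adj
  have h1 := Γ.dist_bot v i
  have h2 := Γ.dist_bot v j
  have hfst : (Γ.down v i).fst = (Γ.down v j).fst := by
    refine Γ.eq_of_adj_of_dist v hi ?_ h1 ?_
    · change Γ.graph.Adj _ (Γ.bot v i)
      rw [h]
      exact hj
    · change Γ.graph.dist v (Γ.bot v i) = _
      rw [h]
      exact h2
  rw [← Γ.source_down v i, ← Γ.source_down v j]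
  congr 1
  exact SimpleGraph.Dart.ext _ _ (Prod.ext hfst h)

theorem down_source_of_dist {a : Γ.Arrow} (h : Γ.graph.dist v a.snd = Γ.graph.dist v a.fst + 1) :
    Γ.down v (Γ.source a) = a := by
  rcases Γ.source_eq_iff.1 (Γ.source_down v (Γ.source a)) with h' | h'
  · exact h'
  · exfalso
    have h1 := Γ.dist_bot v (Γ.source a)
    rw [lev, bot, top, h'] at h1
    change Γ.graph.dist v a.fst = Γ.graph.dist v a.snd + 1 at h1
    omega

theorem exists_bot_eq {x : V} (hx : x ≠ v) : ∃ i, Γ.bot v i = x := by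
  obtain ⟨p, hp⟩ := Γ.isTree.connected.exists_walk_length_eq_dist x v
  cases p with
  | nil => exact absurd rfl hx
  | @cons _ y _ h p =>
    have h1 := SimpleGraph.dist_le p
    rw [SimpleGraph.Walk.length_cons] at hp
    rw [SimpleGraph.dist_comm (v := v)] at h1 hp
    have h2 : Γ.graph.dist v x = Γ.graph.dist v y + 1 := by
      rcases Γ.isTree.dist_eq_dist_add_one_of_adj v h with h' | h' <;> omega
    exact ⟨Γ.source ⟨(y, x), h.symm⟩, by rw [bot, Γ.down_source_of_dist v h2]⟩

theorem top_eq_root_iff {i : Γ.Edge} : Γ.top v i = v ↔ Γ.lev v i = 0 := by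
  rw [lev, Γ.isTree.connected.dist_eq_zero_iff]
  exact eq_comm

open Classical in
/-- The parent of an edge, at the end point closer to the root. -/
noncomputable def par (i : Γ.Edge) : Γ.Edge :=
  if h : Γ.top v i = v then i else (Γ.exists_bot_eq v h).choose

theorem bot_par {i : Γ.Edge} (h : Γ.lev v i ≠ 0) : Γ.bot v (Γ.par v i) = Γ.top v i := by
  have h' := mt (Γ.top_eq_root_iff v).1 h
  rw [par, dif_neg h']
  exact (Γ.exists_bot_eq v h').choose_spec

theorem lev_par {i : Γ.Edge} (h : Γ.lev v i ≠ 0) : Γ.lev v (Γ.par v i) + 1 = Γ.lev v i := by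
  rw [← dist_bot, Γ.bot_par v h]
  rfl

theorem par_eq {i j : Γ.Edge} (h : Γ.bot v j = Γ.top v i) : Γ.par v i = j := by
  apply Γ.bot_injective v
  rw [Γ.bot_par v, h]
  rw [ne_eq, ← Γ.top_eq_root_iff, ← h]
  exact Γ.bot_ne_root v j

/-- The ancestor of an edge at a given level. -/
noncomputable def anc (x : Γ.Edge) (k : ℕ) : Γ.Edge := (Γ.par v)^[Γ.lev v x - k] x

@[simp] theorem anc_lev (x : Γ.Edge) : Γ.anc v x (Γ.lev v x) = x := by simp [anc]

theorem par_anc {x : Γ.Edge} {k : ℕ} (h : k + 1 ≤ Γ.lev v x) :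
    Γ.par v (Γ.anc v x (k + 1)) = Γ.anc v x k := by
  rw [anc, anc, show Γ.lev v x - k = (Γ.lev v x - (k + 1)).succ by omega,
    Function.iterate_succ_apply']

theorem lev_anc_sub (x : Γ.Edge) (m : ℕ) (h : m ≤ Γ.lev v x) :
    Γ.lev v (Γ.anc v x (Γ.lev v x - m)) = Γ.lev v x - m := by
  induction m with
  | zero => simp
  | succ m ih =>
    have h1 := ih (by omega)
    have h2 : Γ.lev v x - m = Γ.lev v x - (m + 1) + 1 := by omega
    rw [h2] at h1
    have h3 := Γ.lev_par v (i := Γ.anc v x (Γ.lev v x - (m + 1) + 1)) (by omega)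
    rw [Γ.par_anc v (by omega)] at h3
    omega

theorem lev_anc {x : Γ.Edge} {k : ℕ} (h : k ≤ Γ.lev v x) : Γ.lev v (Γ.anc v x k) = k := by
  have := Γ.lev_anc_sub v x (Γ.lev v x - k) (by omega)
  rwa [show Γ.lev v x - (Γ.lev v x - k) = k by omega] at this

theorem bot_anc {x : Γ.Edge} {k : ℕ} (h : k + 1 ≤ Γ.lev v x) :
    Γ.bot v (Γ.anc v x k) = Γ.top v (Γ.anc v x (k + 1)) := by
  rw [← Γ.par_anc v h, Γ.bot_par]
  rw [Γ.lev_anc v h]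
  omega

theorem anc_injOn {x : Γ.Edge} {k l : ℕ} (hk : k ≤ Γ.lev v x) (hl : l ≤ Γ.lev v x)
    (h : Γ.anc v x k = Γ.anc v x l) : k = l := by
  rw [← Γ.lev_anc v hk, h, Γ.lev_anc v hl]

theorem lev_eq_or_of_mem_of_mem {i j : Γ.Edge} {x : V} (hi : x ∈ i.1) (hj : x ∈ j.1) :
    Γ.lev v i = Γ.lev v j ∨ (Γ.lev v j = Γ.lev v i + 1 ∧ Γ.par v j = i) ∨
      (Γ.lev v i = Γ.lev v j + 1 ∧ Γ.par v i = j) := by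
  have hbi := Γ.dist_bot v i
  have hbj := Γ.dist_bot v j
  rcases (Γ.mem_iff_top_or_bot v).1 hi with rfl | rfl <;>
    rcases (Γ.mem_iff_top_or_bot v).1 hj with h | h
  · left
    rw [lev, lev, h]
  · right; right
    refine ⟨?_, Γ.par_eq v h.symm⟩
    rw [← hbj, ← h]
    rfl
  · right; left
    refine ⟨?_, Γ.par_eq v h⟩
    rw [← hbi, h]
    rfl
  · left
    rw [Γ.bot_injective v h]

/-- The sign of the two-colouring of the tree for which the root is positive. -/
noncomputable def sgn (x : V) : ℤ := (-1) ^ Γ.graph.dist v x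

theorem sgn_mul_self (x : V) : Γ.sgn v x * Γ.sgn v x = 1 := by
  rw [sgn, ← mul_pow]
  simp

theorem sgn_root : Γ.sgn v v = 1 := by simp [sgn]

theorem sgn_bot (i : Γ.Edge) : Γ.sgn v (Γ.bot v i) = -Γ.sgn v (Γ.top v i) := by
  rw [sgn, dist_bot, sgn, lev, pow_succ]
  ring

theorem inc_eq (i : Γ.Edge) (x : V) [DecidableEq V] :
    Γ.inc i x = (if x = Γ.top v i then 1 else 0) + if x = Γ.bot v i then 1 else 0 := by
  have := Γ.top_ne_bot v i
  rw [inc]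
  simp only [Γ.mem_iff_top_or_bot v]
  split_ifs <;> simp_all

theorem sum_sgn_mul_inc [Fintype V] (i : Γ.Edge) : ∑ x, Γ.sgn v x * Γ.inc i x = 0 := by
  classical
  simp [Γ.inc_eq v, mul_add, Finset.sum_add_distrib, sgn_bot]

theorem sum_sgn_mul_cls [Fintype V] {α : Type*} [Fintype α] (s : α → Γ.Edge) :
    ∑ x, Γ.sgn v x * Γ.cls s x = 0 := by
  simp only [cls, Finset.mul_sum]
  rw [Finset.sum_comm]
  exact Finset.sum_eq_zero fun a _ => Γ.sum_sgn_mul_inc v (s a)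

/-- The incidence vectors of the edges of a tree are linearly independent. -/
theorem eq_zero_of_sum_mul_inc [Fintype Γ.Edge] {m : Γ.Edge → ℤ}
    (h : ∀ x, ∑ i, m i * Γ.inc i x = 0) : m = 0 := by
  classical
  obtain ⟨v⟩ := Γ.isTree.connected.nonempty
  by_contra hm
  obtain ⟨i, hi⟩ := Function.ne_iff.1 hm
  obtain ⟨j, hj, hmax⟩ := Finset.exists_max_image (Finset.univ.filter fun i => m i ≠ 0) (Γ.lev v)
    ⟨i, by simpa using hi⟩
  rw [Finset.mem_filter] at hj
  apply hj.2
  rw [← h (Γ.bot v j), Finset.sum_eq_single j]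
  · have := Γ.top_ne_bot v j
    simp [Γ.inc_eq v, this.symm]
  · intro k _ hk
    by_cases hmk : m k = 0
    · rw [hmk, zero_mul]
    · have h1 := hmax k (by simpa using hmk)
      have h2 : Γ.bot v j ≠ Γ.bot v k := fun h => hk (Γ.bot_injective v h).symm
      have h3 : Γ.bot v j ≠ Γ.top v k := fun h => by
        have := Γ.dist_bot v j
        rw [h] at this
        change Γ.lev v k = _ at this
        omega
      rw [Γ.inc_eq v, if_neg h2, if_neg h3]
      simp
  · simp

open Classical in
theorem cls_eq_sum_card [Fintype Γ.Edge] {α : Type*} [Fintype α] (s : α → Γ.Edge) (x : V) :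
    Γ.cls s x = ∑ i, (Fintype.card {c // s c = i} : ℤ) * Γ.inc i x := by
  rw [cls, ← Finset.sum_fiberwise Finset.univ s]
  refine Finset.sum_congr rfl fun i _ => ?_
  rw [Finset.sum_congr rfl (g := fun _ => Γ.inc i x) fun c hc => by
    rw [(Finset.mem_filter.1 hc).2], Finset.sum_const, Fintype.card_subtype, nsmul_eq_mul]

theorem exists_equiv_of_cls_eq [Fintype V] {α β : Type*} [Fintype α] [Fintype β] {s : α → Γ.Edge}
    {t : β → Γ.Edge} (h : ∀ x, Γ.cls s x = Γ.cls t x) : ∃ e : α ≃ β, ∀ a, t (e a) = s a := by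
  classical
  have := Fintype.ofFinite Γ.Edge
  have hm := Γ.eq_zero_of_sum_mul_inc
    (m := fun i => (Fintype.card {c // s c = i} : ℤ) - Fintype.card {c // t c = i}) fun x => by
      simp only [sub_mul, Finset.sum_sub_distrib]
      rw [← cls_eq_sum_card, ← cls_eq_sum_card, h, sub_self]
  have he : ∀ i, Nonempty ({c // s c = i} ≃ {c // t c = i}) := fun i => by
    rw [← Fintype.card_eq]
    have := congrFun hm i
    simp only [Pi.zero_apply] at this
    omega
  let e := fun i => (he i).some
  refine ⟨(Equiv.sigmaFiberEquiv s).symm.trans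
    ((Equiv.sigmaCongrRight e).trans (Equiv.sigmaFiberEquiv t)), fun a => ?_⟩
  exact (e (s a) ⟨a, rfl⟩).2

end Rooted

end BrauerTree

/-! ### Roots -/

section Roots

variable {V : Type*} [Fintype V] [DecidableEq V]

/-- A vector of square length two whose coordinates have sum zero is a difference of two vectors
of the standard basis. -/
theorem exists_eq_single_sub_single {z : V → ℤ} (h₀ : ∑ x, z x = 0) (h₂ : ∑ x, z x * z x = 2) :
    ∃ a b, a ≠ b ∧ ∀ x, z x = (if x = a then 1 else 0) - if x = b then 1 else 0 := by
  have hex : ∃ x ∈ Finset.univ, z x ≠ 0 := by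
    by_contra! h
    rw [Finset.sum_eq_zero fun x hx => by rw [h x hx, zero_mul]] at h₂
    omega
  obtain ⟨a, -, ha⟩ := Finset.exists_pos_of_sum_zero_of_exists_nonzero z h₀ hex
  obtain ⟨b, -, hb⟩ := Finset.exists_pos_of_sum_zero_of_exists_nonzero (fun x => - z x)
    (by rw [Finset.sum_neg_distrib, h₀, neg_zero]) (by simpa using hex)
  have hab : a ≠ b := by
    rintro rfl
    omega
  have hsq : ∀ x, 0 ≤ z x * z x := fun x => mul_self_nonneg _
  rw [← Finset.add_sum_erase _ _ (Finset.mem_univ a),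
    ← Finset.add_sum_erase _ _ (show b ∈ Finset.univ.erase a by simp [hab.symm])] at h₂
  have hr := Finset.sum_nonneg fun x (_ : x ∈ (Finset.univ.erase a).erase b) => hsq x
  have ha' : z a = 1 := by nlinarith
  have hb' : z b = -1 := by nlinarith
  have hr' : ∑ x ∈ (Finset.univ.erase a).erase b, z x * z x = 0 := by
    rw [ha', hb'] at h₂
    omega
  rw [Finset.sum_eq_zero_iff_of_nonneg fun x _ => hsq x] at hr'
  refine ⟨a, b, hab, fun x => ?_⟩
  by_cases hxa : x = a
  · subst hxa
    simp [ha', hab]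
  · by_cases hxb : x = b
    · subst hxb
      simp [hb', hxa]
    · have := hr' x (by simp [hxa, hxb])
      rw [mul_self_eq_zero] at this
      simp [this, hxa, hxb]

theorem sum_single_sub_single_of_const {ι : Type*} [Fintype ι] {a : V} {b : ι → V}
    (hcard : Fintype.card V = Fintype.card ι + 1) (hab : ∀ i, a ≠ b i)
    (hb : Function.Injective b) (x : V) :
    ∑ i, ((if x = a then (1 : ℤ) else 0) - if x = b i then 1 else 0) =
      if x = a then (Fintype.card ι : ℤ) else -1 := by
  classical
  by_cases hxa : x = a
  · subst hxa
    simp [hab]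
  · have himg : Finset.univ.image b = Finset.univ.erase a := by
      apply Finset.eq_of_subset_of_card_le
      · intro y hy
        obtain ⟨i, -, rfl⟩ := Finset.mem_image.1 hy
        simp [(hab i).symm]
      · rw [Finset.card_image_of_injective _ hb, Finset.card_erase_of_mem (Finset.mem_univ a),
          Finset.card_univ, Finset.card_univ, hcard]
        omega
    obtain ⟨j, -, rfl⟩ := Finset.mem_image.1 (show x ∈ Finset.univ.image b by simp [himg, hxa])
    simp [hxa, hb.eq_iff]

/-- Roots with pairwise inner products one, as many as possible, form a star. -/
theorem exists_sum_eq_of_pairwise_eq_one {ι : Type*} [Fintype ι]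
    (hcard : Fintype.card V = Fintype.card ι + 1) {z : ι → V → ℤ}
    (h₀ : ∀ i, ∑ x, z i x = 0) (h₂ : ∀ i, ∑ x, z i x * z i x = 2)
    (h₁ : ∀ i j, i ≠ j → ∑ x, z i x * z j x = 1) :
    ∃ (v : V) (ε : ℤ), (ε = 1 ∨ ε = -1) ∧
      ∀ x, ∑ i, z i x = ε * if x = v then (Fintype.card ι : ℤ) else -1 := by
  choose a b hab hz using fun i => exists_eq_single_sub_single (h₀ i) (h₂ i)
  have hp : ∀ i j, i ≠ j → (a i = a j ∧ b i ≠ b j) ∨ (a i ≠ a j ∧ b i = b j) := by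
    intro i j hij
    have := h₁ i j hij
    simp only [hz, mul_sub, mul_ite, mul_one, mul_zero,
      Finset.sum_sub_distrib, Finset.sum_ite_eq', Finset.mem_univ, if_true] at this
    have h1 := hab i
    have h2 := hab j
    split_ifs at this <;> grind
  by_cases hA : ∃ i j, i ≠ j ∧ a i = a j
  · obtain ⟨i, j, hij, haij⟩ := hA
    have hbij : b i ≠ b j := by
      rcases hp i j hij with h | h
      · exact h.2
      · exact absurd haij h.1
    have ha : ∀ k, a k = a i := by
      intro k
      by_cases hki : k = i
      · rw [hki]
      by_cases hkj : k = j
      · rw [hkj, haij]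
      rcases hp k i hki with h | h
      · exact h.1
      · rcases hp k j hkj with h' | h'
        · rw [h'.1, haij]
        · exact absurd (h.2.symm.trans h'.2) hbij
    refine ⟨a i, 1, Or.inl rfl, fun x => ?_⟩
    rw [one_mul, ← sum_single_sub_single_of_const hcard (a := a i) (b := b)
      (fun k => (ha k) ▸ hab k) (fun k l hkl => by
        by_contra hne
        rcases hp k l hne with h | h
        · exact h.2 hkl
        · exact h.1 ((ha k).trans (ha l).symm))]
    exact Finset.sum_congr rfl fun k _ => by rw [hz, ha]
  · push Not at hA
    have ha : Function.Injective a := fun k l hkl => by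
      by_contra hne
      exact hA k l hne hkl
    have hb : ∀ i j, b i = b j := by
      intro i j
      by_cases hij : i = j
      · rw [hij]
      rcases hp i j hij with h | h
      · exact absurd h.1 (hA i j hij)
      · exact h.2
    by_cases hι : Nonempty ι
    · obtain ⟨i⟩ := hι
      refine ⟨b i, -1, Or.inr rfl, fun x => ?_⟩
      rw [← sum_single_sub_single_of_const hcard (a := b i) (b := a)
        (fun k => (hb k i) ▸ (hab k).symm) ha, Finset.mul_sum]
      exact Finset.sum_congr rfl fun k _ => by rw [hz, hb k i]; ring
    · rw [not_nonempty_iff] at hι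
      have : Nonempty V := by
        rw [← Fintype.card_pos_iff]
        omega
      obtain ⟨v⟩ := this
      have hs : ∀ x, x = v := fun x => by
        have : Fintype.card V ≤ 1 := by simp [hcard]
        exact Fintype.card_le_one_iff.1 this x v
      exact ⟨v, 1, Or.inl rfl, fun x => by simp [hs x]⟩

end Roots


/-! ### The Euler form -/

section Euler

variable {K : Type*} [Field K] {A : Type u} [Ring A] [Algebra K A]
variable {P₀ P₁ Q₀ Q₁ : Type w} [AddCommGroup P₀] [AddCommGroup P₁] [AddCommGroup Q₀]
  [AddCommGroup Q₁] [Module A P₀] [Module A P₁] [Module A Q₀] [Module A Q₁]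
  [Module K Q₀] [Module K Q₁] [IsScalarTower K A Q₀] [IsScalarTower K A Q₁]
  [SMulCommClass A K Q₀] [SMulCommClass A K Q₁] (f : P₀ →ₗ[A] P₁) (g : Q₀ →ₗ[A] Q₁)

theorem comp_smul_of_algebra {P : Type*} [AddCommGroup P] [Module A P] (φ : Q₀ →ₗ[A] Q₁) (c : K)
    (ψ : P →ₗ[A] Q₀) : φ.comp (c • ψ) = c • φ.comp ψ := by
  ext x
  simp only [LinearMap.comp_apply, LinearMap.smul_apply]
  rw [← algebraMap_smul A, map_smul, algebraMap_smul]

variable (K) in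
/-- The differential of the complex of morphisms in degree `0`. -/
def homDiffZero : ((P₀ →ₗ[A] Q₀) × (P₁ →ₗ[A] Q₁)) →ₗ[K] (P₀ →ₗ[A] Q₁) where
  toFun h := g.comp h.1 - h.2.comp f
  map_add' h k := by
    simp only [Prod.fst_add, Prod.snd_add, LinearMap.comp_add, LinearMap.add_comp]
    abel
  map_smul' c h := by
    simp only [Prod.smul_fst, Prod.smul_snd, comp_smul_of_algebra, LinearMap.smul_comp, smul_sub,
      RingHom.id_apply]

variable (K) in
/-- The differential of the complex of morphisms in degree `-1`. -/
def homDiffNegOne : (P₁ →ₗ[A] Q₀) →ₗ[K] LinearMap.ker (homDiffZero K f g) where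
  toFun k := ⟨(k.comp f, g.comp k), by
    simp [homDiffZero, LinearMap.comp_assoc]⟩
  map_add' h k := by
    ext1
    simp only [LinearMap.comp_add, LinearMap.add_comp, Submodule.coe_add, Prod.mk_add_mk]
  map_smul' c h := by
    ext1
    simp only [comp_smul_of_algebra, LinearMap.smul_comp, RingHom.id_apply, Submodule.coe_smul,
      Prod.smul_mk]

variable (K) in
/-- The passage from morphisms of complexes to the homotopy category. -/
noncomputable def homClass :
    LinearMap.ker (homDiffZero K f g) →ₗ[K] (toHtpy (dbl f) ⟶ toHtpy (dbl g)) where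
  toFun h := qmap h.1.1 h.1.2 (sub_eq_zero.1 h.2)
  map_add' _ _ := (qmap_add _ _ _ _ _ _).symm
  map_smul' c _ := (qmap_smul c _ _ _).symm

theorem homClass_surjective : Function.Surjective (homClass K f g) := by
  intro φ
  obtain ⟨h₀, h₁, h, rfl⟩ := exists_qmap φ
  exact ⟨⟨(h₀, h₁), sub_eq_zero.2 h⟩, rfl⟩

theorem ker_homClass : LinearMap.ker (homClass K f g) = LinearMap.range (homDiffNegOne K f g) := by
  ext ⟨⟨h₀, h₁⟩, h⟩
  rw [LinearMap.mem_ker]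
  change qmap h₀ h₁ _ = 0 ↔ _
  rw [qmap_eq_zero_iff]
  constructor
  · rintro ⟨k, rfl, rfl⟩
    exact ⟨k, rfl⟩
  · rintro ⟨k, hk⟩
    have := congrArg Subtype.val hk
    exact ⟨k, (congrArg Prod.fst this).symm, (congrArg Prod.snd this).symm⟩

variable [Module K P₀] [Module K P₁] [IsScalarTower K A P₀] [IsScalarTower K A P₁]
  [SMulCommClass A K P₀] [SMulCommClass A K P₁] [Module.Finite K P₀] [Module.Finite K P₁]
  [Module.Finite K Q₀] [Module.Finite K Q₁]

theorem finite_htpy_hom : Module.Finite K (toHtpy (dbl f) ⟶ toHtpy (dbl g)) := by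
  have : Module.Finite K (P₀ →ₗ[A] Q₀) := finite_linearMap_of_algebra
  have : Module.Finite K (P₁ →ₗ[A] Q₁) := finite_linearMap_of_algebra
  exact Module.Finite.of_surjective _ (homClass_surjective f g)

variable {f g} in
/-- If there are no morphisms of nonzero degrees, the dimension of the space of morphisms is the
value of the Euler form. -/
theorem finrank_htpy_hom (h₁ : ExtOneVanish f g) (h₂ : ExtNegOneVanish f g) :
    (Module.finrank K (toHtpy (dbl f) ⟶ toHtpy (dbl g)) : ℤ) =
      Module.finrank K (P₀ →ₗ[A] Q₀) + Module.finrank K (P₁ →ₗ[A] Q₁) -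
        Module.finrank K (P₀ →ₗ[A] Q₁) - Module.finrank K (P₁ →ₗ[A] Q₀) := by
  have : Module.Finite K (P₀ →ₗ[A] Q₀) := finite_linearMap_of_algebra
  have : Module.Finite K (P₁ →ₗ[A] Q₁) := finite_linearMap_of_algebra
  have : Module.Finite K (P₁ →ₗ[A] Q₀) := finite_linearMap_of_algebra
  have hsurj : Function.Surjective (homDiffZero K f g) := by
    intro u
    obtain ⟨a, b, rfl⟩ := h₁ u
    refine ⟨(a, -b), ?_⟩
    simp [homDiffZero, LinearMap.neg_comp]
  have hinj : Function.Injective (homDiffNegOne K f g) := by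
    rw [← LinearMap.ker_eq_bot, LinearMap.ker_eq_bot']
    intro k hk
    have := congrArg Subtype.val hk
    exact h₂ k (congrArg Prod.snd this) (congrArg Prod.fst this)
  have e₁ := LinearMap.finrank_range_add_finrank_ker (homDiffZero K f g)
  have e₂ := LinearMap.finrank_range_add_finrank_ker (homClass K f g)
  rw [LinearMap.range_eq_top.2 hsurj, finrank_top, Module.finrank_prod] at e₁
  rw [LinearMap.range_eq_top.2 (homClass_surjective f g), finrank_top, ker_homClass,
    LinearMap.finrank_range_of_inj hinj] at e₂
  omega

end Euler

namespace BrauerTree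

section

variable {V : Type v} [Fintype V] {Γ : BrauerTree V} {K : Type u} [Field K]

theorem finrank_htpy_hom_PiProj {α₀ α₁ β₀ β₁ : Type v} [Fintype α₀] [Fintype α₁] [Fintype β₀]
    [Fintype β₁] {s₀ : α₀ → Γ.Edge} {s₁ : α₁ → Γ.Edge} {t₀ : β₀ → Γ.Edge} {t₁ : β₁ → Γ.Edge}
    {f : PiProj K s₀ →ₗ[Γ.Alg K] PiProj K s₁} {g : PiProj K t₀ →ₗ[Γ.Alg K] PiProj K t₁}
    (h₁ : ExtOneVanish f g) (h₂ : ExtNegOneVanish f g) :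
    (Module.finrank K (toHtpy (dbl f) ⟶ toHtpy (dbl g)) : ℤ) =
      ∑ x, (Γ.cls s₀ x - Γ.cls s₁ x) * (Γ.cls t₀ x - Γ.cls t₁ x) := by
  rw [finrank_htpy_hom h₁ h₂]
  simp only [finrank_hom_PiProj, ← Finset.sum_add_distrib, ← Finset.sum_sub_distrib]
  exact Finset.sum_congr rfl fun x _ => by ring

end

end BrauerTree

/-! ### Lifting idempotents -/

section Lifting

theorem exists_isIdempotentElem_sub_mem {R : Type*} [CommRing R] [IsArtinianRing R] (I : Ideal R)
    {b : R} (hb : b * b - b ∈ I) : ∃ e : R, e * e = e ∧ e - b ∈ I := by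
  obtain ⟨m, hm⟩ := IsArtinian.monotone_stabilizes
    (⟨fun k => OrderDual.toDual (I ^ k), fun k l hkl => Ideal.pow_le_pow_right hkl⟩ :
      ℕ →o (Ideal R)ᵒᵈ)
  have hid : IsIdempotentElem (I ^ m) := by
    change I ^ m * I ^ m = I ^ m
    rw [← pow_add]
    exact (hm (m + m) (by omega)).symm
  have hfg : (I ^ m).FG := IsNoetherian.noetherian _
  obtain ⟨p, hp, hpI⟩ := (Ideal.isIdempotentElem_iff_of_fg _ hfg).1 hid
  replace hpI : I ^ m = Ideal.span {p} := hpI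
  by_cases hm0 : m = 0
  · refine ⟨0, by simp, ?_⟩
    have : I = ⊤ := by
      have h1 : I ^ m = I ^ 1 := hm 1 (by omega)
      rw [← pow_one I, ← h1, hm0, pow_zero, Ideal.one_eq_top]
    simp [this]
  have hpI' : p ∈ I := Ideal.pow_le_self hm0 (hpI ▸ Ideal.mem_span_singleton_self p)
  let φ : R ⧸ Ideal.span {p} →+* R ⧸ I :=
    Ideal.Quotient.factor (by rw [← hpI]; exact Ideal.pow_le_self hm0)
  have hker : ∀ x ∈ RingHom.ker φ, IsNilpotent x := by
    intro x hx
    obtain ⟨y, rfl⟩ := Ideal.Quotient.mk_surjective x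
    rw [RingHom.mem_ker, Ideal.Quotient.factor_mk, Ideal.Quotient.eq_zero_iff_mem] at hx
    refine ⟨m, ?_⟩
    rw [← map_pow, Ideal.Quotient.eq_zero_iff_mem, ← hpI]
    exact Ideal.pow_mem_pow hx m
  obtain ⟨c, hc, hcb⟩ := exists_isIdempotentElem_eq_of_ker_isNilpotent φ hker
    (Ideal.Quotient.mk I b) ⟨Ideal.Quotient.mk _ b, Ideal.Quotient.factor_mk _ _⟩ (by
      rw [IsIdempotentElem, ← map_mul]
      exact Ideal.Quotient.eq.2 hb)
  obtain ⟨c, rfl⟩ := Ideal.Quotient.mk_surjective c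
  rw [Ideal.Quotient.factor_mk, Ideal.Quotient.eq] at hcb
  rw [IsIdempotentElem, ← map_mul, Ideal.Quotient.eq, Ideal.mem_span_singleton] at hc
  obtain ⟨r, hr⟩ := hc
  have hpp : p * p = p := hp
  refine ⟨(1 - p) * c, ?_, ?_⟩
  · have : c * c = c + p * r := by rw [← hr]; ring
    calc (1 - p) * c * ((1 - p) * c) = (1 - 2 * p + p * p) * (c * c) := by ring
      _ = (1 - p) * c + (p - p * p) * r := by rw [this, hpp]; ring_nf; rw [sq, hpp]; ring
      _ = (1 - p) * c := by rw [hpp]; ring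
  · have : (1 - p) * c - b = (c - b) - p * c := by ring
    rw [this]
    exact I.sub_mem hcb (I.mul_mem_right _ hpI')

/-- Idempotents lift along homomorphisms from finite-dimensional algebras. -/
theorem exists_isIdempotentElem_map_eq {K B E : Type*} [Field K] [Ring B] [Ring E] [Algebra K B]
    [Algebra K E] [Module.Finite K B] (q : B →ₐ[K] E) {b : B} (hb : q b * q b = q b) :
    ∃ e : B, e * e = e ∧ q e = q b := by
  let R := Algebra.adjoin K ({b} : Set B)
  have : IsMulCommutative R := Algebra.isMulCommutative_adjoin K (by
    rintro x rfl y rfl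
    rfl)
  let : CommRing R := inferInstance
  have : IsArtinianRing R := by
    have : IsArtinian K R := inferInstance
    exact isArtinian_of_tower K this
  let b' : R := ⟨b, Algebra.self_mem_adjoin_singleton K b⟩
  let φ : R →+* E := (q.comp R.val : R →ₐ[K] E).toRingHom
  obtain ⟨e, he, heb⟩ := exists_isIdempotentElem_sub_mem (RingHom.ker φ) (b := b') (by
    rw [RingHom.mem_ker, map_sub, map_mul, sub_eq_zero]
    exact hb)
  refine ⟨e.1, congrArg Subtype.val he, ?_⟩
  rw [RingHom.mem_ker, map_sub, sub_eq_zero] at heb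
  exact heb

end Lifting


/-! ### Splitting idempotents -/

section StrictRetract

variable {A : Type u} [Ring A]
variable {P₀ P₁ P₀' P₁' Q₀ Q₁ Q₀' Q₁' : Type w} [AddCommGroup P₀] [AddCommGroup P₁]
  [AddCommGroup Q₀] [AddCommGroup Q₁] [Module A P₀] [Module A P₁] [Module A Q₀] [Module A Q₁]
  [AddCommGroup P₀'] [AddCommGroup P₁'] [AddCommGroup Q₀'] [AddCommGroup Q₁'] [Module A P₀']
  [Module A P₁'] [Module A Q₀'] [Module A Q₁']

/-- A direct summand `g` of the two-term complex `f`. -/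
structure StrictRetract (g : Q₀ →ₗ[A] Q₁) (f : P₀ →ₗ[A] P₁) where
  ι₀ : Q₀ →ₗ[A] P₀
  ι₁ : Q₁ →ₗ[A] P₁
  π₀ : P₀ →ₗ[A] Q₀
  π₁ : P₁ →ₗ[A] Q₁
  hι : f.comp ι₀ = ι₁.comp g
  hπ : g.comp π₀ = π₁.comp f
  h₀ : π₀.comp ι₀ = LinearMap.id
  h₁ : π₁.comp ι₁ = LinearMap.id

namespace StrictRetract

variable {f : P₀ →ₗ[A] P₁} {g : Q₀ →ₗ[A] Q₁} {f' : P₀' →ₗ[A] P₁'} {g' : Q₀' →ₗ[A] Q₁'}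

/-- The inclusion of a direct summand. -/
noncomputable def incl (r : StrictRetract g f) : toHtpy (dbl g) ⟶ toHtpy (dbl f) :=
  qmap r.ι₀ r.ι₁ r.hι

/-- The projection to a direct summand. -/
noncomputable def proj (r : StrictRetract g f) : toHtpy (dbl f) ⟶ toHtpy (dbl g) :=
  qmap r.π₀ r.π₁ r.hπ

theorem incl_proj (r : StrictRetract g f) : r.incl ≫ r.proj = 𝟙 _ := by
  rw [incl, proj, qmap_comp, ← qmap_id, qmap_congr _ r.h₀ r.h₁]

theorem π₀_ι₀ (r : StrictRetract g f) (x : Q₀) : r.π₀ (r.ι₀ x) = x := LinearMap.congr_fun r.h₀ x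

theorem π₁_ι₁ (r : StrictRetract g f) (x : Q₁) : r.π₁ (r.ι₁ x) = x := LinearMap.congr_fun r.h₁ x

theorem extOneVanish (r : StrictRetract g f) (r' : StrictRetract g' f') (h : ExtOneVanish f f') :
    ExtOneVanish g g' := by
  intro u
  obtain ⟨a, b, hab⟩ := h (r'.ι₁.comp (u.comp r.π₀))
  refine ⟨r'.π₀.comp (a.comp r.ι₀), r'.π₁.comp (b.comp r.ι₁), ?_⟩
  ext x
  have h1 := congrArg r'.π₁ (LinearMap.congr_fun hab (r.ι₀ x))
  have h2 := LinearMap.congr_fun r.hι x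
  have h3 := LinearMap.congr_fun r'.hπ (a (r.ι₀ x))
  simp only [LinearMap.comp_apply, LinearMap.add_apply, π₀_ι₀, π₁_ι₁, map_add] at h1 h2 h3 ⊢
  rw [h1, h3, h2]

theorem extNegOneVanish (r : StrictRetract g f) (r' : StrictRetract g' f')
    (h : ExtNegOneVanish f f') : ExtNegOneVanish g g' := by
  intro k h1 h2
  have := h (r'.ι₀.comp (k.comp r.π₁)) (by
      rw [← LinearMap.comp_assoc, r'.hι, LinearMap.comp_assoc, ← LinearMap.comp_assoc r.π₁, h1]
      simp) (by
      rw [LinearMap.comp_assoc, LinearMap.comp_assoc, ← r.hπ, ← LinearMap.comp_assoc r.π₀, h2]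
      simp)
  ext x
  have h3 := congrArg r'.π₀ (LinearMap.congr_fun this (r.ι₁ x))
  simpa [π₀_ι₀, π₁_ι₁] using h3

end StrictRetract

variable {K : Type*} [Field K] [Algebra K A] [Module K P₀] [Module K P₁] [IsScalarTower K A P₀]
  [IsScalarTower K A P₁] [SMulCommClass A K P₀] [SMulCommClass A K P₁] (f : P₀ →ₗ[A] P₁)

variable (K) in
/-- The algebra of endomorphisms of a two-term complex. -/
def chainEnd : Subalgebra K (Module.End A P₀ × Module.End A P₁) where
  carrier := {h | f.comp h.1 = h.2.comp f}
  mul_mem' {h k} hh hk := by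
    change f.comp (h.1.comp k.1) = (h.2.comp k.2).comp f
    change f.comp h.1 = h.2.comp f at hh
    change f.comp k.1 = k.2.comp f at hk
    rw [← LinearMap.comp_assoc, hh, LinearMap.comp_assoc, hk, LinearMap.comp_assoc]
  add_mem' {h k} hh hk := by
    change f.comp (h.1 + k.1) = (h.2 + k.2).comp f
    change f.comp h.1 = h.2.comp f at hh
    change f.comp k.1 = k.2.comp f at hk
    rw [LinearMap.comp_add, LinearMap.add_comp, hh, hk]
  algebraMap_mem' c := by
    ext x
    change f (c • x) = c • f x
    rw [← algebraMap_smul A, map_smul, algebraMap_smul]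

variable (K) in
/-- The passage from endomorphisms of complexes to the homotopy category. -/
noncomputable def chainEndClass : chainEnd K f →ₐ[K] End (toHtpy (dbl f)) :=
  AlgHom.ofLinearMap
    { toFun := fun h => (qmap h.1.1 h.1.2 h.2 : toHtpy (dbl f) ⟶ toHtpy (dbl f))
      map_add' := fun _ _ => (qmap_add _ _ _ _ _ _).symm
      map_smul' := fun c _ => (qmap_smul c _ _ _).symm }
    qmap_id fun _ _ => (qmap_comp _ _ _ _ _ _).symm

theorem chainEndClass_surjective : Function.Surjective (chainEndClass K f) := by
  intro φ
  obtain ⟨h₀, h₁, h, hφ⟩ := exists_qmap φ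
  exact ⟨⟨(h₀, h₁), h⟩, hφ.symm⟩

end StrictRetract

namespace BrauerTree

variable {V : Type v} [Fintype V] {Γ : BrauerTree V} {K : Type u} [Field K]

theorem exists_equiv_PiProj_index (M : Type w) [AddCommGroup M] [Module (Γ.Alg K) M]
    [Module.Finite (Γ.Alg K) M] [Module.Projective (Γ.Alg K) M] :
    ∃ (α : Type v) (_ : Fintype α) (s : α → Γ.Edge), Nonempty (M ≃ₗ[Γ.Alg K] PiProj K s) := by
  obtain ⟨k, s, ⟨e⟩⟩ := exists_equiv_PiProj (Γ := Γ) (K := K) M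
  exact ⟨ULift.{v} (Fin k), inferInstance, fun a => s a.down, ⟨e.trans
    (LinearEquiv.piCongrLeft (Γ.Alg K) (fun a => Γ.Proj K (s a)) Equiv.ulift).symm⟩⟩

variable {α₀ α₁ : Type v} [Fintype α₀] [Fintype α₁] {s₀ : α₀ → Γ.Edge} {s₁ : α₁ → Γ.Edge}

instance : Module.Projective (Γ.Alg K) (PiProj K s₀) := by
  classical
  exact Module.Projective.of_equiv
    (DirectSum.linearEquivFunOnFintype (Γ.Alg K) α₀ fun a => Γ.Proj K (s₀ a))

theorem exists_split_module (h : Module.End (Γ.Alg K) (PiProj K s₀)) (hh : h * h = h) :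
    ∃ (β : Type v) (_ : Fintype β) (t : β → Γ.Edge) (ι : PiProj K t →ₗ[Γ.Alg K] PiProj K s₀)
      (π : PiProj K s₀ →ₗ[Γ.Alg K] PiProj K t), π.comp ι = LinearMap.id ∧ ι.comp π = h := by
  have hproj : Module.Projective (Γ.Alg K) (LinearMap.range h) :=
    Module.Projective.of_split (LinearMap.range h).subtype h.rangeRestrict (by
      refine LinearMap.ext ?_
      rintro ⟨_, y, rfl⟩
      exact Subtype.ext (LinearMap.congr_fun hh y))
  have hfin : Module.Finite (Γ.Alg K) (LinearMap.range h) :=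
    Module.Finite.of_surjective h.rangeRestrict h.surjective_rangeRestrict
  obtain ⟨β, hβ, t, ⟨e⟩⟩ := exists_equiv_PiProj_index (Γ := Γ) (K := K) (LinearMap.range h)
  refine ⟨β, hβ, t, (LinearMap.range h).subtype.comp e.symm.toLinearMap,
    e.toLinearMap.comp h.rangeRestrict, ?_, ?_⟩
  · refine LinearMap.ext fun x => ?_
    obtain ⟨z, rfl⟩ := e.surjective x
    obtain ⟨_, y, rfl⟩ := z
    simp only [LinearMap.comp_apply, LinearEquiv.coe_coe, LinearEquiv.symm_apply_apply,
      LinearMap.id_apply]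
    congr 1
    exact Subtype.ext (LinearMap.congr_fun hh y)
  · refine LinearMap.ext fun x => ?_
    simp

/-- Idempotent endomorphisms of two-term complexes split. -/
theorem exists_split (f : PiProj K s₀ →ₗ[Γ.Alg K] PiProj K s₁) (e : End (toHtpy (dbl f)))
    (he : e * e = e) : ∃ (β₀ β₁ : Type v) (_ : Fintype β₀) (_ : Fintype β₁) (t₀ : β₀ → Γ.Edge)
      (t₁ : β₁ → Γ.Edge) (g : PiProj K t₀ →ₗ[Γ.Alg K] PiProj K t₁) (r : StrictRetract g f),
      r.proj ≫ r.incl = e := by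
  have : Module.Finite K (Module.End (Γ.Alg K) (PiProj K s₀)) := finite_linearMap_of_algebra
  have : Module.Finite K (Module.End (Γ.Alg K) (PiProj K s₁)) := finite_linearMap_of_algebra
  obtain ⟨b, rfl⟩ := chainEndClass_surjective (K := K) f e
  obtain ⟨⟨⟨h₀, h₁⟩, hc⟩, hh, hq⟩ := exists_isIdempotentElem_map_eq (B := chainEnd K f)
    (chainEndClass K f) (b := b) he
  replace hc : f.comp h₀ = h₁.comp f := hc
  obtain ⟨β₀, hβ₀, t₀, ι₀, π₀, hπι₀, hιπ₀⟩ :=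
    exists_split_module h₀ (congrArg (fun z : chainEnd K f => z.1.1) hh)
  obtain ⟨β₁, hβ₁, t₁, ι₁, π₁, hπι₁, hιπ₁⟩ :=
    exists_split_module h₁ (congrArg (fun z : chainEnd K f => z.1.2) hh)
  have h1 : h₀.comp ι₀ = ι₀ := by
    rw [← hιπ₀, LinearMap.comp_assoc, hπι₀, LinearMap.comp_id]
  have h2 : π₁.comp h₁ = π₁ := by
    rw [← hιπ₁, ← LinearMap.comp_assoc, hπι₁, LinearMap.id_comp]
  refine ⟨β₀, β₁, hβ₀, hβ₁, t₀, t₁, π₁.comp (f.comp ι₀),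
    ⟨ι₀, ι₁, π₀, π₁, ?_, ?_, hπι₀, hπι₁⟩, ?_⟩
  · rw [← LinearMap.comp_assoc, hιπ₁, ← LinearMap.comp_assoc, ← hc, LinearMap.comp_assoc, h1]
  · rw [LinearMap.comp_assoc, LinearMap.comp_assoc, hιπ₀, hc, ← LinearMap.comp_assoc, h2]
  · rw [← hq, StrictRetract.proj, StrictRetract.incl, qmap_comp, qmap_congr _ hιπ₀ hιπ₁]
    rfl

end BrauerTree


/-! ### The class of a tilting complex whose endomorphism algebra is a Brauer star algebra -/

section Decomposition

variable {K : Type*} [Field K] {C : Type*} [Category* C] [Preadditive C] [Linear K C]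
  {κ : Type*} [Fintype κ] {T : C} {X : κ → C} {i : ∀ j, X j ⟶ T} {p : ∀ j, T ⟶ X j}

theorem finrank_hom_of_sum_eq_id (hs : ∑ j, p j ≫ i j = 𝟙 T) (h₁ : ∀ j, i j ≫ p j = 𝟙 _)
    (h₂ : ∀ j k, j ≠ k → i j ≫ p k = 0) (Y : C) [∀ j, Module.Finite K (X j ⟶ Y)] :
    Module.finrank K (T ⟶ Y) = ∑ j, Module.finrank K (X j ⟶ Y) := by
  classical
  let e : (T ⟶ Y) ≃ₗ[K] (∀ j, X j ⟶ Y) :=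
    { toFun := fun φ j => i j ≫ φ
      map_add' := fun _ _ => by ext; simp
      map_smul' := fun _ _ => by ext; simp
      invFun := fun ψ => ∑ j, p j ≫ ψ j
      left_inv := fun φ => by
        simp only [← Category.assoc, ← Preadditive.sum_comp, hs, Category.id_comp]
      right_inv := fun ψ => by
        funext j
        dsimp only
        rw [Preadditive.comp_sum, Finset.sum_eq_single j]
        · rw [← Category.assoc, h₁, Category.id_comp]
        · intro k _ hk
          rw [← Category.assoc, h₂ j k hk.symm, zero_comp]
        · simp }
  rw [e.finrank_eq, Module.finrank_pi_fintype]

theorem finrank_hom_to_of_sum_eq_id (hs : ∑ j, p j ≫ i j = 𝟙 T) (h₁ : ∀ j, i j ≫ p j = 𝟙 _)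
    (h₂ : ∀ j k, j ≠ k → i j ≫ p k = 0) (Y : C) [∀ j, Module.Finite K (Y ⟶ X j)] :
    Module.finrank K (Y ⟶ T) = ∑ j, Module.finrank K (Y ⟶ X j) := by
  classical
  let e : (Y ⟶ T) ≃ₗ[K] (∀ j, Y ⟶ X j) :=
    { toFun := fun φ j => φ ≫ p j
      map_add' := fun _ _ => by ext; simp
      map_smul' := fun _ _ => by ext; simp
      invFun := fun ψ => ∑ j, ψ j ≫ i j
      left_inv := fun φ => by
        simp only [Category.assoc, ← Preadditive.comp_sum, hs, Category.comp_id]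
      right_inv := fun ψ => by
        funext j
        dsimp only
        rw [Preadditive.sum_comp, Finset.sum_eq_single j]
        · rw [Category.assoc, h₁, Category.comp_id]
        · intro k _ hk
          rw [Category.assoc, h₂ k j hk, comp_zero]
        · simp }
  rw [e.finrank_eq, Module.finrank_pi_fintype]

end Decomposition

namespace BrauerTree

section

variable {V : Type v} (Γ : BrauerTree V)

theorem sgn_mul_sgn (v r x : V) : Γ.sgn r v * Γ.sgn r x = Γ.sgn v x := by
  have key : ∀ {x y : V} (_ : Γ.graph.Walk x y),
      Γ.sgn r x * Γ.sgn v x = Γ.sgn r y * Γ.sgn v y := by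
    intro x y p
    induction p with
    | nil => rfl
    | @cons a b c h p ih =>
      have flip : ∀ r, Γ.sgn r b = - Γ.sgn r a := by
        intro r
        rw [sgn, sgn]
        rcases Γ.isTree.dist_eq_dist_add_one_of_adj r h with h | h <;> rw [h, pow_succ] <;> ring
      rw [← ih, flip, flip]
      ring
  obtain ⟨p⟩ := Γ.isTree.connected x v
  have h1 := key p
  have h2 := Γ.sgn_mul_self r x
  rw [sgn_root, mul_one] at h1
  calc Γ.sgn r v * Γ.sgn r x = (Γ.sgn r x * Γ.sgn r x) * Γ.sgn v x := by rw [← h1]; ring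
    _ = Γ.sgn v x := by rw [h2, one_mul]

theorem card_edge [Fintype V] [Fintype Γ.Edge] : Fintype.card Γ.Edge + 1 = Fintype.card V := by
  classical
  rw [← Γ.isTree.card_edgeFinset, SimpleGraph.edgeFinset, Set.toFinset_card]

theorem IsStar.finrank_corner [Fintype V] {Γ : BrauerTree V} (h : Γ.IsStar) (K : Type u) [Field K]
    [DecidableEq Γ.Edge] (i j : Γ.Edge) :
    (Module.finrank K (Γ.corner K i j) : ℤ) = if i = j then 2 else 1 := by
  rw [BrauerTree.finrank_corner, sum_inc_mul_inc]
  obtain ⟨c, hc⟩ := h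
  have hmem : ∀ i : Γ.Edge, c ∈ i.1 := by
    intro i
    obtain ⟨a, rfl⟩ := Γ.exists_source_eq i
    rw [mem_source_iff]
    rcases hc a with h | h
    · exact Or.inl h.symm
    · exact Or.inr h.symm
  have hex : ∃ x, x ∈ i.1 ∧ x ∈ j.1 := ⟨c, hmem i, hmem j⟩
  simp only [hex, if_true]

end

variable {V : Type v} [Fintype V] {Γ : BrauerTree V} {K : Type u} [Field K]
variable {α₀ α₁ : Type v} [Fintype α₀] [Fintype α₁] {s₀ : α₀ → Γ.Edge} {s₁ : α₁ → Γ.Edge}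

/-- If the endomorphism algebra of a two-term tilting complex is the Brauer star algebra, its
class in the Grothendieck group is one of `2 (n + 1)` classes. -/
theorem exists_cls_eq_of_star [DecidableEq V] {f : PiProj K s₀ →ₗ[Γ.Alg K] PiProj K s₁}
    (h₁ : ExtOneVanish f f) (h₂ : ExtNegOneVanish f f) {n : ℕ} (hV : Fintype.card V = n + 1)
    {S : BrauerTree (Fin (n + 1))} (hS : S.IsStar) (φ : End (toHtpy (dbl f)) ≃ₐ[K] S.Alg K) :
    ∃ (v : V) (ε : ℤ), (ε = 1 ∨ ε = -1) ∧ ∀ x, Γ.cls s₀ x - Γ.cls s₁ x =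
      ε * (Γ.sgn v x * if x = v then (n : ℤ) else -1) := by
  classical
  have := Fintype.ofFinite S.Edge
  have hcard : Fintype.card S.Edge = n := by
    have := S.card_edge
    simp only [Fintype.card_fin] at this
    omega
  let e : S.Edge → End (toHtpy (dbl f)) := fun i => φ.symm (S.idem K i)
  have he : ∀ i, e i * e i = e i := fun i => by rw [← map_mul, idem_mul_self]
  choose β₀ β₁ hβ₀ hβ₁ t₀ t₁ g r hr using fun i => exists_split f (e i) (he i)
  have hr' : ∀ i, (e i : toHtpy (dbl f) ⟶ toHtpy (dbl f)) = (r i).proj ≫ (r i).incl :=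
    fun i => (hr i).symm
  have hsum : ∑ i, (r i).proj ≫ (r i).incl = 𝟙 (toHtpy (dbl f)) := by
    have h3 : ∑ i, e i = 1 := by rw [← map_sum, sum_idem, map_one]
    rw [← show (1 : End (toHtpy (dbl f))) = 𝟙 (toHtpy (dbl f)) from rfl, ← h3]
    exact Finset.sum_congr rfl fun i _ => hr i
  have horth : ∀ i j, i ≠ j → (r i).incl ≫ (r j).proj = 0 := by
    intro i j hij
    have h3 : e j * e i = 0 := by rw [← map_mul, idem_mul_idem S K hij.symm, map_zero]
    have h4 : ((r i).proj ≫ (r i).incl) ≫ ((r j).proj ≫ (r j).incl) = 0 := by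
      rw [hr, hr]
      exact h3
    have h5 := congrArg (fun z => (r i).incl ≫ z ≫ (r j).proj) h4
    simp only [Category.assoc, (r j).incl_proj, Category.comp_id, comp_zero, zero_comp] at h5
    rw [← Category.assoc (r i).incl, (r i).incl_proj, Category.id_comp] at h5
    exact h5
  have hdim : ∀ i j, (Module.finrank K (toHtpy (dbl (g i)) ⟶ toHtpy (dbl (g j))) : ℤ) =
      if j = i then 2 else 1 := by
    intro i j
    rw [← hS.finrank_corner K]
    let L : (toHtpy (dbl (g i)) ⟶ toHtpy (dbl (g j))) →ₗ[K] S.Alg K :=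
      φ.toLinearMap.comp ((Linear.rightComp K _ (r j).incl).comp (Linear.leftComp K _ (r i).proj))
    have hL : ∀ θ, L θ = φ ((r i).proj ≫ θ ≫ (r j).incl : toHtpy (dbl f) ⟶ toHtpy (dbl f)) :=
      fun _ => by rw [← Category.assoc]; rfl
    have hinj : Function.Injective L := by
      intro θ θ' h
      rw [hL, hL] at h
      have h3 := congrArg (fun z => (r i).incl ≫ z ≫ (r j).proj) (φ.injective h)
      simp only [Category.assoc, (r j).incl_proj, Category.comp_id] at h3
      rw [← Category.assoc (r i).incl, (r i).incl_proj, Category.id_comp, ← Category.assoc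
        (r i).incl, (r i).incl_proj, Category.id_comp] at h3
      exact h3
    have hrange : LinearMap.range L = S.corner K j i := by
      apply le_antisymm
      · rintro _ ⟨θ, rfl⟩
        rw [hL, mem_corner]
        constructor
        · rw [← φ.apply_symm_apply (S.idem K j), ← map_mul]
          congr 1
          change ((r i).proj ≫ θ ≫ (r j).incl) ≫ (e j : toHtpy (dbl f) ⟶ toHtpy (dbl f)) = _
          rw [hr' j]
          simp only [Category.assoc]
          rw [← Category.assoc (r j).incl, (r j).incl_proj, Category.id_comp]
        · rw [← φ.apply_symm_apply (S.idem K i), ← map_mul]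
          congr 1
          change (e i : toHtpy (dbl f) ⟶ toHtpy (dbl f)) ≫ ((r i).proj ≫ θ ≫ (r j).incl) = _
          rw [hr' i]
          simp only [Category.assoc]
          rw [← Category.assoc (r i).incl, (r i).incl_proj, Category.id_comp]
      · intro z hz
        rw [mem_corner] at hz
        refine ⟨(r i).incl ≫ (φ.symm z : toHtpy (dbl f) ⟶ toHtpy (dbl f)) ≫ (r j).proj, ?_⟩
        rw [hL]
        have h3 : φ.symm z = e j * φ.symm z * e i := by
          rw [← map_mul, ← map_mul, hz.1, hz.2]
        have h4 : (φ.symm z : toHtpy (dbl f) ⟶ toHtpy (dbl f)) =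
            (r i).proj ≫ ((r i).incl ≫ (φ.symm z : toHtpy (dbl f) ⟶ toHtpy (dbl f)) ≫
              (r j).proj) ≫ (r j).incl := by
          conv_lhs => rw [h3]
          change (e i : toHtpy (dbl f) ⟶ toHtpy (dbl f)) ≫
            (φ.symm z : toHtpy (dbl f) ⟶ toHtpy (dbl f)) ≫
              (e j : toHtpy (dbl f) ⟶ toHtpy (dbl f)) = _
          rw [hr' i, hr' j]
          simp only [Category.assoc]
        rw [← h4, φ.apply_symm_apply]
    rw [← hrange, LinearMap.finrank_range_of_inj hinj]
  let c : V → ℤ := fun x => Γ.cls s₀ x - Γ.cls s₁ x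
  let z : S.Edge → V → ℤ := fun i x => Γ.cls (t₀ i) x - Γ.cls (t₁ i) x
  have hzz : ∀ i j, ∑ x, z i x * z j x = if j = i then 2 else 1 := by
    intro i j
    rw [← hdim, finrank_htpy_hom_PiProj ((r i).extOneVanish (r j) h₁)
      ((r i).extNegOneVanish (r j) h₂)]
  have hfin : ∀ i j, Module.Finite K (toHtpy (dbl (g i)) ⟶ toHtpy (dbl (g j))) :=
    fun i j => finite_htpy_hom _ _
  have hfin' : ∀ j, Module.Finite K (toHtpy (dbl f) ⟶ toHtpy (dbl (g j))) :=
    fun j => finite_htpy_hom _ _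
  let r₀ : StrictRetract f f := ⟨LinearMap.id, LinearMap.id, LinearMap.id, LinearMap.id, rfl, rfl,
    rfl, rfl⟩
  have hcz : ∀ j, ∑ x, c x * z j x = ∑ i, ∑ x, z i x * z j x := by
    intro j
    have h3 := finrank_hom_of_sum_eq_id (K := K) hsum (fun i => (r i).incl_proj) horth
      (toHtpy (dbl (g j)))
    have h4 := congrArg (Nat.cast (R := ℤ)) h3
    rw [finrank_htpy_hom_PiProj (r₀.extOneVanish (r j) h₁) (r₀.extNegOneVanish (r j) h₂)] at h4
    rw [h4, Nat.cast_sum]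
    exact Finset.sum_congr rfl fun i _ => by rw [hdim, hzz]
  have hcc : ∑ x, c x * c x = ∑ j, ∑ x, c x * z j x := by
    have h3 := finrank_hom_to_of_sum_eq_id (K := K) hsum (fun i => (r i).incl_proj) horth
      (toHtpy (dbl f))
    have h4 := congrArg (Nat.cast (R := ℤ)) h3
    rw [finrank_htpy_hom_PiProj h₁ h₂] at h4
    rw [h4, Nat.cast_sum]
    exact Finset.sum_congr rfl fun j _ => by
      rw [finrank_htpy_hom_PiProj (r₀.extOneVanish (r j) h₁) (r₀.extNegOneVanish (r j) h₂)]
  have hc : ∀ x, c x = ∑ i, z i x := by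
    have h3 : ∑ x, (c x - ∑ i, z i x) * (c x - ∑ i, z i x) = 0 := by
      have h4 : ∀ x, (c x - ∑ i, z i x) * (c x - ∑ i, z i x) =
          c x * c x - 2 * ∑ j, c x * z j x + ∑ j, ∑ i, z i x * z j x := by
        intro x
        rw [← Finset.mul_sum, Finset.sum_comm, ← Finset.sum_mul_sum]
        ring
      simp only [h4, Finset.sum_add_distrib, Finset.sum_sub_distrib, ← Finset.mul_sum]
      rw [hcc, Finset.sum_comm (f := fun x j => ∑ i, z i x * z j x)]
      simp only [Finset.mul_sum]
      rw [Finset.sum_comm (f := fun x j => 2 * (c x * z j x)), ← Finset.sum_sub_distrib,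
        ← Finset.sum_add_distrib]
      refine Finset.sum_eq_zero fun j _ => ?_
      rw [Finset.sum_comm (f := fun x i => z i x * z j x), ← hcz, ← Finset.mul_sum]
      ring
    intro x
    have h5 := (Finset.sum_eq_zero_iff_of_nonneg fun x _ => mul_self_nonneg _).1 h3 x
      (Finset.mem_univ x)
    rw [mul_self_eq_zero] at h5
    linarith
  obtain ⟨o⟩ := Γ.isTree.connected.nonempty
  obtain ⟨v, ε, hε, hv⟩ := exists_sum_eq_of_pairwise_eq_one (V := V) (ι := S.Edge)
    (by rw [hV, hcard]) (z := fun i x => Γ.sgn o x * z i x)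
    (fun i => by
      simp only [z, mul_sub, Finset.sum_sub_distrib, sum_sgn_mul_cls, sub_zero])
    (fun i => by
      rw [← (hzz i i).trans (if_pos rfl)]
      refine Finset.sum_congr rfl fun x _ => ?_
      have := Γ.sgn_mul_self o x
      calc Γ.sgn o x * z i x * (Γ.sgn o x * z i x) =
          (Γ.sgn o x * Γ.sgn o x) * (z i x * z i x) := by ring
        _ = _ := by rw [this, one_mul])
    (fun i j hij => by
      rw [← (hzz i j).trans (if_neg hij.symm)]
      refine Finset.sum_congr rfl fun x _ => ?_
      have := Γ.sgn_mul_self o x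
      calc Γ.sgn o x * z i x * (Γ.sgn o x * z j x) =
          (Γ.sgn o x * Γ.sgn o x) * (z i x * z j x) := by ring
        _ = _ := by rw [this, one_mul])
  refine ⟨v, ε * Γ.sgn o v, ?_, fun x => ?_⟩
  · have h3 : Γ.sgn o v = 1 ∨ Γ.sgn o v = -1 := neg_one_pow_eq_or ℤ _
    rcases hε with rfl | rfl <;> rcases h3 with h3 | h3 <;> simp [h3]
  · change c x = _
    have h3 := hv x
    rw [← Finset.mul_sum, ← hc, hcard] at h3
    rw [← Γ.sgn_mul_sgn v o x]
    have h4 := Γ.sgn_mul_self o v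
    have h5 := Γ.sgn_mul_self o x
    calc c x = Γ.sgn o x * (Γ.sgn o x * c x) := by rw [← mul_assoc, h5, one_mul]
      _ = (Γ.sgn o v * Γ.sgn o v) * (Γ.sgn o x * (ε * if x = v then (n : ℤ) else -1)) := by
        rw [h3, h4, one_mul]
      _ = _ := by ring

end BrauerTree


/-! ### Rigid two-term complexes with the same class are isomorphic -/

section Padding

variable {A : Type u} [Ring A]
variable {P₀ P₁ Q₀ Q₁ R : Type w} [AddCommGroup P₀] [AddCommGroup P₁] [AddCommGroup Q₀]
  [AddCommGroup Q₁] [AddCommGroup R] [Module A P₀] [Module A P₁] [Module A Q₀] [Module A Q₁]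
  [Module A R]

theorem ExtOneVanish.prodMap_id {f : P₀ →ₗ[A] P₁} (hf : ExtOneVanish f f) :
    ExtOneVanish (f.prodMap (LinearMap.id : R →ₗ[A] R))
      (f.prodMap (LinearMap.id : R →ₗ[A] R)) := by
  intro u
  obtain ⟨h₀, h₁, h⟩ := hf ((LinearMap.fst A P₁ R).comp (u.comp (LinearMap.inl A P₀ R)))
  refine ⟨LinearMap.prod (h₀.comp (LinearMap.fst A P₀ R)) ((LinearMap.snd A P₁ R).comp u),
    (LinearMap.inl A P₁ R).comp (LinearMap.coprod h₁
      ((LinearMap.fst A P₁ R).comp (u.comp (LinearMap.inr A P₀ R)))), ?_⟩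
  refine LinearMap.ext fun x => ?_
  have h2 := LinearMap.congr_fun h x.1
  have h3 : u x = u (x.1, 0) + u (0, x.2) := by rw [← map_add]; simp
  simp only [LinearMap.comp_apply, LinearMap.add_apply, LinearMap.inl_apply,
    LinearMap.fst_apply] at h2
  ext
  · simp [h3, h2, add_assoc]
  · simp

theorem ExtOneVanish.of_equiv {f : P₀ →ₗ[A] P₁} {g : Q₀ →ₗ[A] Q₁} (hf : ExtOneVanish f f)
    (e₀ : P₀ ≃ₗ[A] Q₀) (e₁ : P₁ ≃ₗ[A] Q₁) (h : g.comp e₀.toLinearMap = e₁.toLinearMap.comp f) :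
    ExtOneVanish g g := by
  have h' : f.comp e₀.symm.toLinearMap = e₁.symm.toLinearMap.comp g := by
    ext x
    have := LinearMap.congr_fun h (e₀.symm x)
    simp only [LinearMap.comp_apply, LinearEquiv.coe_coe, LinearEquiv.apply_symm_apply] at this ⊢
    rw [this, LinearEquiv.symm_apply_apply]
  let r : StrictRetract g f := ⟨e₀.symm, e₁.symm, e₀, e₁, h', h, by ext; simp, by ext; simp⟩
  exact r.extOneVanish r hf

/-- Adding a contractible complex does not change the isomorphism class. -/
noncomputable def padIso (f : P₀ →ₗ[A] P₁) :
    toHtpy (dbl f) ≅ toHtpy (dbl (f.prodMap (LinearMap.id : R →ₗ[A] R))) where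
  hom := qmap (LinearMap.inl A P₀ R) (LinearMap.inl A P₁ R) (by ext <;> simp)
  inv := qmap (LinearMap.fst A P₀ R) (LinearMap.fst A P₁ R) (by ext <;> simp)
  hom_inv_id := by
    rw [qmap_comp, ← qmap_id]
    exact qmap_congr _ (by ext; simp) (by ext; simp)
  inv_hom_id := by
    rw [qmap_comp, ← sub_eq_zero, ← qmap_id, sub_eq_add_neg,
      show -qmap (LinearMap.id : P₀ × R →ₗ[A] P₀ × R) (LinearMap.id : P₁ × R →ₗ[A] P₁ × R)
        (by rfl : (f.prodMap LinearMap.id).comp _ = _) = qmap (-LinearMap.id) (-LinearMap.id)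
        (by ext <;> simp) by
          rw [neg_eq_iff_add_eq_zero, qmap_add, qmap_eq_zero_iff]
          exact ⟨0, by simp, by simp⟩, qmap_add, qmap_eq_zero_iff]
    refine ⟨-(LinearMap.inr A P₀ R).comp (LinearMap.snd A P₁ R), ?_, ?_⟩
    · ext <;> simp
    · ext <;> simp

end Padding

namespace BrauerTree

variable {V : Type v} [Fintype V] {Γ : BrauerTree V} {K : Type u} [Field K]
variable {α₀ α₁ β₀ β₁ : Type v} [Fintype α₀] [Fintype α₁] [Fintype β₀] [Fintype β₁]
  {s₀ : α₀ → Γ.Edge} {s₁ : α₁ → Γ.Edge} {t₀ : β₀ → Γ.Edge} {t₁ : β₁ → Γ.Edge}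

theorem nonempty_equiv_PiProj_of_cls_eq (h : ∀ x, Γ.cls s₀ x = Γ.cls t₀ x) :
    Nonempty (PiProj K s₀ ≃ₗ[Γ.Alg K] PiProj K t₀) := by
  obtain ⟨e, he⟩ := Γ.exists_equiv_of_cls_eq h
  obtain rfl : s₀ = fun a => t₀ (e a) := funext fun a => (he a).symm
  exact ⟨LinearEquiv.piCongrLeft (Γ.Alg K) (fun b => Γ.Proj K (t₀ b)) e⟩

set_option linter.unusedSectionVars false in
theorem cls_sumElim (x : V) : Γ.cls (Sum.elim s₀ s₁) x = Γ.cls s₀ x + Γ.cls s₁ x := by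
  simp [cls, Fintype.sum_sum_type]

theorem nonempty_equiv_prod_of_cls_eq
    (h : ∀ x, Γ.cls s₀ x + Γ.cls s₁ x = Γ.cls t₀ x + Γ.cls t₁ x) :
    Nonempty ((PiProj K s₀ × PiProj K s₁) ≃ₗ[Γ.Alg K] (PiProj K t₀ × PiProj K t₁)) := by
  obtain ⟨e⟩ := nonempty_equiv_PiProj_of_cls_eq (K := K) (s₀ := Sum.elim s₀ s₁)
    (t₀ := Sum.elim t₀ t₁) fun x => by rw [cls_sumElim, cls_sumElim, h]
  exact ⟨(LinearEquiv.sumPiEquivProdPi (Γ.Alg K) α₀ α₁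
      (fun a => Γ.Proj K (Sum.elim s₀ s₁ a))).symm.trans
    (e.trans (LinearEquiv.sumPiEquivProdPi (Γ.Alg K) β₀ β₁
      (fun a => Γ.Proj K (Sum.elim t₀ t₁ a))))⟩

/-- Rigid two-term complexes with the same class are isomorphic. -/
theorem nonempty_iso_of_cls_eq [Infinite K] {f : PiProj K s₀ →ₗ[Γ.Alg K] PiProj K s₁}
    {g : PiProj K t₀ →ₗ[Γ.Alg K] PiProj K t₁} (hf : ExtOneVanish f f) (hg : ExtOneVanish g g)
    (h : ∀ x, Γ.cls s₀ x - Γ.cls s₁ x = Γ.cls t₀ x - Γ.cls t₁ x) :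
    Nonempty (toHtpy (dbl f) ≅ toHtpy (dbl g)) := by
  obtain ⟨a⟩ := nonempty_equiv_prod_of_cls_eq (K := K) (s₀ := s₀) (s₁ := t₁) (t₀ := t₀) (t₁ := s₁)
    fun x => by have := h x; linarith
  let b : (PiProj K s₁ × PiProj K t₁) ≃ₗ[Γ.Alg K] (PiProj K t₁ × PiProj K s₁) :=
    LinearEquiv.prodComm _ _ _
  let F := f.prodMap (LinearMap.id : PiProj K t₁ →ₗ[Γ.Alg K] PiProj K t₁)
  let G := g.prodMap (LinearMap.id : PiProj K s₁ →ₗ[Γ.Alg K] PiProj K s₁)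
  have hF : ExtOneVanish F F := hf.prodMap_id
  have hG : ExtOneVanish G G := hg.prodMap_id
  let G' := b.symm.toLinearMap.comp (G.comp a.toLinearMap)
  have hG' : ExtOneVanish G' G' := hG.of_equiv a.symm b.symm (by ext <;> simp [G'])
  obtain ⟨e₀, e₁, he⟩ := hF.exists_equiv (K := K) hG'
  let i₁ : dbl F ≅ dbl G' := dblIso e₀ e₁ he
  let i₂ : dbl G' ≅ dbl G := dblIso a b (by ext <;> simp [G'])
  exact ⟨padIso f ≪≫ (HomotopyCategory.quotient _ _).mapIso (i₁ ≪≫ i₂) ≪≫ (padIso g).symm⟩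

end BrauerTree


/-! ### Shortest paths between neighbouring edges -/

namespace BrauerTree

section Conn

variable {V : Type v} (Γ : BrauerTree V) (K : Type u) [Field K]

open Classical in
/-- The path from `i` to `j` around a common end point that does not go fully around, and zero if
there is no common end point. -/
noncomputable def conn (i j : Γ.Edge) : Γ.Alg K :=
  if h : ∃ p : Γ.Arrow × ℕ, p.2 < Γ.per p.1 ∧ Γ.source p.1 = i ∧ Γ.source (Γ.next^[p.2] p.1) = j then
    Γ.path K h.choose.2 h.choose.1
  else 0

theorem conn_mem_corner (i j : Γ.Edge) : Γ.conn K i j ∈ Γ.corner K i j := by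
  rw [conn]
  split_ifs with h
  · have h' := h.choose_spec
    have := Γ.path_mem_corner K h.choose.2 h.choose.1
    rwa [h'.2.1, h'.2.2] at this
  · exact Submodule.zero_mem _

variable [Finite V]

theorem conn_source {a : Γ.Arrow} {k : ℕ} (hk : k < Γ.per a) :
    Γ.conn K (Γ.source a) (Γ.source (Γ.next^[k] a)) = Γ.path K k a := by
  have h : ∃ p : Γ.Arrow × ℕ, p.2 < Γ.per p.1 ∧ Γ.source p.1 = Γ.source a ∧
      Γ.source (Γ.next^[p.2] p.1) = Γ.source (Γ.next^[k] a) := ⟨(a, k), hk, rfl, rfl⟩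
  rw [conn, dif_pos h]
  obtain ⟨h₁, h₂, h₃⟩ := h.choose_spec
  generalize h.choose = p at *
  obtain ⟨b, l⟩ := p
  dsimp only at h₁ h₂ h₃ ⊢
  by_cases hs : Γ.source a = Γ.source (Γ.next^[k] a)
  · have e₁ : k = 0 := by
      have := Γ.eq_of_source_eq hs (by simp)
      exact Γ.iterate_inj hk (Γ.per_pos a) this.symm
    have e₂ : l = 0 := by
      have := Γ.eq_of_source_eq (h₂.trans (hs.trans h₃.symm)) (by simp)
      exact Γ.iterate_inj h₁ (Γ.per_pos b) this.symm
    rw [e₁, e₂, path_zero, path_zero, h₂]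
  · have hab : b.fst = a.fst := by
      refine Γ.eq_of_mem_of_mem hs ?_ ?_ (Γ.fst_mem_source a) ?_
      · rw [← h₂]
        exact Γ.fst_mem_source b
      · rw [← h₃, ← Γ.iterate_next_fst b l]
        exact Γ.fst_mem_source _
      · rw [← Γ.iterate_next_fst a k]
        exact Γ.fst_mem_source _
    obtain rfl := Γ.eq_of_source_eq h₂ hab
    rw [Γ.iterate_inj h₁ hk (Γ.eq_of_source_eq h₃ (by simp))]

variable {Γ K}

theorem exists_conn_eq_path {i j : Γ.Edge} {x : V} (hi : x ∈ i.1) (hj : x ∈ j.1) :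
    ∃ (a : Γ.Arrow) (k : ℕ), k < Γ.per a ∧ Γ.source a = i ∧ Γ.source (Γ.next^[k] a) = j ∧
      a.fst = x := by
  obtain ⟨a, rfl, rfl⟩ := Γ.exists_dart_of_mem hi
  obtain ⟨b, rfl, hb⟩ := Γ.exists_dart_of_mem hj
  obtain ⟨k, hk, rfl⟩ := Γ.exists_iterate_eq hb.symm
  exact ⟨a, k, hk, rfl, rfl, rfl⟩

theorem exists_eq_smul_conn {i j : Γ.Edge} (hij : i ≠ j) {z : Γ.Alg K}
    (hz : z ∈ Γ.corner K i j) : ∃ c : K, z = c • Γ.conn K i j := by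
  by_cases h : ∃ x, x ∈ i.1 ∧ x ∈ j.1
  · obtain ⟨x, hi, hj⟩ := h
    obtain ⟨a, k, hk, rfl, rfl, -⟩ := exists_conn_eq_path hi hj
    rw [Γ.conn_source K hk]
    exact Γ.exists_eq_of_mem_corner K (fun h => hij (congrArg Γ.source h)) (by simp) hk rfl hz
  · push Not at h
    exact ⟨0, by rw [zero_smul]; exact Γ.eq_zero_of_mem_corner K h hz⟩

theorem conn_mul_conn {i j : Γ.Edge} (hij : i ≠ j) {x : V} (hi : x ∈ i.1) (hj : x ∈ j.1) :
    Γ.conn K i j * Γ.conn K j i = Γ.soc K i := by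
  obtain ⟨a, k, hk, rfl, rfl, -⟩ := exists_conn_eq_path hi hj
  have hk0 : k ≠ 0 := by
    rintro rfl
    exact hij rfl
  have h : Γ.source a = Γ.source (Γ.next^[Γ.per a - k] (Γ.next^[k] a)) := by
    rw [← Function.iterate_add_apply, show Γ.per a - k + k = Γ.per a by omega, iterate_per]
  rw [Γ.conn_source K hk]
  conv_lhs =>
    enter [2, 4]
    rw [h]
  rw [Γ.conn_source K (by rw [per_iterate]; omega), path_add,
    show k + (Γ.per a - k) = Γ.per a by omega, path_per]

end Conn

/-! ### Zigzag complexes -/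

section Ancestors

variable {V : Type v} (Γ : BrauerTree V) (v : V)

/-- `i` lies on the way from the root to `x`. -/
def IsAnc (i x : Γ.Edge) : Prop := Γ.lev v i ≤ Γ.lev v x ∧ Γ.anc v x (Γ.lev v i) = i

variable {Γ v}

theorem isAnc_self (x : Γ.Edge) : Γ.IsAnc v x x := ⟨le_rfl, Γ.anc_lev v x⟩

theorem isAnc_anc {x : Γ.Edge} {k : ℕ} (h : k ≤ Γ.lev v x) : Γ.IsAnc v (Γ.anc v x k) x := by
  rw [IsAnc, Γ.lev_anc v h]
  exact ⟨h, rfl⟩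

theorem IsAnc.par {i x : Γ.Edge} (h : Γ.IsAnc v i x) (h0 : Γ.lev v i ≠ 0) :
    Γ.IsAnc v (Γ.par v i) x := by
  have h1 := Γ.lev_par v h0
  refine ⟨by have := h.1; omega, ?_⟩
  rw [← Γ.par_anc v (by have := h.1; omega), h1, h.2]

theorem IsAnc.eq_of_lev_eq {i j x : Γ.Edge} (hi : Γ.IsAnc v i x) (hj : Γ.IsAnc v j x)
    (h : Γ.lev v i = Γ.lev v j) : i = j := by
  rw [← hi.2, ← hj.2, h]

theorem IsAnc.eq_par_of_lev_eq {i j x : Γ.Edge} (hi : Γ.IsAnc v i x) (hj : Γ.IsAnc v j x)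
    (h : Γ.lev v i = Γ.lev v j + 1) : j = Γ.par v i := by
  have h1 := Γ.lev_par v (i := i) (by omega)
  exact hj.eq_of_lev_eq (hi.par (by omega)) (by omega)

theorem exists_mem_par {i : Γ.Edge} (h : Γ.lev v i ≠ 0) :
    ∃ x, x ∈ (Γ.par v i).1 ∧ x ∈ i.1 :=
  ⟨Γ.top v i, (Γ.mem_iff_top_or_bot v).2 (Or.inr (Γ.bot_par v h).symm),
    (Γ.mem_iff_top_or_bot v).2 (Or.inl rfl)⟩

theorem IsAnc.exists_mem {i j x : Γ.Edge} (hi : Γ.IsAnc v i x) (hj : Γ.IsAnc v j x)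
    (h : Γ.lev v i + 1 = Γ.lev v j ∨ Γ.lev v j + 1 = Γ.lev v i) : ∃ y, y ∈ i.1 ∧ y ∈ j.1 := by
  rcases h with h | h
  · rw [hj.eq_par_of_lev_eq hi h.symm]
    exact exists_mem_par (by omega)
  · rw [hi.eq_par_of_lev_eq hj h.symm]
    obtain ⟨y, h1, h2⟩ := exists_mem_par (v := v) (i := i) (by omega)
    exact ⟨y, h2, h1⟩

variable (Γ v) in
open Classical in
/-- The terms of the zigzag complex of the edge `x`: the edges on the way from the root to `x` with
levels of a given parity. -/
noncomputable def zigI [Fintype Γ.Edge] (ε b : ℕ) (x : Γ.Edge) : Finset Γ.Edge :=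
  {i | Γ.IsAnc v i x ∧ (Γ.lev v i + ε) % 2 = b}

theorem mem_zigI [Fintype Γ.Edge] {ε b : ℕ} {x i : Γ.Edge} :
    i ∈ Γ.zigI v ε b x ↔ Γ.IsAnc v i x ∧ (Γ.lev v i + ε) % 2 = b := by
  simp [zigI]

end Ancestors

section Zigzag

set_option linter.unusedSectionVars false

variable {V : Type v} (Γ : BrauerTree V) (K : Type u) [Field K] (v : V) (ε : ℕ) [Fintype Γ.Edge]

open Classical in
/-- The components of the differential of a zigzag complex. -/
noncomputable def zigEnt (i j : Γ.Edge) : Γ.Alg K :=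
  if Γ.lev v i + 1 = Γ.lev v j ∨ Γ.lev v j + 1 = Γ.lev v i then Γ.conn K i j else 0

theorem zigEnt_mem_corner (i j : Γ.Edge) : Γ.zigEnt K v i j ∈ Γ.corner K i j := by
  rw [zigEnt]
  split_ifs
  · exact Γ.conn_mem_corner K i j
  · exact Submodule.zero_mem _

/-- The zigzag complex of an edge `x`: its terms are the edges on the way from the root to `x`,
alternately in degrees `0` and `1`. -/
noncomputable def zig (x : Γ.Edge) : Γ.Presentation K where
  I := Γ.zigI v ε 0 x
  J := Γ.zigI v ε 1 x
  disjoint := by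
    rw [Finset.disjoint_left]
    intro i h0 h1
    rw [mem_zigI] at h0 h1
    omega
  comp i j := homOf i.1 (Γ.zigEnt K v i j • Γ.gen K j)

/-- The matrix of the differential of a zigzag complex. -/
noncomputable def zigMat (x : Γ.Edge) :
    Matrix (Γ.zigI v ε 0 x) (Γ.zigI v ε 1 x) (Γ.Alg K) := fun i j => Γ.zigEnt K v i j

theorem zigMat_mem (x : Γ.Edge) : Γ.zigMat K v ε x ∈
    MatHom K (fun i : Γ.zigI v ε 0 x => i.1) (fun j : Γ.zigI v ε 1 x => j.1) :=
  fun _ _ => Γ.zigEnt_mem_corner K v _ _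

theorem zig_map_eq (x : Γ.Edge) : (Γ.zig K v ε x).map = toLin
    (fun i : Γ.zigI v ε 0 x => i.1) (fun j : Γ.zigI v ε 1 x => j.1) (Γ.zigMat K v ε x) := rfl

variable {Γ K v ε}

theorem lev_of_ne_zero [Finite V] {i j : Γ.Edge}
    (hp : (Γ.lev v i + ε) % 2 ≠ (Γ.lev v j + ε) % 2) {z : Γ.Alg K} (hz : z ∈ Γ.corner K i j)
    (h0 : z ≠ 0) : (Γ.lev v j = Γ.lev v i + 1 ∧ Γ.par v j = i) ∨
      (Γ.lev v i = Γ.lev v j + 1 ∧ Γ.par v i = j) := by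
  by_contra hc
  refine h0 (Γ.eq_zero_of_mem_corner K (fun w hwi hwj => ?_) hz)
  rcases Γ.lev_eq_or_of_mem_of_mem v hwi hwj with h | h
  · rw [h] at hp
    exact hp rfl
  · exact hc h

theorem single_mem_MatHom {α β : Type*} [DecidableEq α] [DecidableEq β] {s : α → Γ.Edge}
    {t : β → Γ.Edge} {a : α} {b : β} {z : Γ.Alg K} (hz : z ∈ Γ.corner K (s a) (t b)) :
    Matrix.single a b z ∈ MatHom K s t := by
  intro a' b'
  rw [Matrix.single_apply]
  split_ifs with h
  · rw [← h.1, ← h.2]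
    exact hz
  · exact Submodule.zero_mem _

/-- There are no morphisms of degree one between zigzag complexes. -/
theorem zig_extOneVanish [Finite V] (x y : Γ.Edge) :
    ExtOneVanish (Γ.zig K v ε x).map (Γ.zig K v ε y).map := by
  classical
  let s₀ : Γ.zigI v ε 0 x → Γ.Edge := fun i => i.1
  let s₁ : Γ.zigI v ε 1 x → Γ.Edge := fun i => i.1
  let t₀ : Γ.zigI v ε 0 y → Γ.Edge := fun i => i.1
  let t₁ : Γ.zigI v ε 1 y → Γ.Edge := fun i => i.1
  let F := Γ.zigMat K v ε x
  let G := Γ.zigMat K v ε y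
  have hF : F ∈ MatHom K s₀ s₁ := Γ.zigMat_mem K v ε x
  have hG : G ∈ MatHom K t₀ t₁ := Γ.zigMat_mem K v ε y
  let R : Submodule K (Matrix (Γ.zigI v ε 0 x) (Γ.zigI v ε 1 y) (Γ.Alg K)) :=
    { carrier := {u | ∃ h₀ ∈ MatHom K s₀ t₀, ∃ h₁ ∈ MatHom K s₁ t₁, u = h₀ * G + F * h₁}
      zero_mem' := ⟨0, Submodule.zero_mem _, 0, Submodule.zero_mem _, by simp⟩
      add_mem' := by
        rintro _ _ ⟨h₀, hh₀, h₁, hh₁, rfl⟩ ⟨k₀, hk₀, k₁, hk₁, rfl⟩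
        refine ⟨h₀ + k₀, Submodule.add_mem _ hh₀ hk₀, h₁ + k₁, Submodule.add_mem _ hh₁ hk₁, ?_⟩
        rw [Matrix.add_mul, Matrix.mul_add]
        abel
      smul_mem' := by
        rintro c _ ⟨h₀, hh₀, h₁, hh₁, rfl⟩
        refine ⟨c • h₀, Submodule.smul_mem _ c hh₀, c • h₁, Submodule.smul_mem _ c hh₁, ?_⟩
        rw [Matrix.smul_mul, Matrix.mul_smul, smul_add] }
  have hsum : ∀ u : Matrix (Γ.zigI v ε 0 x) (Γ.zigI v ε 1 y) (Γ.Alg K),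
      (∀ a b, Matrix.single a b (u a b) ∈ R) → u ∈ R := by
    intro u hu
    rw [Matrix.matrix_eq_sum_single u]
    exact Submodule.sum_mem _ fun a _ => Submodule.sum_mem _ fun b _ => hu a b
  have key : ∀ (N : ℕ) (a : Γ.zigI v ε 0 x) (b : Γ.zigI v ε 1 y) (z : Γ.Alg K),
      z ∈ Γ.corner K a.1 b.1 → min (Γ.lev v a.1) (Γ.lev v b.1) < N → Matrix.single a b z ∈ R := by
    intro N
    induction N with
    | zero =>
      intro a b z _ h
      omega
    | succ N ih =>
      intro a b z hz hN
      by_cases hz0 : z = 0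
      · rw [hz0, Matrix.single_zero]
        exact Submodule.zero_mem _
      have ha := mem_zigI.1 a.2
      have hb := mem_zigI.1 b.2
      have hab : a.1 ≠ b.1 := fun h => by
        rw [h] at ha
        omega
      obtain ⟨c, rfl⟩ := exists_eq_smul_conn hab hz
      rw [← Matrix.smul_single]
      refine Submodule.smul_mem _ c ?_
      rcases lev_of_ne_zero (v := v) (ε := ε) (i := a.1) (j := b.1) (by omega) hz hz0 with ⟨hl, hpar⟩ | ⟨hl, hpar⟩
      · have ha' : a.1 ∈ Γ.zigI v ε 0 y := mem_zigI.2 ⟨hpar ▸ hb.1.par (by omega), ha.2⟩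
        let h₀ : Matrix (Γ.zigI v ε 0 x) (Γ.zigI v ε 0 y) (Γ.Alg K) :=
          Matrix.single a ⟨a.1, ha'⟩ (Γ.idem K a.1)
        have hh₀ : h₀ ∈ MatHom K s₀ t₀ := single_mem_MatHom (Γ.idem_mem_corner K a.1)
        have hent : ∀ a' b', (h₀ * G) a' b' = if a' = a then Γ.zigEnt K v a.1 b'.1 else 0 := by
          intro a' b'
          by_cases haa : a' = a
          · subst haa
            rw [Matrix.single_mul_apply_same, if_pos rfl]
            exact (Γ.zigEnt_mem_corner K v a'.1 b'.1).1
          · rw [Matrix.single_mul_apply_of_ne _ _ _ _ _ haa, if_neg haa]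
        have hmem : h₀ * G ∈ R := ⟨h₀, hh₀, 0, Submodule.zero_mem _, by simp⟩
        have hd : h₀ * G - Matrix.single a b (Γ.conn K a.1 b.1) ∈ R := by
          refine hsum _ fun a' b' => ?_
          rw [Matrix.sub_apply, hent, Matrix.single_apply]
          by_cases haa : a' = a
          · subst haa
            have hb' := mem_zigI.1 b'.2
            by_cases hbb : b' = b
            · subst hbb
              rw [zigEnt, if_pos (Or.inl hl.symm)]
              simp
            · have hbb' : b ≠ b' := fun h => hbb h.symm
              simp only [hbb', and_false, if_false, sub_zero, if_true]
              by_cases hl' : Γ.lev v b'.1 + 1 = Γ.lev v a'.1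
              · exact ih _ _ _ (Γ.zigEnt_mem_corner K v _ _) (by omega)
              · have hl'' : Γ.lev v a'.1 + 1 ≠ Γ.lev v b'.1 := fun h =>
                  hbb (Subtype.ext (hb'.1.eq_of_lev_eq hb.1 (by omega)))
                rw [zigEnt, if_neg (by tauto), Matrix.single_zero]
                exact Submodule.zero_mem _
          · have haa' : a ≠ a' := fun h => haa h.symm
            simp [haa, haa']
        have := Submodule.sub_mem _ hmem hd
        rwa [sub_sub_cancel] at this
      · have hb' : b.1 ∈ Γ.zigI v ε 1 x := mem_zigI.2 ⟨hpar ▸ ha.1.par (by omega), hb.2⟩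
        let h₁ : Matrix (Γ.zigI v ε 1 x) (Γ.zigI v ε 1 y) (Γ.Alg K) :=
          Matrix.single ⟨b.1, hb'⟩ b (Γ.idem K b.1)
        have hh₁ : h₁ ∈ MatHom K s₁ t₁ := single_mem_MatHom (Γ.idem_mem_corner K b.1)
        have hent : ∀ a' b', (F * h₁) a' b' = if b' = b then Γ.zigEnt K v a'.1 b.1 else 0 := by
          intro a' b'
          by_cases hbb : b' = b
          · subst hbb
            rw [Matrix.mul_single_apply_same, if_pos rfl]
            exact (Γ.zigEnt_mem_corner K v a'.1 b'.1).2
          · rw [Matrix.mul_single_apply_of_ne _ _ _ _ _ hbb, if_neg hbb]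
        have hmem : F * h₁ ∈ R := ⟨0, Submodule.zero_mem _, h₁, hh₁, by simp⟩
        have hd : F * h₁ - Matrix.single a b (Γ.conn K a.1 b.1) ∈ R := by
          refine hsum _ fun a' b' => ?_
          rw [Matrix.sub_apply, hent, Matrix.single_apply]
          by_cases hbb : b' = b
          · subst hbb
            have ha' := mem_zigI.1 a'.2
            by_cases haa : a' = a
            · subst haa
              rw [zigEnt, if_pos (Or.inr hl.symm)]
              simp
            · have haa' : a ≠ a' := fun h => haa h.symm
              simp only [haa', false_and, if_false, sub_zero, if_true]
              by_cases hl' : Γ.lev v a'.1 + 1 = Γ.lev v b'.1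
              · exact ih _ _ _ (Γ.zigEnt_mem_corner K v _ _) (by omega)
              · have hl'' : Γ.lev v b'.1 + 1 ≠ Γ.lev v a'.1 := fun h =>
                  haa (Subtype.ext (ha'.1.eq_of_lev_eq ha.1 (by omega)))
                rw [zigEnt, if_neg (by tauto), Matrix.single_zero]
                exact Submodule.zero_mem _
          · have hbb' : b ≠ b' := fun h => hbb h.symm
            simp [hbb, hbb']
        have := Submodule.sub_mem _ hmem hd
        rwa [sub_sub_cancel] at this
  intro u
  obtain ⟨h₀, hh₀, h₁, hh₁, hu⟩ : toMat u ∈ R := hsum _ fun a b =>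
    key _ a b _ (toMat_mem u a b) (Nat.lt_succ_self _)
  refine ⟨toLin s₀ t₀ h₀, toLin s₁ t₁ h₁, ?_⟩
  rw [zig_map_eq, zig_map_eq]
  apply (matEquiv K s₀ t₁).injective
  apply Subtype.ext
  change toMat u = toMat (((toLin t₀ t₁ G).comp (toLin s₀ t₀ h₀) : _ →ₗ[Γ.Alg K] _) +
    (toLin s₁ t₁ h₁).comp (toLin s₀ s₁ F))
  rw [toLin_comp hh₀ hG, toLin_comp hF hh₁, hu]
  change _ = toMat (toLin s₀ t₁ (h₀ * G)) + toMat (toLin s₀ t₁ (F * h₁))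
  rw [toMat_toLin (mul_mem_MatHom hh₀ hG), toMat_toLin (mul_mem_MatHom hF hh₁)]

/-- There are no morphisms of degree minus one between zigzag complexes. -/
theorem zig_extNegOneVanish [Finite V] (x y : Γ.Edge) :
    ExtNegOneVanish (Γ.zig K v ε x).map (Γ.zig K v ε y).map := by
  classical
  let s₀ : Γ.zigI v ε 0 x → Γ.Edge := fun i => i.1
  let s₁ : Γ.zigI v ε 1 x → Γ.Edge := fun i => i.1
  let t₀ : Γ.zigI v ε 0 y → Γ.Edge := fun i => i.1
  let t₁ : Γ.zigI v ε 1 y → Γ.Edge := fun i => i.1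
  let F := Γ.zigMat K v ε x
  let G := Γ.zigMat K v ε y
  have hF : F ∈ MatHom K s₀ s₁ := Γ.zigMat_mem K v ε x
  have hG : G ∈ MatHom K t₀ t₁ := Γ.zigMat_mem K v ε y
  intro κ h₁ h₂
  let k : Matrix (Γ.zigI v ε 1 x) (Γ.zigI v ε 0 y) (Γ.Alg K) := toMat (s := s₁) (t := t₀) κ
  have hk : k ∈ MatHom K s₁ t₀ := toMat_mem (s := s₁) (t := t₀) κ
  have hkG : k * G = 0 := by
    have := congrArg (toMat (s := s₁) (t := t₁)) h₁
    rw [zig_map_eq] at this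
    erw [toMat_comp (s := s₁) (t := t₀) (r := t₁) κ] at this
    rw [toMat_toLin hG] at this
    exact this
  have hFk : F * k = 0 := by
    have := congrArg (toMat (s := s₀) (t := t₀)) h₂
    rw [zig_map_eq] at this
    erw [toMat_comp (s := s₀) (t := s₁) (r := t₀) _ κ] at this
    rw [toMat_toLin hF] at this
    exact this
  have key : ∀ (N : ℕ) (a : Γ.zigI v ε 1 x) (b : Γ.zigI v ε 0 y),
      min (Γ.lev v a.1) (Γ.lev v b.1) < N → k a b = 0 := by
    intro N
    induction N with
    | zero =>
      intro a b h
      omega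
    | succ N ih =>
      intro a b hN
      by_contra hk0
      have ha := mem_zigI.1 a.2
      have hb := mem_zigI.1 b.2
      have hab : a.1 ≠ b.1 := fun h => by
        rw [h] at ha
        omega
      obtain ⟨c, hc⟩ := exists_eq_smul_conn hab (hk a b)
      have hc0 : c ≠ 0 := by
        rintro rfl
        rw [zero_smul] at hc
        exact hk0 hc
      rcases lev_of_ne_zero (v := v) (ε := ε) (i := a.1) (j := b.1) (by omega) (hk a b) hk0 with
        ⟨hl, hpar⟩ | ⟨hl, hpar⟩
      · have ha' : Γ.IsAnc v a.1 y := hpar ▸ hb.1.par (by omega)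
        have h3 := congrFun (congrFun hkG a) ⟨a.1, mem_zigI.2 ⟨ha', ha.2⟩⟩
        rw [Matrix.mul_apply, Finset.sum_eq_single b] at h3
        · obtain ⟨w, hwa, hwb⟩ := ha'.exists_mem hb.1 (Or.inl hl.symm)
          change k a b * Γ.zigEnt K v b.1 a.1 = 0 at h3
          rw [zigEnt, if_pos (Or.inr hl.symm), hc, smul_mul_assoc, conn_mul_conn hab hwa hwb,
            smul_eq_zero] at h3
          exact h3.elim hc0 (Γ.soc_ne_zero K a.1)
        · intro b' _ hbb
          have hb' := mem_zigI.1 b'.2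
          by_cases hl' : Γ.lev v b'.1 + 1 = Γ.lev v a.1
          · rw [ih a b' (by omega), zero_mul]
          · have hl'' : Γ.lev v a.1 + 1 ≠ Γ.lev v b'.1 := fun h =>
              hbb (Subtype.ext (hb'.1.eq_of_lev_eq hb.1 (by omega)))
            change _ * Γ.zigEnt K v b'.1 a.1 = 0
            rw [zigEnt, if_neg (by tauto), mul_zero]
        · simp
      · have hb' : Γ.IsAnc v b.1 x := hpar ▸ ha.1.par (by omega)
        have h3 := congrFun (congrFun hFk ⟨b.1, mem_zigI.2 ⟨hb', hb.2⟩⟩) b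
        rw [Matrix.mul_apply, Finset.sum_eq_single a] at h3
        · obtain ⟨w, hwb, hwa⟩ := hb'.exists_mem ha.1 (Or.inl hl.symm)
          change Γ.zigEnt K v b.1 a.1 * k a b = 0 at h3
          rw [zigEnt, if_pos (Or.inl hl.symm), hc, mul_smul_comm, conn_mul_conn hab.symm hwb hwa,
            smul_eq_zero] at h3
          exact h3.elim hc0 (Γ.soc_ne_zero K b.1)
        · intro a' _ haa
          have ha' := mem_zigI.1 a'.2
          by_cases hl' : Γ.lev v a'.1 + 1 = Γ.lev v b.1
          · rw [ih a' b (by omega), mul_zero]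
          · have hl'' : Γ.lev v b.1 + 1 ≠ Γ.lev v a'.1 := fun h =>
              haa (Subtype.ext (ha'.1.eq_of_lev_eq ha.1 (by omega)))
            change Γ.zigEnt K v b.1 a'.1 * _ = 0
            rw [zigEnt, if_neg (by tauto), zero_mul]
        · simp
  apply (matEquiv K s₁ t₀).injective
  apply Subtype.ext
  funext a b
  exact key _ a b (Nat.lt_succ_self _)

end Zigzag

end BrauerTree


/-! ### Direct sums of two-term complexes -/

section PiComplex

set_option linter.unusedSectionVars false

variable {A : Type u} [Ring A] {κ : Type v} [Fintype κ] [DecidableEq κ] {P₀ P₁ : κ → Type (max v w)}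
  [∀ x, AddCommGroup (P₀ x)] [∀ x, AddCommGroup (P₁ x)] [∀ x, Module A (P₀ x)]
  [∀ x, Module A (P₁ x)]

/-- The direct sum of a finite family of two-term complexes. -/
def piMap (f : ∀ x, P₀ x →ₗ[A] P₁ x) : (∀ x, P₀ x) →ₗ[A] (∀ x, P₁ x) :=
  LinearMap.pi fun x => (f x).comp (LinearMap.proj x)

variable {f : ∀ x, P₀ x →ₗ[A] P₁ x}

theorem piMap_single (x : κ) (p : P₀ x) : piMap f (Pi.single x p) = Pi.single x (f x p) := by
  funext y
  by_cases h : y = x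
  · subst h
    simp [piMap]
  · simp [piMap, Pi.single_eq_of_ne h]

theorem ExtOneVanish.pi (h : ∀ x y, ExtOneVanish (f x) (f y)) :
    ExtOneVanish (piMap f) (piMap f) := by
  intro u
  choose h₀ h₁ hu using fun x y =>
    h x y ((LinearMap.proj y).comp (u.comp (LinearMap.single A P₀ x)))
  refine ⟨LinearMap.pi fun y => ∑ x, (h₀ x y).comp (LinearMap.proj x),
    LinearMap.pi fun y => ∑ x, (h₁ x y).comp (LinearMap.proj x), ?_⟩
  refine LinearMap.pi_ext fun x p => funext fun y => ?_
  have h2 := LinearMap.congr_fun (hu x y) p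
  simp only [LinearMap.comp_apply, LinearMap.single_apply, LinearMap.proj_apply,
    LinearMap.add_apply] at h2
  rw [h2, LinearMap.add_apply, Pi.add_apply, LinearMap.comp_apply, LinearMap.comp_apply,
    piMap_single]
  have key : ∀ {Q R : κ → Type (max v w)} [∀ x, AddCommGroup (Q x)] [∀ x, AddCommGroup (R x)]
      [∀ x, Module A (Q x)] [∀ x, Module A (R x)] (k : ∀ x, Q x →ₗ[A] R y) (q : Q x),
      (∑ x, (k x).comp (LinearMap.proj x)) (Pi.single x q : ∀ x, Q x) = k x q := by
    intro Q R _ _ _ _ k q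
    rw [LinearMap.sum_apply, Finset.sum_eq_single x]
    · simp
    · intro z _ hz
      simp [Pi.single_eq_of_ne hz]
    · simp
  rw [LinearMap.pi_apply, key]
  congr 1
  rw [piMap, LinearMap.pi_apply, LinearMap.comp_apply, LinearMap.proj_apply, LinearMap.pi_apply,
    key]

theorem ExtNegOneVanish.pi (h : ∀ x y, ExtNegOneVanish (f x) (f y)) :
    ExtNegOneVanish (piMap f) (piMap f) := by
  intro k h₁ h₂
  refine LinearMap.pi_ext fun x p => funext fun y => ?_
  have := h x y ((LinearMap.proj y).comp (k.comp (LinearMap.single A P₁ x))) (by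
    ext q
    exact congrFun (LinearMap.congr_fun h₁ (Pi.single x q)) y) (by
    ext q
    have := congrFun (LinearMap.congr_fun h₂ (Pi.single x q)) y
    rw [LinearMap.comp_apply, piMap_single] at this
    exact this)
  exact LinearMap.congr_fun this p

variable (f) in
/-- The inclusion of a summand of a direct sum. -/
def piRetract (x : κ) : StrictRetract (f x) (piMap f) where
  ι₀ := LinearMap.single A P₀ x
  ι₁ := LinearMap.single A P₁ x
  π₀ := LinearMap.proj x
  π₁ := LinearMap.proj x
  hι := by
    ext p : 1
    simp [piMap_single]
  hπ := rfl
  h₀ := by ext; simp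
  h₁ := by ext; simp

theorem piRetract_incl_proj_of_ne {x y : κ} (h : x ≠ y) :
    (piRetract f x).incl ≫ (piRetract f y).proj = 0 := by
  rw [StrictRetract.incl, StrictRetract.proj, qmap_comp, qmap_eq_zero_iff]
  refine ⟨0, ?_, ?_⟩
  · ext p
    simp [piRetract, Pi.single_eq_of_ne h.symm]
  · ext p
    simp [piRetract, Pi.single_eq_of_ne h.symm]

theorem qmap_sum {ι : Type*} {A : Type u} [Ring A] {P₀ P₁ Q₀ Q₁ : Type w} [AddCommGroup P₀]
    [AddCommGroup P₁] [AddCommGroup Q₀] [AddCommGroup Q₁] [Module A P₀] [Module A P₁] [Module A Q₀]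
    [Module A Q₁] {f : P₀ →ₗ[A] P₁} {g : Q₀ →ₗ[A] Q₁} (s : Finset ι) (h₀ : ι → P₀ →ₗ[A] Q₀)
    (h₁ : ι → P₁ →ₗ[A] Q₁) (h : ∀ i, g.comp (h₀ i) = (h₁ i).comp f) :
    ∑ i ∈ s, qmap (h₀ i) (h₁ i) (h i) = qmap (∑ i ∈ s, h₀ i) (∑ i ∈ s, h₁ i) (by
      ext x
      simp only [LinearMap.comp_apply, LinearMap.sum_apply, map_sum]
      exact Finset.sum_congr rfl fun i _ => LinearMap.congr_fun (h i) x) := by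
  classical
  induction s using Finset.induction_on with
  | empty =>
    rw [Finset.sum_empty]
    symm
    rw [qmap_eq_zero_iff]
    exact ⟨0, by simp, by simp⟩
  | insert i s hi ih =>
    rw [Finset.sum_insert hi, ih, qmap_add]
    exact qmap_congr _ (Finset.sum_insert hi).symm (Finset.sum_insert hi).symm

theorem sum_piRetract : ∑ x, (piRetract f x).proj ≫ (piRetract f x).incl =
    𝟙 (toHtpy (dbl (piMap f))) := by
  have key : ∀ {Q : κ → Type (max v w)} [∀ x, AddCommGroup (Q x)] [∀ x, Module A (Q x)],
      ∑ x, (LinearMap.single A Q x).comp (LinearMap.proj x) = LinearMap.id := by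
    intro Q _ _
    refine LinearMap.ext fun p => ?_
    rw [LinearMap.sum_apply]
    exact Finset.univ_sum_single p
  simp only [StrictRetract.incl, StrictRetract.proj, qmap_comp]
  rw [qmap_sum, ← qmap_id]
  exact qmap_congr _ key key

end PiComplex

/-! ### The tilting complex attached to a vertex -/

namespace BrauerTree

variable {V : Type v} (Γ : BrauerTree V) (K : Type u) [Field K] (v : V) (ε : ℕ)

section

variable [DecidableEq V]

theorem sum_anc_inc (x : Γ.Edge) (y : V) (m : ℕ) (hm : m ≤ Γ.lev v x) :
    ∑ k ∈ Finset.range (m + 1), (-1) ^ k * Γ.inc (Γ.anc v x k) y =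
      (if y = v then 1 else 0) + (-1) ^ m * if y = Γ.bot v (Γ.anc v x m) then 1 else 0 := by
  induction m with
  | zero =>
    have h : Γ.top v (Γ.anc v x 0) = v := by
      rw [top_eq_root_iff, Γ.lev_anc v hm]
    simp [Γ.inc_eq v, h]
  | succ m ih =>
    rw [Finset.sum_range_succ, ih (by omega), Γ.inc_eq v, Γ.bot_anc v hm, pow_succ]
    ring

/-- The class of a zigzag complex. -/
theorem cls_zig [Fintype Γ.Edge] (x : Γ.Edge) (y : V) :
    Γ.cls (fun i : Γ.zigI v ε 0 x => i.1) y - Γ.cls (fun i : Γ.zigI v ε 1 x => i.1) y =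
      (-1) ^ ε * ((if y = v then 1 else 0) -
        Γ.sgn v (Γ.bot v x) * if y = Γ.bot v x then 1 else 0) := by
  classical
  have h1 : ∀ b, Γ.cls (fun i : Γ.zigI v ε b x => i.1) y =
      ∑ i, if Γ.IsAnc v i x then (if (Γ.lev v i + ε) % 2 = b then Γ.inc i y else 0) else 0 := by
    intro b
    rw [cls, Finset.sum_coe_sort (Γ.zigI v ε b x)
      (fun i => Γ.inc i y), zigI, Finset.sum_filter]
    exact Finset.sum_congr rfl fun i _ => by split_ifs <;> simp_all
  have h2 := Γ.sum_anc_inc v x y (Γ.lev v x) le_rfl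
  rw [anc_lev] at h2
  have h3 : ∑ i, (if Γ.IsAnc v i x then (-1) ^ (Γ.lev v i) * Γ.inc i y else 0) =
      ∑ k ∈ Finset.range (Γ.lev v x + 1), (-1) ^ k * Γ.inc (Γ.anc v x k) y := by
    rw [← Finset.sum_filter]
    refine Finset.sum_bij' (fun i _ => Γ.lev v i) (fun k _ => Γ.anc v x k) ?_ ?_ ?_ ?_ ?_
    · intro i hi
      have := (Finset.mem_filter.1 hi).2.1
      simpa [Nat.lt_succ_iff] using this
    · intro k hk
      have : k ≤ Γ.lev v x := by simpa [Nat.lt_succ_iff] using hk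
      simpa using isAnc_anc this
    · intro i hi
      exact (Finset.mem_filter.1 hi).2.2
    · intro k hk
      exact Γ.lev_anc v (by simpa [Nat.lt_succ_iff] using hk)
    · intro i hi
      rw [(Finset.mem_filter.1 hi).2.2]
  have h4 : Γ.sgn v (Γ.bot v x) = -(-1) ^ Γ.lev v x := by
    rw [sgn, dist_bot, pow_succ]
    ring
  rw [h4, neg_mul, sub_neg_eq_add, ← h2, ← h3, h1, h1, ← Finset.sum_sub_distrib, Finset.mul_sum]
  refine Finset.sum_congr rfl fun i _ => ?_
  by_cases hi : Γ.IsAnc v i x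
  · simp only [if_pos hi]
    have h5 : (-1 : ℤ) ^ ε * ((-1) ^ Γ.lev v i * Γ.inc i y) =
        (-1) ^ (Γ.lev v i + ε) * Γ.inc i y := by
      rw [pow_add]
      ring
    rw [h5]
    rcases Nat.mod_two_eq_zero_or_one (Γ.lev v i + ε) with h | h
    · rw [(Nat.even_iff.2 h).neg_one_pow]
      simp [h]
    · rw [(Nat.odd_iff.2 h).neg_one_pow]
      simp [h]
  · simp [hi]

end

section

variable [Fintype V] [Fintype Γ.Edge] [DecidableEq Γ.Edge]

/-- The differential of the tilting complex attached to a vertex: the direct sum of the zigzag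
complexes of all edges. -/
noncomputable def tiltMap : (∀ x : Γ.Edge, ∀ i : Γ.zigI v ε 0 x, Γ.Proj K i.1) →ₗ[Γ.Alg K]
    (∀ x : Γ.Edge, ∀ i : Γ.zigI v ε 1 x, Γ.Proj K i.1) :=
  piMap fun x => (Γ.zig K v ε x).map

theorem tilt_extOneVanish : ExtOneVanish (Γ.tiltMap K v ε) (Γ.tiltMap K v ε) :=
  ExtOneVanish.pi fun x y => zig_extOneVanish x y

theorem tilt_extNegOneVanish : ExtNegOneVanish (Γ.tiltMap K v ε) (Γ.tiltMap K v ε) :=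
  ExtNegOneVanish.pi fun x y => zig_extNegOneVanish x y

theorem finrank_zig_hom (x y : Γ.Edge) :
    Module.finrank K (toHtpy (dbl (Γ.zig K v ε x).map) ⟶ toHtpy (dbl (Γ.zig K v ε y).map)) =
      if x = y then 2 else 1 := by
  classical
  have h := finrank_htpy_hom_PiProj (Γ := Γ) (K := K)
    (s₀ := fun i : Γ.zigI v ε 0 x => i.1) (s₁ := fun i : Γ.zigI v ε 1 x => i.1)
    (t₀ := fun i : Γ.zigI v ε 0 y => i.1) (t₁ := fun i : Γ.zigI v ε 1 y => i.1)
    (zig_extOneVanish (K := K) (v := v) (ε := ε) x y)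
    (zig_extNegOneVanish (K := K) (v := v) (ε := ε) x y)
  simp only [cls_zig] at h
  have hx := Γ.bot_ne_root v x
  have hy := Γ.bot_ne_root v y
  have hs := Γ.sgn_mul_self v (Γ.bot v x)
  have h5 : ∀ z, (-1 : ℤ) ^ ε * ((if z = v then 1 else 0) - Γ.sgn v (Γ.bot v x) *
      if z = Γ.bot v x then 1 else 0) * ((-1) ^ ε * ((if z = v then 1 else 0) -
        Γ.sgn v (Γ.bot v y) * if z = Γ.bot v y then 1 else 0)) =
      (if z = v then 1 else 0) + if z = Γ.bot v x then (if x = y then 1 else 0) else 0 := by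
    intro z
    have h6 : (-1 : ℤ) ^ ε * (-1) ^ ε = 1 := by rw [← mul_pow]; simp
    have h7 : ∀ a b : ℤ, (-1 : ℤ) ^ ε * a * ((-1) ^ ε * b) = a * b := fun a b => by
      calc (-1 : ℤ) ^ ε * a * ((-1) ^ ε * b) = ((-1) ^ ε * (-1) ^ ε) * (a * b) := by ring
        _ = a * b := by rw [h6, one_mul]
    rw [h7]
    by_cases hzv : z = v
    · subst hzv
      simp [hx.symm, hy.symm]
    · by_cases hzx : z = Γ.bot v x
      · subst hzx
        by_cases hxy : x = y
        · subst hxy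
          simp [hx, hs]
        · have : Γ.bot v x ≠ Γ.bot v y := fun h => hxy (Γ.bot_injective v h)
          simp [hx, hxy, this]
      · simp [hzv, hzx]
  simp only [h5, Finset.sum_add_distrib, Finset.sum_ite_eq', Finset.mem_univ, if_true] at h
  have h8 : (Module.finrank K (toHtpy (dbl (Γ.zig K v ε x).map) ⟶
      toHtpy (dbl (Γ.zig K v ε y).map)) : ℤ) = 1 + if x = y then 1 else 0 := h
  split_ifs at h8 ⊢ <;> omega

end

end BrauerTree


/-! ### Morphisms between zigzag complexes -/

namespace BrauerTree

section ZMap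

variable {V : Type v} (Γ : BrauerTree V) (K : Type u) [Field K] (v : V) (ε : ℕ)

/-- A family `θ` of elements of the algebra, one for each level from `m` on, that defines a
morphism between the parts of level at least `m` of the zigzag complexes of `x` and `y`. -/
structure ZMap (m : ℕ) (x y : Γ.Edge) (θ : ℕ → Γ.Alg K) : Prop where
  mem : ∀ k, k ≤ Γ.lev v x → k ≤ Γ.lev v y → θ k ∈ Γ.corner K (Γ.anc v x k) (Γ.anc v y k)
  zero : ∀ k, k < m ∨ Γ.lev v x < k ∨ Γ.lev v y < k → θ k = 0
  comm : ∀ k l, m ≤ k → m ≤ l → (k + ε) % 2 = 0 → k + 1 = l ∨ l + 1 = k → k ≤ Γ.lev v x →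
    l ≤ Γ.lev v y → θ k * Γ.conn K (Γ.anc v y k) (Γ.anc v y l) =
      Γ.conn K (Γ.anc v x k) (Γ.anc v x l) * θ l

variable {Γ K v ε}

theorem ZMap.mul {m : ℕ} {x y z : Γ.Edge} {θ θ' : ℕ → Γ.Alg K} (h : Γ.ZMap K v ε m x y θ)
    (h' : Γ.ZMap K v ε m y z θ') : Γ.ZMap K v ε m x z fun k => θ k * θ' k where
  mem k hx hz := by
    by_cases hy : k ≤ Γ.lev v y
    · exact mul_mem_corner (h.mem k hx hy) (h'.mem k hy hz)
    · rw [h.zero k (by omega), zero_mul]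
      exact Submodule.zero_mem _
  zero k hk := by
    rcases hk with hk | hk | hk
    · rw [h.zero k (by omega), zero_mul]
    · rw [h.zero k (by omega), zero_mul]
    · rw [h'.zero k (by omega), mul_zero]
  comm k l hk hl hp hkl hx hz := by
    by_cases hyk : k ≤ Γ.lev v y
    · rw [mul_assoc, h'.comm k l hk hl hp hkl hyk hz, ← mul_assoc]
      by_cases hyl : l ≤ Γ.lev v y
      · rw [h.comm k l hk hl hp hkl hx hyl, mul_assoc]
      · rw [h'.zero l (by omega), mul_zero, mul_zero, mul_zero]
    · rw [h.zero k (by omega), zero_mul, zero_mul]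
      by_cases hyl : l ≤ Γ.lev v y
      · rw [← mul_assoc, ← h.comm k l hk hl hp hkl hx hyl, h.zero k (by omega), zero_mul, zero_mul]
      · rw [h.zero l (by omega), zero_mul, mul_zero]

theorem ZMap.single_idem {m : ℕ} {x y : Γ.Edge} (hx : m ≤ Γ.lev v x) (hy : m ≤ Γ.lev v y)
    (hxy : Γ.anc v x m = Γ.anc v y m) (h₀ : (m + ε) % 2 = 0 → Γ.lev v y = m)
    (h₁ : (m + ε) % 2 = 1 → Γ.lev v x = m) :
    Γ.ZMap K v ε m x y (Pi.single m (Γ.idem K (Γ.anc v x m))) where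
  mem k hkx hky := by
    by_cases hk : k = m
    · subst hk
      rw [Pi.single_eq_same, ← hxy]
      exact Γ.idem_mem_corner K _
    · rw [Pi.single_eq_of_ne hk]
      exact Submodule.zero_mem _
  zero k hk := Pi.single_eq_of_ne (by omega) _
  comm k l hk hl hp hkl hkx hly := by
    by_cases hkm : k = m
    · subst hkm
      have := h₀ hp
      omega
    · by_cases hlm : l = m
      · subst hlm
        have := h₁ (by omega)
        omega
      · rw [Pi.single_eq_of_ne hkm, Pi.single_eq_of_ne hlm, zero_mul, mul_zero]

theorem ZMap.update {m : ℕ} {x y : Γ.Edge} {θ : ℕ → Γ.Alg K} (h : Γ.ZMap K v ε (m + 1) x y θ)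
    (hx : m + 1 ≤ Γ.lev v x) (hy : m + 1 ≤ Γ.lev v y) {z : Γ.Alg K}
    (hz : z ∈ Γ.corner K (Γ.anc v x m) (Γ.anc v y m))
    (h₁ : z * Γ.conn K (Γ.anc v y m) (Γ.anc v y (m + 1)) =
      Γ.conn K (Γ.anc v x m) (Γ.anc v x (m + 1)) * θ (m + 1))
    (h₂ : θ (m + 1) * Γ.conn K (Γ.anc v y (m + 1)) (Γ.anc v y m) =
      Γ.conn K (Γ.anc v x (m + 1)) (Γ.anc v x m) * z) :
    Γ.ZMap K v ε m x y (Function.update θ m z) where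
  mem k hkx hky := by
    by_cases hk : k = m
    · subst hk
      rwa [Function.update_self]
    · rw [Function.update_of_ne hk]
      exact h.mem k hkx hky
  zero k hk := by
    rw [Function.update_of_ne (by omega)]
    exact h.zero k (by omega)
  comm k l hk hl hp hkl hkx hly := by
    by_cases hkm : k = m
    · subst hkm
      obtain rfl : k + 1 = l := by omega
      rw [Function.update_self, Function.update_of_ne (by omega), h₁]
    · by_cases hlm : l = m
      · subst hlm
        obtain rfl : l + 1 = k := by omega
        rw [Function.update_self, Function.update_of_ne (by omega), h₂]
      · rw [Function.update_of_ne hkm, Function.update_of_ne hlm]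
        exact h.comm k l (by omega) (by omega) hp hkl hkx hly

variable [Finite V]

theorem conn_eq_path_down {x : Γ.Edge} {k : ℕ} (h : k + 1 ≤ Γ.lev v x) :
    ∃ l, 0 < l ∧ l < Γ.per (Γ.down v (Γ.anc v x k)).symm ∧
      Γ.next^[l] (Γ.down v (Γ.anc v x k)).symm = Γ.down v (Γ.anc v x (k + 1)) ∧
      Γ.conn K (Γ.anc v x k) (Γ.anc v x (k + 1)) = Γ.path K l (Γ.down v (Γ.anc v x k)).symm ∧
      Γ.conn K (Γ.anc v x (k + 1)) (Γ.anc v x k) =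
        Γ.path K (Γ.per (Γ.down v (Γ.anc v x k)).symm - l) (Γ.down v (Γ.anc v x (k + 1))) := by
  obtain ⟨l, hl, hl'⟩ := Γ.exists_iterate_eq (a := (Γ.down v (Γ.anc v x k)).symm)
    (b := Γ.down v (Γ.anc v x (k + 1))) (Γ.bot_anc v h)
  have hs : Γ.source (Γ.down v (Γ.anc v x k)).symm = Γ.anc v x k := by simp
  have hs' : Γ.source (Γ.next^[l] (Γ.down v (Γ.anc v x k)).symm) = Γ.anc v x (k + 1) := by
    rw [hl']
    simp
  have hl0 : 0 < l := by
    rcases Nat.eq_zero_or_pos l with rfl | h0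
    · have := Γ.anc_injOn v (x := x) (by omega) h (hs.symm.trans hs')
      omega
    · exact h0
  refine ⟨l, hl0, hl, hl', ?_, ?_⟩
  · conv_lhs => rw [← hs', ← hs]
    rw [source_symm, source_down, ← Γ.conn_source K hl, source_symm, source_down]
  · have hback : Γ.source (Γ.next^[Γ.per (Γ.down v (Γ.anc v x k)).symm - l]
        (Γ.down v (Γ.anc v x (k + 1)))) = Γ.anc v x k := by
      rw [← hl', ← Function.iterate_add_apply, Nat.sub_add_cancel hl.le, iterate_per, hs]
    have := Γ.conn_source K (a := Γ.down v (Γ.anc v x (k + 1)))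
      (k := Γ.per (Γ.down v (Γ.anc v x k)).symm - l) (by
        rw [← hl', per_iterate]
        omega)
    rwa [hback, source_down] at this

/-- A path around the upper end point of two edges of level `m` defines a morphism concentrated at
level `m`. -/
theorem ZMap.single_path {m l : ℕ} {x y : Γ.Edge} (hx : m ≤ Γ.lev v x) (hy : m ≤ Γ.lev v y)
    (hl : 0 < l) (hxy : Γ.next^[l] (Γ.down v (Γ.anc v x m)) = Γ.down v (Γ.anc v y m)) :
    Γ.ZMap K v ε m x y (Pi.single m (Γ.path K l (Γ.down v (Γ.anc v x m)))) where
  mem k hkx hky := by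
    by_cases hk : k = m
    · subst hk
      rw [Pi.single_eq_same]
      have := Γ.path_mem_corner K l (Γ.down v (Γ.anc v x k))
      rwa [hxy, source_down, source_down] at this
    · rw [Pi.single_eq_of_ne hk]
      exact Submodule.zero_mem _
  zero k hk := Pi.single_eq_of_ne (by omega) _
  comm k j hk hj hp hkj hkx hjy := by
    by_cases hkm : k = m
    · subst hkm
      obtain rfl : k + 1 = j := by omega
      obtain ⟨n, hn, -, -, hn', -⟩ := conn_eq_path_down (K := K) hjy
      rw [Pi.single_eq_same, Pi.single_eq_of_ne (by omega), mul_zero, hn']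
      refine Γ.path_mul_path_of_ne K hl hn ?_
      rw [hxy]
      exact SimpleGraph.Dart.symm_ne _ |>.symm
    · by_cases hjm : j = m
      · subst hjm
        obtain rfl : j + 1 = k := by omega
        obtain ⟨n, hn, hn2, hn3, -, hn'⟩ := conn_eq_path_down (K := K) hkx
        rw [Pi.single_eq_same, Pi.single_eq_of_ne (by omega), zero_mul, hn']
        symm
        refine Γ.path_mul_path_of_ne K (by omega) hl ?_
        rw [← hn3, ← Function.iterate_add_apply, Nat.sub_add_cancel hn2.le, iterate_per]
        exact SimpleGraph.Dart.symm_ne _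
      · rw [Pi.single_eq_of_ne hkm, Pi.single_eq_of_ne hjm, zero_mul, mul_zero]

/-- Zigzag complexes with a common part are comparable. -/
theorem exists_zMap_or (m : ℕ) {x y : Γ.Edge} (hx : m ≤ Γ.lev v x) (hy : m ≤ Γ.lev v y)
    (hxy : Γ.anc v x m = Γ.anc v y m) :
    (∃ θ, Γ.ZMap K v ε m x y θ ∧ θ m = Γ.idem K (Γ.anc v x m)) ∨
      ∃ θ, Γ.ZMap K v ε m y x θ ∧ θ m = Γ.idem K (Γ.anc v x m) := by
  obtain ⟨N, hN⟩ : ∃ N, Γ.lev v x - m = N := ⟨_, rfl⟩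
  induction N generalizing m with
  | zero =>
    have hxm : Γ.lev v x = m := by omega
    rcases Nat.mod_two_eq_zero_or_one (m + ε) with h | h
    · right
      exact ⟨_, ZMap.single_idem hy hx hxy.symm (fun _ => hxm) (fun h' => by omega), by
        rw [Pi.single_eq_same, hxy]⟩
    · left
      exact ⟨_, ZMap.single_idem hx hy hxy (fun h' => by omega) (fun _ => hxm), by
        rw [Pi.single_eq_same]⟩
  | succ N ih =>
    by_cases hym : Γ.lev v y = m
    · rcases Nat.mod_two_eq_zero_or_one (m + ε) with h | h
      · left
        exact ⟨_, ZMap.single_idem hx hy hxy (fun _ => hym) (fun h' => by omega), by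
          rw [Pi.single_eq_same]⟩
      · right
        exact ⟨_, ZMap.single_idem hy hx hxy.symm (fun h' => by omega) (fun _ => hym), by
          rw [Pi.single_eq_same, hxy]⟩
    have hx' : m + 1 ≤ Γ.lev v x := by omega
    have hy' : m + 1 ≤ Γ.lev v y := by omega
    have hid : Γ.idem K (Γ.anc v x m) ∈ Γ.corner K (Γ.anc v x m) (Γ.anc v y m) := by
      rw [← hxy]
      exact Γ.idem_mem_corner K _
    have hid' : Γ.idem K (Γ.anc v x m) ∈ Γ.corner K (Γ.anc v y m) (Γ.anc v x m) := by
      rw [← hxy]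
      exact Γ.idem_mem_corner K _
    by_cases hxy' : Γ.anc v x (m + 1) = Γ.anc v y (m + 1)
    · rcases ih (m + 1) hx' hy' hxy' (by omega) with ⟨θ, hθ, h1⟩ | ⟨θ, hθ, h1⟩
      · refine Or.inl ⟨_, hθ.update hx' hy' hid ?_ ?_, Function.update_self _ _ _⟩
        · rw [h1, ← hxy, ← hxy', (Γ.conn_mem_corner K _ _).1, (Γ.conn_mem_corner K _ _).2]
        · rw [h1, ← hxy, ← hxy', (Γ.conn_mem_corner K _ _).1, (Γ.conn_mem_corner K _ _).2]
      · refine Or.inr ⟨_, hθ.update hy' hx' hid' ?_ ?_, Function.update_self _ _ _⟩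
        · rw [h1, ← hxy, ← hxy', (Γ.conn_mem_corner K _ _).1, (Γ.conn_mem_corner K _ _).2]
        · rw [h1, ← hxy, ← hxy', (Γ.conn_mem_corner K _ _).1, (Γ.conn_mem_corner K _ _).2]
    · have key : ∀ {x y : Γ.Edge} (hx : m + 1 ≤ Γ.lev v x) (hy : m + 1 ≤ Γ.lev v y)
          (hxy : Γ.anc v x m = Γ.anc v y m) {a b : ℕ}
          (_ : Γ.next^[a] (Γ.down v (Γ.anc v x m)).symm = Γ.down v (Γ.anc v x (m + 1)))
          (_ : Γ.next^[b] (Γ.down v (Γ.anc v x m)).symm = Γ.down v (Γ.anc v y (m + 1)))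
          (_ : a < b) (_ : b < Γ.per (Γ.down v (Γ.anc v x m)).symm)
          (_ : Γ.conn K (Γ.anc v x m) (Γ.anc v x (m + 1)) =
            Γ.path K a (Γ.down v (Γ.anc v x m)).symm)
          (_ : Γ.conn K (Γ.anc v x m) (Γ.anc v y (m + 1)) =
            Γ.path K b (Γ.down v (Γ.anc v x m)).symm)
          (_ : Γ.conn K (Γ.anc v x (m + 1)) (Γ.anc v x m) =
            Γ.path K (Γ.per (Γ.down v (Γ.anc v x m)).symm - a) (Γ.down v (Γ.anc v x (m + 1))))
          (_ : Γ.conn K (Γ.anc v y (m + 1)) (Γ.anc v x m) =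
            Γ.path K (Γ.per (Γ.down v (Γ.anc v x m)).symm - b) (Γ.down v (Γ.anc v y (m + 1)))),
          ∃ θ, Γ.ZMap K v ε m x y θ ∧ θ m = Γ.idem K (Γ.anc v x m) := by
        intro x y hx hy hxy a b ha hb hab hbp e₁ e₂ e₃ e₄
        have hit : Γ.next^[b - a] (Γ.down v (Γ.anc v x (m + 1))) =
            Γ.down v (Γ.anc v y (m + 1)) := by
          rw [← ha, ← Function.iterate_add_apply, Nat.sub_add_cancel hab.le, hb]
        have h1 := ZMap.single_path (K := K) (ε := ε) hx hy (l := b - a) (by omega) hit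
        refine ⟨_, h1.update hx hy (z := Γ.idem K (Γ.anc v x m)) ?_ ?_ ?_,
          Function.update_self _ _ _⟩
        · rw [← hxy]
          exact Γ.idem_mem_corner K _
        · rw [Pi.single_eq_same, ← hxy, (Γ.conn_mem_corner K _ _).1, e₂, e₁, ← ha, path_add,
            Nat.add_sub_cancel' hab.le]
        · rw [Pi.single_eq_same, ← hxy, (Γ.conn_mem_corner K _ _).2, e₃, e₄, ← hit, path_add]
          congr 1
          omega
      obtain ⟨a, ha0, hap, ha, e₁, e₃⟩ := conn_eq_path_down (K := K) hx'
      obtain ⟨b, hb0, hbp, hb, e₂, e₄⟩ := conn_eq_path_down (K := K) hy'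
      rcases Nat.lt_trichotomy a b with hab | hab | hab
      · rw [← hxy] at hbp hb e₂ e₄
        exact Or.inl (key hx' hy' hxy ha hb hab hbp e₁ e₂ e₃ e₄)
      · exfalso
        apply hxy'
        subst hab
        rw [← hxy, ha] at hb
        rw [← Γ.source_down v (Γ.anc v x (m + 1)), hb, source_down]
      · rw [hxy] at hap ha e₁ e₃ ⊢
        exact Or.inr (key hy' hx' hxy.symm hb ha hab hap e₂ e₁ e₄ e₃)

end ZMap

end BrauerTree


namespace BrauerTree

section ZMorphism

set_option linter.unusedSectionVars false

variable {V : Type v} {Γ : BrauerTree V} {K : Type u} [Field K] {v : V} {ε : ℕ} [Fintype Γ.Edge]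

variable (v ε) in
/-- The components of degree `b` of the morphism of zigzag complexes defined by `θ`. -/
noncomputable def zMatrix (b : ℕ) (x y : Γ.Edge) (θ : ℕ → Γ.Alg K) :
    Matrix (Γ.zigI v ε b x) (Γ.zigI v ε b y) (Γ.Alg K) :=
  fun i j => if Γ.lev v i.1 = Γ.lev v j.1 then θ (Γ.lev v i.1) else 0

theorem ZMap.zMatrix_mem {x y : Γ.Edge} {θ : ℕ → Γ.Alg K} (h : Γ.ZMap K v ε 0 x y θ) (b : ℕ) :
    zMatrix v ε b x y θ ∈ MatHom K (fun i : Γ.zigI v ε b x => i.1)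
      (fun i : Γ.zigI v ε b y => i.1) := by
  intro i j
  have hi := (mem_zigI.1 i.2).1
  have hj := (mem_zigI.1 j.2).1
  rw [zMatrix]
  split_ifs with hl
  · have := h.mem (Γ.lev v i.1) hi.1 (hl ▸ hj.1)
    rw [hi.2] at this
    rwa [hl, hj.2, ← hl] at this
  · exact Submodule.zero_mem _

theorem zMatrix_mul_apply {x y : Γ.Edge} {θ : ℕ → Γ.Alg K} {b : ℕ}
    {β : Type*} (N : Matrix (Γ.zigI v ε b y) β (Γ.Alg K)) (i : Γ.zigI v ε b x) (j : β) :
    (zMatrix v ε b x y θ * N) i j = if hi : Γ.lev v i.1 ≤ Γ.lev v y then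
      θ (Γ.lev v i.1) * N ⟨Γ.anc v y (Γ.lev v i.1), mem_zigI.2 ⟨isAnc_anc hi, by
        rw [Γ.lev_anc v hi]
        exact (mem_zigI.1 i.2).2⟩⟩ j else 0 := by
  rw [Matrix.mul_apply]
  split_ifs with hi
  · rw [Finset.sum_eq_single ⟨Γ.anc v y (Γ.lev v i.1), mem_zigI.2 ⟨isAnc_anc hi, by
        rw [Γ.lev_anc v hi]
        exact (mem_zigI.1 i.2).2⟩⟩]
    · rw [zMatrix, if_pos (Γ.lev_anc v hi).symm]
    · intro k _ hk
      rw [zMatrix, if_neg, zero_mul]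
      intro h'
      exact hk (Subtype.ext ((mem_zigI.1 k.2).1.2.symm.trans (congrArg (Γ.anc v y) h'.symm)))
    · simp
  · refine Finset.sum_eq_zero fun k _ => ?_
    rw [zMatrix, if_neg, zero_mul]
    intro h'
    exact hi (h' ▸ (mem_zigI.1 k.2).1.1)

theorem mul_zMatrix_apply {x y : Γ.Edge} {θ : ℕ → Γ.Alg K} {b : ℕ}
    {β : Type*} (N : Matrix β (Γ.zigI v ε b x) (Γ.Alg K)) (j : Γ.zigI v ε b y) (i : β) :
    (N * zMatrix v ε b x y θ) i j = if hj : Γ.lev v j.1 ≤ Γ.lev v x then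
      N i ⟨Γ.anc v x (Γ.lev v j.1), mem_zigI.2 ⟨isAnc_anc hj, by
        rw [Γ.lev_anc v hj]
        exact (mem_zigI.1 j.2).2⟩⟩ * θ (Γ.lev v j.1) else 0 := by
  rw [Matrix.mul_apply]
  split_ifs with hj
  · rw [Finset.sum_eq_single ⟨Γ.anc v x (Γ.lev v j.1), mem_zigI.2 ⟨isAnc_anc hj, by
        rw [Γ.lev_anc v hj]
        exact (mem_zigI.1 j.2).2⟩⟩]
    · rw [zMatrix, if_pos (Γ.lev_anc v hj)]
      exact congrArg (fun k => _ * θ k) (Γ.lev_anc v hj)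
    · intro k _ hk
      rw [zMatrix, if_neg, mul_zero]
      intro h'
      exact hk (Subtype.ext ((mem_zigI.1 k.2).1.2.symm.trans (congrArg (Γ.anc v x) h')))
    · simp
  · refine Finset.sum_eq_zero fun k _ => ?_
    rw [zMatrix, if_neg, mul_zero]
    intro h'
    exact hj (h' ▸ (mem_zigI.1 k.2).1.1)

theorem ZMap.zMatrix_mul_zMatrix {x y z : Γ.Edge} {θ θ' : ℕ → Γ.Alg K}
    (h : Γ.ZMap K v ε 0 x y θ) (b : ℕ) :
    zMatrix v ε b x y θ * zMatrix v ε b y z θ' = zMatrix v ε b x z fun k => θ k * θ' k := by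
  ext i j
  rw [zMatrix_mul_apply, zMatrix]
  by_cases hi : Γ.lev v i.1 ≤ Γ.lev v y
  · rw [dif_pos hi, zMatrix]
    change θ _ * (if Γ.lev v (Γ.anc v y (Γ.lev v i.1)) = Γ.lev v j.1 then
      θ' (Γ.lev v (Γ.anc v y (Γ.lev v i.1))) else 0) = _
    rw [Γ.lev_anc v hi]
    split_ifs <;> simp
  · rw [dif_neg hi, h.zero (Γ.lev v i.1) (by omega)]
    simp

theorem ZMap.zMatrix_comm {x y : Γ.Edge} {θ : ℕ → Γ.Alg K} (h : Γ.ZMap K v ε 0 x y θ) :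
    zMatrix v ε 0 x y θ * Γ.zigMat K v ε y = Γ.zigMat K v ε x * zMatrix v ε 1 x y θ := by
  ext i j
  rw [zMatrix_mul_apply, mul_zMatrix_apply]
  have hi := mem_zigI.1 i.2
  have hj := mem_zigI.1 j.2
  have e : ∀ hk : Γ.lev v i.1 ≤ Γ.lev v y, Γ.zigEnt K v (Γ.anc v y (Γ.lev v i.1)) j.1 =
      if Γ.lev v i.1 + 1 = Γ.lev v j.1 ∨ Γ.lev v j.1 + 1 = Γ.lev v i.1 then
        Γ.conn K (Γ.anc v y (Γ.lev v i.1)) (Γ.anc v y (Γ.lev v j.1)) else 0 := by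
    intro hk
    rw [zigEnt, Γ.lev_anc v hk, hj.1.2]
  have e' : ∀ hk : Γ.lev v j.1 ≤ Γ.lev v x, Γ.zigEnt K v i.1 (Γ.anc v x (Γ.lev v j.1)) =
      if Γ.lev v i.1 + 1 = Γ.lev v j.1 ∨ Γ.lev v j.1 + 1 = Γ.lev v i.1 then
        Γ.conn K (Γ.anc v x (Γ.lev v i.1)) (Γ.anc v x (Γ.lev v j.1)) else 0 := by
    intro hk
    rw [zigEnt, Γ.lev_anc v hk, hi.1.2]
  by_cases hl : Γ.lev v i.1 + 1 = Γ.lev v j.1 ∨ Γ.lev v j.1 + 1 = Γ.lev v i.1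
  · simp only [if_pos hl] at e e'
    have hc := h.comm _ _ (Nat.zero_le _) (Nat.zero_le _) hi.2 hl hi.1.1 hj.1.1
    split_ifs with h1 h2 h2
    · change θ _ * Γ.zigEnt K v _ _ = Γ.zigEnt K v _ _ * θ _
      rw [e h1, e' h2, hc]
    · change θ _ * Γ.zigEnt K v _ _ = _
      rw [e h1, hc, h.zero (Γ.lev v j.1) (by omega), mul_zero]
    · change _ = Γ.zigEnt K v _ _ * θ _
      rw [e' h2, ← hc, h.zero (Γ.lev v i.1) (by omega), zero_mul]
    · rfl
  · simp only [if_neg hl] at e e'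
    split_ifs with h1 h2 h2
    · change θ _ * Γ.zigEnt K v _ _ = Γ.zigEnt K v _ _ * θ _
      rw [e h1, e' h2, mul_zero, zero_mul]
    · change θ _ * Γ.zigEnt K v _ _ = _
      rw [e h1, mul_zero]
    · change _ = Γ.zigEnt K v _ _ * θ _
      rw [e' h2, zero_mul]
    · rfl

/-- The component in degree `b` of the morphism of zigzag complexes defined by `θ`. -/
noncomputable abbrev zLin (v : V) (ε b : ℕ) (x y : Γ.Edge) (θ : ℕ → Γ.Alg K) :
    PiProj K (fun i : Γ.zigI v ε b x => i.1) →ₗ[Γ.Alg K]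
      PiProj K (fun i : Γ.zigI v ε b y => i.1) :=
  toLin (fun i : Γ.zigI v ε b x => i.1) (fun i : Γ.zigI v ε b y => i.1) (zMatrix v ε b x y θ)

variable (K v ε) in
/-- The differential of a zigzag complex. -/
noncomputable def zigMap (x : Γ.Edge) : PiProj K (fun i : Γ.zigI v ε 0 x => i.1) →ₗ[Γ.Alg K]
    PiProj K (fun i : Γ.zigI v ε 1 x => i.1) :=
  toLin (fun i : Γ.zigI v ε 0 x => i.1) (fun i : Γ.zigI v ε 1 x => i.1) (Γ.zigMat K v ε x)

theorem ZMap.zLin_comm {x y : Γ.Edge} {θ : ℕ → Γ.Alg K} (h : Γ.ZMap K v ε 0 x y θ) :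
    (zigMap K v ε y).comp (zLin v ε 0 x y θ) = (zLin v ε 1 x y θ).comp (zigMap K v ε x) := by
  classical
  rw [zigMap, zigMap]
  have h1 := toLin_comp (h.zMatrix_mem 0) (Γ.zigMat_mem K v ε y)
  have h2 := toLin_comp (Γ.zigMat_mem K v ε x) (h.zMatrix_mem 1)
  rw [h.zMatrix_comm, ← h2] at h1
  exact h1

/-- The morphism of zigzag complexes defined by `θ`. -/
noncomputable def zHom {x y : Γ.Edge} {θ : ℕ → Γ.Alg K} (h : Γ.ZMap K v ε 0 x y θ) :
    toHtpy (dbl (zigMap K v ε x)) ⟶ toHtpy (dbl (zigMap K v ε y)) :=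
  qmap (zLin v ε 0 x y θ) (zLin v ε 1 x y θ) h.zLin_comm

theorem zHom_comp {x y z : Γ.Edge} {θ θ' : ℕ → Γ.Alg K} (h : Γ.ZMap K v ε 0 x y θ)
    (h' : Γ.ZMap K v ε 0 y z θ') : zHom h ≫ zHom h' = zHom (h.mul h') := by
  classical
  rw [zHom, zHom, zHom, qmap_comp]
  refine qmap_congr _ ?_ ?_
  · have := toLin_comp (h.zMatrix_mem 0) (h'.zMatrix_mem 0)
    rw [h.zMatrix_mul_zMatrix] at this
    exact this
  · have := toLin_comp (h.zMatrix_mem 1) (h'.zMatrix_mem 1)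
    rw [h.zMatrix_mul_zMatrix] at this
    exact this

theorem zHom_congr {x y : Γ.Edge} {θ θ' : ℕ → Γ.Alg K} (h : Γ.ZMap K v ε 0 x y θ)
    (e : θ = θ') : zHom h = zHom (e ▸ h) := by
  subst e
  rfl

theorem zHom_zero {x y : Γ.Edge} (h : Γ.ZMap K v ε 0 x y 0) : zHom h = 0 := by
  classical
  have key : ∀ b, zLin v ε b x y (0 : ℕ → Γ.Alg K) = 0 := by
    intro b
    have : zMatrix v ε b x y (0 : ℕ → Γ.Alg K) = 0 := by
      ext i j
      simp [zMatrix]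
    rw [zLin, this]
    exact map_zero (matEquiv K _ _).symm
  rw [zHom, qmap_eq_zero_iff]
  exact ⟨0, by rw [key, LinearMap.zero_comp], by rw [key, LinearMap.comp_zero]⟩

variable [Finite V]

/-- A morphism that is the socle on the term of level zero, and zero on the other terms, is not
zero in the homotopy category. -/
theorem zHom_soc_ne_zero {x : Γ.Edge} {θ : ℕ → Γ.Alg K} (h : Γ.ZMap K v ε 0 x x θ)
    (hθ : θ = Pi.single 0 (Γ.soc K (Γ.anc v x 0))) : zHom h ≠ 0 := by
  classical
  intro h0
  rw [zHom, qmap_eq_zero_iff] at h0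
  obtain ⟨κ, h₀, h₁⟩ := h0
  let s₀ : Γ.zigI v ε 0 x → Γ.Edge := fun i => i.1
  let s₁ : Γ.zigI v ε 1 x → Γ.Edge := fun i => i.1
  let k : Matrix (Γ.zigI v ε 1 x) (Γ.zigI v ε 0 x) (Γ.Alg K) := toMat (s := s₁) (t := s₀) κ
  have hk : k ∈ MatHom K s₁ s₀ := toMat_mem (s := s₁) (t := s₀) κ
  have e₀ : zMatrix v ε 0 x x θ = Γ.zigMat K v ε x * k := by
    have h3 := congrArg (toMat (s := s₀) (t := s₀)) h₀
    rw [zigMap] at h3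
    erw [toMat_comp (s := s₀) (t := s₁) (r := s₀) _ κ] at h3
    rw [toMat_toLin (Γ.zigMat_mem K v ε x)] at h3
    have h4 := toMat_toLin (h.zMatrix_mem 0)
    convert h4.symm.trans h3
  have e₁ : zMatrix v ε 1 x x θ = k * Γ.zigMat K v ε x := by
    have h3 := congrArg (toMat (s := s₁) (t := s₁)) h₁
    rw [zigMap] at h3
    erw [toMat_comp (s := s₁) (t := s₀) (r := s₁) κ] at h3
    rw [toMat_toLin (Γ.zigMat_mem K v ε x)] at h3
    have h4 := toMat_toLin (h.zMatrix_mem 1)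
    convert h4.symm.trans h3
  have hne : ∀ (i : Γ.zigI v ε 0 x) (j : Γ.zigI v ε 1 x), i.1 ≠ j.1 := by
    intro i j hij
    have := (mem_zigI.1 i.2).2
    have := (mem_zigI.1 j.2).2
    rw [← hij] at this
    omega
  choose c hc using fun j i => exists_eq_smul_conn (hne i j).symm (hk j i)
  let A : Γ.zigI v ε 1 x → Γ.zigI v ε 0 x → K := fun j i =>
    if Γ.lev v i.1 + 1 = Γ.lev v j.1 ∨ Γ.lev v j.1 + 1 = Γ.lev v i.1 then c j i else 0
  have hs : ∀ b, ∀ i : Γ.zigI v ε b x, zMatrix v ε b x x θ i i =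
      (if Γ.lev v i.1 = 0 then (1 : K) else 0) • Γ.soc K i.1 := by
    intro b i
    rw [zMatrix, if_pos rfl, hθ]
    split_ifs with hl
    · rw [hl, Pi.single_eq_same, ← (mem_zigI.1 i.2).1.2, hl, one_smul]
    · rw [Pi.single_eq_of_ne hl, zero_smul]
  have hinj : ∀ (i : Γ.Edge) (a b : K), a • Γ.soc K i = b • Γ.soc K i → a = b := by
    intro i a b hab
    rw [← sub_eq_zero, ← sub_smul, smul_eq_zero] at hab
    exact sub_eq_zero.1 (hab.resolve_right (Γ.soc_ne_zero K i))
  have hA₀ : ∀ i, ∑ j, A j i = if Γ.lev v i.1 = 0 then (1 : K) else 0 := by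
    intro i
    refine hinj i.1 _ _ ?_
    rw [← hs, e₀, Matrix.mul_apply, Finset.sum_smul]
    refine Finset.sum_congr rfl fun j _ => ?_
    change _ = Γ.zigEnt K v i.1 j.1 * k j i
    rw [zigEnt]
    simp only [A]
    split_ifs with hl
    · obtain ⟨y, hyi, hyj⟩ := (mem_zigI.1 i.2).1.exists_mem (mem_zigI.1 j.2).1 hl
      rw [hc, mul_smul_comm, conn_mul_conn (hne i j) hyi hyj]
    · rw [zero_smul, zero_mul]
  have hA₁ : ∀ j, ∑ i, A j i = if Γ.lev v j.1 = 0 then (1 : K) else 0 := by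
    intro j
    refine hinj j.1 _ _ ?_
    rw [← hs, e₁, Matrix.mul_apply, Finset.sum_smul]
    refine Finset.sum_congr rfl fun i _ => ?_
    change _ = k j i * Γ.zigEnt K v i.1 j.1
    rw [zigEnt]
    simp only [A]
    split_ifs with hl
    · obtain ⟨y, hyi, hyj⟩ := (mem_zigI.1 i.2).1.exists_mem (mem_zigI.1 j.2).1 hl
      rw [hc, smul_mul_assoc, conn_mul_conn (hne i j).symm hyj hyi]
    · rw [zero_smul, mul_zero]
  have hcount : ∀ b, (∑ i : Γ.zigI v ε b x, if Γ.lev v i.1 = 0 then (1 : K) else 0) =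
      if ε % 2 = b then 1 else 0 := by
    intro b
    split_ifs with hb
    · have hl0 := Γ.lev_anc v (Nat.zero_le (Γ.lev v x))
      rw [Finset.sum_eq_single ⟨Γ.anc v x 0, mem_zigI.2 ⟨isAnc_anc (Nat.zero_le _), by
        rw [hl0, zero_add, hb]⟩⟩]
      · rw [if_pos hl0]
      · intro i _ hi
        rw [if_neg]
        intro hl
        exact hi (Subtype.ext ((mem_zigI.1 i.2).1.2.symm.trans (by rw [hl])))
      · simp
    · refine Finset.sum_eq_zero fun i _ => ?_
      rw [if_neg]
      intro hl
      have := (mem_zigI.1 i.2).2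
      rw [hl, zero_add] at this
      exact hb this
  have h5 := Finset.sum_comm (f := fun j i => A j i) (s := Finset.univ) (t := Finset.univ)
  simp only [hA₀, hA₁, hcount] at h5
  rcases Nat.mod_two_eq_zero_or_one ε with hε | hε <;> simp [hε] at h5

end ZMorphism

end BrauerTree


/-! ### A recognition theorem for Brauer star algebras -/

section Star

open scoped Fin.NatCast Fin.CommRing

variable (n : ℕ)

theorem starDart_bijective : Function.Bijective (Sum.elim
    (fun i : Fin n => (⟨(0, i.succ), by simp [(Fin.succ_ne_zero i).symm]⟩ :
      (SimpleGraph.starGraph (0 : Fin (n + 1))).Dart))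
    (fun i : Fin n => ⟨(i.succ, 0), by simp⟩)) := by
  constructor
  · rintro (i | i) (j | j) h <;>
      simp [SimpleGraph.Dart.ext_iff, Prod.ext_iff, (Fin.succ_ne_zero _).symm] at h <;> simp [h]
  · rintro ⟨⟨a, b⟩, h⟩
    rw [SimpleGraph.starGraph_adj] at h
    obtain ⟨h, rfl | rfl⟩ := h
    · obtain ⟨i, rfl⟩ := Fin.exists_succ_eq.2 h.symm
      exact ⟨Sum.inl i, rfl⟩
    · obtain ⟨i, rfl⟩ := Fin.exists_succ_eq.2 h
      exact ⟨Sum.inr i, rfl⟩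

/-- The darts of a star: those that start at the center, and those that end there. -/
noncomputable def starDart :
    Fin n ⊕ Fin n ≃ (SimpleGraph.starGraph (0 : Fin (n + 1))).Dart :=
  Equiv.ofBijective _ (starDart_bijective n)

theorem starDart_inl_fst (i : Fin n) : (starDart n (Sum.inl i)).fst = 0 := rfl

theorem starDart_inr_fst (i : Fin n) : (starDart n (Sum.inr i)).fst = i.succ := rfl

variable [NeZero n]

/-- The cyclic ordering of the edges of a star. -/
noncomputable def starNext : Equiv.Perm (SimpleGraph.starGraph (0 : Fin (n + 1))).Dart :=
  (starDart n).permCongr (Equiv.sumCongr (Equiv.addRight 1) (Equiv.refl _))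

theorem starNext_inl (i : Fin n) :
    starNext n (starDart n (Sum.inl i)) = starDart n (Sum.inl (i + 1)) := by
  simp [starNext, Equiv.permCongr_apply]

theorem starNext_inr (i : Fin n) :
    starNext n (starDart n (Sum.inr i)) = starDart n (Sum.inr i) := by
  simp [starNext, Equiv.permCongr_apply]

theorem starNext_iterate_inl (k : ℕ) (i : Fin n) :
    (starNext n)^[k] (starDart n (Sum.inl i)) = starDart n (Sum.inl (i + (k : Fin n))) := by
  induction k with
  | zero => simp
  | succ k ih => rw [Function.iterate_succ_apply', ih, starNext_inl, Nat.cast_succ, add_assoc]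

/-- The star with `n` edges. -/
noncomputable def starTree : BrauerTree (Fin (n + 1)) where
  graph := SimpleGraph.starGraph 0
  isTree := SimpleGraph.isTree_starGraph 0
  next := starNext n
  next_fst d := by
    obtain ⟨i | i, rfl⟩ := (starDart n).surjective d
    · rw [starNext_inl, starDart_inl_fst, starDart_inl_fst]
    · rw [starNext_inr]
  next_cyclic d d' h := by
    obtain ⟨i | i, rfl⟩ := (starDart n).surjective d <;>
      obtain ⟨j | j, rfl⟩ := (starDart n).surjective d'
    · refine ⟨((j - i).val : ℕ), ?_⟩
      rw [zpow_natCast, ← Equiv.Perm.iterate_eq_pow, starNext_iterate_inl]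
      simp
    · simp [starDart_inl_fst, starDart_inr_fst, (Fin.succ_ne_zero _).symm] at h
    · simp [starDart_inl_fst, starDart_inr_fst] at h
    · rw [starDart_inr_fst, starDart_inr_fst, Fin.succ_inj] at h
      rw [h]

/-- The arrows of the quiver of a star. -/
noncomputable def starArrow : Fin n ⊕ Fin n ≃ (starTree n).Arrow := starDart n

theorem starArrow_inl_symm (i : Fin n) :
    (starArrow n (Sum.inl i)).symm = starArrow n (Sum.inr i) := rfl

theorem starArrow_inr_symm (i : Fin n) :
    (starArrow n (Sum.inr i)).symm = starArrow n (Sum.inl i) := rfl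

theorem starTree_next_inr (i : Fin n) :
    (starTree n).next (starArrow n (Sum.inr i)) = starArrow n (Sum.inr i) := starNext_inr n i

theorem starTree_iterate_inl (k : ℕ) (i : Fin n) :
    (starTree n).next^[k] (starArrow n (Sum.inl i)) = starArrow n (Sum.inl (i + (k : Fin n))) :=
  starNext_iterate_inl n k i

theorem isStar_starTree : (starTree n).IsStar := by
  refine ⟨0, fun d => ?_⟩
  obtain ⟨i | i, rfl⟩ := (starArrow n).surjective d
  · exact Or.inl rfl
  · exact Or.inr rfl

theorem starTree_per_inl (i : Fin n) : (starTree n).per (starArrow n (Sum.inl i)) = n := by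
  have key : ∀ k, Function.IsPeriodicPt (starTree n).next k (starArrow n (Sum.inl i)) ↔ n ∣ k := by
    intro k
    rw [Function.IsPeriodicPt, Function.IsFixedPt, starTree_iterate_inl, ← Fin.natCast_eq_zero]
    simp
  apply Nat.dvd_antisymm
  · exact Function.isPeriodicPt_iff_minimalPeriod_dvd.1 ((key n).2 dvd_rfl)
  · exact (key _).1 (Function.isPeriodicPt_minimalPeriod _ _)

theorem starTree_per_inr (i : Fin n) : (starTree n).per (starArrow n (Sum.inr i)) = 1 :=
  Function.minimalPeriod_eq_one_iff_isFixedPt.2 (starTree_next_inr n i)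

theorem starTree_source_bijective :
    Function.Bijective fun i : Fin n => (starTree n).source (starArrow n (Sum.inl i)) := by
  constructor
  · intro i j h
    have := (starArrow n).injective ((starTree n).eq_of_source_eq h rfl)
    simpa using this
  · intro e
    obtain ⟨a, rfl⟩ := (starTree n).exists_source_eq e
    obtain ⟨i | i, rfl⟩ := (starArrow n).surjective a
    · exact ⟨i, rfl⟩
    · exact ⟨i, by rw [← starArrow_inl_symm]; exact ((starTree n).source_symm _).symm⟩

/-- The edges of a star. -/
noncomputable def starEdge : Fin n ≃ (starTree n).Edge :=
  Equiv.ofBijective _ (starTree_source_bijective n)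

theorem starTree_source_inl (i : Fin n) :
    (starTree n).source (starArrow n (Sum.inl i)) = starEdge n i := rfl

theorem starTree_source_inr (i : Fin n) :
    (starTree n).source (starArrow n (Sum.inr i)) = starEdge n i :=
  (starTree n).source_symm (starArrow n (Sum.inl i))

theorem starTree_target_inl (i : Fin n) :
    (starTree n).target (starArrow n (Sum.inl i)) = starEdge n (i + 1) := by
  exact (congrArg (starTree n).source (starNext_inl n i)).trans (starTree_source_inl n _)

theorem starTree_target_inr (i : Fin n) :
    (starTree n).target (starArrow n (Sum.inr i)) = starEdge n i := by
  exact (congrArg (starTree n).source (starTree_next_inr n i)).trans (starTree_source_inr n _)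

end Star

section Recognition

open scoped Fin.NatCast Fin.CommRing

variable {n : ℕ} [NeZero n] {K : Type u} [Field K] {R : Type w} [Ring R] [Algebra K R]

/-- The space `e R f`. -/
def peirceSpace (K : Type u) [Field K] {R : Type w} [Ring R] [Algebra K R] (e f : R) :
    Submodule K R where
  carrier := {z | e * z = z ∧ z * f = z}
  add_mem' := fun h h' => ⟨by rw [mul_add, h.1, h'.1], by rw [add_mul, h.2, h'.2]⟩
  zero_mem' := ⟨mul_zero _, zero_mul _⟩
  smul_mem' := fun c z h => ⟨by rw [mul_smul_comm, h.1], by rw [smul_mul_assoc, h.2]⟩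

/-- An algebra with the dimensions of a Brauer star algebra, with elements in the positions of the
arrows such that the product over a full cycle is nonzero, is a Brauer star algebra. -/
theorem nonempty_algEquiv_star (hn : 2 ≤ n) (e A : Fin n → R) (he : ∀ i, e i * e i = e i)
    (ho : ∀ i j, i ≠ j → e i * e j = 0) (h1 : ∑ i, e i = 1) (hA : ∀ i, e i * A i = A i)
    (hA' : ∀ i, A i * e (i + 1) = A i)
    (hdim : ∀ i j, Module.finrank K (peirceSpace K (e i) (e j)) = if i = j then 2 else 1)
    (hB : ∀ i : Fin n, ((List.range n).map fun k : ℕ => A (i + (k : Fin n))).prod ≠ 0)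
    (hBB : ∀ i : Fin n, ((List.range n).map fun k : ℕ => A (i + (k : Fin n))).prod *
      ((List.range n).map fun k : ℕ => A (i + (k : Fin n))).prod = 0) :
    Nonempty (R ≃ₐ[K] (starTree n).Alg K) := by
  classical
  let B : Fin n → R := fun i => ((List.range n).map fun k : ℕ => A (i + (k : Fin n))).prod
  have hn1 : n = (n - 1) + 1 := by omega
  have hB1 : ∀ i, B i = A i * ((List.range (n - 1)).map fun k => A (i + ((k + 1 : ℕ) : Fin n))).prod := by
    intro i
    simp only [B]
    conv_lhs => rw [congrArg List.range hn1, List.range_succ_eq_map, List.map_cons, List.prod_cons, List.map_map]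
    simp [Function.comp_def]
  have hB2 : ∀ i, B i = ((List.range (n - 1)).map fun k : ℕ => A (i + (k : Fin n))).prod * A (i - 1) := by
    intro i
    simp only [B]
    conv_lhs => rw [congrArg List.range hn1, List.range_succ, List.map_append, List.prod_append]
    have : ((n - 1 : ℕ) : Fin n) = -1 := by
      rw [Nat.cast_sub (by omega)]
      simp
    simp [this, sub_eq_add_neg]
  have heB : ∀ i, e i * B i = B i := fun i => by rw [hB1, ← mul_assoc, hA]
  have hBe : ∀ i, B i * e i = B i := fun i => by
    have := hA' (i - 1)
    rw [sub_add_cancel] at this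
    rw [hB2, mul_assoc, this]
  have hA0 : ∀ i, A i ≠ 0 := fun i h => hB i (by
    change B i = 0
    rw [hB1, h, zero_mul])
  have hne : ∀ i : Fin n, i ≠ i + 1 := by
    intro i h
    have : (1 : Fin n) = 0 := by simpa using h.symm
    have h2 : ((1 : ℕ) : Fin n) = 0 := by simpa using this
    rw [Fin.natCast_eq_zero] at h2
    have := Nat.le_of_dvd one_pos h2
    omega
  have hmem : ∀ i, ∀ z ∈ peirceSpace K (e i) (e (i + 1)), ∃ c : K, c • A i = z := by
    intro i z hz
    obtain ⟨c, hc⟩ := (finrank_eq_one_iff_of_nonzero' (K := K)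
      (⟨A i, hA i, hA' i⟩ : peirceSpace K (e i) (e (i + 1)))
      (fun h => hA0 i (congrArg Subtype.val h))).1 (by rw [hdim, if_neg (hne i)]) ⟨z, hz⟩
    exact ⟨c, congrArg Subtype.val hc⟩
  have hAB : ∀ i j, A i * B j = 0 := by
    intro i j
    by_cases hj : j = i + 1
    · subst hj
      obtain ⟨c, hc⟩ := hmem i (A i * B (i + 1)) ⟨by rw [← mul_assoc, hA], by
        rw [mul_assoc, hBe]⟩
      have h2 : A i * B (i + 1) * B (i + 1) = 0 := by rw [mul_assoc, hBB, mul_zero]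
      rw [← hc, smul_mul_assoc, ← hc, smul_smul, smul_eq_zero] at h2
      rw [← hc, mul_self_eq_zero.1 (h2.resolve_right (hA0 i)), zero_smul]
    · rw [← heB j, ← hA' i, mul_assoc, ← mul_assoc (e (i + 1)), ho _ _ (Ne.symm hj), zero_mul,
        mul_zero]
  have hBA : ∀ i j, B i * A j = 0 := by
    intro i j
    by_cases hj : i = j
    · subst hj
      obtain ⟨c, hc⟩ := hmem i (B i * A i) ⟨by rw [← mul_assoc, heB], by
        rw [mul_assoc, hA']⟩
      have h2 : B i * (B i * A i) = 0 := by rw [← mul_assoc, hBB, zero_mul]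
      rw [← hc, mul_smul_comm, ← hc, smul_smul, smul_eq_zero] at h2
      rw [← hc, mul_self_eq_zero.1 (h2.resolve_right (hA0 i)), zero_smul]
    · rw [← hA j, ← hBe i, mul_assoc, ← mul_assoc (e i), ho _ _ hj, zero_mul, mul_zero]
  let x : (starTree n).Arrow → R := fun a => Sum.elim A B ((starArrow n).symm a)
  have hxl : ∀ i, x (starArrow n (Sum.inl i)) = A i := fun i => by simp [x]
  have hxr : ∀ i, x (starArrow n (Sum.inr i)) = B i := fun i => by simp [x]
  let e' : (starTree n).Edge → R := fun i => e ((starEdge n).symm i)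
  have hprod : ∀ i, ((List.range ((starTree n).per (starArrow n (Sum.inl i)))).map fun k =>
      x ((starTree n).next^[k] (starArrow n (Sum.inl i)))).prod = B i := by
    intro i
    rw [starTree_per_inl]
    simp only [B]
    congr 2
    funext k
    exact (congrArg x (starTree_iterate_inl n k i)).trans (hxl _)
  have hprod' : ∀ i, ((List.range ((starTree n).per (starArrow n (Sum.inr i)))).map fun k =>
      x ((starTree n).next^[k] (starArrow n (Sum.inr i)))).prod = B i := by
    intro i
    rw [starTree_per_inr]
    rw [List.range_one, List.map_singleton, List.prod_singleton]
    exact hxr i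
  obtain ⟨φ, hφe, hφx⟩ := (starTree n).exists_algHom K e' x (fun i => he _)
    (fun i j hij => ho _ _ fun h => hij ((starEdge n).symm.injective h))
    (by rw [finsum_eq_sum_of_fintype, ← h1]; exact (starEdge n).symm.sum_comp e)
    (fun a => by
      obtain ⟨i | i, rfl⟩ := (starArrow n).surjective a
      · rw [hxl, starTree_source_inl]
        simpa [e'] using hA i
      · rw [hxr, starTree_source_inr]
        simpa [e'] using heB i)
    (fun a => by
      obtain ⟨i | i, rfl⟩ := (starArrow n).surjective a
      · rw [hxl, starTree_target_inl]
        simpa [e'] using hA' i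
      · rw [hxr, starTree_target_inr]
        simpa [e'] using hBe i)
    (fun a b hab => by
      obtain ⟨i | i, rfl⟩ := (starArrow n).surjective a <;>
        obtain ⟨j | j, rfl⟩ := (starArrow n).surjective b
      · exact absurd rfl hab
      · rw [hxl, hxr, hAB]
      · rw [hxr, hxl, hBA]
      · rw [hxr, hxr]
        have hij : i ≠ j := fun h => hab (by rw [h])
        rw [← hBe i, ← heB j, mul_assoc, ← mul_assoc (e i), ho _ _ hij, zero_mul, mul_zero])
    (fun a => by
      obtain ⟨i | i, rfl⟩ := (starArrow n).surjective a
      · rw [starArrow_inl_symm, hprod, hprod']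
      · rw [starArrow_inr_symm, hprod, hprod'])
  have hsoc : ∀ i, φ ((starTree n).soc K i) ≠ 0 := by
    intro i
    obtain ⟨j, rfl⟩ := (starEdge n).surjective i
    rw [← starTree_source_inl, ← BrauerTree.path_per]
    have hpath : ∀ k a, φ ((starTree n).path K k a) = e' ((starTree n).source a) *
        ((List.range k).map fun l => x ((starTree n).next^[l] a)).prod := by
      intro k a
      induction k with
      | zero => simp [hφe]
      | succ k ih =>
        rw [BrauerTree.path_succ', map_mul, ih, hφx, List.range_succ, List.map_append,
          List.prod_append]
        simp [mul_assoc]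
    rw [hpath, hprod, starTree_source_inl]
    have : e' (starEdge n j) = e j := by simp [e']
    rw [this, heB]
    exact hB j
  have hinj : Function.Injective φ := by
    rw [injective_iff_map_eq_zero]
    intro z hz
    by_contra hz0
    obtain ⟨i, hi⟩ := BrauerTree.exists_idem_smul_ne_zero (Γ := starTree n) (K := K) hz0
    rw [smul_eq_mul] at hi
    obtain ⟨j, hj⟩ : ∃ j, (starTree n).idem K i * z * (starTree n).idem K j ≠ 0 := by
      by_contra! hj
      apply hi
      rw [← mul_one ((starTree n).idem K i * z), ← (starTree n).sum_idem K, Finset.mul_sum]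
      exact Finset.sum_eq_zero fun j _ => hj j
    set y := (starTree n).idem K i * z * (starTree n).idem K j with hy
    have hφy : φ y = 0 := by rw [hy, map_mul, map_mul, hz, mul_zero, zero_mul]
    have hyc : y ∈ (starTree n).corner K i j := ⟨by
      rw [hy, ← mul_assoc, ← mul_assoc, (starTree n).idem_mul_self], by rw [hy, mul_assoc, (starTree n).idem_mul_self]⟩
    by_cases hij : i = j
    · subst hij
      obtain ⟨c, d, hcd⟩ := (starTree n).exists_eq_of_mem_corner_self K hyc
      by_cases hc : c = 0
      · rw [hc, zero_smul, zero_add] at hcd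
        rw [hcd, map_smul, smul_eq_zero] at hφy
        rcases hφy with hd | hd
        · rw [hd, zero_smul] at hcd
          exact hj hcd
        · exact hsoc i hd
      · have h2 : φ (y * (starTree n).soc K i) = 0 := by rw [map_mul, hφy, zero_mul]
        rw [hcd, add_mul, smul_mul_assoc, smul_mul_assoc, (starTree n).idem_mul_soc,
          BrauerTree.soc_mul_soc, smul_zero, add_zero, map_smul, smul_eq_zero] at h2
        exact h2.elim hc (hsoc i)
    · obtain ⟨c, hc⟩ := BrauerTree.exists_eq_smul_conn hij hyc
      have hc0 : c ≠ 0 := by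
        rintro rfl
        rw [zero_smul] at hc
        exact hj hc
      have hmem : ∀ i : (starTree n).Edge, (0 : Fin (n + 1)) ∈ i.1 := by
        intro i
        obtain ⟨k, rfl⟩ := (starEdge n).surjective i
        rw [← starTree_source_inl]
        exact (starTree n).fst_mem_source _
      have h2 : φ (y * (starTree n).conn K j i) = 0 := by rw [map_mul, hφy, zero_mul]
      rw [hc, smul_mul_assoc, BrauerTree.conn_mul_conn hij (hmem i) (hmem j), map_smul,
        smul_eq_zero] at h2
      exact h2.elim hc0 (hsoc i)
  have hsurj : Function.Surjective φ := by
    have hcor : ∀ i j, ∀ r ∈ peirceSpace K (e i) (e j), ∃ z, φ z = r := by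
      intro i j r hr
      let ψ : (starTree n).corner K (starEdge n i) (starEdge n j) →ₗ[K] peirceSpace K (e i) (e j) :=
        (φ.toLinearMap.domRestrict _).codRestrict _ (by
          rintro ⟨z, hz⟩
          have h2 := congrArg φ hz.1
          have h3 := congrArg φ hz.2
          rw [map_mul, hφe] at h2 h3
          exact ⟨by simpa [e'] using h2, by simpa [e'] using h3⟩)
      have hψ : Function.Injective ψ := by
        intro y z hyz
        exact Subtype.ext (hinj (congrArg Subtype.val hyz))
      have hd1 : Module.finrank K ((starTree n).corner K (starEdge n i) (starEdge n j)) =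
          if i = j then 2 else 1 := by
        have := (isStar_starTree n).finrank_corner K (starEdge n i) (starEdge n j)
        by_cases hij : i = j
        · subst hij
          rw [if_pos rfl] at this ⊢
          exact_mod_cast this
        · rw [if_neg fun h => hij ((starEdge n).injective h)] at this
          rw [if_neg hij]
          exact_mod_cast this
      have hpos : ∀ i j : Fin n, 0 < if i = j then 2 else 1 := by
        intro i j
        split_ifs <;> omega
      have := Module.finite_of_finrank_pos (hd1 ▸ hpos i j)
      have := Module.finite_of_finrank_pos (hdim i j ▸ hpos i j)
      obtain ⟨z, hz⟩ := (LinearMap.injective_iff_surjective_of_finrank_eq_finrank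
        (hd1.trans (hdim i j).symm)).1 hψ ⟨r, hr⟩
      exact ⟨z.1, congrArg Subtype.val hz⟩
    intro r
    have hr : r = ∑ i, ∑ j, e i * r * e j := by
      simp only [← Finset.mul_sum, h1, mul_one, ← Finset.sum_mul, one_mul]
    rw [hr]
    change _ ∈ φ.range
    refine Subalgebra.sum_mem _ fun i _ => Subalgebra.sum_mem _ fun j _ => ?_
    obtain ⟨z, hz⟩ := hcor i j (e i * r * e j) ⟨by rw [← mul_assoc, ← mul_assoc, he], by
      rw [mul_assoc, he]⟩
    exact ⟨z, hz⟩
  exact ⟨(AlgEquiv.ofBijective φ ⟨hinj, hsurj⟩).symm⟩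

end Recognition


/-! ### The endomorphism algebra of the tilting complex attached to a vertex -/

namespace BrauerTree

section Sorting

variable {V : Type v} (Γ : BrauerTree V) (K : Type u) [Field K] (v : V) (ε : ℕ)

/-- A morphism from the zigzag complex of `x` to that of `y` whose component of level zero is a path
of length `d` around the root. -/
structure ZPath (x y : Γ.Edge) (d : ℕ) (θ : ℕ → Γ.Alg K) : Prop where
  zMap : Γ.ZMap K v ε 0 x y θ
  lead : θ 0 = Γ.path K d (Γ.down v (Γ.anc v x 0))
  next : Γ.next^[d] (Γ.down v (Γ.anc v x 0)) = Γ.down v (Γ.anc v y 0)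

variable {Γ K v ε}

theorem ZPath.mul {x y z : Γ.Edge} {c d : ℕ} {θ θ' : ℕ → Γ.Alg K} (h : Γ.ZPath K v ε x y c θ)
    (h' : Γ.ZPath K v ε y z d θ') : Γ.ZPath K v ε x z (c + d) fun k => θ k * θ' k where
  zMap := h.zMap.mul h'.zMap
  lead := by rw [h.lead, h'.lead, ← h.next, path_add]
  next := by rw [add_comm, Function.iterate_add_apply, h.next, h'.next]

/-- The product of the morphisms in a sequence. -/
noncomputable def zProd (θ : ℕ → ℕ → Γ.Alg K) (i : ℕ) : ℕ → ℕ → Γ.Alg K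
  | 0 => θ i
  | k + 1 => fun m => θ (i + k + 1) m * zProd θ i k m

theorem exists_zPath [Finite V] {x y : Γ.Edge} {d : ℕ} (hd : 0 < d)
    (h : Γ.next^[d] (Γ.down v (Γ.anc v x 0)) = Γ.down v (Γ.anc v y 0)) :
    Γ.ZPath K v ε x y d (Pi.single 0 (Γ.path K d (Γ.down v (Γ.anc v x 0)))) where
  zMap := ZMap.single_path (Nat.zero_le _) (Nat.zero_le _) hd h
  lead := Pi.single_eq_same _ _
  next := h

theorem down_anc_zero_fst (x : Γ.Edge) : (Γ.down v (Γ.anc v x 0)).fst = v :=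
  (Γ.top_eq_root_iff v).2 (Γ.lev_anc v (Nat.zero_le _))

/-- The zigzag complexes can be arranged in a cycle, with a morphism from each to the preceding one,
such that the composition of the morphisms over a full turn is the socle at level zero. -/
theorem exists_zMap_cycle [Finite V] [Fintype Γ.Edge] {n : ℕ} (hn : Fintype.card Γ.Edge = n)
    (hn0 : 0 < n) : ∃ (x : ℕ → Γ.Edge) (θ : ℕ → ℕ → Γ.Alg K),
      (∀ i, Γ.ZMap K v ε 0 (x (i + 1)) (x i) (θ i)) ∧ (∀ i, x (i + n) = x i) ∧
      (∀ i, θ (i + n) = θ i) ∧ (∀ i j, i < n → j < n → x i = x j → i = j) ∧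
      ∀ i, zProd θ i (n - 1) = Pi.single 0 (Γ.soc K (Γ.anc v (x i) 0)) := by
  classical
  obtain ⟨x₀⟩ : Nonempty Γ.Edge := Fintype.card_pos_iff.1 (hn ▸ hn0)
  set a := Γ.down v (Γ.anc v x₀ 0) with ha
  have hav : a.fst = v := down_anc_zero_fst x₀
  choose p hp hpa using fun x : Γ.Edge => Γ.exists_iterate_eq (a := a)
    (b := Γ.down v (Γ.anc v x 0)) (hav.trans (down_anc_zero_fst x).symm)
  have hper : ∀ x : Γ.Edge, Γ.per (Γ.down v (Γ.anc v x 0)) = Γ.per a := fun x => by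
    rw [← hpa x, per_iterate]
  have hpath : ∀ {x y : Γ.Edge}, p x ≤ p y →
      Γ.next^[p y - p x] (Γ.down v (Γ.anc v x 0)) = Γ.down v (Γ.anc v y 0) := by
    intro x y h
    rw [← hpa x, ← Function.iterate_add_apply, Nat.sub_add_cancel h, hpa]
  let r : Γ.Edge → Γ.Edge → Prop := fun y x =>
    p x ≤ p y ∧ ∃ θ, Γ.ZPath K v ε x y (p y - p x) θ
  have hsame : ∀ {x y : Γ.Edge}, p x = p y → Γ.anc v x 0 = Γ.anc v y 0 := by
    intro x y h
    have h2 : Γ.down v (Γ.anc v x 0) = Γ.down v (Γ.anc v y 0) := by rw [← hpa, ← hpa, h]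
    rw [← Γ.source_down v (Γ.anc v x 0), h2, source_down]
  have htot : ∀ x y, r x y ∨ r y x := by
    intro x y
    rcases Nat.lt_trichotomy (p x) (p y) with h | h | h
    · exact Or.inr ⟨h.le, _, exists_zPath (by omega) (hpath h.le)⟩
    · rcases exists_zMap_or (K := K) (ε := ε) 0 (Nat.zero_le _) (Nat.zero_le _) (hsame h) with
        ⟨θ, hθ, h0⟩ | ⟨θ, hθ, h0⟩
      · exact Or.inr ⟨h.le, θ, hθ, by rw [h0, h, Nat.sub_self, path_zero, source_down],
          hpath h.le⟩
      · exact Or.inl ⟨h.ge, θ, hθ, by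
          rw [h0, h, Nat.sub_self, path_zero, source_down, hsame h], hpath h.ge⟩
    · exact Or.inl ⟨h.le, _, exists_zPath (by omega) (hpath h.le)⟩
  have htrans : ∀ x y z, r x y → r y z → r x z := by
    rintro x y z ⟨h1, θ, hθ⟩ ⟨h2, θ', hθ'⟩
    have h3 := hθ'.mul hθ
    rw [show p y - p z + (p x - p y) = p x - p z by omega] at h3
    exact ⟨h2.trans h1, _, h3⟩
  have : Std.Total r := ⟨htot⟩
  have : IsTrans Γ.Edge r := ⟨htrans⟩
  let L := List.insertionSort r Finset.univ.toList
  have hL : L.Pairwise r := List.pairwise_insertionSort r _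
  have hperm : L.Perm Finset.univ.toList := List.perm_insertionSort r _
  have hlen : L.length = n := by rw [hperm.length_eq, Finset.length_toList, ← hn]; rfl
  have hnd : L.Nodup := hperm.nodup_iff.2 (Finset.nodup_toList _)
  have hlt : ∀ i, i % n < L.length := fun i => (Nat.mod_lt i hn0).trans_eq hlen.symm
  let x : ℕ → Γ.Edge := fun i => L[i % n]'(hlt i)
  let D : ℕ → ℤ := fun i => p (x i) - Γ.per a * (i / n : ℕ)
  have hxn : ∀ i, x (i + n) = x i := fun i => by simp [x]
  have hD : ∀ i, D (i + n) = D i - Γ.per a := fun i => by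
    simp only [D, hxn, Nat.add_div_right i hn0, Nat.cast_succ]
    ring
  have hstep : ∀ i, ∃ (θ : ℕ → Γ.Alg K) (d : ℕ), Γ.ZPath K v ε (x (i + 1)) (x i) d θ ∧
      (d : ℤ) = D i - D (i + 1) ∧ (n ∣ i + 1 → ∀ m, m ≠ 0 → θ m = 0) := by
    intro i
    by_cases hi : n ∣ i + 1
    · have h1 := hp (x (i + 1))
      refine ⟨_, Γ.per a - p (x (i + 1)) + p (x i), exists_zPath (by omega) ?_, ?_, ?_⟩
      · rw [← hpa (x (i + 1)), ← Function.iterate_add_apply,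
          show Γ.per a - p (x (i + 1)) + p (x i) + p (x (i + 1)) = p (x i) + Γ.per a by omega,
          Function.iterate_add_apply, iterate_per, hpa]
      · have h2 : (i + 1) / n = i / n + 1 := Nat.succ_div_of_dvd hi
        simp only [D, h2, Nat.cast_succ, Nat.cast_add, Nat.cast_sub h1.le]
        ring
      · intro _ m hm
        exact Pi.single_eq_of_ne hm _
    · have h2 : (i + 1) / n = i / n := Nat.succ_div_of_not_dvd hi
      have h3 : i % n + 1 < n := by
        have := Nat.mod_lt i hn0
        by_contra hc
        apply hi
        have h4 : i % n + 1 = n := by omega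
        rw [← Nat.div_add_mod i n, add_assoc, h4]
        exact Dvd.dvd.add (Dvd.intro _ rfl) dvd_rfl
      have h4 : (i + 1) % n = i % n + 1 := by
        rw [Nat.add_mod, Nat.mod_eq_of_lt (show 1 < n by omega), Nat.mod_eq_of_lt h3]
      obtain ⟨h5, θ, hθ⟩ : r (x i) (x (i + 1)) := by
        refine List.pairwise_iff_getElem.1 hL (i % n) ((i + 1) % n) (hlt i) (hlt (i + 1)) ?_
        omega
      refine ⟨θ, _, hθ, ?_, fun h => absurd h hi⟩
      simp only [D, h2, Nat.cast_sub h5]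
      ring
  choose θ₀ d₀ hθ₀ hd₀ hw₀ using hstep
  have hmod : ∀ i, x (i % n) = x i := fun i => by simp [x]
  have hmod' : ∀ i, x (i % n + 1) = x (i + 1) := fun i => by simp [x]
  let θ : ℕ → ℕ → Γ.Alg K := fun i => θ₀ (i % n)
  have hθ : ∀ i, Γ.ZPath K v ε (x (i + 1)) (x i) (d₀ (i % n)) (θ i) := fun i => by
    have := hθ₀ (i % n)
    rwa [hmod, hmod'] at this
  have hd : ∀ i, (d₀ (i % n) : ℤ) = D i - D (i + 1) := fun i => by
    have key : ∀ k j, D (j + n * k) = D j - Γ.per a * k := by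
      intro k j
      induction k with
      | zero => simp
      | succ k ih =>
        rw [Nat.mul_succ, ← add_assoc, hD, ih]
        push_cast
        ring
    have h1 := key (i / n) (i % n)
    have h2 := key (i / n) (i % n + 1)
    rw [Nat.mod_add_div] at h1
    rw [add_right_comm, Nat.mod_add_div] at h2
    rw [hd₀, h1, h2]
    ring
  have hw : ∀ i, n ∣ i + 1 → ∀ m, m ≠ 0 → θ i m = 0 := fun i hi m hm =>
    hw₀ (i % n) ((Nat.dvd_add_iff_right (Dvd.intro (i / n) rfl)).2 (by
      rw [← add_assoc, Nat.div_add_mod]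
      exact hi)) m hm
  have hprod : ∀ i k, ∃ d : ℕ, Γ.ZPath K v ε (x (i + k + 1)) (x i) d (zProd θ i k) ∧
      (d : ℤ) = D i - D (i + k + 1) ∧
      ((∃ j ≤ k, n ∣ i + j + 1) → ∀ m, m ≠ 0 → zProd θ i k m = 0) := by
    intro i k
    induction k with
    | zero =>
      refine ⟨_, hθ i, hd i, ?_⟩
      rintro ⟨j, hj, hj'⟩
      obtain rfl : j = 0 := by omega
      exact hw i hj'
    | succ k ih =>
      obtain ⟨d, h1, h2, h3⟩ := ih
      refine ⟨_, (hθ (i + k + 1)).mul h1, ?_, ?_⟩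
      · rw [Nat.cast_add, hd, h2]
        have : i + (k + 1) + 1 = i + k + 1 + 1 := by omega
        rw [this]
        ring
      · rintro ⟨j, hj, hj'⟩ m hm
        change θ (i + k + 1) m * zProd θ i k m = 0
        rcases Nat.lt_or_ge k j with hkj | hkj
        · obtain rfl : j = k + 1 := by omega
          rw [hw (i + k + 1) hj' m hm, zero_mul]
        · rw [h3 ⟨j, hkj, hj'⟩ m hm, mul_zero]
  refine ⟨x, θ, fun i => (hθ i).zMap, hxn, fun i => by simp [θ], ?_, fun i => ?_⟩
  · intro i j hi hj hij
    have := hnd.getElem_inj_iff.1 hij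
    rwa [Nat.mod_eq_of_lt hi, Nat.mod_eq_of_lt hj] at this
  · obtain ⟨d, h1, h2, h3⟩ := hprod i (n - 1)
    have hin : i + (n - 1) + 1 = i + n := by omega
    rw [hin, hD] at h2
    rw [hin, hxn] at h1
    have hdper : d = Γ.per a := by
      have : (d : ℤ) = Γ.per a := by rw [h2]; ring
      exact_mod_cast this
    have hex : ∃ j ≤ n - 1, n ∣ i + j + 1 := by
      refine ⟨n - 1 - i % n, by omega, ?_⟩
      have := Nat.mod_lt i hn0
      have h4 : i + (n - 1 - i % n) + 1 = n * (i / n) + n := by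
        have := Nat.div_add_mod i n
        omega
      rw [h4]
      exact Dvd.dvd.add (Dvd.intro _ rfl) dvd_rfl
    funext m
    by_cases hm : m = 0
    · subst hm
      rw [Pi.single_eq_same, h1.lead, hdper, ← hper (x i), path_per, source_down]
    · rw [Pi.single_eq_of_ne hm, h3 hex m hm]

end Sorting

end BrauerTree

theorem finrank_peirceSpace {K : Type*} [Field K] {C : Type*} [Category* C] [Preadditive C]
    [Linear K C] {T X Y : C} {i : X ⟶ T} {p : T ⟶ X} {j : Y ⟶ T} {q : T ⟶ Y} (h : i ≫ p = 𝟙 X)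
    (h' : j ≫ q = 𝟙 Y) : Module.finrank K (peirceSpace K (R := End T) (q ≫ j) (p ≫ i)) =
      Module.finrank K (X ⟶ Y) := by
  let φ : (X ⟶ Y) →ₗ[K] (T ⟶ T) := (Linear.rightComp K T j).comp (Linear.leftComp K Y p)
  have hφ : ∀ θ, φ θ = (p ≫ θ) ≫ j := fun _ => rfl
  let ψ : (X ⟶ Y) ≃ₗ[K] peirceSpace K (R := End T) (q ≫ j) (p ≫ i) :=
    { φ.codRestrict (peirceSpace K (R := End T) (q ≫ j) (p ≫ i)) (fun θ => by
        rw [hφ]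
        constructor
        · change ((p ≫ θ) ≫ j) ≫ q ≫ j = _
          rw [Category.assoc, ← Category.assoc j, h', Category.id_comp]
        · change (p ≫ i) ≫ (p ≫ θ) ≫ j = _
          simp only [Category.assoc]
          rw [← Category.assoc i, h, Category.id_comp]) with
      invFun := fun z => i ≫ (z.1 : T ⟶ T) ≫ q
      left_inv := fun θ => by
        change i ≫ ((p ≫ θ) ≫ j) ≫ q = θ
        simp only [Category.assoc, h', Category.comp_id]
        rw [← Category.assoc, h, Category.id_comp]
      right_inv := fun z => by
        apply Subtype.ext
        change (p ≫ i ≫ (z.1 : T ⟶ T) ≫ q) ≫ j = z.1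
        have h1 : (z.1 : T ⟶ T) ≫ q ≫ j = z.1 := z.2.1
        have h2 : (p ≫ i) ≫ (z.1 : T ⟶ T) = z.1 := z.2.2
        simp only [Category.assoc] at h2 ⊢
        rw [h1, h2] }
  exact ψ.finrank_eq.symm

namespace BrauerTree

section EndStar

set_option linter.unusedSectionVars false

variable {V : Type v} {Γ : BrauerTree V} {K : Type u} [Field K] {v : V} {ε : ℕ} [Fintype V]
  [Fintype Γ.Edge] [DecidableEq Γ.Edge]

variable (K v ε) in
/-- The zigzag complexes are direct summands of the tilting complex. -/
noncomputable def zigRetract (x : Γ.Edge) : StrictRetract (zigMap K v ε x) (Γ.tiltMap K v ε) :=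
  piRetract (fun x => zigMap K v ε x) x

theorem zigRetract_incl_proj_of_ne {x y : Γ.Edge} (h : x ≠ y) :
    (zigRetract K v ε x).incl ≫ (zigRetract K v ε y).proj = 0 :=
  piRetract_incl_proj_of_ne (f := fun x => zigMap K v ε x) h

theorem sum_zigRetract : ∑ x, (zigRetract K v ε x).proj ≫ (zigRetract K v ε x).incl =
    𝟙 (toHtpy (dbl (Γ.tiltMap K v ε))) :=
  sum_piRetract (f := fun x => zigMap K v ε x)

theorem finrank_zigMap_hom (x y : Γ.Edge) :
    Module.finrank K (toHtpy (dbl (zigMap K v ε x)) ⟶ toHtpy (dbl (zigMap K v ε y))) =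
      if x = y then 2 else 1 :=
  Γ.finrank_zig_hom K v ε x y

/-- The endomorphism of the tilting complex given by a morphism between two summands. -/
noncomputable def zEnd {x y : Γ.Edge} {θ : ℕ → Γ.Alg K} (h : Γ.ZMap K v ε 0 x y θ) :
    End (toHtpy (dbl (Γ.tiltMap K v ε))) :=
  (zigRetract K v ε x).proj ≫ zHom h ≫ (zigRetract K v ε y).incl

theorem zEnd_mul {x y z : Γ.Edge} {θ θ' : ℕ → Γ.Alg K} (h : Γ.ZMap K v ε 0 x y θ)
    (h' : Γ.ZMap K v ε 0 y z θ') : zEnd h' * zEnd h = zEnd (h.mul h') := by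
  rw [zEnd, zEnd, zEnd, ← zHom_comp]
  change ((zigRetract K v ε x).proj ≫ zHom h ≫ (zigRetract K v ε y).incl) ≫
    (zigRetract K v ε y).proj ≫ zHom h' ≫ (zigRetract K v ε z).incl = _
  simp only [Category.assoc]
  rw [← Category.assoc (zigRetract K v ε y).incl, StrictRetract.incl_proj, Category.id_comp]

theorem zEnd_congr {x x' y y' : Γ.Edge} {θ θ' : ℕ → Γ.Alg K} (h : Γ.ZMap K v ε 0 x y θ)
    (h' : Γ.ZMap K v ε 0 x' y' θ') (hx : x = x') (hy : y = y') (hθ : θ = θ') :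
    zEnd h = zEnd h' := by
  subst hx hy hθ
  rfl

theorem zHom_eq_of_zEnd {x y : Γ.Edge} {θ : ℕ → Γ.Alg K} (h : Γ.ZMap K v ε 0 x y θ) :
    zHom h = (zigRetract K v ε x).incl ≫ zEnd h ≫ (zigRetract K v ε y).proj := by
  rw [zEnd]
  simp only [Category.assoc, StrictRetract.incl_proj, Category.comp_id]
  rw [← Category.assoc, StrictRetract.incl_proj, Category.id_comp]

open scoped Fin.NatCast Fin.CommRing in
/-- The endomorphism algebra of the tilting complex attached to a vertex is a Brauer star
algebra. -/
theorem endIsStar_tilt {n : ℕ} (hn : 2 ≤ n) (hcard : Fintype.card Γ.Edge = n) (v : V) (ε : ℕ) :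
    EndIsStar n (dbl (Γ.tiltMap K v ε)) := by
  have : NeZero n := ⟨by omega⟩
  obtain ⟨x, θ, hz, hx, hθ, hinj, hprod⟩ :=
    exists_zMap_cycle (K := K) (v := v) (ε := ε) hcard (by omega)
  have hxm : ∀ i, x (i % n) = x i := fun i => Function.Periodic.map_mod_nat hx i
  let E : Γ.Edge → End (toHtpy (dbl (Γ.tiltMap K v ε))) := fun x =>
    (zigRetract K v ε x).proj ≫ (zigRetract K v ε x).incl
  have hEE : ∀ x, E x * E x = E x := by
    intro x
    change ((zigRetract K v ε x).proj ≫ (zigRetract K v ε x).incl) ≫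
      (zigRetract K v ε x).proj ≫ (zigRetract K v ε x).incl = _
    rw [Category.assoc, ← Category.assoc (zigRetract K v ε x).incl, StrictRetract.incl_proj,
      Category.id_comp]
  have hEo : ∀ x y, x ≠ y → E x * E y = 0 := by
    intro x y h
    change ((zigRetract K v ε y).proj ≫ (zigRetract K v ε y).incl) ≫
      (zigRetract K v ε x).proj ≫ (zigRetract K v ε x).incl = 0
    rw [Category.assoc, ← Category.assoc (zigRetract K v ε y).incl,
      zigRetract_incl_proj_of_ne h.symm, zero_comp, comp_zero]
  have hEl : ∀ {x y : Γ.Edge} {θ : ℕ → Γ.Alg K} (h : Γ.ZMap K v ε 0 x y θ),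
      E y * zEnd h = zEnd h := by
    intro x y θ h
    change ((zigRetract K v ε x).proj ≫ zHom h ≫ (zigRetract K v ε y).incl) ≫
      (zigRetract K v ε y).proj ≫ (zigRetract K v ε y).incl = _
    simp only [Category.assoc]
    rw [← Category.assoc (zigRetract K v ε y).incl, StrictRetract.incl_proj, Category.id_comp]
    rfl
  have hEr : ∀ {x y : Γ.Edge} {θ : ℕ → Γ.Alg K} (h : Γ.ZMap K v ε 0 x y θ),
      zEnd h * E x = zEnd h := by
    intro x y θ h
    change ((zigRetract K v ε x).proj ≫ (zigRetract K v ε x).incl) ≫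
      (zigRetract K v ε x).proj ≫ zHom h ≫ (zigRetract K v ε y).incl = _
    simp only [Category.assoc]
    rw [← Category.assoc (zigRetract K v ε x).incl, StrictRetract.incl_proj, Category.id_comp]
    rfl
  let a : ℕ → End (toHtpy (dbl (Γ.tiltMap K v ε))) := fun i => zEnd (hz i)
  have ha : ∀ i, a (i % n) = a i := fun i => Function.Periodic.map_mod_nat (f := a) (fun i =>
    zEnd_congr _ _ (by rw [add_right_comm, hx]) (hx i) (hθ i)) i
  have hval : ∀ (i : Fin n) (k : ℕ), (i + (k : Fin n)).val = (i.val + k) % n := by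
    intro i k
    rw [Fin.val_add, Fin.val_natCast, Nat.add_mod_mod]
  have hzP : ∀ i k, Γ.ZMap K v ε 0 (x (i + k + 1)) (x i) (zProd θ i k) := by
    intro i k
    induction k with
    | zero => exact hz i
    | succ k ih => exact (hz (i + k + 1)).mul ih
  have hP : ∀ i k, ((List.range (k + 1)).map fun l => a (i + l)).prod = zEnd (hzP i k) := by
    intro i k
    induction k with
    | zero => simp [a]; rfl
    | succ k ih =>
      rw [List.range_succ, List.map_append, List.prod_append, ih, List.map_singleton,
        List.prod_singleton]
      exact zEnd_mul _ _
  have hzS : ∀ i, Γ.ZMap K v ε 0 (x i) (x i) (Pi.single 0 (Γ.soc K (Γ.anc v (x i) 0))) := by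
    intro i
    have := hzP i (n - 1)
    rwa [hprod, show i + (n - 1) + 1 = i + n by omega, hx] at this
  have hB : ∀ i : Fin n, ((List.range n).map fun k : ℕ => a (i + (k : Fin n)).val).prod =
      zEnd (hzS i) := by
    intro i
    simp only [hval, ha]
    have h1 := hP i (n - 1)
    rw [show n - 1 + 1 = n by omega] at h1
    rw [h1]
    exact zEnd_congr _ _ (by rw [show i.val + (n - 1) + 1 = i + n by omega, hx]) rfl (hprod i)
  have hbij : Function.Bijective fun i : Fin n => x i := by
    rw [Fintype.bijective_iff_injective_and_card]
    exact ⟨fun i j h => Fin.ext (hinj i j i.2 j.2 h), by rw [Fintype.card_fin, hcard]⟩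
  obtain ⟨φ⟩ := nonempty_algEquiv_star (K := K) hn (fun i => E (x i)) (fun i => a i)
    (fun i => hEE _) (fun i j hij => hEo _ _ fun h => hij (hbij.1 h))
    ((Equiv.ofBijective _ hbij).sum_comp E |>.trans sum_zigRetract)
    (fun i => hEl _) (fun i => by
      have h1 : x (i + 1 : Fin n).val = x (i.val + 1) := by
        have := hval i 1
        rw [Nat.cast_one] at this
        rw [this, hxm]
      rw [h1]
      exact hEr _) (fun i j => by
      rw [finrank_peirceSpace (StrictRetract.incl_proj _) (StrictRetract.incl_proj _),
        finrank_zigMap_hom]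
      by_cases hij : i = j
      · subst hij
        simp
      · rw [if_neg hij, if_neg fun h => hij (hbij.1 h).symm]) (fun i => by
      rw [hB]
      intro h0
      have h1 := zHom_eq_of_zEnd (hzS i)
      rw [h0] at h1
      refine zHom_soc_ne_zero (hzS i) rfl (h1.trans ?_)
      exact (congrArg _ zero_comp).trans comp_zero) (fun i => by
      rw [hB, zEnd_mul]
      have h1 : (fun k => (Pi.single 0 (Γ.soc K (Γ.anc v (x i) 0)) : ℕ → Γ.Alg K) k *
          (Pi.single 0 (Γ.soc K (Γ.anc v (x i) 0)) : ℕ → Γ.Alg K) k) = 0 := by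
        funext k
        by_cases hk : k = 0
        · subst hk
          rw [Pi.single_eq_same, soc_mul_soc, Pi.zero_apply]
        · rw [Pi.single_eq_of_ne hk, mul_zero, Pi.zero_apply]
      rw [zEnd, zHom_congr _ h1, zHom_zero]
      exact (congrArg _ zero_comp).trans comp_zero)
  exact ⟨starTree n, isStar_starTree n, ⟨φ⟩⟩

end EndStar

end BrauerTree


/-! ### Generation of the perfect complexes -/

section Generation

variable {A : Type u} [Ring A]

section DblExact

variable {P₀ P₁ Q₀ Q₁ R₀ R₁ : Type w} [AddCommGroup P₀] [AddCommGroup P₁]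
  [AddCommGroup Q₀] [AddCommGroup Q₁] [AddCommGroup R₀] [AddCommGroup R₁] [Module A P₀]
  [Module A P₁] [Module A Q₀] [Module A Q₁] [Module A R₀] [Module A R₁] {f : P₀ →ₗ[A] P₁}
  {g : Q₀ →ₗ[A] Q₁} {h : R₀ →ₗ[A] R₁} {i₀ : P₀ →ₗ[A] Q₀} {i₁ : P₁ →ₗ[A] Q₁} {p₀ : Q₀ →ₗ[A] R₀}
  {p₁ : Q₁ →ₗ[A] R₁}

theorem dblMap_comp_eq_zero (hi : g.comp i₀ = i₁.comp f) (hp : h.comp p₀ = p₁.comp g)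
    (e₀ : Function.Exact i₀ p₀) (e₁ : Function.Exact i₁ p₁) :
    dblMap i₀ i₁ hi ≫ dblMap p₀ p₁ hp = 0 := by
  rw [dblMap_comp]
  apply dbl_hom_ext
  · rw [dblMap_f₀, e₀.linearMap_comp_eq_zero]
    simp
  · rw [dblMap_f₁, e₁.linearMap_comp_eq_zero]
    simp

theorem shortExact_dbl (hi : g.comp i₀ = i₁.comp f) (hp : h.comp p₀ = p₁.comp g)
    (e₀ : Function.Exact i₀ p₀) (e₁ : Function.Exact i₁ p₁) (ii₀ : Function.Injective i₀)
    (ii₁ : Function.Injective i₁) (pp₀ : Function.Surjective p₀) (pp₁ : Function.Surjective p₁) :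
    (ShortComplex.mk (dblMap i₀ i₁ hi) (dblMap p₀ p₁ hp)
      (dblMap_comp_eq_zero hi hp e₀ e₁)).ShortExact := by
  apply HomologicalComplex.shortExact_of_degreewise_shortExact
  intro k
  by_cases hk₀ : k = 0
  · subst hk₀
    refine ShortComplex.shortExact_of_iso (ShortComplex.isoMk (dblX₀ f).symm (dblX₀ g).symm
      (dblX₀ h).symm ?_ ?_) (ModuleCat.shortComplex_shortExact (ShortComplex.mk
        (ModuleCat.ofHom i₀) (ModuleCat.ofHom p₀) (by
          rw [← ModuleCat.ofHom_comp, e₀.linearMap_comp_eq_zero]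
          rfl)) e₀ ii₀ pp₀)
    · simp [dblMap_f₀]
      exact (dblX₀ f).inv_hom_id_assoc _
    · simp [dblMap_f₀]
      exact (dblX₀ g).inv_hom_id_assoc _
  · by_cases hk₁ : k = 1
    · subst hk₁
      refine ShortComplex.shortExact_of_iso (ShortComplex.isoMk (dblX₁ f).symm (dblX₁ g).symm
        (dblX₁ h).symm ?_ ?_) (ModuleCat.shortComplex_shortExact (ShortComplex.mk
          (ModuleCat.ofHom i₁) (ModuleCat.ofHom p₁) (by
            rw [← ModuleCat.ofHom_comp, e₁.linearMap_comp_eq_zero]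
            rfl)) e₁ ii₁ pp₁)
      · simp [dblMap_f₁]
        exact (dblX₁ f).inv_hom_id_assoc _
      · simp [dblMap_f₁]
        exact (dblX₁ g).inv_hom_id_assoc _
    · exact
        { exact := ShortComplex.exact_of_isZero_X₂ _ (isZero_dbl_X g hk₀ hk₁)
          mono_f := ⟨fun _ _ _ => (isZero_dbl_X f hk₀ hk₁).eq_of_tgt _ _⟩
          epi_g := ⟨fun _ _ _ => (isZero_dbl_X h hk₀ hk₁).eq_of_src _ _⟩ }

end DblExact

section Stalk

variable {P₀ P₁ : Type w} [AddCommGroup P₀] [AddCommGroup P₁] [Module A P₀] [Module A P₁]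

theorem isPerfectComplex_single (M : ModuleCat.{w} A) [Module.Finite A M] [Module.Projective A M]
    (m : ℤ) : IsPerfectComplex ((HomologicalComplex.single (ModuleCat.{w} A)
      (ComplexShape.up ℤ) m).obj M) := by
  have hz : ∀ i, i ≠ m → IsZero (((HomologicalComplex.single (ModuleCat.{w} A)
      (ComplexShape.up ℤ) m).obj M).X i) := fun i hi =>
    HomologicalComplex.isZero_single_obj_X _ _ _ _ hi
  refine ⟨fun i => ?_, m, m, fun i hi => hz i (by omega)⟩
  by_cases hi : i = m
  · subst hi
    let e := (HomologicalComplex.singleObjXSelf (ComplexShape.up ℤ) i M).toLinearEquiv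
    exact ⟨Module.Finite.equiv e.symm, Module.Projective.of_equiv e.symm⟩
  · have := ModuleCat.subsingleton_of_isZero (hz i hi)
    exact ⟨inferInstance, inferInstance⟩

/-- A two-term complex that is zero in degree `1` is a stalk complex. -/
theorem nonempty_iso_single_zero [Module.Finite A P₀] [Module.Projective A P₀] [Subsingleton P₁]
    (f : P₀ →ₗ[A] P₁) : Nonempty (dbl f ≅ (HomologicalComplex.single (ModuleCat.{w} A)
      (ComplexShape.up ℤ) 0).obj (ModuleCat.of A P₀)) := by
  have hz : ∀ i, i ≠ 0 → IsZero (((HomologicalComplex.single (ModuleCat.{w} A)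
      (ComplexShape.up ℤ) 0).obj (ModuleCat.of A P₀)).X i) := fun i hi =>
    HomologicalComplex.isZero_single_obj_X _ _ _ _ hi
  obtain ⟨e⟩ := IsTwoTerm.exists_iso
    ⟨isPerfectComplex_single (ModuleCat.of A P₀) 0, fun i hi _ => hz i hi⟩
  have := ModuleCat.subsingleton_of_isZero (hz 1 (by simp))
  refine ⟨(dblIso (HomologicalComplex.singleObjXSelf (ComplexShape.up ℤ) 0
    (ModuleCat.of A P₀)).toLinearEquiv.symm
    (0 : P₁ ≃ₗ[A] ((HomologicalComplex.single (ModuleCat.{w} A)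
      (ComplexShape.up ℤ) 0).obj (ModuleCat.of A P₀)).X 1) ?_) ≪≫ e⟩
  exact LinearMap.ext fun x => Subsingleton.elim _ _

/-- A two-term complex that is zero in degree `0` is a stalk complex. -/
theorem nonempty_iso_single_one [Module.Finite A P₁] [Module.Projective A P₁] [Subsingleton P₀]
    (f : P₀ →ₗ[A] P₁) : Nonempty (dbl f ≅ (HomologicalComplex.single (ModuleCat.{w} A)
      (ComplexShape.up ℤ) 1).obj (ModuleCat.of A P₁)) := by
  have hz : ∀ i, i ≠ 1 → IsZero (((HomologicalComplex.single (ModuleCat.{w} A)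
      (ComplexShape.up ℤ) 1).obj (ModuleCat.of A P₁)).X i) := fun i hi =>
    HomologicalComplex.isZero_single_obj_X _ _ _ _ hi
  obtain ⟨e⟩ := IsTwoTerm.exists_iso
    ⟨isPerfectComplex_single (ModuleCat.of A P₁) 1, fun i _ hi => hz i hi⟩
  have := ModuleCat.subsingleton_of_isZero (hz 0 (by simp))
  refine ⟨(dblIso (0 : P₀ ≃ₗ[A] ((HomologicalComplex.single (ModuleCat.{w} A)
      (ComplexShape.up ℤ) 1).obj (ModuleCat.of A P₁)).X 0)
    (HomologicalComplex.singleObjXSelf (ComplexShape.up ℤ) 1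
      (ModuleCat.of A P₁)).toLinearEquiv.symm ?_) ≪≫ e⟩
  exact LinearMap.ext fun x => by
    rw [Subsingleton.elim x 0, map_zero, map_zero]

end Stalk

section Envelope

variable [HasDerivedCategory.{v} (ModuleCat.{w} A)]
  (E : ObjectProperty (DerivedCategory (ModuleCat.{w} A))) [E.IsTriangulated]
  [E.IsClosedUnderIsomorphisms]

variable {E} in
theorem prop_single_of_prop_single {M : ModuleCat.{w} A} {m : ℤ}
    (h : E (DerivedCategory.Q.obj ((HomologicalComplex.single _ (ComplexShape.up ℤ) m).obj M)))
    (k : ℤ) :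
    E (DerivedCategory.Q.obj ((HomologicalComplex.single _ (ComplexShape.up ℤ) k).obj M)) := by
  rw [DerivedCategory.Q_obj_single_obj] at h ⊢
  exact E.prop_of_iso (((DerivedCategory.singleFunctors (ModuleCat.{w} A)).shiftIso (m - k) k m
    (by omega)).app M) (E.le_shift (m - k) _ h)

variable {E} in
/-- A triangulated subcategory that contains the stalk complexes of the finitely generated
projective modules contains the perfect complexes. -/
theorem prop_of_isPerfectComplex (hE : ∀ (M : ModuleCat.{w} A), Module.Finite A M →
      Module.Projective A M → ∀ m : ℤ,
      E (DerivedCategory.Q.obj ((HomologicalComplex.single _ (ComplexShape.up ℤ) m).obj M)))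
    {X : CochainComplex (ModuleCat.{w} A) ℤ} (hX : IsPerfectComplex X) :
    E (DerivedCategory.Q.obj X) := by
  obtain ⟨hX, a, b, hab⟩ := hX
  obtain ⟨k, hk⟩ : ∃ k : ℕ, b < a + k := ⟨(b - a + 1).toNat, by omega⟩
  replace hab : ∀ i, i < a ∨ a + k ≤ i → IsZero (X.X i) := fun i hi => hab i (by omega)
  clear hk b
  induction k generalizing X with
  | zero =>
    have : IsZero X := by
      rw [IsZero.iff_id_eq_zero]
      ext i : 1
      exact (hab i (by omega)).eq_of_src _ _
    exact E.prop_of_isZero (DerivedCategory.Q.map_isZero this)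
  | succ k ih =>
    set m : ℤ := a + k with hm
    have hzm : IsZero (X.X (m + 1)) := hab _ (by push_cast; omega)
    let φ : (HomologicalComplex.single _ (ComplexShape.up ℤ) m).obj (X.X m) ⟶ X :=
      HomologicalComplex.mkHomFromSingle (𝟙 (X.X m)) (fun l hl => by
        obtain rfl : m + 1 = l := hl
        exact hzm.eq_of_tgt _ _)
    have hφm : IsIso (φ.f m) := by
      rw [HomologicalComplex.mkHomFromSingle_f]
      infer_instance
    have hz : ∀ i, i ≠ m → IsZero (((HomologicalComplex.single (ModuleCat.{w} A)
        (ComplexShape.up ℤ) m).obj (X.X m)).X i) := fun i hi =>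
      HomologicalComplex.isZero_single_obj_X _ _ _ _ hi
    have hmono : ∀ i, Mono (φ.f i) := by
      intro i
      by_cases hi : i = m
      · subst hi
        infer_instance
      · exact ⟨fun _ _ _ => (hz i hi).eq_of_tgt _ _⟩
    have : Mono φ := HomologicalComplex.mono_of_mono_f φ hmono
    let S : ShortComplex (CochainComplex (ModuleCat.{w} A) ℤ) :=
      ShortComplex.mk φ (cokernel.π φ) (cokernel.condition φ)
    have hS : S.ShortExact :=
      { exact := ShortComplex.exact_cokernel φ
        mono_f := this
        epi_g := inferInstanceAs (Epi (cokernel.π φ)) }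
    have hS' : ∀ i, (S.map (HomologicalComplex.eval _ _ i)).ShortExact := fun i =>
      hS.map_of_exact (HomologicalComplex.eval _ _ i)
    have hzc : IsZero ((cokernel φ).X m) := by
      have h1 : IsIso (S.map (HomologicalComplex.eval _ _ m)).f := hφm
      exact (hS' m).isIso_f_iff.1 h1
    have hiso : ∀ i, i ≠ m → IsIso ((cokernel.π φ).f i) := fun i hi =>
      (hS' i).isIso_g_iff.2 (hz i hi)
    refine E.ext_of_isTriangulatedClosed₂ _ (DerivedCategory.triangleOfSES_distinguished hS)
      (hE _ (hX m).1 (hX m).2 m) (ih (X := cokernel φ) (fun i => ?_) fun i hi => ?_)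
    · by_cases hi : i = m
      · subst hi
        have := ModuleCat.subsingleton_of_isZero hzc
        exact ⟨inferInstance, inferInstance⟩
      · have := hiso i hi
        have := hX i
        let e := (asIso ((cokernel.π φ).f i)).toLinearEquiv
        have := (hX i).1
        have := (hX i).2
        exact ⟨Module.Finite.equiv e, Module.Projective.of_equiv e⟩
    · by_cases hi' : i = m
      · subst hi'
        exact hzc
      · have := hiso i hi'
        exact (hab i (by push_cast; omega)).of_iso (asIso ((cokernel.π φ).f i)).symm

end Envelope

end Generation


namespace BrauerTree

section Generate

set_option linter.unusedSectionVars false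

variable {V : Type v} {Γ : BrauerTree V} {K : Type u} [Field K] {v : V}

/-- The terms of the zigzag complex of `x` are `x` and the terms of that of its parent. -/
theorem exists_zigI_eq_insert [Fintype Γ.Edge] {ε : ℕ} (x : Γ.Edge) : ∃ I : ℕ → Finset Γ.Edge,
    (∀ b, x ∉ I b) ∧ (∀ b, Γ.zigI v ε b x =
      open Classical in if (Γ.lev v x + ε) % 2 = b then insert x (I b) else I b) ∧
    ((∀ b, I b = ∅) ∨ Γ.lev v x ≠ 0 ∧ ∀ b, I b = Γ.zigI v ε b (Γ.par v x)) := by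
  classical
  by_cases h0 : Γ.lev v x = 0
  · refine ⟨fun _ => ∅, by simp, fun b => ?_, Or.inl fun _ => rfl⟩
    ext i
    have h1 : Γ.IsAnc v i x ↔ i = x := by
      refine ⟨fun h => ?_, fun h => by rw [h]; exact isAnc_self x⟩
      have := h.1
      exact h.eq_of_lev_eq (isAnc_self x) (by omega)
    rw [mem_zigI, h1]
    split_ifs with hb
    · simp only [insert_empty_eq, Finset.mem_singleton]
      exact ⟨fun h => h.1, fun h => ⟨h, h ▸ hb⟩⟩
    · simp only [Finset.notMem_empty, iff_false, not_and]
      rintro rfl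
      exact hb
  · have hl := Γ.lev_par v h0
    refine ⟨fun b => Γ.zigI v ε b (Γ.par v x), fun b hx => ?_, fun b => ?_,
      Or.inr ⟨h0, fun _ => rfl⟩⟩
    · have := (mem_zigI.1 hx).1.1
      omega
    · have h1 : ∀ i, Γ.IsAnc v i x ↔ i = x ∨ Γ.IsAnc v i (Γ.par v x) := by
        have h2 : ∀ k, k ≤ Γ.lev v (Γ.par v x) → Γ.anc v (Γ.par v x) k = Γ.anc v x k := by
          intro k hk
          obtain ⟨d, hd⟩ := Nat.exists_eq_add_of_le hk
          induction d generalizing k with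
          | zero =>
            rw [add_zero] at hd
            rw [← hd, anc_lev, ← Γ.par_anc v (x := x) (k := Γ.lev v (Γ.par v x)) (by omega), hl, anc_lev]
          | succ d ih =>
            rw [← Γ.par_anc v (x := Γ.par v x) (k := k) (by omega), ih (k + 1) (by omega) (by omega),
              Γ.par_anc v (x := x) (k := k) (by omega)]
        intro i
        constructor
        · intro h
          by_cases hi : Γ.lev v i = Γ.lev v x
          · exact Or.inl (h.eq_of_lev_eq (isAnc_self x) hi)
          · have := h.1
            have h3 : Γ.lev v i ≤ Γ.lev v (Γ.par v x) := by omega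
            exact Or.inr ⟨h3, by rw [h2 _ h3, h.2]⟩
        · rintro (rfl | h)
          · exact isAnc_self i
          · have := h.1
            exact ⟨by omega, by rw [← h2 _ h.1, h.2]⟩
      ext i
      rw [mem_zigI, h1]
      split_ifs with hb
      · rw [Finset.mem_insert, mem_zigI]
        constructor
        · rintro ⟨h | h, h'⟩
          · exact Or.inl h
          · exact Or.inr ⟨h, h'⟩
        · rintro (rfl | h)
          · exact ⟨Or.inl rfl, hb⟩
          · exact ⟨Or.inr h.1, h.2⟩
      · rw [mem_zigI]
        constructor
        · rintro ⟨rfl | h, h'⟩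
          · exact absurd h' hb
          · exact ⟨h, h'⟩
        · exact fun h => ⟨Or.inr h.1, h.2⟩

variable (K v) in
/-- The two-term complex with given sets of terms and the components of a zigzag complex. -/
noncomputable def setMap (I J : Finset Γ.Edge) : PiProj K (fun i : I => i.1) →ₗ[Γ.Alg K]
    PiProj K (fun j : J => j.1) :=
  toLin (fun i : I => i.1) (fun j : J => j.1) fun i j => Γ.zigEnt K v i j

theorem setMap_apply [Fintype Γ.Edge] {I J : Finset Γ.Edge} (z : PiProj K (fun i : I => i.1)) (j : J) :
    (setMap K v I J z j : Γ.Alg K) = ∑ i : I, (z i : Γ.Alg K) * Γ.zigEnt K v i j := by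
  classical
  exact toLin_apply (fun _ _ => Γ.zigEnt_mem_corner K v _ _) z j

section

variable [DecidableEq Γ.Edge] (I : Finset Γ.Edge) (x : Γ.Edge)

/-- The inclusion of a part of a direct sum. -/
noncomputable def extendZero :
    PiProj K (fun i : I => i.1) →ₗ[Γ.Alg K] PiProj K (fun i : (insert x I : Finset Γ.Edge) => i.1) where
  toFun z i := if h : i.1 ∈ I then z ⟨i.1, h⟩ else 0
  map_add' z z' := by
    funext i
    dsimp only [Pi.add_apply]
    split_ifs <;> simp
  map_smul' c z := by
    funext i
    dsimp only [Pi.smul_apply, RingHom.id_apply]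
    split_ifs <;> simp

/-- The projection to a part of a direct sum. -/
def restrictTerms :
    PiProj K (fun i : (insert x I : Finset Γ.Edge) => i.1) →ₗ[Γ.Alg K] PiProj K (fun i : I => i.1) where
  toFun z i := z ⟨i.1, Finset.mem_insert_of_mem i.2⟩
  map_add' _ _ := rfl
  map_smul' _ _ := rfl

/-- The inclusion of the additional summand. -/
noncomputable def newIncl :
    Γ.Proj K x →ₗ[Γ.Alg K] PiProj K (fun i : (insert x I : Finset Γ.Edge) => i.1) where
  toFun z i := if h : i.1 = x then ⟨z.1, by
    change _ ∈ Γ.Proj K i.1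
    rw [h]
    exact z.2⟩ else 0
  map_add' z z' := by
    funext i
    dsimp only [Pi.add_apply]
    split_ifs
    · rfl
    · simp
  map_smul' c z := by
    funext i
    dsimp only [Pi.smul_apply, RingHom.id_apply]
    split_ifs
    · rfl
    · simp

/-- The projection to the additional summand. -/
def newProj :
    PiProj K (fun i : (insert x I : Finset Γ.Edge) => i.1) →ₗ[Γ.Alg K] Γ.Proj K x where
  toFun z := z ⟨x, Finset.mem_insert_self x I⟩
  map_add' _ _ := rfl
  map_smul' _ _ := rfl

variable {I x}

theorem exact_extendZero (hx : x ∉ I) :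
    Function.Exact (extendZero (K := K) I x) (newProj I x) := by
  intro z
  constructor
  · intro hz
    refine ⟨restrictTerms I x z, funext fun i => ?_⟩
    change (if h : i.1 ∈ I then z ⟨i.1, Finset.mem_insert_of_mem h⟩ else 0) = z i
    split_ifs with h
    · rfl
    · obtain ⟨i, hi⟩ := i
      obtain rfl := (Finset.mem_insert.1 hi).resolve_right h
      exact hz.symm
  · rintro ⟨y, rfl⟩
    exact dif_neg hx

theorem extendZero_injective : Function.Injective (extendZero (K := K) I x) := by
  intro y z h
  funext i
  have := congrFun h ⟨i.1, Finset.mem_insert_of_mem i.2⟩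
  simpa [extendZero] using this

theorem newProj_surjective : Function.Surjective (newProj (K := K) I x) := by
  intro z
  refine ⟨newIncl I x z, ?_⟩
  exact dif_pos rfl

theorem exact_newIncl (hx : x ∉ I) :
    Function.Exact (newIncl (K := K) I x) (restrictTerms I x) := by
  intro z
  constructor
  · intro hz
    refine ⟨newProj I x z, funext fun i => ?_⟩
    by_cases h : i.1 = x
    · obtain ⟨i, hi⟩ := i
      obtain rfl : i = x := h
      exact dif_pos rfl
    · refine (dif_neg h).trans ?_
      exact (congrFun hz ⟨i.1, (Finset.mem_insert.1 i.2).resolve_left h⟩).symm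
  · rintro ⟨y, rfl⟩
    funext i
    exact dif_neg fun h : i.1 = x => hx (h ▸ i.2)

theorem newIncl_injective : Function.Injective (newIncl (K := K) I x) := by
  intro y z h
  have := congrFun h ⟨x, Finset.mem_insert_self x I⟩
  simpa [newIncl] using this

theorem restrictTerms_surjective : Function.Surjective (restrictTerms (K := K) I x) := by
  intro z
  refine ⟨extendZero I x z, funext fun i => ?_⟩
  exact dif_pos i.2

end

variable [Finite V] [HasDerivedCategory.{w} (ModuleCat.{max u v} (Γ.Alg K))]
  {E : ObjectProperty (DerivedCategory (ModuleCat.{max u v} (Γ.Alg K)))} [E.IsTriangulated]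
  [E.IsClosedUnderIsomorphisms]

instance (i : Γ.Edge) : Module.Finite (Γ.Alg K) (Γ.Proj K i) :=
  Module.Finite.iff_fg.2 ⟨{Γ.idem K i}, by simp⟩

theorem prop_stalk_of_insert_left [Fintype Γ.Edge] [DecidableEq Γ.Edge] {I J : Finset Γ.Edge} {x : Γ.Edge} (hx : x ∉ I)
    (h : E (DerivedCategory.Q.obj (dbl (setMap K v I J))))
    (h' : E (DerivedCategory.Q.obj (dbl (setMap K v (insert x I) J)))) (m : ℤ) :
    E (DerivedCategory.Q.obj (Γ.stalk K m x)) := by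
  have hi : (setMap K v (insert x I) J).comp (extendZero I x) =
      LinearMap.id.comp (setMap K v I J) := by
    refine LinearMap.ext fun z => funext fun j => Subtype.ext ?_
    change (setMap K v (insert x I) J (extendZero I x z) j).1 = (setMap K v I J z j).1
    rw [setMap_apply, setMap_apply]
    have h1 : ∀ i : (insert x I : Finset Γ.Edge), ((extendZero I x z i : Γ.Proj K i.1) : Γ.Alg K) =
        if h : i.1 ∈ I then (z ⟨i.1, h⟩ : Γ.Alg K) else 0 := by
      intro i
      change ((if h : i.1 ∈ I then z ⟨i.1, h⟩ else 0 : Γ.Proj K i.1) : Γ.Alg K) = _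
      split_ifs <;> rfl
    simp only [h1]
    rw [Finset.sum_coe_sort (insert x I) (fun i => (if h : i ∈ I then (z ⟨i, h⟩ : Γ.Alg K) else 0) *
      Γ.zigEnt K v i j), Finset.sum_insert hx, dif_neg hx, zero_mul, zero_add,
      ← Finset.sum_coe_sort I]
    exact Finset.sum_congr rfl fun i _ => by rw [dif_pos i.2]
  have hS := shortExact_dbl (h := (0 : Γ.Proj K x →ₗ[Γ.Alg K] PUnit.{max u v + 1}))
    (p₀ := newProj I x) (p₁ := 0) hi rfl (exact_extendZero hx)
    (fun y => ⟨fun _ => ⟨y, rfl⟩, fun _ => rfl⟩) extendZero_injective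
    (fun _ _ h => h) newProj_surjective (fun _ => ⟨0, Subsingleton.elim _ _⟩)
  have h3 := E.ext_of_isTriangulatedClosed₃ _ (DerivedCategory.triangleOfSES_distinguished hS) h h'
  obtain ⟨e⟩ := nonempty_iso_single_zero (0 : Γ.Proj K x →ₗ[Γ.Alg K] PUnit.{max u v + 1})
  exact prop_single_of_prop_single (E.prop_of_iso (DerivedCategory.Q.mapIso e) h3) m

theorem prop_stalk_of_insert_right [Fintype Γ.Edge] [DecidableEq Γ.Edge] {I J : Finset Γ.Edge} {x : Γ.Edge} (hx : x ∉ J)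
    (h : E (DerivedCategory.Q.obj (dbl (setMap K v I J))))
    (h' : E (DerivedCategory.Q.obj (dbl (setMap K v I (insert x J))))) (m : ℤ) :
    E (DerivedCategory.Q.obj (Γ.stalk K m x)) := by
  have hp : (setMap K v I J).comp LinearMap.id =
      (restrictTerms J x).comp (setMap K v I (insert x J)) := by
    refine LinearMap.ext fun z => funext fun j => Subtype.ext ?_
    change (setMap K v I J z j).1 =
      (setMap K v I (insert x J) z ⟨j.1, Finset.mem_insert_of_mem j.2⟩).1
    rw [setMap_apply, setMap_apply]
  have hS := shortExact_dbl (f := (0 : PUnit.{max u v + 1} →ₗ[Γ.Alg K] Γ.Proj K x))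
    (i₀ := 0) (i₁ := newIncl J x) (g := setMap K v I (insert x J)) (by
      rw [LinearMap.comp_zero, LinearMap.comp_zero]) hp
    (fun y => ⟨fun h => ⟨0, h.symm⟩, by
      rintro ⟨_, rfl⟩
      rfl⟩) (exact_newIncl hx)
    (fun _ _ _ => rfl) newIncl_injective (fun y => ⟨y, rfl⟩) restrictTerms_surjective
  have h3 := E.ext_of_isTriangulatedClosed₁ _ (DerivedCategory.triangleOfSES_distinguished hS) h' h
  obtain ⟨e⟩ := nonempty_iso_single_one (0 : PUnit.{max u v + 1} →ₗ[Γ.Alg K] Γ.Proj K x)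
  exact prop_single_of_prop_single (E.prop_of_iso (DerivedCategory.Q.mapIso e) h3) m

theorem prop_single_of_prop_stalk (hE : ∀ x m, E (DerivedCategory.Q.obj (Γ.stalk K m x)))
    (M : ModuleCat.{max u v} (Γ.Alg K)) (hM : Module.Finite (Γ.Alg K) M)
    (hM' : Module.Projective (Γ.Alg K) M) (m : ℤ) :
    E (DerivedCategory.Q.obj ((HomologicalComplex.single _ (ComplexShape.up ℤ) m).obj M)) := by
  have := Fintype.ofFinite V
  obtain ⟨k, s, ⟨e⟩⟩ := exists_equiv_PiProj (Γ := Γ) (K := K) M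
  suffices h : E (DerivedCategory.Q.obj ((HomologicalComplex.single _ (ComplexShape.up ℤ) 0).obj
      (ModuleCat.of (Γ.Alg K) (PiProj K s)))) by
    refine prop_single_of_prop_single (m := 0) (E.prop_of_iso ?_ h) m
    exact (DerivedCategory.Q.mapIso ((HomologicalComplex.single _ (ComplexShape.up ℤ) 0).mapIso
      e.symm.toModuleIso))
  clear e
  induction k with
  | zero =>
    have : IsZero (ModuleCat.of (Γ.Alg K) (PiProj K s)) :=
      ModuleCat.isZero_of_subsingleton _
    exact E.prop_of_isZero (DerivedCategory.Q.map_isZero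
      ((HomologicalComplex.single _ (ComplexShape.up ℤ) 0).map_isZero this))
  | succ k ih =>
    let g : PiProj K s →ₗ[Γ.Alg K] Γ.Proj K (s 0) := LinearMap.proj 0
    let f : PiProj K (fun i : Fin k => s i.succ) →ₗ[Γ.Alg K] PiProj K s :=
      LinearMap.pi (Fin.cons 0 fun i => LinearMap.proj i)
    have hf0 : ∀ z, f z 0 = 0 := fun z => rfl
    have hfs : ∀ z (i : Fin k), f z i.succ = z i := fun z i => rfl
    let S : ShortComplex (ModuleCat.{max u v} (Γ.Alg K)) :=
      ShortComplex.mk (ModuleCat.ofHom f) (ModuleCat.ofHom g) rfl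
    have hS : S.ShortExact := by
      refine ModuleCat.shortComplex_shortExact S ?_ ?_ ?_
      · intro z
        constructor
        · intro hz
          refine ⟨(fun i => z i.succ : PiProj K (fun i : Fin k => s i.succ)), funext fun i => ?_⟩
          refine Fin.cases ?_ (fun i => ?_) i
          · exact hz.symm
          · rfl
        · rintro ⟨y, rfl⟩
          rfl
      · intro y z h
        funext i
        exact congrFun h i.succ
      · intro y
        exact ⟨(Pi.single 0 y : PiProj K s), Pi.single_eq_same (M := fun i => Γ.Proj K (s i)) 0 y⟩
    exact E.ext_of_isTriangulatedClosed₂ _ hS.singleTriangle_distinguished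
      (ih (fun i => s i.succ)) (hE (s 0) 0)

/-- The zigzag complexes generate the perfect complexes. -/
theorem prop_of_prop_zig [Fintype Γ.Edge] {ε : ℕ}
    (hE : ∀ x, E (DerivedCategory.Q.obj (dbl (zigMap K v ε x)))) {X : Γ.Cplx K}
    (hX : IsPerfectComplex X) : E (DerivedCategory.Q.obj X) := by
  classical
  refine prop_of_isPerfectComplex (prop_single_of_prop_stalk fun x m => ?_) hX
  obtain ⟨I, hx, hI, hI'⟩ := exists_zigI_eq_insert (v := v) (ε := ε) x
  have h1 : E (DerivedCategory.Q.obj (dbl (setMap K v (I 0) (I 1)))) := by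
    rcases hI' with h | ⟨-, h⟩
    · have : IsZero (dbl (setMap K v (I 0) (I 1))) := by
        have h2 : ∀ b, IsEmpty (I b) := fun b => by rw [h]; infer_instance
        rw [IsZero.iff_id_eq_zero, ← dblMap_id]
        apply dbl_hom_ext
        · rw [dblMap_f₀, Subsingleton.elim LinearMap.id 0]
          simp
        · rw [dblMap_f₁, Subsingleton.elim LinearMap.id 0]
          simp
      exact E.prop_of_isZero (DerivedCategory.Q.map_isZero this)
    · rw [h, h]
      exact hE _
  have h2 : E (DerivedCategory.Q.obj (dbl (setMap K v (Γ.zigI v ε 0 x) (Γ.zigI v ε 1 x)))) := hE x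
  rw [hI, hI] at h2
  rcases Nat.mod_two_eq_zero_or_one (Γ.lev v x + ε) with h | h
  · rw [if_pos h, if_neg (by omega)] at h2
    exact prop_stalk_of_insert_left (hx 0) h1 (by convert h2) m
  · rw [if_neg (by omega), if_pos h] at h2
    exact prop_stalk_of_insert_right (hx 1) h1 (by convert h2) m

end Generate

section Tilting

set_option linter.unusedSectionVars false

variable {V : Type v} {Γ : BrauerTree V} {K : Type u} [Field K] [Fintype V]
  [Fintype Γ.Edge] [DecidableEq Γ.Edge]

instance {α : Type v} [Fintype α] {s : α → Γ.Edge} : Module.Finite (Γ.Alg K) (PiProj K s) :=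
  Module.Finite.pi

theorem finite_tilt (v : V) (ε b : ℕ) : Module.Finite (Γ.Alg K)
    (∀ x : Γ.Edge, ∀ i : Γ.zigI v ε b x, Γ.Proj K i.1) := inferInstance

theorem projective_tilt (v : V) (ε b : ℕ) : Module.Projective (Γ.Alg K)
    (∀ x : Γ.Edge, ∀ i : Γ.zigI v ε b x, Γ.Proj K i.1) := by
  have : ∀ x : Γ.Edge, Module.Projective (Γ.Alg K) (∀ i : Γ.zigI v ε b x, Γ.Proj K i.1) :=
    fun x => inferInstanceAs (Module.Projective (Γ.Alg K)
      (PiProj K (fun i : Γ.zigI v ε b x => i.1)))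
  exact Module.Projective.of_equiv
    (DirectSum.linearEquivFunOnFintype (Γ.Alg K) Γ.Edge
      fun x => ∀ i : Γ.zigI v ε b x, Γ.Proj K i.1)

theorem isTwoTerm_tilt (v : V) (ε : ℕ) : IsTwoTerm (dbl (Γ.tiltMap K v ε)) := by
  have := finite_tilt (Γ := Γ) (K := K) v ε 0
  have := finite_tilt (Γ := Γ) (K := K) v ε 1
  have := projective_tilt (Γ := Γ) (K := K) v ε 0
  have := projective_tilt (Γ := Γ) (K := K) v ε 1
  exact isTwoTerm_dbl _

theorem isTilting_tilt [HasDerivedCategory.{w} (ModuleCat.{max u v} (Γ.Alg K))] (v : V) (ε : ℕ) :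
    IsTilting (dbl (Γ.tiltMap K v ε)) := by
  have hT := isTwoTerm_tilt (Γ := Γ) (K := K) v ε
  refine ⟨hT.1, ?_, fun X hX => ?_⟩
  · have := finite_tilt (Γ := Γ) (K := K) v ε 0
    have := finite_tilt (Γ := Γ) (K := K) v ε 1
    have := projective_tilt (Γ := Γ) (K := K) v ε 0
    have := projective_tilt (Γ := Γ) (K := K) v ε 1
    exact subsingleton_derived_dbl_iff.2
      ⟨Γ.tilt_extOneVanish K v ε, Γ.tilt_extNegOneVanish K v ε⟩
  · refine prop_of_prop_zig (v := v) (ε := ε) (fun x => ?_) hX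
    let r := zigRetract K v ε x
    have r' : Retract (dbl (zigMap K v ε x)) (dbl (Γ.tiltMap K v ε)) :=
      { i := dblMap r.ι₀ r.ι₁ r.hι
        r := dblMap r.π₀ r.π₁ r.hπ
        retract := by
          rw [dblMap_comp, ← dblMap_id]
          congr 1
          · exact r.h₀
          · exact r.h₁ }
    exact ObjectProperty.prop_of_retract _ (r'.map DerivedCategory.Q)
      (ObjectProperty.le_triangEnvelope _ _ (by simp))

end Tilting

end BrauerTree


/-! ### Direct summands and characters of the endomorphism algebra -/

section Characters

set_option linter.unusedSectionVars false

variable {C : Type*} [Category* C] [Preadditive C] {K : Type u} [Field K] [Linear K C] {T : C}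
  {κ : Type*} {χ : κ → (End T →ₐ[K] K)}

theorem eq_zero_of_forall_char_eq_zero (hχ : ∀ z, (∀ k, χ k z = 0) → IsNilpotent z) {e : End T}
    (he : e * e = e) (h : ∀ k, χ k e = 0) : e = 0 := by
  obtain ⟨m, hm⟩ := hχ e h
  rcases m with _ | m
  · rw [pow_zero] at hm
    rw [← mul_one e, hm, mul_zero]
  · rwa [IsIdempotentElem.pow_succ_eq _ he] at hm

variable {X : C}

/-- The endomorphism of `T` given by an endomorphism of a direct summand. -/
def sandwich (p : T ⟶ X) (i : X ⟶ T) (f : End X) : End T := p ≫ f ≫ i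

theorem sandwich_mul {p : T ⟶ X} {i : X ⟶ T} (h : i ≫ p = 𝟙 X) (f g : End X) :
    sandwich p i f * sandwich p i g = sandwich p i (f * g) := by
  change (p ≫ g ≫ i) ≫ p ≫ f ≫ i = p ≫ (g ≫ f) ≫ i
  simp only [Category.assoc]
  rw [reassoc_of% h]

theorem sandwich_sub_smul (p : T ⟶ X) (i : X ⟶ T) (f g : X ⟶ X) (a : K) :
    sandwich p i (f - a • g) = sandwich p i f - a • sandwich p i g := by
  change p ≫ (f - a • g) ≫ i = p ≫ f ≫ i - a • p ≫ g ≫ i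
  rw [Preadditive.sub_comp, Preadditive.comp_sub, Linear.smul_comp, Linear.comp_smul]

theorem eq_zero_of_sandwich_eq_zero {p : T ⟶ X} {i : X ⟶ T} (h : i ≫ p = 𝟙 X) {f : End X}
    (hf : sandwich p i f = 0) : f = 0 := by
  have h1 : i ≫ (p ≫ f ≫ i) ≫ p = f := by
    simp only [Category.assoc]
    rw [h, Category.comp_id, reassoc_of% h]
  rw [← h1]
  change p ≫ f ≫ i = 0 at hf
  rw [hf, zero_comp, comp_zero]

theorem isNilpotent_of_sandwich {p : T ⟶ X} {i : X ⟶ T} (h : i ≫ p = 𝟙 X) {f : End X}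
    (hf : IsNilpotent (sandwich p i f)) : IsNilpotent f := by
  have hpow : ∀ m : ℕ, sandwich p i (f ^ (m + 1)) = sandwich p i f ^ (m + 1) := by
    intro m
    induction m with
    | zero => simp
    | succ m ih => rw [pow_succ, ← sandwich_mul h, ih, ← pow_succ]
  obtain ⟨m, hm⟩ := hf
  exact ⟨m + 1, eq_zero_of_sandwich_eq_zero h (by rw [hpow, pow_succ, hm, zero_mul])⟩

theorem isZero_of_retract_biprod_self [HasBinaryBiproducts C]
    (hχ : ∀ z, (∀ k, χ k z = 0) → IsNilpotent z) {S : C} (r : Retract (S ⊞ S) T) : IsZero S := by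
  let m : (S ⊞ S ⟶ S) → (S ⟶ S ⊞ S) → End T := fun p i => r.r ≫ p ≫ i ≫ r.i
  have hm : ∀ p i p' i', m p' i' * m p i = m p (i ≫ p' ≫ i') := by
    intro p i p' i'
    change (r.r ≫ p ≫ i ≫ r.i) ≫ r.r ≫ p' ≫ i' ≫ r.i = r.r ≫ p ≫ (i ≫ p' ≫ i') ≫ r.i
    simp
  have h0 : m biprod.fst biprod.inl = 0 := by
    refine eq_zero_of_forall_char_eq_zero hχ (by rw [hm]; simp) fun k => ?_
    have h1 := congrArg (χ k) (hm biprod.fst biprod.inr biprod.snd biprod.inl)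
    have h2 := congrArg (χ k) (hm biprod.snd biprod.inl biprod.fst biprod.inr)
    have h3 := congrArg (χ k) (hm biprod.fst biprod.inl biprod.snd biprod.inr)
    rw [biprod.inr_snd_assoc, map_mul] at h1
    rw [biprod.inl_fst_assoc, map_mul, mul_comm, h1] at h2
    rw [biprod.inl_snd_assoc, zero_comp, map_mul, ← h2] at h3
    have h4 : m biprod.fst (0 : S ⟶ S ⊞ S) = 0 := by
      change r.r ≫ biprod.fst ≫ 0 ≫ r.i = 0
      simp
    rw [h4, map_zero] at h3
    exact mul_self_eq_zero.1 h3
  rw [IsZero.iff_id_eq_zero]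
  have h5 : biprod.inl ≫ r.i ≫ (m biprod.fst biprod.inl : T ⟶ T) ≫ r.r ≫ biprod.fst = 𝟙 S := by
    change biprod.inl ≫ r.i ≫ (r.r ≫ biprod.fst ≫ biprod.inl ≫ r.i) ≫ r.r ≫ biprod.fst = 𝟙 S
    simp
  rw [← h5, h0]
  exact (congrArg _ ((congrArg _ zero_comp).trans comp_zero)).trans comp_zero

section Decomposition

variable {ι : Type*} [Fintype ι] [Fintype κ] {X : ι → C} {p : ∀ x, T ⟶ X x} {i : ∀ x, X x ⟶ T}

theorem exists_bijective_char (hχ : ∀ z, (∀ k, χ k z = 0) → IsNilpotent z)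
    (hcard : Fintype.card κ = Fintype.card ι) (hX : ∀ x, ¬ IsZero (X x))
    (hi : ∀ x, i x ≫ p x = 𝟙 (X x)) (hne : ∀ x y, x ≠ y → i x ≫ p y = 0)
    (hsum : ∑ x, p x ≫ i x = 𝟙 T) : ∃ c : κ → ι, Function.Bijective c ∧
      (∀ k, χ k (sandwich (p (c k)) (i (c k)) 1) = 1) ∧
      ∀ k x, x ≠ c k → χ k (sandwich (p x) (i x) 1) = 0 := by
  have hE : ∀ x, sandwich (p x) (i x) 1 = p x ≫ i x := fun x => by
    change p x ≫ 𝟙 _ ≫ i x = _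
    rw [Category.id_comp]
  have hs : ∀ k, ∑ x, χ k (sandwich (p x) (i x) 1) = 1 := by
    intro k
    rw [← map_sum, ← map_one (χ k)]
    congr 1
    simp only [hE]
    exact hsum
  have hex : ∀ k, ∃ x, χ k (sandwich (p x) (i x) 1) ≠ 0 := by
    intro k
    by_contra! h
    have := hs k
    rw [Finset.sum_eq_zero fun x _ => h x] at this
    exact zero_ne_one this
  choose c hc using hex
  have h0 : ∀ k x, x ≠ c k → χ k (sandwich (p x) (i x) 1) = 0 := by
    intro k x hx
    have h1 : sandwich (p x) (i x) 1 * sandwich (p (c k)) (i (c k)) 1 = 0 := by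
      rw [hE, hE]
      change (p (c k) ≫ i (c k)) ≫ p x ≫ i x = 0
      rw [Category.assoc, ← Category.assoc (i (c k)), hne _ _ hx.symm, zero_comp, comp_zero]
    have h2 := congrArg (χ k) h1
    rw [map_mul, map_zero] at h2
    exact (mul_eq_zero.1 h2).resolve_right (hc k)
  refine ⟨c, ?_, fun k => ?_, h0⟩
  · rw [Fintype.bijective_iff_surjective_and_card]
    refine ⟨fun x => ?_, hcard⟩
    by_contra! h
    refine hX x ?_
    rw [IsZero.iff_id_eq_zero]
    refine eq_zero_of_sandwich_eq_zero (hi x) (f := 1) ?_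
    exact eq_zero_of_forall_char_eq_zero hχ (by rw [sandwich_mul (hi x), mul_one])
      fun k => h0 k x (h k).symm
  · have := hs k
    rwa [Fintype.sum_eq_single (c k) (h0 k)] at this

theorem indecomposable_of_char [HasBinaryBiproducts C]
    (hχ : ∀ z, (∀ k, χ k z = 0) → IsNilpotent z)
    (hcard : Fintype.card κ = Fintype.card ι) (hX : ∀ x, ¬ IsZero (X x))
    (hi : ∀ x, i x ≫ p x = 𝟙 (X x)) (hne : ∀ x y, x ≠ y → i x ≫ p y = 0)
    (hsum : ∑ x, p x ≫ i x = 𝟙 T) (x : ι) : Indecomposable (X x) := by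
  obtain ⟨c, hc, -, hc0⟩ := exists_bijective_char hχ hcard hX hi hne hsum
  obtain ⟨k, rfl⟩ := hc.2 x
  refine ⟨hX _, fun Y Z e' => ?_⟩
  let e := e'.symm
  set x := c k
  have key : ∀ f : End (X x), f * f = f → χ k (sandwich (p x) (i x) f) = 0 → f = 0 := by
    intro f hf h
    refine eq_zero_of_sandwich_eq_zero (hi x)
      (eq_zero_of_forall_char_eq_zero hχ (by rw [sandwich_mul (hi x), hf]) fun l => ?_)
    by_cases hl : l = k
    · rw [hl, h]
    · rw [← mul_one f, ← sandwich_mul (hi x), map_mul, hc0 l x (fun h => hl (hc.1 h).symm), mul_zero]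
  let f : End (X x) := e.inv ≫ biprod.fst ≫ biprod.inl ≫ e.hom
  let g : End (X x) := e.inv ≫ biprod.snd ≫ biprod.inr ≫ e.hom
  have hf : f * f = f := by
    change (e.inv ≫ biprod.fst ≫ biprod.inl ≫ e.hom) ≫ e.inv ≫ biprod.fst ≫ biprod.inl ≫ e.hom = _
    simp [f]
  have hg : g * g = g := by
    change (e.inv ≫ biprod.snd ≫ biprod.inr ≫ e.hom) ≫ e.inv ≫ biprod.snd ≫ biprod.inr ≫ e.hom = _
    simp [g]
  have hfg : f * g = 0 := by
    change (e.inv ≫ biprod.snd ≫ biprod.inr ≫ e.hom) ≫ e.inv ≫ biprod.fst ≫ biprod.inl ≫ e.hom = _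
    simp
  have hfg' := congrArg (fun z => χ k (sandwich (p x) (i x) z)) hfg
  simp only [← sandwich_mul (hi x), map_mul] at hfg'
  rw [show sandwich (p x) (i x) 0 = 0 by simp [sandwich], map_zero] at hfg'
  rcases mul_eq_zero.1 hfg' with h | h
  · left
    have h1 : biprod.inl ≫ e.hom ≫ (f : X x ⟶ X x) ≫ e.inv ≫ biprod.fst = 𝟙 Y := by
      change biprod.inl ≫ e.hom ≫ (e.inv ≫ biprod.fst ≫ biprod.inl ≫ e.hom) ≫ e.inv ≫ biprod.fst = _
      simp
    rw [IsZero.iff_id_eq_zero, ← h1, key f hf h]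
    exact (congrArg _ ((congrArg _ zero_comp).trans comp_zero)).trans comp_zero
  · right
    have h1 : biprod.inr ≫ e.hom ≫ (g : X x ⟶ X x) ≫ e.inv ≫ biprod.snd = 𝟙 Z := by
      change biprod.inr ≫ e.hom ≫ (e.inv ≫ biprod.snd ≫ biprod.inr ≫ e.hom) ≫ e.inv ≫ biprod.snd = _
      simp
    rw [IsZero.iff_id_eq_zero, ← h1, key g hg h]
    exact (congrArg _ ((congrArg _ zero_comp).trans comp_zero)).trans comp_zero

theorem exists_retract_of_retract (hχ : ∀ z, (∀ k, χ k z = 0) → IsNilpotent z)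
    (hcard : Fintype.card κ = Fintype.card ι) (hX : ∀ x, ¬ IsZero (X x))
    (hi : ∀ x, i x ≫ p x = 𝟙 (X x)) (hne : ∀ x y, x ≠ y → i x ≫ p y = 0)
    (hsum : ∑ x, p x ≫ i x = 𝟙 T) {S : C} (r : Retract S T) (hS : ¬ IsZero S) :
    ∃ x, Nonempty (Retract (X x) S) := by
  obtain ⟨c, hc, hc1, hc0⟩ := exists_bijective_char hχ hcard hX hi hne hsum
  obtain ⟨k, hk⟩ : ∃ k, χ k (sandwich r.r r.i 1) ≠ 0 := by
    by_contra! h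
    refine hS ?_
    rw [IsZero.iff_id_eq_zero]
    exact eq_zero_of_sandwich_eq_zero r.retract (f := 1) (eq_zero_of_forall_char_eq_zero hχ
      (by rw [sandwich_mul r.retract, mul_one]) h)
  set x := c k with hx
  let f : End (X x) := i x ≫ r.r ≫ r.i ≫ p x
  have hf : sandwich (p x) (i x) f =
      sandwich (p x) (i x) 1 * sandwich r.r r.i 1 * sandwich (p x) (i x) 1 := by
    change p x ≫ (i x ≫ r.r ≫ r.i ≫ p x) ≫ i x =
      (p x ≫ 𝟙 _ ≫ i x) ≫ (r.r ≫ 𝟙 _ ≫ r.i) ≫ p x ≫ 𝟙 _ ≫ i x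
    simp
  have hfk : χ k (sandwich (p x) (i x) f) ≠ 0 := by
    rw [hf, map_mul, map_mul, hc1, one_mul, mul_one]
    exact hk
  set a := χ k (sandwich (p x) (i x) f) with ha
  have hnil : IsNilpotent (f - a • 1) := by
    refine isNilpotent_of_sandwich (hi x) (hχ _ fun l => ?_)
    by_cases hl : l = k
    · subst hl
      rw [sandwich_sub_smul, map_sub, map_smul, hc1, ← ha, smul_eq_mul, mul_one, sub_self]
    · rw [← mul_one (f - a • 1), ← sandwich_mul (hi x), map_mul,
        hc0 l x (fun h => hl (hc.1 h).symm), mul_zero]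
  have hu : IsUnit f := by
    have h1 : IsUnit (a • (1 : End (X x))) := by
      rw [← Algebra.algebraMap_eq_smul_one]
      exact (IsUnit.mk0 a hfk).map (algebraMap K (End (X x)))
    have h2 := hnil.isUnit_add_left_of_commute h1 (by
      rw [← Algebra.algebraMap_eq_smul_one]
      exact (Algebra.commutes a _).symm)
    rwa [add_sub_cancel] at h2
  obtain ⟨u, hu⟩ := hu
  refine ⟨x, ⟨⟨i x ≫ r.r, r.i ≫ p x ≫ (u⁻¹ : (End (X x))ˣ).1, ?_⟩⟩⟩
  have h3 : (u⁻¹ : (End (X x))ˣ).1 * f = 1 := by rw [← hu, Units.inv_mul]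
  change f ≫ (u⁻¹ : (End (X x))ˣ).1 = 𝟙 _ at h3
  rw [← h3]
  change (i x ≫ r.r) ≫ r.i ≫ p x ≫ _ = (i x ≫ r.r ≫ r.i ≫ p x) ≫ _
  simp only [Category.assoc]

end Decomposition

theorem nonempty_iso_of_retract_of_indecomposable {C : Type*} [Category* C] [Preadditive C]
    [HasZeroObject C] [HasShift C ℤ] [∀ n : ℤ, (shiftFunctor C n).Additive] [Pretriangulated C]
    [HasBinaryBiproducts C] {X S : C} (r : Retract X S) (hX : ¬ IsZero X) (hS : Indecomposable S) :
    Nonempty (X ≅ S) := by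
  obtain ⟨Z, g, h, hT⟩ := Pretriangulated.distinguished_cocone_triangle r.i
  have h0 : h = 0 := by
    have h1 := Pretriangulated.comp_distTriang_mor_zero₃₁ _ hT
    change h ≫ (shiftFunctor C (1 : ℤ)).map r.i = 0 at h1
    have h2 : h ≫ (shiftFunctor C (1 : ℤ)).map (r.i ≫ r.r) = 0 := by
      rw [Functor.map_comp, reassoc_of% h1, zero_comp]
    rwa [r.retract, CategoryTheory.Functor.map_id, Category.comp_id] at h2
  obtain ⟨e, he, -⟩ := Pretriangulated.exists_iso_binaryBiproduct_of_distTriang _ hT h0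
  rcases hS.2 X Z e with h1 | h1
  · exact (hX h1).elim
  · exact ⟨isoBiprodZero h1 ≪≫ e.symm⟩

end Characters


/-! ### The direct summands of the tilting complexes -/

namespace BrauerTree

section Nilpotent

set_option linter.unusedSectionVars false

variable {V : Type v} [Finite V] {Γ : BrauerTree V} {K : Type u} [Field K]

variable (Γ K) in
/-- The span of the paths of length at least `m`. -/
noncomputable def pathSpan (m : ℕ) : Submodule K (Γ.Alg K) :=
  Submodule.span K (Set.range fun p : ℕ × Γ.Arrow => Γ.path K (p.1 + m) p.2)

theorem sub_sum_char_mem_pathSpan [Fintype Γ.Edge] (z : Γ.Alg K) :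
    z - ∑ i, Γ.char K i z • Γ.idem K i ∈ Γ.pathSpan K 1 := by
  induction Γ.mem_span_path K z using Submodule.span_induction with
  | mem z hz =>
    rcases hz with ⟨j, rfl⟩ | ⟨p, rfl⟩
    · rw [Fintype.sum_eq_single j fun i hi => by
        rw [Γ.char_idem_of_ne K hi.symm, zero_smul], char_idem_self, one_smul, sub_self]
      exact Submodule.zero_mem _
    · simp only [char_path_succ, zero_smul, Finset.sum_const_zero, sub_zero]
      exact Submodule.subset_span ⟨p, rfl⟩
  | zero => simp
  | add y z _ _ hy hz =>
    have := Submodule.add_mem _ hy hz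
    simp only [map_add, add_smul, Finset.sum_add_distrib]
    convert this using 1
    abel
  | smul c z _ hz =>
    have := Submodule.smul_mem _ c hz
    rw [smul_sub, Finset.smul_sum] at this
    simpa only [map_smul, smul_assoc] using this

theorem mul_mem_pathSpan {m : ℕ} (hm : 0 < m) {y z : Γ.Alg K} (hy : y ∈ Γ.pathSpan K 1)
    (hz : z ∈ Γ.pathSpan K m) : y * z ∈ Γ.pathSpan K (m + 1) := by
  induction hy, hz using Submodule.span_induction₂ with
  | mem_mem y z hy hz =>
    obtain ⟨⟨k, a⟩, rfl⟩ := hy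
    obtain ⟨⟨l, b⟩, rfl⟩ := hz
    by_cases h : Γ.next^[k + 1] a = b
    · subst h
      dsimp only
      rw [path_add]
      exact Submodule.subset_span ⟨(k + l, a), by dsimp only; congr 1; omega⟩
    · rw [Γ.path_mul_path_of_ne K (by omega) (by omega) h]
      exact Submodule.zero_mem _
  | zero_left => simp
  | zero_right => simp
  | add_left x y z _ _ _ hx hy => rw [add_mul]; exact Submodule.add_mem _ hx hy
  | add_right x y z _ _ _ hx hy => rw [mul_add]; exact Submodule.add_mem _ hx hy
  | smul_left c x y _ _ h => rw [smul_mul_assoc]; exact Submodule.smul_mem _ c h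
  | smul_right c x y _ _ h => rw [mul_smul_comm]; exact Submodule.smul_mem _ c h

theorem isNilpotent_of_forall_char_eq_zero {z : Γ.Alg K} (h : ∀ i, Γ.char K i z = 0) :
    IsNilpotent z := by
  have := Fintype.ofFinite Γ.Edge
  have hz : z ∈ Γ.pathSpan K 1 := by
    simpa [h] using sub_sum_char_mem_pathSpan z
  have hpow : ∀ m, z ^ (m + 1) ∈ Γ.pathSpan K (m + 1) := by
    intro m
    induction m with
    | zero => simpa using hz
    | succ m ih => rw [pow_succ']; exact mul_mem_pathSpan (by omega) hz ih
  obtain ⟨M, hM⟩ := (Set.finite_range Γ.per).bddAbove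
  refine ⟨M + 1, ?_⟩
  have h0 : Γ.pathSpan K (M + 1) ≤ ⊥ := by
    rw [pathSpan, Submodule.span_le]
    rintro _ ⟨⟨k, a⟩, rfl⟩
    refine (Γ.path_eq_zero K ?_ : Γ.path K (k + (M + 1)) a = 0)
    have := hM ⟨a, rfl⟩
    omega
  exact (Submodule.mem_bot K).1 (h0 (hpow M))

end Nilpotent

section Summands

set_option linter.unusedSectionVars false

variable {V : Type v} [Fintype V] {Γ : BrauerTree V} {K : Type u} [Field K]
  [Fintype Γ.Edge] [DecidableEq Γ.Edge] {n : ℕ}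

theorem EndIsStar.exists_char {T : Γ.Cplx K} (hT : EndIsStar n T) :
    ∃ (κ : Type) (_ : Fintype κ) (χ : κ → (End (toHtpy T) →ₐ[K] K)),
      Fintype.card κ = n ∧ ∀ z, (∀ k, χ k z = 0) → IsNilpotent z := by
  obtain ⟨S, -, ⟨φ⟩⟩ := hT
  have := Fintype.ofFinite S.Edge
  refine ⟨S.Edge, inferInstance, fun k => (S.char K k).comp φ.toAlgHom, ?_, fun z hz => ?_⟩
  · have := S.card_edge
    simp only [Fintype.card_fin] at this
    omega
  · have h : IsNilpotent (φ z) := isNilpotent_of_forall_char_eq_zero hz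
    exact (IsNilpotent.map_iff φ.injective).1 h

theorem isBasic_of_endIsStar {T : Γ.Cplx K} (hT : EndIsStar n T) : IsBasic T := by
  rintro S ⟨r⟩
  obtain ⟨κ, _, χ, -, hχ⟩ := hT.exists_char
  exact isZero_of_retract_biprod_self hχ r

theorem not_isZero_zigMap (v : V) (ε : ℕ) (x : Γ.Edge) :
    ¬ IsZero (toHtpy (dbl (zigMap K v ε x))) := by
  intro h
  have h1 := finrank_zigMap_hom (K := K) (v := v) (ε := ε) x x
  have : Subsingleton (toHtpy (dbl (zigMap K v ε x)) ⟶ toHtpy (dbl (zigMap K v ε x))) :=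
    ⟨fun f g => h.eq_of_src f g⟩
  rw [Module.finrank_zero_of_subsingleton, if_pos rfl] at h1
  omega

theorem isIndecSummand_zigMap (hn : 2 ≤ n) (hcard : Fintype.card Γ.Edge = n) (v : V) (ε : ℕ)
    (x : Γ.Edge) : IsIndecSummand (dbl (zigMap K v ε x)) (dbl (Γ.tiltMap K v ε)) := by
  obtain ⟨κ, _, χ, hκ, hχ⟩ := (endIsStar_tilt (K := K) hn hcard v ε).exists_char
  refine ⟨(isTwoTerm_dbl _).1, ?_, ⟨⟨_, _, (zigRetract K v ε x).incl_proj⟩⟩⟩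
  exact indecomposable_of_char hχ (hκ.trans hcard.symm) (not_isZero_zigMap v ε)
    (fun x => (zigRetract K v ε x).incl_proj) (fun x y => zigRetract_incl_proj_of_ne)
    sum_zigRetract x

theorem IsIndecSummand.exists_iso_zigMap (hn : 2 ≤ n) (hcard : Fintype.card Γ.Edge = n) {v : V}
    {ε : ℕ} {S : Γ.Cplx K} (hS : IsIndecSummand S (dbl (Γ.tiltMap K v ε))) :
    ∃ x, Nonempty (toHtpy S ≅ toHtpy (dbl (zigMap K v ε x))) := by
  obtain ⟨-, hS, ⟨r⟩⟩ := hS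
  obtain ⟨κ, _, χ, hκ, hχ⟩ := (endIsStar_tilt (K := K) hn hcard v ε).exists_char
  obtain ⟨x, ⟨r'⟩⟩ := exists_retract_of_retract hχ (hκ.trans hcard.symm) (not_isZero_zigMap v ε)
    (fun x => (zigRetract K v ε x).incl_proj) (fun x y => zigRetract_incl_proj_of_ne)
    sum_zigRetract r hS.1
  obtain ⟨e⟩ := nonempty_iso_of_retract_of_indecomposable r' (not_isZero_zigMap v ε x) hS
  exact ⟨x, ⟨e.symm⟩⟩

end Summands

end BrauerTree


/-! ### The diagrams of the zigzag complexes -/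

namespace BrauerTree

section Diagram

set_option linter.unusedSectionVars false

variable {V : Type v} [Finite V] {Γ : BrauerTree V} {K : Type u} [Field K] [Fintype Γ.Edge]
  {v : V} {ε : ℕ}

theorem mem_root_iff {i : Γ.Edge} : v ∈ i.1 ↔ Γ.lev v i = 0 := by
  rw [Γ.mem_iff_top_or_bot v, ← Γ.top_eq_root_iff v]
  exact ⟨fun h => (h.resolve_right (Γ.bot_ne_root v i).symm).symm, fun h => Or.inl h.symm⟩

theorem homOf_smul_gen_ne_zero {i j : Γ.Edge} {z : Γ.Alg K} (hz : z ∈ Γ.corner K i j)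
    (h0 : z ≠ 0) : homOf (Γ := Γ) (K := K) i (z • Γ.gen K j) ≠ 0 := by
  intro h
  have h1 := congrArg (Subtype.val : Γ.Proj K j → Γ.Alg K) (LinearMap.congr_fun h (Γ.gen K i))
  refine h0 ?_
  change Γ.idem K i * (z * Γ.idem K j) = 0 at h1
  obtain ⟨h2, h3⟩ := (Γ.mem_corner K).1 hz
  rwa [h3, h2] at h1

theorem conn_ne_zero {i j : Γ.Edge} {y : V} (hi : y ∈ i.1) (hj : y ∈ j.1) :
    Γ.conn K i j ≠ 0 := by
  obtain ⟨a, k, hk, rfl, rfl, -⟩ := exists_conn_eq_path hi hj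
  rw [Γ.conn_source K hk]
  exact Γ.path_ne_zero K hk.le

theorem zig_comp_ne_zero_iff {x : Γ.Edge} (i : Γ.zigI v ε 0 x) (j : Γ.zigI v ε 1 x) :
    (Γ.zig K v ε x).comp i j ≠ 0 ↔
      (Γ.lev v i.1 + 1 = Γ.lev v j.1 ∨ Γ.lev v j.1 + 1 = Γ.lev v i.1) := by
  constructor
  · intro h
    by_contra h'
    refine h ?_
    change homOf i.1 (Γ.zigEnt K v i j • Γ.gen K j.1) = 0
    rw [zigEnt, if_neg h', zero_smul]
    ext
    simp
  · intro h
    refine homOf_smul_gen_ne_zero (Γ.zigEnt_mem_corner K v _ _) ?_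
    rw [zigEnt, if_pos h]
    obtain ⟨y, h1, h2⟩ := (mem_zigI.1 i.2).1.exists_mem (mem_zigI.1 j.2).1 h
    exact conn_ne_zero h1 h2

theorem eq_of_onPath_of_mem_root {i j y : Γ.Edge}
    (h : Γ.bot v i = Γ.top v j ∨ Γ.bot v j = Γ.top v i) (hy : Γ.OnPath i j y) (hv : v ∈ y.1) :
    y = i ∨ y = j := by
  obtain ⟨a, k, l, -, -, rfl, rfl, rfl⟩ := hy
  have hne : Γ.source a ≠ Γ.source (Γ.next^[k] a) := by
    rintro h'
    rw [← h'] at h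
    rcases h with h | h <;> exact Γ.top_ne_bot v _ h.symm
  have hmem : ∀ m, a.fst ∈ (Γ.source (Γ.next^[m] a)).1 := fun m => by
    rw [← Γ.iterate_next_fst a m]
    exact Γ.fst_mem_source _
  have key : ∀ {i j : Γ.Edge}, i ≠ j → a.fst ∈ i.1 → a.fst ∈ j.1 → Γ.bot v i = Γ.top v j →
      Γ.source (Γ.next^[l] a) = i := by
    intro i j hij hi hj hb
    have h1 : a.fst = Γ.bot v i := Γ.eq_of_mem_of_mem hij hi hj
      ((Γ.mem_iff_top_or_bot v).2 (Or.inr rfl)) ((Γ.mem_iff_top_or_bot v).2 (Or.inl hb))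
    rcases (Γ.mem_iff_top_or_bot v).1 (hmem l) with h2 | h2
    · rw [mem_root_iff, ← Γ.top_eq_root_iff v, ← h2, h1] at hv
      exact (Γ.bot_ne_root v i hv).elim
    · exact Γ.bot_injective v (h2.symm.trans h1)
  rcases h with h | h
  · exact Or.inl (key hne (hmem 0) (hmem k) h)
  · exact Or.inr (key hne.symm (hmem k) (hmem 0) h)

theorem zig_onlyVertexOn {Υ : Cycle Γ.Arrow} (hΥ : ∀ x, Γ.OnCycle x Υ ↔ v ∈ x.1) (x : Γ.Edge) :
    (Γ.zig K v ε x).OnlyVertexOn (Γ.anc v x 0) Υ := by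
  have h0 := isAnc_anc (v := v) (Nat.zero_le (Γ.lev v x))
  have hl := Γ.lev_anc v (Nat.zero_le (Γ.lev v x))
  refine ⟨(hΥ _).2 (mem_root_iff.2 hl), fun y hy hyΥ => ?_⟩
  rw [hΥ] at hyΥ
  have key : Γ.IsAnc v y x → y = Γ.anc v x 0 := fun h =>
    h.eq_of_lev_eq h0 ((mem_root_iff.1 hyΥ).trans hl.symm)
  rcases hy with hy | hy | ⟨i, j, hc, hp⟩
  · exact key (mem_zigI.1 hy).1
  · exact key (mem_zigI.1 hy).1
  · have hi := (mem_zigI.1 i.2).1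
    have hj := (mem_zigI.1 j.2).1
    have hb : Γ.bot v i.1 = Γ.top v j.1 ∨ Γ.bot v j.1 = Γ.top v i.1 := by
      rcases (zig_comp_ne_zero_iff i j).1 hc with h | h
      · left
        rw [hj.eq_par_of_lev_eq hi h.symm]
        exact Γ.bot_par v (by omega)
      · right
        rw [hi.eq_par_of_lev_eq hj h.symm]
        exact Γ.bot_par v (by omega)
    rcases eq_of_onPath_of_mem_root hb hp hyΥ with rfl | rfl
    · exact key hi
    · exact key hj

theorem zig_degOneSource {x : Γ.Edge} (hx : Γ.lev v x ≠ 0) :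
    (Γ.zig K v 0 x).DegOneSource (Γ.anc v x 0) := by
  have hl := Γ.lev_anc v (Nat.zero_le (Γ.lev v x))
  have hl1 := Γ.lev_anc v (x := x) (k := 1) (by omega)
  refine ⟨mem_zigI.2 ⟨isAnc_anc (Nat.zero_le _), by omega⟩,
    ⟨Γ.anc v x 1, mem_zigI.2 ⟨isAnc_anc (by omega), by omega⟩⟩, ?_, fun j hj => ?_⟩
  · exact (zig_comp_ne_zero_iff _ _).2 (Or.inl (by rw [hl, hl1]))
  · have := (zig_comp_ne_zero_iff _ _).1 hj
    rw [hl] at this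
    exact Subtype.ext ((mem_zigI.1 j.2).1.eq_of_lev_eq (isAnc_anc (k := 1) (by omega))
      (by rw [hl1]; omega))

theorem zig_degOneSink {x : Γ.Edge} (hx : Γ.lev v x ≠ 0) :
    (Γ.zig K v 1 x).DegOneSink (Γ.anc v x 0) := by
  have hl := Γ.lev_anc v (Nat.zero_le (Γ.lev v x))
  have hl1 := Γ.lev_anc v (x := x) (k := 1) (by omega)
  refine ⟨mem_zigI.2 ⟨isAnc_anc (Nat.zero_le _), by omega⟩,
    ⟨Γ.anc v x 1, mem_zigI.2 ⟨isAnc_anc (by omega), by omega⟩⟩, ?_, fun j hj => ?_⟩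
  · exact (zig_comp_ne_zero_iff _ _).2 (Or.inr (by rw [hl, hl1]))
  · have := (zig_comp_ne_zero_iff _ _).1 hj
    rw [hl] at this
    exact Subtype.ext ((mem_zigI.1 j.2).1.eq_of_lev_eq (isAnc_anc (k := 1) (by omega))
      (by rw [hl1]; omega))

theorem zigI_of_lev_eq_zero {b : ℕ} {x : Γ.Edge} (hx : Γ.lev v x = 0) :
    Γ.zigI v ε b x = if ε % 2 = b then {x} else ∅ := by
  have h1 : ∀ i, Γ.IsAnc v i x ↔ i = x := fun i => by
    refine ⟨fun h => ?_, fun h => by rw [h]; exact isAnc_self x⟩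
    have := h.1
    exact h.eq_of_lev_eq (isAnc_self x) (by omega)
  ext i
  rw [mem_zigI, h1]
  split_ifs with h
  · rw [Finset.mem_singleton, and_iff_left_iff_imp]
    rintro rfl
    omega
  · simp only [Finset.notMem_empty, iff_false]
    rintro ⟨rfl, h2⟩
    omega

end Diagram

section Stalk

set_option linter.unusedSectionVars false

variable {V : Type v} [Finite V] {Γ : BrauerTree V} {K : Type u} [Field K]

/-- The product over a one-element set of edges. -/
noncomputable def piSingletonEquiv {I : Finset Γ.Edge} {x : Γ.Edge} (h : I = {x}) :
    (∀ i : I, Γ.Proj K i.1) ≃ₗ[Γ.Alg K] Γ.Proj K x :=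
  letI : Unique I := { default := ⟨x, by simp [h]⟩, uniq := fun i => Subtype.ext (by
    exact Finset.mem_singleton.1 (h.subset i.2)) }
  LinearEquiv.piUnique (Γ.Alg K) (fun i : I => Γ.Proj K i.1)

theorem nonempty_iso_stalk_zero (D : Γ.Presentation K) {x : Γ.Edge} (hI : D.I = {x})
    (hJ : D.J = ∅) : Nonempty (toHtpy D.complex ≅ toHtpy (Γ.stalk K 0 x)) := by
  have : IsEmpty D.J := by rw [hJ]; infer_instance
  have : Module.Projective (Γ.Alg K) (∀ i : D.I, Γ.Proj K i.1) :=
    Module.Projective.of_equiv (piSingletonEquiv hI).symm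
  obtain ⟨e⟩ := nonempty_iso_single_zero D.map
  exact ⟨(HomotopyCategory.quotient _ _).mapIso (e ≪≫
    (HomologicalComplex.single _ (ComplexShape.up ℤ) 0).mapIso (piSingletonEquiv hI).toModuleIso)⟩

theorem nonempty_iso_stalk_one (D : Γ.Presentation K) {x : Γ.Edge} (hI : D.I = ∅)
    (hJ : D.J = {x}) : Nonempty (toHtpy D.complex ≅ toHtpy (Γ.stalk K 1 x)) := by
  have : IsEmpty D.I := by rw [hI]; infer_instance
  have : Module.Projective (Γ.Alg K) (∀ i : D.J, Γ.Proj K i.1) :=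
    Module.Projective.of_equiv (piSingletonEquiv hJ).symm
  obtain ⟨e⟩ := nonempty_iso_single_one D.map
  exact ⟨(HomotopyCategory.quotient _ _).mapIso (e ≪≫
    (HomologicalComplex.single _ (ComplexShape.up ℤ) 1).mapIso (piSingletonEquiv hJ).toModuleIso)⟩

theorem isSourceSummand_zigMap [Fintype Γ.Edge] {v : V} {Υ : Cycle Γ.Arrow}
    (hΥ : ∀ x, Γ.OnCycle x Υ ↔ v ∈ x.1) {x : Γ.Edge} {S : Γ.Cplx K}
    (e : toHtpy S ≅ toHtpy (dbl (zigMap K v 0 x))) : IsSourceSummand Υ S := by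
  by_cases hx : Γ.lev v x = 0
  · refine Or.inl ⟨x, (hΥ x).2 (mem_root_iff.2 hx), ?_⟩
    obtain ⟨e'⟩ := nonempty_iso_stalk_zero (Γ.zig K v 0 x) (zigI_of_lev_eq_zero hx)
      (zigI_of_lev_eq_zero hx)
    exact ⟨e ≪≫ e'⟩
  · exact Or.inr ⟨Γ.zig K v 0 x, ⟨e⟩, _, zig_degOneSource hx, zig_onlyVertexOn hΥ x⟩

theorem isSinkSummand_zigMap [Fintype Γ.Edge] {v : V} {Υ : Cycle Γ.Arrow}
    (hΥ : ∀ x, Γ.OnCycle x Υ ↔ v ∈ x.1) {x : Γ.Edge} {S : Γ.Cplx K}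
    (e : toHtpy S ≅ toHtpy (dbl (zigMap K v 1 x))) : IsSinkSummand Υ S := by
  by_cases hx : Γ.lev v x = 0
  · refine Or.inl ⟨x, (hΥ x).2 (mem_root_iff.2 hx), ?_⟩
    obtain ⟨e'⟩ := nonempty_iso_stalk_one (Γ.zig K v 1 x) (zigI_of_lev_eq_zero hx)
      (zigI_of_lev_eq_zero hx)
    exact ⟨e ≪≫ e'⟩
  · exact Or.inr ⟨Γ.zig K v 1 x, ⟨e⟩, _, zig_degOneSink hx, zig_onlyVertexOn hΥ x⟩

theorem cls_coe [Fintype V] (I : Finset Γ.Edge) (v : V) :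
    Γ.cls (fun i : I => i.1) v = ∑ i ∈ I, Γ.inc i v :=
  Finset.sum_coe_sort I fun i => Γ.inc i v

theorem sum_inc_eq_one {I : Finset Γ.Edge} {x : Γ.Edge} {v : V} (hx : x ∈ I)
    (h : ∀ y ∈ I, v ∈ y.1 ↔ y = x) : ∑ i ∈ I, Γ.inc i v = 1 := by
  rw [Finset.sum_eq_single_of_mem x hx fun y hy hyx => by
    rw [inc, if_neg fun hv => hyx ((h y hy).1 hv)], inc, if_pos ((h x hx).2 rfl)]

theorem sum_inc_eq_zero {I : Finset Γ.Edge} {v : V} (h : ∀ y ∈ I, v ∉ y.1) :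
    ∑ i ∈ I, Γ.inc i v = 0 :=
  Finset.sum_eq_zero fun y hy => by rw [inc, if_neg (h y hy)]

theorem IsSourceSummand.exists_presentation [Fintype V] {v : V} {Υ : Cycle Γ.Arrow}
    (hΥ : ∀ x, Γ.OnCycle x Υ ↔ v ∈ x.1) {S : Γ.Cplx K} (hS : IsSourceSummand Υ S) :
    ∃ D : Γ.Presentation K, Nonempty (toHtpy S ≅ toHtpy D.complex) ∧
      Γ.cls (fun i : D.I => i.1) v - Γ.cls (fun i : D.J => i.1) v = 1 := by
  simp only [cls_coe]
  rcases hS with ⟨x, hx, ⟨e⟩⟩ | ⟨D, e, x, ⟨hx, -⟩, h1, h2⟩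
  · obtain ⟨e'⟩ := nonempty_iso_stalk_zero (Γ := Γ) (K := K) ⟨{x}, ∅, by simp, fun _ _ => 0⟩ rfl rfl
    refine ⟨_, ⟨e ≪≫ e'.symm⟩, ?_⟩
    rw [Finset.sum_singleton, Finset.sum_empty, inc, if_pos ((hΥ x).1 hx), sub_zero]
  · refine ⟨D, e, ?_⟩
    rw [sum_inc_eq_one hx fun y hy => ⟨fun hv => h2 y (Or.inl hy) ((hΥ y).2 hv), fun h => by
      rw [h]
      exact (hΥ x).1 h1⟩, sum_inc_eq_zero fun y hy hv => ?_, sub_zero]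
    rw [h2 y (Or.inr (Or.inl hy)) ((hΥ y).2 hv)] at hy
    exact Finset.disjoint_left.1 D.disjoint hx hy

theorem IsSinkSummand.exists_presentation [Fintype V] {v : V} {Υ : Cycle Γ.Arrow}
    (hΥ : ∀ x, Γ.OnCycle x Υ ↔ v ∈ x.1) {S : Γ.Cplx K} (hS : IsSinkSummand Υ S) :
    ∃ D : Γ.Presentation K, Nonempty (toHtpy S ≅ toHtpy D.complex) ∧
      Γ.cls (fun i : D.I => i.1) v - Γ.cls (fun i : D.J => i.1) v = -1 := by
  simp only [cls_coe]
  rcases hS with ⟨x, hx, ⟨e⟩⟩ | ⟨D, e, x, ⟨hx, -⟩, h1, h2⟩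
  · obtain ⟨e'⟩ := nonempty_iso_stalk_one (Γ := Γ) (K := K) ⟨∅, {x}, by simp, fun _ _ => 0⟩ rfl rfl
    refine ⟨_, ⟨e ≪≫ e'.symm⟩, ?_⟩
    rw [Finset.sum_singleton, Finset.sum_empty, inc, if_pos ((hΥ x).1 hx), zero_sub]
  · refine ⟨D, e, ?_⟩
    rw [sum_inc_eq_one hx fun y hy => ⟨fun hv => h2 y (Or.inr (Or.inl hy)) ((hΥ y).2 hv),
      fun h => by
        rw [h]
        exact (hΥ x).1 h1⟩, sum_inc_eq_zero fun y hy hv => ?_, zero_sub]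
    rw [h2 y (Or.inl hy) ((hΥ y).2 hv)] at hy
    exact Finset.disjoint_left.1 D.disjoint hy hx

end Stalk

end BrauerTree


/-! ### Classification -/

section DerivedIso

variable {A : Type u} [Ring A] [HasDerivedCategory.{v} (ModuleCat.{w} A)]

theorem subsingleton_derived_of_iso {X X' Y Y' : CochainComplex (ModuleCat.{w} A) ℤ}
    (e : toHtpy X ≅ toHtpy X') (e' : toHtpy Y ≅ toHtpy Y') {i : ℤ}
    (h : Subsingleton (DerivedCategory.Q.obj X ⟶ (DerivedCategory.Q.obj Y)⟦i⟧)) :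
    Subsingleton (DerivedCategory.Q.obj X' ⟶ (DerivedCategory.Q.obj Y')⟦i⟧) := by
  have key : ∀ {X X' : CochainComplex (ModuleCat.{w} A) ℤ}, (toHtpy X ≅ toHtpy X') →
      Nonempty (DerivedCategory.Q.obj X ≅ DerivedCategory.Q.obj X') := fun {X X'} e =>
    ⟨(DerivedCategory.quotientCompQhIso _).symm.app X ≪≫ DerivedCategory.Qh.mapIso e ≪≫
      (DerivedCategory.quotientCompQhIso _).app X'⟩
  obtain ⟨a⟩ := key e
  obtain ⟨b⟩ := key e'
  exact (Iso.homCongr a ((shiftFunctor _ i).mapIso b)).symm.subsingleton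

end DerivedIso

namespace BrauerTree

section Classification

set_option linter.unusedSectionVars false

variable {V : Type v} [Fintype V] {Γ : BrauerTree V} {K : Type u} [Field K]

theorem cls_eq_of_iso [HasDerivedCategory.{w} (ModuleCat.{max u v} (Γ.Alg K))]
    {α₀ α₁ β₀ β₁ : Type v} [Fintype α₀] [Fintype α₁] [Fintype β₀]
    [Fintype β₁] {s₀ : α₀ → Γ.Edge} {s₁ : α₁ → Γ.Edge} {t₀ : β₀ → Γ.Edge} {t₁ : β₁ → Γ.Edge}
    {f : PiProj K s₀ →ₗ[Γ.Alg K] PiProj K s₁} {g : PiProj K t₀ →ₗ[Γ.Alg K] PiProj K t₁}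
    (h₁ : ExtOneVanish f f) (h₂ : ExtNegOneVanish f f) (e : toHtpy (dbl f) ≅ toHtpy (dbl g))
    (x : V) : Γ.cls s₀ x - Γ.cls s₁ x = Γ.cls t₀ x - Γ.cls t₁ x := by
  have h := subsingleton_derived_dbl_iff.2 ⟨h₁, h₂⟩
  obtain ⟨h₃, h₄⟩ := subsingleton_derived_dbl_iff.1 fun i hi =>
    subsingleton_derived_of_iso (Iso.refl _) e (h i hi)
  obtain ⟨h₅, h₆⟩ := subsingleton_derived_dbl_iff.1 fun i hi =>
    subsingleton_derived_of_iso e e (h i hi)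
  have e₁ := finrank_htpy_hom_PiProj h₁ h₂
  have e₂ := finrank_htpy_hom_PiProj h₃ h₄
  have e₃ := finrank_htpy_hom_PiProj h₅ h₆
  rw [(Linear.homCongr K (Iso.refl (toHtpy (dbl f))) e).finrank_eq] at e₁
  rw [(Linear.homCongr K e (Iso.refl (toHtpy (dbl g)))).finrank_eq] at e₂
  rw [e₃] at e₂
  have e₄ := finrank_htpy_hom_PiProj h₃ h₄
  rw [e₄] at e₁
  have hs : ∑ x, ((Γ.cls s₀ x - Γ.cls s₁ x) - (Γ.cls t₀ x - Γ.cls t₁ x)) ^ 2 = 0 := by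
    have : ∀ x, ((Γ.cls s₀ x - Γ.cls s₁ x) - (Γ.cls t₀ x - Γ.cls t₁ x)) ^ 2 =
        (Γ.cls s₀ x - Γ.cls s₁ x) * (Γ.cls s₀ x - Γ.cls s₁ x) -
        (Γ.cls s₀ x - Γ.cls s₁ x) * (Γ.cls t₀ x - Γ.cls t₁ x) -
        ((Γ.cls s₀ x - Γ.cls s₁ x) * (Γ.cls t₀ x - Γ.cls t₁ x) -
        (Γ.cls t₀ x - Γ.cls t₁ x) * (Γ.cls t₀ x - Γ.cls t₁ x)) := fun x => by ring
    simp only [this, Finset.sum_sub_distrib]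
    linarith
  have h0 := (Finset.sum_eq_zero_iff_of_nonneg fun x _ => sq_nonneg _).1 hs x (Finset.mem_univ x)
  exact sub_eq_zero.1 (pow_eq_zero_iff (two_ne_zero)|>.1 h0)

variable [Fintype Γ.Edge]

theorem sum_cls_zig [DecidableEq V] (v : V) (ε : ℕ) (y : V) :
    ∑ x, (Γ.cls (fun i : Γ.zigI v ε 0 x => i.1) y - Γ.cls (fun i : Γ.zigI v ε 1 x => i.1) y) =
      (-1) ^ ε * (Γ.sgn v y * if y = v then (Fintype.card Γ.Edge : ℤ) else -1) := by
  simp only [cls_zig]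
  rw [← Finset.mul_sum]
  congr 1
  by_cases hy : y = v
  · subst hy
    have h1 : ∀ x, y ≠ Γ.bot y x := fun x => (Γ.bot_ne_root y x).symm
    simp [h1, sgn_root]
  · obtain ⟨x, rfl⟩ := Γ.exists_bot_eq v hy
    rw [Fintype.sum_eq_single x fun x' hx' => ?_]
    · simp [hy]
    · rw [if_neg hy, if_neg fun h => hx' (Γ.bot_injective v h).symm]
      simp

theorem exists_iso_tilt_of_cls [DecidableEq V] [DecidableEq Γ.Edge] [Infinite K]
    {α₀ α₁ : Type v} [Fintype α₀] [Fintype α₁]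
    {s₀ : α₀ → Γ.Edge} {s₁ : α₁ → Γ.Edge} {f : PiProj K s₀ →ₗ[Γ.Alg K] PiProj K s₁}
    (h₁ : ExtOneVanish f f) {v : V} {ε : ℕ} (h : ∀ y, Γ.cls s₀ y - Γ.cls s₁ y =
      (-1) ^ ε * (Γ.sgn v y * if y = v then (Fintype.card Γ.Edge : ℤ) else -1)) :
    Nonempty (toHtpy (dbl f) ≅ toHtpy (dbl (Γ.tiltMap K v ε))) := by
  let t : ∀ b, (Σ x : Γ.Edge, Γ.zigI v ε b x) → Γ.Edge := fun b p => p.2.1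
  let c : ∀ b, PiProj K (t b) ≃ₗ[Γ.Alg K] (∀ x : Γ.Edge, ∀ i : Γ.zigI v ε b x, Γ.Proj K i.1) :=
    fun b => LinearEquiv.piCurry (Γ.Alg K) fun x (i : Γ.zigI v ε b x) => Γ.Proj K i.1
  let g : PiProj K (t 0) →ₗ[Γ.Alg K] PiProj K (t 1) :=
    (c 1).symm.toLinearMap ∘ₗ Γ.tiltMap K v ε ∘ₗ (c 0).toLinearMap
  have hg : (Γ.tiltMap K v ε).comp (c 0).toLinearMap = (c 1).toLinearMap.comp g := by
    ext1 z
    simp [g]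
  have hg1 : ExtOneVanish g g :=
    (Γ.tilt_extOneVanish K v ε).of_equiv (c 0).symm (c 1).symm
      (LinearMap.ext fun z => by simp [g])
  obtain ⟨e⟩ := nonempty_iso_of_cls_eq h₁ hg1 fun y => by
    rw [h, ← sum_cls_zig]
    simp only [cls, Fintype.sum_sigma, Finset.sum_sub_distrib, t]
  exact ⟨e ≪≫ (HomotopyCategory.quotient _ _).mapIso (dblIso (c 0) (c 1) hg)⟩

theorem IsStarTilting.exists_iso_tilt [DecidableEq Γ.Edge] [Infinite K]
    [HasDerivedCategory.{w} (ModuleCat.{max u v} (Γ.Alg K))] {n : ℕ}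
    (hn : Fintype.card Γ.Edge = n) {T : Γ.Cplx K} (hT : IsStarTilting n T) :
    ∃ p : V × Fin 2, Nonempty (toHtpy T ≅ toHtpy (dbl (Γ.tiltMap K p.1 p.2))) := by
  classical
  obtain ⟨h2, ht, -, S, hS, ⟨φ⟩⟩ := hT
  obtain ⟨e⟩ := h2.exists_iso
  have := (h2.1.1 0).1
  have := (h2.1.1 1).1
  have := (h2.1.1 0).2
  have := (h2.1.1 1).2
  obtain ⟨α₀, _, s₀, ⟨c₀⟩⟩ := exists_equiv_PiProj_index (Γ := Γ) (K := K) (T.X 0)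
  obtain ⟨α₁, _, s₁, ⟨c₁⟩⟩ := exists_equiv_PiProj_index (Γ := Γ) (K := K) (T.X 1)
  let f : PiProj K s₀ →ₗ[Γ.Alg K] PiProj K s₁ :=
    c₁.toLinearMap ∘ₗ (T.d 0 1).hom ∘ₗ c₀.symm.toLinearMap
  let e' : toHtpy T ≅ toHtpy (dbl f) := (HomotopyCategory.quotient _ _).mapIso
    (e.symm ≪≫ dblIso (g := f) c₀ c₁ (by ext1 z; simp [f]))
  obtain ⟨h₁, h₂⟩ := subsingleton_derived_dbl_iff.1 fun i hi =>
    subsingleton_derived_of_iso e' e' (ht.2.1 i hi)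
  let ψ : End (toHtpy (dbl f)) ≃ₐ[K] End (toHtpy T) :=
    AlgEquiv.ofLinearEquiv (Linear.homCongr K e'.symm e'.symm) (by
      change e'.symm.inv ≫ 𝟙 _ ≫ e'.symm.hom = 𝟙 _
      simp) fun a b => by
      have hL : ∀ c : toHtpy (dbl f) ⟶ toHtpy (dbl f), Linear.homCongr K e'.symm e'.symm c =
          e'.hom ≫ c ≫ e'.inv := fun c => by simp [Linear.homCongr_apply]
      change Linear.homCongr K e'.symm e'.symm (b ≫ a) =
        Linear.homCongr K e'.symm e'.symm b ≫ Linear.homCongr K e'.symm e'.symm a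
      simp [hL]
  have hV : Fintype.card V = n + 1 := by rw [← Γ.card_edge, hn]
  obtain ⟨v, ε, hε, hc⟩ := exists_cls_eq_of_star h₁ h₂ hV hS (ψ.trans φ)
  obtain ⟨δ, hδ⟩ : ∃ δ : Fin 2, ε = (-1) ^ (δ : ℕ) := by
    rcases hε with rfl | rfl
    · exact ⟨0, by simp⟩
    · exact ⟨1, by simp⟩
  obtain ⟨e''⟩ := exists_iso_tilt_of_cls (ε := δ) h₁ (v := v) (fun y => by rw [hc, hδ, hn])
  exact ⟨(v, δ), ⟨e' ≪≫ e''⟩⟩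

theorem isStarTilting_tilt [DecidableEq Γ.Edge]
    [HasDerivedCategory.{w} (ModuleCat.{max u v} (Γ.Alg K))] {n : ℕ} (hn : 2 ≤ n)
    (hcard : Fintype.card Γ.Edge = n) (v : V) (ε : ℕ) :
    IsStarTilting n (dbl (Γ.tiltMap K v ε)) :=
  ⟨isTwoTerm_tilt v ε, isTilting_tilt v ε, isBasic_of_endIsStar (endIsStar_tilt hn hcard v ε),
    endIsStar_tilt hn hcard v ε⟩

theorem isSourceComplex_tilt [DecidableEq Γ.Edge] {n : ℕ} (hn : 2 ≤ n)
    (hcard : Fintype.card Γ.Edge = n) {v : V} {Υ : Cycle Γ.Arrow}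
    (hΥ : ∀ x, Γ.OnCycle x Υ ↔ v ∈ x.1) : IsSourceComplex Υ (dbl (Γ.tiltMap K v 0)) := by
  intro S hS
  obtain ⟨x, ⟨e⟩⟩ := IsIndecSummand.exists_iso_zigMap hn hcard hS
  exact isSourceSummand_zigMap hΥ e

theorem isSinkComplex_tilt [DecidableEq Γ.Edge] {n : ℕ} (hn : 2 ≤ n)
    (hcard : Fintype.card Γ.Edge = n) {v : V} {Υ : Cycle Γ.Arrow}
    (hΥ : ∀ x, Γ.OnCycle x Υ ↔ v ∈ x.1) : IsSinkComplex Υ (dbl (Γ.tiltMap K v 1)) := by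
  intro S hS
  obtain ⟨x, ⟨e⟩⟩ := IsIndecSummand.exists_iso_zigMap hn hcard hS
  exact isSinkSummand_zigMap hΥ e

theorem isIndecSummand_of_iso [DecidableEq Γ.Edge] {n : ℕ} (hn : 2 ≤ n)
    (hcard : Fintype.card Γ.Edge = n) {T : Γ.Cplx K} {v : V} {ε : ℕ}
    (e : toHtpy T ≅ toHtpy (dbl (Γ.tiltMap K v ε))) (x : Γ.Edge) :
    IsIndecSummand (dbl (zigMap K v ε x)) T := by
  obtain ⟨h₁, h₂, ⟨r⟩⟩ := isIndecSummand_zigMap (K := K) hn hcard v ε x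
  exact ⟨h₁, h₂, ⟨r.trans (Retract.ofIso e.symm)⟩⟩

theorem eq_of_cls_zig_eq (hn : 2 ≤ Fintype.card Γ.Edge) {v w : V} {δ : Fin 2} {c : ℤ}
    (hc : c ≠ 0) (h : ∀ x, Γ.cls (fun i : Γ.zigI w δ 0 x => i.1) v -
      Γ.cls (fun i : Γ.zigI w δ 1 x => i.1) v = c) : w = v ∧ c = (-1) ^ (δ : ℕ) := by
  classical
  obtain ⟨x, y, hxy⟩ := Fintype.exists_pair_of_one_lt_card (α := Γ.Edge) (by omega)
  simp only [cls_zig] at h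
  have hwv : v = w := by
    by_contra hne
    have key : ∀ x, v = Γ.bot w x := by
      intro x
      by_contra hx
      have := h x
      rw [if_neg hne, if_neg hx] at this
      simp at this
      exact hc this.symm
    exact hxy (Γ.bot_injective w ((key x).symm.trans (key y)))
  subst hwv
  have := h x
  rw [if_pos rfl, if_neg (Γ.bot_ne_root v x).symm] at this
  simp at this
  exact ⟨rfl, this.symm⟩

theorem IsSourceComplex.eq [DecidableEq Γ.Edge]
    [HasDerivedCategory.{w} (ModuleCat.{max u v} (Γ.Alg K))] {n : ℕ} (hn : 2 ≤ n)
    (hcard : Fintype.card Γ.Edge = n) {v : V} {Υ : Cycle Γ.Arrow}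
    (hΥ : ∀ x, Γ.OnCycle x Υ ↔ v ∈ x.1) {T : Γ.Cplx K} (hT : IsSourceComplex Υ T)
    {p : V × Fin 2} (e : toHtpy T ≅ toHtpy (dbl (Γ.tiltMap K p.1 p.2))) : p = (v, 0) := by
  obtain ⟨w, δ⟩ := p
  obtain ⟨h1, h2⟩ := eq_of_cls_zig_eq (hn.trans hcard.ge) (v := v) (w := w) (δ := δ) one_ne_zero
    fun x => by
      obtain ⟨D, ⟨e'⟩, h⟩ := IsSourceSummand.exists_presentation hΥ
        (hT _ (isIndecSummand_of_iso hn hcard e x))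
      rw [← h]
      exact cls_eq_of_iso (f := zigMap K w δ x) (g := D.map) (zig_extOneVanish x x)
        (zig_extNegOneVanish x x) e' v
  have h3 : δ = 0 := by
    by_contra h0
    rw [Fin.eq_one_of_ne_zero δ h0] at h2
    norm_num at h2
  rw [h1, h3]

theorem IsSinkComplex.eq [DecidableEq Γ.Edge]
    [HasDerivedCategory.{w} (ModuleCat.{max u v} (Γ.Alg K))] {n : ℕ} (hn : 2 ≤ n)
    (hcard : Fintype.card Γ.Edge = n) {v : V} {Υ : Cycle Γ.Arrow}
    (hΥ : ∀ x, Γ.OnCycle x Υ ↔ v ∈ x.1) {T : Γ.Cplx K} (hT : IsSinkComplex Υ T)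
    {p : V × Fin 2} (e : toHtpy T ≅ toHtpy (dbl (Γ.tiltMap K p.1 p.2))) : p = (v, 1) := by
  obtain ⟨w, δ⟩ := p
  obtain ⟨h1, h2⟩ := eq_of_cls_zig_eq (hn.trans hcard.ge) (v := v) (w := w) (δ := δ) (c := -1)
    (by simp) fun x => by
      obtain ⟨D, ⟨e'⟩, h⟩ := IsSinkSummand.exists_presentation hΥ
        (hT _ (isIndecSummand_of_iso hn hcard e x))
      rw [← h]
      exact cls_eq_of_iso (f := zigMap K w δ x) (g := D.map) (zig_extOneVanish x x)
        (zig_extNegOneVanish x x) e' v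
  have h3 : δ = 1 := Fin.eq_one_of_ne_zero δ fun h0 => by
    rw [h0] at h2
    norm_num at h2
  rw [h1, h3]

end Classification

end BrauerTree


/-! ### The cycles of the quiver -/

namespace BrauerTree

section Cycles

set_option linter.unusedSectionVars false

variable {V : Type v} [Finite V] {Γ : BrauerTree V} {K : Type u} [Field K]

variable (Γ) in
/-- The arrows around the vertex `a.fst`, starting with `a`. -/
noncomputable def turn (a : Γ.Arrow) : List Γ.Arrow := List.iterate Γ.next a (Γ.per a)

theorem mem_turn {a b : Γ.Arrow} : b ∈ Γ.turn a ↔ b.fst = a.fst := by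
  rw [turn, List.mem_iterate]
  constructor
  · rintro ⟨m, -, rfl⟩
    exact Γ.iterate_next_fst a m
  · intro h
    obtain ⟨k, hk, h⟩ := Γ.exists_iterate_eq h.symm
    exact ⟨k, hk, h.symm⟩

theorem arrow_mul_arrow_ne_zero_iff {a b : Γ.Arrow} :
    Γ.arrow K a * Γ.arrow K b ≠ 0 ↔ b = Γ.next a ∧ 2 ≤ Γ.per a := by
  rw [← path_one, ← path_one]
  by_cases h : Γ.next^[1] a = b
  · have hb : b = Γ.next a := h.symm
    subst h
    rw [path_add]
    refine ⟨fun h0 => ⟨hb, ?_⟩, fun h0 => Γ.path_ne_zero K h0.2⟩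
    by_contra hp
    exact h0 (Γ.path_eq_zero K (by omega))
  · rw [Γ.path_mul_path_of_ne K one_pos one_pos h]
    exact ⟨fun h0 => (h0 rfl).elim, fun h0 => (h h0.1.symm).elim⟩

theorem isArrowChain_turn (a : Γ.Arrow) : Γ.IsArrowChain K (Γ.turn a) := by
  refine ⟨fun h => (Γ.per_pos a).ne' (List.iterate_eq_nil.1 h), ?_, ?_⟩
  · rw [List.nodup_iff_injective_getElem]
    intro i j h
    have hi := i.2
    have hj := j.2
    simp only [turn, List.getElem_iterate, List.length_iterate] at h hi hj
    exact Fin.ext (Γ.iterate_inj hi hj h)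
  · rw [List.isChain_iff_getElem]
    intro i hi
    simp only [turn, List.getElem_iterate, List.length_iterate] at hi ⊢
    rw [arrow_mul_arrow_ne_zero_iff, Function.iterate_succ_apply', per_iterate]
    exact ⟨rfl, by omega⟩

theorem eq_iterate_of_isChain {a : Γ.Arrow} {L : List Γ.Arrow}
    (h : (a :: L).IsChain fun a b => Γ.arrow K a * Γ.arrow K b ≠ 0) :
    a :: L = List.iterate Γ.next a (L.length + 1) := by
  induction L generalizing a with
  | nil => rfl
  | cons b L ih =>
    rw [List.isChain_cons_cons] at h
    rw [List.length_cons, List.iterate, ← (arrow_mul_arrow_ne_zero_iff.1 h.1).1, ← ih h.2]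

theorem IsArrowChain.exists_eq_iterate {L : List Γ.Arrow} (h : Γ.IsArrowChain K L) :
    ∃ a, L = List.iterate Γ.next a L.length ∧ a ∈ L ∧ L.length ≤ Γ.per a := by
  obtain ⟨h0, hd, hc⟩ := h
  obtain ⟨a, L, rfl⟩ := List.exists_cons_of_ne_nil h0
  have hL := eq_iterate_of_isChain hc
  refine ⟨a, hL, List.mem_cons_self, ?_⟩
  by_contra! hlt
  have h1 := List.nodup_iff_injective_getElem.1 hd
    (a₁ := ⟨0, by simp⟩) (a₂ := ⟨Γ.per a, hlt⟩) (by
      simp only [hL, List.getElem_iterate]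
      rw [iterate_per]
      rfl)
  exact (Γ.per_pos a).ne (congrArg Fin.val h1)

theorem iterate_isPrefix_turn {a : Γ.Arrow} {m : ℕ} (h : m ≤ Γ.per a) :
    List.iterate Γ.next a m <+: Γ.turn a := by
  obtain ⟨k, hk⟩ := Nat.exists_eq_add_of_le h
  rw [turn, hk, List.iterate_add]
  exact List.prefix_append _ _

theorem isACycle_iff {Υ : Cycle Γ.Arrow} : Γ.IsACycle K Υ ↔ ∃ a, (Γ.turn a : Cycle Γ.Arrow) = Υ := by
  constructor
  · rintro ⟨L, rfl, hL, hmax⟩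
    obtain ⟨a, ha, -, hl⟩ := hL.exists_eq_iterate
    exact ⟨a, congrArg _ (hmax _ (isArrowChain_turn a) (by
      rw [ha]
      exact (iterate_isPrefix_turn hl).isInfix))⟩
  · rintro ⟨a, rfl⟩
    refine ⟨Γ.turn a, rfl, isArrowChain_turn a, fun L hL hin => ?_⟩
    obtain ⟨b, hb, -, hl⟩ := hL.exists_eq_iterate
    refine (hin.eq_of_length_le ?_).symm
    have ha : a ∈ L := hin.subset (mem_turn.2 rfl)
    rw [hb, List.mem_iterate] at ha
    obtain ⟨k, -, rfl⟩ := ha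
    rwa [turn, List.length_iterate, per_iterate]

theorem turn_next_isRotated (a : Γ.Arrow) : Γ.turn (Γ.next a) ~r Γ.turn a := by
  have h1 : Γ.per (Γ.next a) = Γ.per a := Γ.per_iterate a 1
  obtain ⟨m, hm⟩ := Nat.exists_eq_add_of_lt (Γ.per_pos a)
  have hm' : Γ.per a = m + 1 := by omega
  have h2 : Γ.next^[m] (Γ.next a) = a := by
    rw [← Function.iterate_succ_apply, Nat.succ_eq_add_one, ← hm', iterate_per]
  rw [turn, turn, h1, hm', List.iterate_add, List.iterate, List.iterate, List.iterate, h2]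
  exact List.isRotated_append

theorem coe_turn_eq_iff {a b : Γ.Arrow} :
    (Γ.turn a : Cycle Γ.Arrow) = Γ.turn b ↔ a.fst = b.fst := by
  constructor
  · intro h
    have h1 : a ∈ Γ.turn b := (Cycle.coe_eq_coe.1 h).mem_iff.1 (mem_turn.2 rfl)
    exact mem_turn.1 h1
  · intro h
    obtain ⟨k, -, rfl⟩ := Γ.exists_iterate_eq h
    rw [Cycle.coe_eq_coe]
    clear h
    induction k with
    | zero => exact List.IsRotated.refl _
    | succ k ih =>
      rw [Function.iterate_succ_apply']
      exact ih.trans (turn_next_isRotated _).symm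

theorem onCycle_turn {a : Γ.Arrow} (x : Γ.Edge) :
    Γ.OnCycle x (Γ.turn a : Cycle Γ.Arrow) ↔ a.fst ∈ x.1 := by
  constructor
  · rintro ⟨b, hb, rfl⟩
    rw [Cycle.mem_coe_iff, mem_turn] at hb
    rw [← hb]
    exact Γ.fst_mem_source b
  · intro h
    obtain ⟨b, rfl, hb⟩ := Γ.exists_dart_of_mem h
    exact ⟨b, Cycle.mem_coe_iff.2 (mem_turn.2 hb), rfl⟩

theorem exists_arrow_fst_eq [Nonempty Γ.Edge] (v : V) : ∃ a : Γ.Arrow, a.fst = v := by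
  exact ⟨_, down_anc_zero_fst (Classical.arbitrary Γ.Edge)⟩

theorem ncard_isACycle [Nonempty Γ.Edge] :
    {Υ : Cycle Γ.Arrow | Γ.IsACycle K Υ}.ncard = Nat.card V := by
  choose d hd using exists_arrow_fst_eq (Γ := Γ)
  have h : {Υ : Cycle Γ.Arrow | Γ.IsACycle K Υ} =
      Set.range fun v => (Γ.turn (d v) : Cycle Γ.Arrow) := by
    ext Υ
    rw [Set.mem_ofPred_eq, isACycle_iff]
    constructor
    · rintro ⟨a, rfl⟩
      exact ⟨a.fst, coe_turn_eq_iff.2 (hd _)⟩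
    · rintro ⟨v, rfl⟩
      exact ⟨_, rfl⟩
  rw [h, ← Set.image_univ, Set.ncard_image_of_injective, Set.ncard_univ]
  intro v w hvw
  rw [← hd v, ← hd w, coe_turn_eq_iff.1 hvw]

end Cycles

end BrauerTree

theorem count_star_tilting_complexes {K : Type u} [Field K] [IsAlgClosed K]
    {V : Type v} [Finite V] (Γ : BrauerTree V) (n : ℕ) (hn : 2 ≤ n)
    (hΓ : Γ.graph.edgeSet.ncard = n)
    [HasDerivedCategory.{w} (ModuleCat.{max u v} (Γ.Alg K))] :
    (isoClasses fun T : Γ.Cplx K => BrauerTree.IsStarTilting n T).ncard = 2 * (n + 1) ∧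
    {Υ : Cycle Γ.Arrow | Γ.IsACycle K Υ}.ncard = n + 1 ∧
    ∀ Υ : Cycle Γ.Arrow, Γ.IsACycle K Υ →
      (∃! c, c ∈ isoClasses fun T : Γ.Cplx K =>
        BrauerTree.IsStarTilting n T ∧ BrauerTree.IsSourceComplex Υ T) ∧
      (∃! c, c ∈ isoClasses fun T : Γ.Cplx K =>
        BrauerTree.IsStarTilting n T ∧ BrauerTree.IsSinkComplex Υ T) := by
  classical
  have := Fintype.ofFinite V
  have := Fintype.ofFinite Γ.Edge
  have : Infinite K := IsAlgClosed.instInfinite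
  have hcard : Fintype.card Γ.Edge = n := by
    rw [← hΓ, ← Nat.card_eq_fintype_card, Nat.card_coe_set_eq]
  have hV : Fintype.card V = n + 1 := by rw [← Γ.card_edge, hcard]
  have : Nonempty Γ.Edge := Fintype.card_pos_iff.1 (by omega)
  let F : V × Fin 2 → Quotient (isIsomorphicSetoid (HtpyCat.{max u v} (Γ.Alg K))) := fun p =>
    Quotient.mk _ (toHtpy (dbl (Γ.tiltMap K p.1 p.2)))
  have hF : Function.Injective F := by
    rintro ⟨v, δ⟩ p h
    obtain ⟨e⟩ := Quotient.exact h
    obtain ⟨a, rfl⟩ := BrauerTree.exists_arrow_fst_eq (Γ := Γ) v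
    obtain rfl | rfl : δ = 0 ∨ δ = 1 := by omega
    · exact ((BrauerTree.isSourceComplex_tilt hn hcard BrauerTree.onCycle_turn).eq hn hcard
        BrauerTree.onCycle_turn e).symm
    · exact ((BrauerTree.isSinkComplex_tilt hn hcard BrauerTree.onCycle_turn).eq hn hcard
        BrauerTree.onCycle_turn e).symm
  refine ⟨?_, ?_, fun Υ hΥ => ?_⟩
  · have h : (isoClasses fun T : Γ.Cplx K => BrauerTree.IsStarTilting n T) = Set.range F := by
      ext c
      constructor
      · rintro ⟨T, hT, rfl⟩
        obtain ⟨p, ⟨e⟩⟩ := hT.exists_iso_tilt hcard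
        exact ⟨p, Quotient.sound ⟨e.symm⟩⟩
      · rintro ⟨p, rfl⟩
        exact ⟨_, BrauerTree.isStarTilting_tilt hn hcard p.1 p.2, rfl⟩
    rw [h, ← Set.image_univ, Set.ncard_image_of_injective _ hF, Set.ncard_univ,
      Nat.card_eq_fintype_card, Fintype.card_prod, Fintype.card_fin, hV, mul_comm]
  · rw [BrauerTree.ncard_isACycle, Nat.card_eq_fintype_card, hV]
  · obtain ⟨a, rfl⟩ := BrauerTree.isACycle_iff.1 hΥ
    refine ⟨⟨F (a.fst, 0), ⟨_, ⟨BrauerTree.isStarTilting_tilt hn hcard _ _,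
      BrauerTree.isSourceComplex_tilt hn hcard BrauerTree.onCycle_turn⟩, rfl⟩, ?_⟩,
      ⟨F (a.fst, 1), ⟨_, ⟨BrauerTree.isStarTilting_tilt hn hcard _ _,
      BrauerTree.isSinkComplex_tilt hn hcard BrauerTree.onCycle_turn⟩, rfl⟩, ?_⟩⟩
    · rintro _ ⟨T, ⟨hT, hs⟩, rfl⟩
      obtain ⟨p, ⟨e⟩⟩ := hT.exists_iso_tilt hcard
      rw [← hs.eq hn hcard BrauerTree.onCycle_turn e]
      exact Quotient.sound ⟨e⟩
    · rintro _ ⟨T, ⟨hT, hs⟩, rfl⟩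
      obtain ⟨p, ⟨e⟩⟩ := hT.exists_iso_tilt hcard
      rw [← hs.eq hn hcard BrauerTree.onCycle_turn e]
      exact Quotient.sound ⟨e⟩
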